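/- Let b = 0 and fix A ∈ ℝ. For every ν > 0 and every q > 0 one has limsup_{γ→0} E^γ_{β,0}[ ‖Ex X_γ‖_{C^{−ν}}^q ] < ∞, where β = 1 + γ²(𝔠_γ + A) and the limsup is taken along the sequence γ = N^{−1/2}, N → ∞. In particular the q-th moments of the C^{−ν}-norm of the extended magnetisation fluctuation field under the Gibbs measure are bounded uniformly in γ. -/

import Mathlib

open scoped BigOperators ENNReal
open MeasureTheory

noncomputable section

namespace IsingKac

/-- The periodic lattice `Λ_N = {1-N, …, N}²`, realised as `(ℤ/2Nℤ)²`. -/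
abbrev Lat (N : ℕ) : Type := ZMod (2*N) × ZMod (2*N)

instance latNeZero (N : ℕ) [NeZero N] : NeZero (2*N) := ⟨by have := NeZero.ne N; omega⟩

/-- The representative of `v ∈ ℤ/2Nℤ` lying in `{1-N, …, N}`. -/
def latRep (N : ℕ) (v : ZMod (2*N)) : ℤ :=
  if (v.val : ℤ) ≤ (N : ℤ) then (v.val : ℤ) else (v.val : ℤ) - 2*N

def latRep2 (N : ℕ) (z : Lat N) : ℤ × ℤ := (latRep N z.1, latRep N z.2)

/-- The character `e_w(x) = exp(iπ w·x)`. -/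
def eW (w : ℤ × ℤ) (x : ℝ × ℝ) : ℂ :=
  Complex.exp ((Real.pi : ℂ) * Complex.I * ((w.1 : ℂ) * (x.1 : ℂ) + (w.2 : ℂ) * (x.2 : ℂ)))

/-- The point `ε z ∈ Λ_ε ⊂ 𝕋²` corresponding to `z ∈ Λ_N` (with `ε = 1/N`). -/
def latPt (N : ℕ) (z : Lat N) : ℝ × ℝ :=
  ((latRep N z.1 : ℝ) / N, (latRep N z.2 : ℝ) / N)

/-- Discrete Fourier coefficient `f̂(w) = Σ_{x ∈ Λ_ε} ε² f(x) e^{-iπ w·x}`. -/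
def dFT (N : ℕ) [NeZero N] (f : Lat N → ℂ) (w : ℤ × ℤ) : ℂ :=
  ∑ z : Lat N, ((N : ℂ)^2)⁻¹ * f z * (starRingEnd ℂ) (eW w (latPt N z))

/-- The extension operator `(Ex f)(x) = (1/4) Σ_{w ∈ Λ_N} f̂(w) e^{iπ w·x}` for `x ∈ 𝕋²`. -/
def Ex (N : ℕ) [NeZero N] (f : Lat N → ℂ) (x : ℝ × ℝ) : ℂ :=
  (1/4 : ℂ) * ∑ z : Lat N, dFT N f (latRep2 N z) * eW (latRep2 N z) x

/-- Discrete `L^p` norm on `Λ_ε`, `p ∈ [1,∞]`. -/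
def dLp (N : ℕ) [NeZero N] (p : ℝ≥0∞) {E : Type*} [NormedAddCommGroup E]
    (f : Lat N → E) : ℝ :=
  if p = ∞ then ⨆ z : Lat N, ‖f z‖
  else (∑ z : Lat N, ((N : ℝ)^2)⁻¹ * ‖f z‖ ^ p.toReal) ^ (1/p.toReal)

/-- Fundamental domain of the torus `𝕋² = [-1,1]²`. -/
def box : Set (ℝ × ℝ) := Set.Icc (-1 : ℝ) 1 ×ˢ Set.Icc (-1 : ℝ) 1

/-- `L^p(𝕋²)` norm, `p ∈ [1,∞]`. -/
def cLp (p : ℝ≥0∞) {E : Type*} [NormedAddCommGroup E] (g : ℝ × ℝ → E) : ℝ≥0∞ :=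
  eLpNorm g p (volume.restrict box)

/-- Euclidean norm on `ℝ²`. -/
def enorm2 (r : ℝ × ℝ) : ℝ := Real.sqrt (r.1^2 + r.2^2)

/-- A Littlewood–Paley partition of unity `(χ̃, χ)` on `ℝ²`. -/
structure LPpartition : Type where
  chit : ℝ × ℝ → ℝ
  chi : ℝ × ℝ → ℝ
  cont_t : Continuous chit
  cont : Continuous chi
  mem_t : ∀ r, chit r ∈ Set.Icc (0:ℝ) 1
  mem : ∀ r, chi r ∈ Set.Icc (0:ℝ) 1
  supp_t : ∀ r : ℝ × ℝ, 4/3 < enorm2 r → chit r = 0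
  supp : ∀ r : ℝ × ℝ, enorm2 r < 3/4 ∨ 8/3 < enorm2 r → chi r = 0
  partition : ∀ r : ℝ × ℝ, chit r + ∑' k : ℕ, chi ((2:ℝ)^(-(k:ℤ)) • r) = 1

/-- `χ_k`, for `k ≥ -1`. -/
def LPchi (P : LPpartition) (k : ℤ) : ℝ × ℝ → ℝ :=
  if k = -1 then P.chit else fun r => P.chi ((2:ℝ)^(-k) • r)

/-- The Littlewood–Paley block `δ_k (Ex f)` of (the extension of) a lattice function. -/
def dBlock (N : ℕ) [NeZero N] (P : LPpartition) (k : ℤ) (f : Lat N → ℂ) (x : ℝ × ℝ) : ℂ :=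
  (1/4 : ℂ) * ∑ z : Lat N,
    ((LPchi P k ((latRep N z.1 : ℝ), (latRep N z.2 : ℝ)) : ℝ) : ℂ) *
      dFT N f (latRep2 N z) * eW (latRep2 N z) x

/-- Discrete Besov norm `‖f‖_{B^ν_{p,q}(Λ_ε)}`. -/
def dBesov (N : ℕ) [NeZero N] (P : LPpartition) (ν : ℝ) (p q : ℝ≥0∞) (f : Lat N → ℂ) : ℝ :=
  if q = ∞ then
    ⨆ k : ℕ, (2:ℝ)^(ν * ((k:ℝ) - 1)) * dLp N p (fun z => dBlock N P ((k:ℤ)-1) f (latPt N z))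
  else
    (∑' k : ℕ, ((2:ℝ)^(ν * ((k:ℝ) - 1)) *
      dLp N p (fun z => dBlock N P ((k:ℤ)-1) f (latPt N z))) ^ q.toReal) ^ (1/q.toReal)

/-- The `C^{-ν}` (Besov–Hölder) norm of the extension `Ex f`:
`sup_{k ≥ -1} 2^{-νk} ‖δ_k (Ex f)‖_{L^∞(𝕋²)}`. -/
def holderNeg (N : ℕ) [NeZero N] (P : LPpartition) (ν : ℝ) (f : Lat N → ℂ) : ℝ :=
  ⨆ k : ℕ, (2:ℝ)^(-ν * ((k:ℝ) - 1)) * ⨆ x : ℝ × ℝ, ‖dBlock N P ((k:ℤ)-1) f x‖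

/-- Spin values. -/
def spin (s : Bool) : ℝ := if s then 1 else -1

/-- Hamiltonian `H(σ) = (β/2) Σ_{x,y} k(x-y) σ_x σ_y + b Σ_x σ_x`. -/
def hamil (N : ℕ) [NeZero N] (kk : Lat N → ℝ) (β b : ℝ) (σ : Lat N → ℝ) : ℝ :=
  β/2 * ∑ x : Lat N, ∑ y : Lat N, kk (x - y) * σ x * σ y + b * ∑ x : Lat N, σ x

/-- Gibbs expectation `E^γ_{β,b}[F]`. -/
def gibbsE (N : ℕ) [NeZero N] (kk : Lat N → ℝ) (β b : ℝ) (F : (Lat N → ℝ) → ℝ) : ℝ :=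
  (∑ s : Lat N → Bool, Real.exp (hamil N kk β b (fun x => spin (s x))) * F (fun x => spin (s x))) /
  (∑ s : Lat N → Bool, Real.exp (hamil N kk β b (fun x => spin (s x))))

/-- The profile `𝔎 : ℝ² → [0,1]`, twice differentiable, radial, supported in `B(0,3)`,
not identically zero. -/
structure KacProfile : Type where
  f : ℝ × ℝ → ℝ
  smooth : ContDiff ℝ 2 f
  mem : ∀ x, f x ∈ Set.Icc (0:ℝ) 1
  radial : ∀ x y : ℝ × ℝ, enorm2 x = enorm2 y → f x = f y
  supp : ∀ x : ℝ × ℝ, 3 < enorm2 x → f x = 0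
  nontriv : ∃ x, f x ≠ 0

/-- The Kac kernel `k_γ(z) = c γ² 𝔎(γ·z)` (shortest periodic representative), `k_γ(0)=0`. -/
def kGamma (𝔎 : KacProfile) (N : ℕ) (c γ : ℝ) (z : Lat N) : ℝ :=
  if z = 0 then 0 else c * γ^2 * 𝔎.f (γ * (latRep N z.1 : ℝ), γ * (latRep N z.2 : ℝ))

/-- `γ = N^{-1/2}`, so that `γ² = ε = 1/N`. -/
def gam (N : ℕ) : ℝ := Real.sqrt ((N : ℝ)⁻¹)

/-- Fourier transform `K̂_γ(ω) = Σ_z k_γ(z) e^{-iπ ω·(εz)}` of the macroscopic kernel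
(real, since the kernel is even). -/
def kHat (N : ℕ) [NeZero N] (kk : Lat N → ℝ) (ω : ℤ × ℤ) : ℝ :=
  ∑ z : Lat N, kk z *
    Real.cos (Real.pi * ((ω.1 : ℝ) * (latRep N z.1 : ℝ) / N + (ω.2 : ℝ) * (latRep N z.2 : ℝ) / N))

/-- The renormalisation constant
`𝔠_γ = (1/4) Σ_{ω ∈ Λ_N \ {0}} |K̂_γ(ω)|² / (γ^{-2} (1-K̂_γ(ω)))`. -/
def cGamma (N : ℕ) [NeZero N] (kk : Lat N → ℝ) (γ : ℝ) : ℝ :=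
  (1/4) * ∑ z : Lat N, if z = (0 : Lat N) then 0 else
    (kHat N kk (latRep2 N z))^2 / ((γ^2)⁻¹ * (1 - kHat N kk (latRep2 N z)))

/-- Critical inverse temperature `β = 1 + γ²(𝔠_γ + A)`. -/
def betaCrit (𝔎 : KacProfile) (N : ℕ) [NeZero N] (c A : ℝ) : ℝ :=
  1 + (gam N)^2 * (cGamma N (kGamma 𝔎 N c (gam N)) (gam N) + A)

/-- The fluctuation field `X_γ(x) = γ^{-1} Σ_z k_γ(ε^{-1}x - z) σ_z`, as a function on `Λ_N`. -/
def fluct (N : ℕ) [NeZero N] (kk : Lat N → ℝ) (γ : ℝ) (σ : Lat N → ℝ) (z : Lat N) : ℝ :=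
  γ⁻¹ * ∑ y : Lat N, kk (z - y) * σ y

/-- The rescaled step field `γ^{-1} σ_{⌊ε^{-1}x⌋}` on the torus (without the `γ^{-1}`). -/
def stepField (N : ℕ) (σ : Lat N → ℝ) (x : ℝ × ℝ) : ℝ :=
  σ (((⌊(N : ℝ) * x.1⌋ : ℤ) : ZMod (2*N)), ((⌊(N : ℝ) * x.2⌋ : ℤ) : ZMod (2*N)))

/-- Fourier coefficient on the torus: `ĝ(ω) = ∫_{𝕋²} g(x) e^{-iπω·x} dx`. -/
def cFT (g : ℝ × ℝ → ℂ) (ω : ℤ × ℤ) : ℂ :=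
  ∫ x in box, g x * (starRingEnd ℂ) (eW ω x)


/-! ### Additional definitions -/

/-- Nearest-neighbour Dirichlet sum `Σ_{x,y ∈ Λ_ε, |x-y|=ε} ε² (f(y)-f(x))²`. -/
def nnSum (N : ℕ) [NeZero N] (f : Lat N → ℝ) : ℝ :=
  ∑ x : Lat N, ((N : ℝ)^2)⁻¹ *
    ((f (x + (1, 0)) - f x)^2 + (f (x + (0, 1)) - f x)^2 +
     (f (x - (1, 0)) - f x)^2 + (f (x - (0, 1)) - f x)^2)

/-- The `d`-dimensional periodic lattice `Λ_N^d`. -/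
abbrev LatD (d N : ℕ) : Type := Fin d → ZMod (2*N)

/-- Discrete `L^p` norm on `Λ_ε^d`, `p ∈ [1,∞]`. -/
def dLpD (d N : ℕ) [NeZero N] (p : ℝ≥0∞) (f : LatD d N → ℂ) : ℝ :=
  if p = ∞ then ⨆ z : LatD d N, ‖f z‖
  else (∑ z : LatD d N, ((N : ℝ)^d)⁻¹ * ‖f z‖ ^ p.toReal) ^ (1/p.toReal)

/-- `Σ_{w ∈ Λ_N^d} χ(λ w) e_w`, evaluated at the lattice point `ε z ∈ Λ_ε^d`. -/
def gLam (d N : ℕ) [NeZero N] (χ : (Fin d → ℝ) → ℝ) (lam : ℝ) (z : LatD d N) : ℂ :=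
  ∑ w : LatD d N, ((χ (fun i => lam * (latRep N (w i) : ℝ)) : ℝ) : ℂ) *
    Complex.exp ((Real.pi : ℂ) * Complex.I *
      ((∑ i : Fin d, (latRep N (w i) : ℝ) * ((latRep N (z i) : ℝ) / N) : ℝ) : ℂ))

/-- Second partial derivative of `φ` in directions `v, w`. -/
def pd2 (φ : ℝ × ℝ → ℝ) (v w : ℝ × ℝ) : ℝ × ℝ → ℝ :=
  fun x => fderiv ℝ (fun y => fderiv ℝ φ y v) x w

/-- `max_{i,j ∈ {1,2}} ‖∂_i ∂_j φ‖_{L^∞}`. -/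
def secondDerivBound (φ : ℝ × ℝ → ℝ) : ℝ :=
  max (max (⨆ x : ℝ × ℝ, |pd2 φ (1,0) (1,0) x|) (⨆ x : ℝ × ℝ, |pd2 φ (1,0) (0,1) x|))
      (max (⨆ x : ℝ × ℝ, |pd2 φ (0,1) (1,0) x|) (⨆ x : ℝ × ℝ, |pd2 φ (0,1) (0,1) x|))

/-- The Littlewood–Paley block `δ_k g` of a function on the torus. -/
def cBlock (P : LPpartition) (k : ℤ) (g : ℝ × ℝ → ℂ) (x : ℝ × ℝ) : ℂ :=
  (1/4 : ℂ) * ∑' ω : ℤ × ℤ, ((LPchi P k ((ω.1 : ℝ), (ω.2 : ℝ)) : ℝ) : ℂ) * cFT g ω * eW ω x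

/-- Besov norm `‖g‖_{B^ν_{1,1}(𝕋²)} = Σ_{k ≥ -1} 2^{νk} ‖δ_k g‖_{L¹(𝕋²)}`. -/
def cBesov11 (P : LPpartition) (ν : ℝ) (g : ℝ × ℝ → ℂ) : ℝ :=
  ∑' k : ℕ, (2:ℝ) ^ (ν * ((k:ℝ) - 1)) * ∫ x in box, ‖cBlock P ((k:ℤ)-1) g x‖

/-! ### Part A: a Prékopa-Leindler type inequality for Gaussian measures -/

lemma bm_one {A B C : Set ℝ} (hA : MeasurableSet A) (hB : MeasurableSet B)
    (hAn : A.Nonempty) (hBn : B.Nonempty) (h : ∀ a ∈ A, ∀ b ∈ B, a + b ∈ C) :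
    volume A + volume B ≤ volume C := by
  rw [hA.measure_eq_iSup_isCompact, hB.measure_eq_iSup_isCompact]
  have trans : ∀ (L : Set ℝ) (a : ℝ), volume ((fun x => a + x) '' L) = volume L := by
    intro L a
    rw [Set.image_add_left]
    exact measure_preimage_add volume (-a) L
  have key : ∀ K, K ⊆ A → IsCompact K → ∀ L, L ⊆ B → IsCompact L →
      volume K + volume L ≤ volume C := by
    intro K hK hKc L hL hLc
    rcases K.eq_empty_or_nonempty with rfl | hKn
    · obtain ⟨a, ha⟩ := hAn
      simp only [measure_empty, zero_add]
      rw [← trans L a]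
      apply measure_mono
      rintro _ ⟨l, hl, rfl⟩
      exact h a ha l (hL hl)
    rcases L.eq_empty_or_nonempty with rfl | hLn
    · obtain ⟨b, hb⟩ := hBn
      simp only [measure_empty, add_zero]
      rw [← trans K b]
      apply measure_mono
      rintro _ ⟨l, hl, rfl⟩
      have := h l (hK hl) b hb
      simpa [add_comm] using this
    obtain ⟨k0, hk0, hkmax⟩ := hKc.exists_isGreatest hKn
    obtain ⟨l0, hl0, hlmin⟩ := hLc.exists_isLeast hLn
    rw [← trans K l0, ← trans L k0]
    have hmeas : MeasurableSet ((fun x => k0 + x) '' L) :=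
      (hLc.image (by fun_prop)).isClosed.measurableSet
    rw [← measure_union₀ hmeas.nullMeasurableSet]
    · apply measure_mono
      rintro _ (⟨l, hl, rfl⟩ | ⟨l, hl, rfl⟩)
      · have := h l (hK hl) l0 (hL hl0)
        simpa [add_comm] using this
      · exact h k0 (hK hk0) l (hL hl)
    · have : (fun x => l0 + x) '' K ∩ (fun x => k0 + x) '' L ⊆ {k0 + l0} := by
        rintro _ ⟨⟨x, hx, rfl⟩, ⟨y, hy, hxy⟩⟩
        have h1 := hkmax hx
        have h2 := hlmin hy
        simp only [Set.mem_singleton_iff] at *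
        linarith
      exact measure_mono_null this (by simp)
  simp only [iSup_and']
  exact ENNReal.biSup_add_biSup_le' (p := fun K => K ⊆ A ∧ IsCompact K)
    (q := fun K => K ⊆ B ∧ IsCompact K) ⟨∅, by simp⟩ ⟨∅, by simp⟩
    (fun K hK L hL => key K hK.1 hK.2 L hL.1 hL.2)

lemma pl_norm {F G H : ℝ → ℝ} {t : ℝ} (ht : 0 < t) (ht1 : t < 1)
    (hF : Measurable F) (hG : Measurable G) (hH : Measurable H)
    (hF0 : ∀ x, 0 ≤ F x) (hG0 : ∀ x, 0 ≤ G x) (hH0 : ∀ x, 0 ≤ H x)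
    (hF1 : ∀ x, F x ≤ 1) (hG1 : ∀ x, G x ≤ 1)
    (hFs : ∀ s < 1, ∃ x, s < F x) (hGs : ∀ s < 1, ∃ x, s < G x)
    (h : ∀ x y s, 0 ≤ s → s < F x → s < G y → s < H (t * x + (1 - t) * y)) :
    ENNReal.ofReal t * (∫⁻ x, ENNReal.ofReal (F x)) +
      ENNReal.ofReal (1 - t) * (∫⁻ x, ENNReal.ofReal (G x)) ≤ ∫⁻ x, ENNReal.ofReal (H x) := by
  have ht2 : 0 < 1 - t := by linarith
  rw [lintegral_eq_lintegral_meas_lt volume (Filter.Eventually.of_forall hF0) hF.aemeasurable,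
    lintegral_eq_lintegral_meas_lt volume (Filter.Eventually.of_forall hG0) hG.aemeasurable,
    lintegral_eq_lintegral_meas_lt volume (Filter.Eventually.of_forall hH0) hH.aemeasurable]
  have mm : ∀ f : ℝ → ℝ, Measurable (fun s : ℝ => volume {a | s < f a}) := by
    intro f
    apply Antitone.measurable
    intro a b hab
    apply measure_mono
    intro x hx
    exact lt_of_le_of_lt hab hx
  rw [← lintegral_const_mul _ (mm F), ← lintegral_const_mul _ (mm G),
    ← lintegral_add_left ((mm F).const_mul _)]
  apply setLIntegral_mono' measurableSet_Ioi
  intro s hs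
  rcases lt_or_ge s 1 with hs1 | hs1
  · have sc : ∀ (c : ℝ), 0 < c → ∀ L : Set ℝ,
        ENNReal.ofReal c * volume L = volume ((fun x => c * x) '' L) := by
      intro c hc L
      have := Measure.addHaar_smul (volume : Measure ℝ) c L
      rw [Module.finrank_self, pow_one, abs_of_pos hc] at this
      rw [← this]
      congr 1
    rw [sc t ht, sc _ ht2]
    have hme : ∀ c : ℝ, 0 < c → MeasurableEmbedding (fun x : ℝ => c * x) := fun c hc =>
      measurableEmbedding_mulLeft₀ hc.ne'
    apply bm_one
    · exact (hme t ht).measurableSet_image.2 (measurableSet_lt measurable_const hF)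
    · exact (hme _ ht2).measurableSet_image.2 (measurableSet_lt measurable_const hG)
    · exact Set.Nonempty.image _ (hFs s hs1)
    · exact Set.Nonempty.image _ (hGs s hs1)
    · rintro _ ⟨x, hx, rfl⟩ _ ⟨y, hy, rfl⟩
      exact h x y s (le_of_lt hs) hx hy
  · have e1 : {a | s < F a} = ∅ := by
      ext x; simp; linarith [hF1 x]
    have e2 : {a | s < G a} = ∅ := by
      ext x; simp; linarith [hG1 x]
    simp [e1, e2]

lemma pl_one {F G H : ℝ → ℝ} {t : ℝ} (ht : 0 < t) (ht1 : t < 1)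
    (hF : Measurable F) (hG : Measurable G) (hH : Measurable H)
    (hF0 : ∀ x, 0 ≤ F x) (hG0 : ∀ x, 0 ≤ G x) (hH0 : ∀ x, 0 ≤ H x)
    (hFb : BddAbove (Set.range F)) (hGb : BddAbove (Set.range G))
    (hFn : ∃ x, 0 < F x) (hGn : ∃ x, 0 < G x)
    (hFi : Integrable F) (hGi : Integrable G) (hHi : Integrable H)
    (h : ∀ x y, (F x) ^ t * (G y) ^ (1 - t) ≤ H (t * x + (1 - t) * y)) :
    (∫ x, F x) ^ t * (∫ x, G x) ^ (1 - t) ≤ ∫ x, H x := by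
  have ht2 : 0 < 1 - t := by linarith
  set mF := sSup (Set.range F) with hmF
  set mG := sSup (Set.range G) with hmG
  have hFle : ∀ x, F x ≤ mF := fun x => le_csSup hFb ⟨x, rfl⟩
  have hGle : ∀ x, G x ≤ mG := fun x => le_csSup hGb ⟨x, rfl⟩
  have mF0 : 0 < mF := by obtain ⟨x, hx⟩ := hFn; exact hx.trans_le (hFle x)
  have mG0 : 0 < mG := by obtain ⟨x, hx⟩ := hGn; exact hx.trans_le (hGle x)
  have hm : 0 < mF ^ t * mG ^ (1 - t) := by positivity
  set m := mF ^ t * mG ^ (1 - t) with hmdef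
  have sup : ∀ (f : ℝ → ℝ) (mm : ℝ), mm = sSup (Set.range f) → 0 < mm → ∀ s < (1:ℝ),
      ∃ x, s < f x / mm := by
    intro f mm e hmm s hs
    have : s * mm < sSup (Set.range f) := by rw [← e]; nlinarith
    obtain ⟨_, ⟨x, rfl⟩, hx⟩ := exists_lt_of_lt_csSup (Set.range_nonempty f) this
    exact ⟨x, by rwa [lt_div_iff₀ hmm]⟩
  have key := pl_norm (F := fun x => F x / mF) (G := fun x => G x / mG) (H := fun x => H x / m)
    ht ht1 (hF.div_const _) (hG.div_const _) (hH.div_const _)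
    (fun x => div_nonneg (hF0 x) mF0.le) (fun x => div_nonneg (hG0 x) mG0.le)
    (fun x => div_nonneg (hH0 x) hm.le)
    (fun x => (div_le_one mF0).2 (hFle x)) (fun x => (div_le_one mG0).2 (hGle x))
    (sup F mF hmF mF0) (sup G mG hmG mG0) (by
      intro x y s hs hx hy
      rw [lt_div_iff₀ hm]
      rw [lt_div_iff₀ mF0] at hx
      rw [lt_div_iff₀ mG0] at hy
      refine lt_of_lt_of_le ?_ (h x y)
      have : s * m = (s * mF) ^ t * (s * mG) ^ (1 - t) := by
        rw [Real.mul_rpow hs mF0.le, Real.mul_rpow hs mG0.le, hmdef]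
        have : s = s ^ t * s ^ (1 - t) := by
          rcases hs.eq_or_lt with rfl | hs
          · rw [Real.zero_rpow ht.ne']; simp
          · rw [← Real.rpow_add hs]; simp
        calc s * (mF ^ t * mG ^ (1 - t)) = (s ^ t * s ^ (1 - t)) * (mF ^ t * mG ^ (1 - t)) := by
              rw [← this]
          _ = _ := by ring
      rw [this]
      exact mul_lt_mul'' (Real.rpow_lt_rpow (by positivity) hx ht)
        (Real.rpow_lt_rpow (by positivity) hy ht2) (by positivity) (by positivity))
  rw [← ofReal_integral_eq_lintegral_ofReal (hFi.div_const _)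
      (Filter.Eventually.of_forall (fun x => div_nonneg (hF0 x) mF0.le)),
    ← ofReal_integral_eq_lintegral_ofReal (hGi.div_const _)
      (Filter.Eventually.of_forall (fun x => div_nonneg (hG0 x) mG0.le)),
    ← ofReal_integral_eq_lintegral_ofReal (hHi.div_const _)
      (Filter.Eventually.of_forall (fun x => div_nonneg (hH0 x) hm.le)),
    integral_div, integral_div, integral_div] at key
  have iF : 0 ≤ ∫ x, F x := integral_nonneg hF0
  have iG : 0 ≤ ∫ x, G x := integral_nonneg hG0
  have iH : 0 ≤ ∫ x, H x := integral_nonneg hH0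
  rw [← ENNReal.ofReal_mul ht.le, ← ENNReal.ofReal_mul ht2.le, ← ENNReal.ofReal_add
    (by positivity) (by positivity), ENNReal.ofReal_le_ofReal_iff (by positivity)] at key
  have amgm := Real.geom_mean_le_arith_mean2_weighted ht.le ht2.le
    (p₁ := (∫ x, F x) / mF) (p₂ := (∫ x, G x) / mG) (by positivity) (by positivity) (by ring)
  have := amgm.trans key
  rw [Real.div_rpow iF mF0.le, Real.div_rpow iG mG0.le, div_mul_div_comm, ← hmdef] at this
  rwa [div_le_div_iff_of_pos_right hm] at this

lemma gauss_pdf_identity (t x y : ℝ) :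
    ProbabilityTheory.gaussianPDFReal 0 1 (t * x + (1 - t) * y) =
      (ProbabilityTheory.gaussianPDFReal 0 1 x) ^ t *
      (ProbabilityTheory.gaussianPDFReal 0 1 y) ^ (1 - t) *
        Real.exp (t * ((1 - t) / 2 * (x - y) ^ 2)) := by
  unfold ProbabilityTheory.gaussianPDFReal
  have h0 : 0 < (√(2 * Real.pi * ((1 : NNReal) : ℝ)))⁻¹ := by positivity
  set a := (√(2 * Real.pi * ((1 : NNReal) : ℝ)))⁻¹
  rw [Real.mul_rpow h0.le (Real.exp_pos _).le, Real.mul_rpow h0.le (Real.exp_pos _).le,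
    ← Real.exp_mul, ← Real.exp_mul]
  have : a = a ^ t * a ^ (1 - t) := by rw [← Real.rpow_add h0]; simp
  calc _ = (a ^ t * a ^ (1 - t)) * Real.exp (-(t * x + (1 - t) * y - 0) ^ 2 / (2 * ((1:NNReal):ℝ))) := by
        rw [← this]
    _ = a ^ t * a ^ (1 - t) * (Real.exp (-(x - 0) ^ 2 / (2 * ((1:NNReal):ℝ)) * t) *
          Real.exp (-(y - 0) ^ 2 / (2 * ((1:NNReal):ℝ)) * (1 - t)) *
            Real.exp (t * ((1 - t) / 2 * (x - y) ^ 2))) := by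
        rw [← Real.exp_add, ← Real.exp_add]
        congr 2
        push_cast
        ring
    _ = _ := by ring

open ProbabilityTheory in
lemma gauss1_bdd {t : ℝ} (ht : 0 < t) (ht1 : t < 1) {u f : ℝ → ℝ} {S : Set ℝ} {n : ℝ}
    (hS : MeasurableSet S) (hS0 : gaussianReal 0 1 Sᶜ = 0) (hu : Measurable u)
    (hf : Measurable f) (hu0 : ∀ x, 0 ≤ u x) (hun : ∀ x, u x ≤ n)
    (hfi : Integrable f (gaussianReal 0 1))
    (h : ∀ x, ∀ y ∈ S, u x ≤ f y + (1 - t) / 2 * (x - y) ^ 2) :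
    ∫ x, Real.exp (u x) ∂(gaussianReal 0 1) ≤ Real.exp (∫ x, f x ∂(gaussianReal 0 1)) := by
  have ht2 : 0 < 1 - t := by linarith
  have hv : (1 : NNReal) ≠ 0 := one_ne_zero
  have hf0 : ∀ y ∈ S, 0 ≤ f y := by
    intro y hy
    have := h y y hy
    have := hu0 y
    simp at *
    linarith
  set φ := gaussianPDFReal 0 1 with hφ
  have φpos : ∀ x, 0 < φ x := fun x => gaussianPDFReal_pos 0 1 x hv
  have φmeas : Measurable φ := measurable_gaussianPDFReal 0 1
  have φint : Integrable φ := integrable_gaussianPDFReal 0 1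
  have φbd : ∀ x, φ x ≤ (√(2 * Real.pi * ((1 : NNReal) : ℝ)))⁻¹ := by
    intro x
    rw [hφ, gaussianPDFReal]
    have : Real.exp (-(x - 0) ^ 2 / (2 * ((1:NNReal):ℝ))) ≤ 1 := by
      apply Real.exp_le_one_iff.2
      push_cast
      have := sq_nonneg (x - 0)
      linarith
    exact mul_le_of_le_one_right (by positivity) this
  set b := (√(2 * Real.pi * ((1 : NNReal) : ℝ)))⁻¹
  have hb : 0 < b := (φpos 0).trans_le (φbd 0)
  set c := t / (1 - t) with hc
  have hc0 : 0 < c := by positivity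
  set g : ℝ → ℝ := S.indicator (fun y => Real.exp (-c * f y)) with hg
  have gmeas : Measurable g := by
    apply Measurable.indicator _ hS
    fun_prop
  have g0 : ∀ y, 0 ≤ g y := fun y => Set.indicator_nonneg (fun _ _ => (Real.exp_pos _).le) y
  have g1 : ∀ y, g y ≤ 1 := by
    intro y
    by_cases hy : y ∈ S
    · rw [hg, Set.indicator_of_mem hy, Real.exp_le_one_iff]
      have := hf0 y hy
      nlinarith
    · rw [hg, Set.indicator_of_notMem hy]; norm_num
  have hSne : S.Nonempty := by
    by_contra hne
    rw [Set.not_nonempty_iff_eq_empty] at hne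
    rw [hne] at hS0
    simp at hS0
  have uexp : ∀ x, Real.exp (u x) ≤ Real.exp n := fun x => Real.exp_le_exp.2 (hun x)
  have Fint : Integrable (fun x => φ x * Real.exp (u x)) := by
    apply (φint.mul_const (Real.exp n)).mono' (by fun_prop)
    refine Filter.Eventually.of_forall (fun x => ?_)
    rw [Real.norm_of_nonneg (by have := φpos x; positivity)]
    exact mul_le_mul_of_nonneg_left (uexp x) (φpos x).le
  have Gint : Integrable (fun x => φ x * g x) := by
    apply φint.mono' (by fun_prop)
    refine Filter.Eventually.of_forall (fun x => ?_)
    rw [Real.norm_of_nonneg (mul_nonneg (φpos x).le (g0 x))]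
    exact mul_le_of_le_one_right (φpos x).le (g1 x)
  have key := pl_one (F := fun x => φ x * Real.exp (u x)) (G := fun x => φ x * g x) (H := φ) ht ht1
    (by fun_prop) (by fun_prop) φmeas (fun x => mul_nonneg (φpos x).le (Real.exp_pos _).le)
    (fun x => mul_nonneg (φpos x).le (g0 x)) (fun x => (φpos x).le)
    ⟨b * Real.exp n, by
      rintro _ ⟨x, rfl⟩
      exact mul_le_mul (φbd x) (uexp x) (Real.exp_pos _).le hb.le⟩
    ⟨b, by
      rintro _ ⟨x, rfl⟩
      exact (mul_le_of_le_one_right (φpos x).le (g1 x)).trans (φbd x)⟩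
    ⟨0, mul_pos (φpos 0) (Real.exp_pos _)⟩
    (by
      obtain ⟨y, hy⟩ := hSne
      refine ⟨y, mul_pos (φpos y) ?_⟩
      rw [hg, Set.indicator_of_mem hy]
      exact Real.exp_pos _)
    Fint Gint φint
    (by
      intro x y
      by_cases hy : y ∈ S
      · simp only [hg, Set.indicator_of_mem hy]
        rw [hφ, gauss_pdf_identity, ← hφ, Real.mul_rpow (φpos x).le (Real.exp_pos _).le,
          Real.mul_rpow (φpos y).le (Real.exp_pos _).le, ← Real.exp_mul, ← Real.exp_mul]
        have h1 : Real.exp (u x * t) * Real.exp (-c * f y * (1 - t)) ≤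
            Real.exp (t * ((1 - t) / 2 * (x - y) ^ 2)) := by
          rw [← Real.exp_add, Real.exp_le_exp]
          have h2 := h x y hy
          have h3 : -c * f y * (1 - t) = - t * f y := by rw [hc]; field_simp
          rw [h3]
          nlinarith
        have h4 : 0 ≤ φ x ^ t * φ y ^ (1 - t) := by
          have := φpos x; have := φpos y; positivity
        calc _ = φ x ^ t * φ y ^ (1 - t) * (Real.exp (u x * t) * Real.exp (-c * f y * (1 - t))) := by
              ring
          _ ≤ _ := mul_le_mul_of_nonneg_left h1 h4
      · simp only [hg, Set.indicator_of_notMem hy, mul_zero]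
        rw [Real.zero_rpow ht2.ne', mul_zero]
        exact (φpos _).le)
  have iφ : ∫ x, φ x = 1 := integral_gaussianPDFReal_eq_one 0 hv
  have eF : ∫ x, φ x * Real.exp (u x) = ∫ x, Real.exp (u x) ∂(gaussianReal 0 1) := by
    rw [integral_gaussianReal_eq_integral_smul hv]; rfl
  have eG : ∫ x, φ x * g x = ∫ x, g x ∂(gaussianReal 0 1) := by
    rw [integral_gaussianReal_eq_integral_smul hv]; rfl
  rw [iφ, eF, eG] at key
  set m := ∫ x, f x ∂(gaussianReal 0 1) with hm
  have gi : Integrable g (gaussianReal 0 1) :=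
    Integrable.of_bound (C := 1) gmeas.aestronglyMeasurable (Filter.Eventually.of_forall (fun x => by
      rw [Real.norm_of_nonneg (g0 x)]; exact g1 x))
  have jensen : Real.exp (-c * m) ≤ ∫ x, g x ∂(gaussianReal 0 1) := by
    have e1 : ∫ x, (Real.exp (-c * m) * (1 - c * (f x - m))) ∂(gaussianReal 0 1) =
        Real.exp (-c * m) := by
      have hsub : Integrable (fun x => f x - m) (gaussianReal 0 1) := hfi.sub (integrable_const m)
      rw [integral_const_mul, integral_sub (integrable_const 1) (hsub.const_mul c),
        integral_const_mul, integral_sub hfi (integrable_const m)]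
      simp [← hm]
    rw [← e1]
    apply integral_mono_ae
    · exact ((integrable_const _).sub ((hfi.sub (integrable_const _)).const_mul c)).const_mul _
    · exact gi
    · have : ∀ᵐ x ∂(gaussianReal 0 1), x ∈ S := hS0
      filter_upwards [this] with x hx
      simp only [hg, Set.indicator_of_mem hx]
      have h5 : Real.exp (-c * f x) = Real.exp (-c * m) * Real.exp (-c * (f x - m)) := by
        rw [← Real.exp_add]; ring_nf
      rw [h5]
      apply mul_le_mul_of_nonneg_left _ (Real.exp_pos _).le
      have := Real.add_one_le_exp (-c * (f x - m))
      linarith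
  set I := ∫ x, Real.exp (u x) ∂(gaussianReal 0 1) with hI
  have I0 : 0 ≤ I := integral_nonneg (fun x => (Real.exp_pos _).le)
  have h6 : I ^ t * Real.exp (-c * m) ^ (1 - t) ≤ 1 :=
    (mul_le_mul_of_nonneg_left (Real.rpow_le_rpow (Real.exp_pos _).le jensen ht2.le)
      (by positivity)).trans key
  rw [← Real.exp_mul] at h6
  have h7 : -c * m * (1 - t) = - (m * t) := by rw [hc]; field_simp
  rw [h7, Real.exp_neg, ← div_eq_mul_inv, div_le_one (Real.exp_pos _), Real.exp_mul] at h6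
  exact (Real.rpow_le_rpow_iff I0 (Real.exp_pos _).le ht).1 h6

open ProbabilityTheory in
lemma gauss1 {t : ℝ} (ht : 0 < t) (ht1 : t < 1) {u f : ℝ → ℝ} {S : Set ℝ}
    (hS : MeasurableSet S) (hS0 : gaussianReal 0 1 Sᶜ = 0) (hu : Measurable u)
    (hf : Measurable f) (hu0 : ∀ x, 0 ≤ u x)
    (hfi : Integrable f (gaussianReal 0 1))
    (h : ∀ x, ∀ y ∈ S, u x ≤ f y + (1 - t) / 2 * (x - y) ^ 2) :
    ∫⁻ x, ENNReal.ofReal (Real.exp (u x)) ∂(gaussianReal 0 1) ≤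
      ENNReal.ofReal (Real.exp (∫ x, f x ∂(gaussianReal 0 1))) := by
  have hn : ∀ n : ℕ, ∫⁻ x, ENNReal.ofReal (Real.exp (min (u x) n)) ∂(gaussianReal 0 1) ≤
      ENNReal.ofReal (Real.exp (∫ x, f x ∂(gaussianReal 0 1))) := by
    intro n
    have hb := gauss1_bdd (u := fun x => min (u x) n) (f := f) (n := n) ht ht1 hS hS0
      (hu.min measurable_const) hf (fun x => le_min (hu0 x) (Nat.cast_nonneg n))
      (fun x => min_le_right _ _) hfi (fun x y hy => (min_le_left _ _).trans (h x y hy))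
    rw [← ofReal_integral_eq_lintegral_ofReal]
    · exact ENNReal.ofReal_le_ofReal hb
    · apply Integrable.of_bound (C := Real.exp n)
      · exact (Real.measurable_exp.comp (hu.min measurable_const)).aestronglyMeasurable
      · refine Filter.Eventually.of_forall (fun x => ?_)
        rw [Real.norm_of_nonneg (Real.exp_pos _).le]
        exact Real.exp_le_exp.2 (min_le_right _ _)
    · exact Filter.Eventually.of_forall (fun x => (Real.exp_pos _).le)
  refine le_of_tendsto' (lintegral_tendsto_of_tendsto_of_monotone (μ := gaussianReal 0 1)
    (f := fun (n : ℕ) x => ENNReal.ofReal (Real.exp (min (u x) n)))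
    (fun n => ?_) ?_ ?_) hn
  · exact (Real.measurable_exp.comp (hu.min measurable_const)).ennreal_ofReal.aemeasurable
  · refine Filter.Eventually.of_forall (fun x a b hab => ?_)
    apply ENNReal.ofReal_le_ofReal (Real.exp_le_exp.2 (min_le_min le_rfl (by exact_mod_cast hab)))
  · refine Filter.Eventually.of_forall (fun x => ?_)
    apply tendsto_const_nhds.congr'
    obtain ⟨n, hn⟩ := exists_nat_ge (u x)
    filter_upwards [Filter.eventually_ge_atTop n] with k hk
    rw [min_eq_left]
    exact hn.trans (by exact_mod_cast hk)

open ProbabilityTheory in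
lemma gaussn {t : ℝ} (ht : 0 < t) (ht1 : t < 1) (n : ℕ) : ∀ {u f : (Fin n → ℝ) → ℝ}
    (_ : Measurable u) (_ : Measurable f) (_ : ∀ x, 0 ≤ u x)
    (_ : Integrable f (Measure.pi (fun _ : Fin n => gaussianReal 0 1)))
    (_ : ∀ x y, u x ≤ f y + (1 - t) / 2 * ∑ i, (x i - y i) ^ 2),
    ∫⁻ x, ENNReal.ofReal (Real.exp (u x)) ∂(Measure.pi (fun _ : Fin n => gaussianReal 0 1)) ≤
      ENNReal.ofReal (Real.exp (∫ x, f x ∂(Measure.pi (fun _ : Fin n => gaussianReal 0 1)))) := by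
  induction n with
  | zero =>
    intro u f hu hf hu0 hfi h
    have e : Measure.pi (fun _ : Fin 0 => gaussianReal 0 1) = Measure.dirac 0 := by
      rw [Measure.pi_of_empty _ (0 : Fin 0 → ℝ)]
    rw [e, lintegral_dirac' _ (by fun_prop), integral_dirac]
    apply ENNReal.ofReal_le_ofReal (Real.exp_le_exp.2 _)
    simpa using h 0 0
  | succ n ih =>
    intro u f hu hf hu0 hfi h
    set γ := gaussianReal 0 1
    set μ := Measure.pi (fun _ : Fin n => gaussianReal 0 1)
    have mp := (measurePreserving_piFinSuccAbove (fun _ : Fin (n+1) => gaussianReal 0 1) 0).symm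
    set e := (MeasurableEquiv.piFinSuccAbove (fun _ : Fin (n+1) => ℝ) 0).symm with he
    have sum : ∀ a b x y, ∑ i, (e (a, x) i - e (b, y) i) ^ 2 = (a - b) ^ 2 + ∑ i, (x i - y i) ^ 2 := by
      intro a b x y
      rw [Fin.sum_univ_succ]
      rfl
    rw [← mp.lintegral_comp_emb e.measurableEmbedding, ← mp.integral_comp e.measurableEmbedding]
    have hfi' : Integrable (fun p => f (e p)) (γ.prod μ) :=
      (mp.integrable_comp_emb e.measurableEmbedding).2 hfi
    have um : Measurable (fun p => u (e p)) := hu.comp e.measurable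
    have fm : Measurable (fun p => f (e p)) := hf.comp e.measurable
    have uem : Measurable (fun p => ENNReal.ofReal (Real.exp (u (e p)))) := by fun_prop
    change ∫⁻ p, ENNReal.ofReal (Real.exp (u (e p))) ∂(γ.prod μ) ≤
      ENNReal.ofReal (Real.exp (∫ p, f (e p) ∂(γ.prod μ)))
    rw [lintegral_prod _ uem.aemeasurable, integral_prod _ hfi']
    set S : Set ℝ := {a | Integrable (fun y => f (e (a, y))) μ} with hSdef
    have hS : MeasurableSet S :=
      measurableSet_integrable (f := fun a y => f (e (a, y))) fm.stronglyMeasurable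
    have hS0 : γ Sᶜ = 0 := hfi'.prod_right_ae
    have hSne : S.Nonempty := by
      by_contra hne
      rw [Set.not_nonempty_iff_eq_empty] at hne
      rw [hne] at hS0
      simp [γ] at hS0
    set I : ℝ → ℝ≥0∞ := fun a => ∫⁻ y, ENNReal.ofReal (Real.exp (u (e (a, y)))) ∂μ with hI
    have Im : Measurable I := uem.lintegral_prod_right'
    have hIb : ∀ a, ∀ b ∈ S, I a ≤ ENNReal.ofReal (Real.exp ((∫ y, f (e (b, y)) ∂μ) +
        (1 - t) / 2 * (a - b) ^ 2)) := by
      intro a b hb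
      have hb' : Integrable (fun y => f (e (b, y))) μ := hb
      have := ih (u := fun y => u (e (a, y)))
        (f := fun y => f (e (b, y)) + (1 - t) / 2 * (a - b) ^ 2)
        (um.comp measurable_prodMk_left) ((fm.comp measurable_prodMk_left).add_const _)
        (fun y => hu0 _) (hb'.add (integrable_const _)) (by
          intro x y
          have := h (e (a, x)) (e (b, y))
          rw [sum] at this
          linarith)
      rw [integral_add hb' (integrable_const _)] at this
      simpa using this
    have I1 : ∀ a, 1 ≤ I a := by
      intro a
      calc (1 : ℝ≥0∞) = ∫⁻ y, 1 ∂μ := by simp [μ]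
        _ ≤ _ := by
          apply lintegral_mono
          intro y
          change 1 ≤ ENNReal.ofReal (Real.exp (u (e (a, y))))
          rw [ENNReal.one_le_ofReal]
          exact Real.one_le_exp (hu0 _)
    have Ifin : ∀ a, I a ≠ ∞ := by
      intro a
      obtain ⟨b, hb⟩ := hSne
      exact ne_top_of_le_ne_top ENNReal.ofReal_ne_top (hIb a b hb)
    have Ir : ∀ a, 1 ≤ (I a).toReal := by
      intro a
      have := ENNReal.toReal_mono (Ifin a) (I1 a)
      simpa using this
    have eI : ∀ a, I a = ENNReal.ofReal (Real.exp (Real.log (I a).toReal)) := by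
      intro a
      rw [Real.exp_log (by linarith [Ir a]), ENNReal.ofReal_toReal (Ifin a)]
    calc ∫⁻ a, I a ∂γ = ∫⁻ a, ENNReal.ofReal (Real.exp (Real.log (I a).toReal)) ∂γ :=
          lintegral_congr eI
      _ ≤ _ := by
        apply gauss1 ht ht1 hS hS0 (Real.measurable_log.comp Im.ennreal_toReal)
          (fm.stronglyMeasurable.integral_prod_right').measurable
          (fun a => Real.log_nonneg (Ir a)) hfi'.integral_prod_left
        intro a b hb
        have h1 := hIb a b hb
        rw [eI a, ENNReal.ofReal_le_ofReal_iff (Real.exp_pos _).le, Real.exp_le_exp] at h1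
        exact h1

/-- The standard Gaussian measure on `ι → ℝ`. -/
abbrev gpi (ι : Type) [Fintype ι] : Measure (ι → ℝ) :=
  Measure.pi (fun _ : ι => ProbabilityTheory.gaussianReal 0 1)

theorem gauss_dual {ι : Type} [Fintype ι] {t : ℝ} (ht : 0 < t) (ht1 : t < 1) {u f : (ι → ℝ) → ℝ}
    (hu : Measurable u) (hf : Measurable f) (hu0 : ∀ x, 0 ≤ u x)
    (hfi : Integrable f (gpi ι))
    (h : ∀ x y, u x ≤ f y + (1 - t) / 2 * ∑ i, (x i - y i) ^ 2) :
    ∫⁻ x, ENNReal.ofReal (Real.exp (u x)) ∂(gpi ι) ≤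
      ENNReal.ofReal (Real.exp (∫ x, f x ∂(gpi ι))) := by
  set e := MeasurableEquiv.piCongrLeft (fun _ : ι => ℝ) (Fintype.equivFin ι).symm with he
  have mp : MeasurePreserving e (gpi (Fin (Fintype.card ι))) (gpi ι) :=
    measurePreserving_piCongrLeft (fun _ : ι => ProbabilityTheory.gaussianReal 0 1)
      (Fintype.equivFin ι).symm
  rw [← mp.lintegral_comp_emb e.measurableEmbedding, ← mp.integral_comp e.measurableEmbedding]
  apply gaussn ht ht1 _ (hu.comp e.measurable) (hf.comp e.measurable) (fun x => hu0 _)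
    ((mp.integrable_comp_emb e.measurableEmbedding).2 hfi)
  intro x y
  refine (h (e x) (e y)).trans (le_of_eq ?_)
  congr 2
  rw [← Equiv.sum_comp (Fintype.equivFin ι).symm]
  apply Finset.sum_congr rfl
  intro i _
  simp [he, MeasurableEquiv.coe_piCongrLeft, Equiv.piCongrLeft_apply_apply]

/-! ### Part C: scalar inequalities -/

lemma cosh_expansion (z : ℂ) (hz : ‖z‖ ≤ 1/4) :
    ∃ r : ℂ, Complex.cosh z = Complex.exp (z^2/2 - z^4/12 + r) ∧ ‖r‖ ≤ 6 * ‖z‖^6 := by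
  set w := z^2 with hw
  have hwn : ‖w‖ = ‖z‖^2 := by rw [hw, norm_pow]
  have hw1 : ‖w‖ ≤ 1/16 := by rw [hwn]; nlinarith [norm_nonneg z]
  have hw0 : 0 ≤ ‖w‖ := norm_nonneg w
  set ρ1 := Complex.cosh z - (1 + w/2 + w^2/24) with hρ1
  have b1 : ‖ρ1‖ ≤ ‖w‖^3 := by
    have e1 := Complex.exp_bound (x := z) (by linarith) (n := 6) (by norm_num)
    have e2 := Complex.exp_bound (x := -z) (by rw [norm_neg]; linarith) (n := 6) (by norm_num)
    simp only [Finset.sum_range_succ, Finset.sum_range_zero, norm_neg] at e1 e2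
    norm_num [Nat.factorial] at e1 e2
    have e3 : ρ1 = ((Complex.exp z - (1 + z + z^2/2 + z^3/6 + z^4/24 + z^5/120)) +
        (Complex.exp (-z) - (1 + -z + z^2/2 + (-z)^3/6 + z^4/24 + (-z)^5/120)))/2 := by
      rw [hρ1, Complex.cosh, hw]; ring
    rw [e3, norm_div, hwn]
    have n2 : ‖(2:ℂ)‖ = 2 := by simp
    rw [n2, ← pow_mul]
    have e4 := norm_add_le (Complex.exp z - (1 + z + z^2/2 + z^3/6 + z^4/24 + z^5/120))
      (Complex.exp (-z) - (1 + -z + z^2/2 + (-z)^3/6 + z^4/24 + (-z)^5/120))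
    have : 0 ≤ ‖z‖^6 := by positivity
    have e5 : 2 * 3 = 6 := by norm_num
    rw [e5]
    linarith
  set v := -(w/2 - w^2/12) with hv
  have bv : ‖v‖ ≤ ‖w‖ := by
    rw [hv, norm_neg]
    calc ‖w/2 - w^2/12‖ ≤ ‖w/2‖ + ‖w^2/12‖ := norm_sub_le _ _
      _ = ‖w‖/2 + ‖w‖^2/12 := by simp
      _ ≤ ‖w‖ := by nlinarith
  set ρ2 := Complex.exp v - (1 + v + v^2/2) with hρ2
  have b2 : ‖ρ2‖ ≤ ‖w‖^3 := by
    have e1 := Complex.exp_bound (x := v) (by linarith) (n := 3) (by norm_num)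
    simp only [Finset.sum_range_succ, Finset.sum_range_zero] at e1
    norm_num [Nat.factorial] at e1
    have : ‖v‖^3 ≤ ‖w‖^3 := pow_le_pow_left₀ (norm_nonneg v) bv 3
    have h0 : 0 ≤ ‖v‖^3 := by positivity
    rw [hρ2]
    linarith
  have bE : ‖Complex.exp v‖ ≤ 2 := by
    have : Complex.exp v = 1 + v + v^2/2 + ρ2 := by rw [hρ2]; ring
    rw [this]
    have h1 : ‖1 + v + v^2/2 + ρ2‖ ≤ 1 + ‖v‖ + ‖v‖^2/2 + ‖ρ2‖ := by
      refine (norm_add_le _ _).trans (add_le_add ((norm_add_le _ _).trans (add_le_add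
        ((norm_add_le _ _).trans (by simp)) (by simp))) le_rfl)
    have : ‖w‖^3 ≤ ‖w‖ := by nlinarith [sq_nonneg ‖w‖]
    nlinarith [norm_nonneg v]
  set R := Complex.cosh z * Complex.exp v - 1 with hR
  have eR : R = ρ1 * Complex.exp v + (1 + w/2 + w^2/24) * ρ2 +
      (w^3/24 - 5*w^4/576 + w^6/6912) := by
    have h1 : Complex.cosh z = 1 + w/2 + w^2/24 + ρ1 := by rw [hρ1]; ring
    have h2 : R = ρ1 * Complex.exp v + (1 + w/2 + w^2/24) * Complex.exp v - 1 := by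
      rw [hR, h1]; ring
    have h3 : Complex.exp v = 1 + v + v^2/2 + ρ2 := by rw [hρ2]; ring
    rw [h2]
    have h4 : (1 + w/2 + w^2/24) * Complex.exp v =
        (1 + w/2 + w^2/24) * ρ2 + (1 + w/2 + w^2/24) * (1 + v + v^2/2) := by rw [h3]; ring
    rw [h4, hv]; ring
  have bR : ‖R‖ ≤ 4 * ‖w‖^3 := by
    rw [eR]
    have h1 : ‖ρ1 * Complex.exp v‖ ≤ ‖w‖^3 * 2 := by
      rw [norm_mul]; exact mul_le_mul b1 bE (norm_nonneg _) (by positivity)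
    have h2 : ‖(1 + w/2 + w^2/24)‖ ≤ 1.1 := by
      refine ((norm_add_le _ _).trans (add_le_add (norm_add_le _ _) le_rfl)).trans ?_
      simp only [norm_one, norm_div, norm_pow]
      norm_num
      nlinarith
    have h3 : ‖(1 + w/2 + w^2/24) * ρ2‖ ≤ 1.1 * ‖w‖^3 := by
      rw [norm_mul]; exact mul_le_mul h2 b2 (norm_nonneg _) (by norm_num)
    have h4 : ‖w^3/24 - 5*w^4/576 + w^6/6912‖ ≤ ‖w‖^3/24 + 5*‖w‖^4/576 + ‖w‖^6/6912 := by
      refine ((norm_add_le _ _).trans (add_le_add (norm_sub_le _ _) le_rfl)).trans ?_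
      simp
    have h5 : ‖w‖^4 ≤ ‖w‖^3 := pow_le_pow_of_le_one hw0 (by linarith) (by norm_num)
    have h6 : ‖w‖^6 ≤ ‖w‖^3 := pow_le_pow_of_le_one hw0 (by linarith) (by norm_num)
    have h7 : 0 ≤ ‖w‖^3 := by positivity
    refine ((norm_add_le _ _).trans (add_le_add (norm_add_le _ _) le_rfl)).trans ?_
    linarith
  have bw3 : ‖w‖^3 ≤ 1/4096 := by
    calc ‖w‖^3 ≤ (1/16)^3 := pow_le_pow_left₀ hw0 hw1 3
      _ = 1/4096 := by norm_num
  have R2 : ‖R‖ ≤ 1/2 := by linarith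
  refine ⟨Complex.log (1 + R), ?_, ?_⟩
  · have ne : (1 + R) ≠ 0 := by
      intro h0
      have : R = -1 := by linear_combination h0
      rw [this] at R2
      norm_num at R2
    have h1 : z^2/2 - z^4/12 + Complex.log (1+R) = -v + Complex.log (1+R) := by
      rw [hv, hw]; ring
    rw [h1, Complex.exp_add, Complex.exp_log ne, hR, Complex.exp_neg]
    have := Complex.exp_ne_zero v
    field_simp
    ring
  · have := Complex.norm_log_one_add_half_le_self R2
    have e : ‖w‖^3 = ‖z‖^6 := by rw [hwn, ← pow_mul]
    rw [e] at bR
    linarith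

lemma norm_cosh_le (z : ℂ) : ‖Complex.cosh z‖ ≤ Real.exp ‖z‖ := by
  rw [Complex.cosh, norm_div]
  have h1 := norm_add_le (Complex.exp z) (Complex.exp (-z))
  have h2 := Complex.norm_exp_le_exp_norm z
  have h3 := Complex.norm_exp_le_exp_norm (-z)
  rw [norm_neg] at h3
  have : ‖(2:ℂ)‖ = 2 := by simp
  rw [this]
  linarith

lemma cosh_upper (z : ℂ) :
    ‖Complex.cosh z‖ ≤ Real.exp ((z^2/2 - z^4/12).re + 2000 * ‖z‖^6) := by
  have h0 := norm_nonneg z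
  rcases le_or_gt ‖z‖ (1/4) with hz | hz
  · obtain ⟨r, hr, hb⟩ := cosh_expansion z hz
    rw [hr, Complex.norm_exp, Complex.add_re]
    apply Real.exp_le_exp.2
    have := Complex.re_le_norm r
    have : 0 ≤ ‖z‖^6 := by positivity
    linarith
  · refine (norm_cosh_le z).trans (Real.exp_le_exp.2 ?_)
    have h1 := Complex.abs_re_le_norm (z^2/2 - z^4/12)
    have h2 : ‖z^2/2 - z^4/12‖ ≤ ‖z‖^2/2 + ‖z‖^4/12 := (norm_sub_le _ _).trans (by simp)
    have h3 := neg_le_of_abs_le h1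
    have p1 : 1 ≤ 4 * ‖z‖ := by linarith
    have q1 : ‖z‖ * 1 ≤ ‖z‖ * (4 * ‖z‖)^5 := mul_le_mul_of_nonneg_left (one_le_pow₀ p1) h0
    have q2 : ‖z‖^2 * 1 ≤ ‖z‖^2 * (4 * ‖z‖)^4 :=
      mul_le_mul_of_nonneg_left (one_le_pow₀ p1) (by positivity)
    have q3 : ‖z‖^4 * 1 ≤ ‖z‖^4 * (4 * ‖z‖)^2 :=
      mul_le_mul_of_nonneg_left (one_le_pow₀ p1) (by positivity)
    ring_nf at q1 q2 q3 h2 h3 ⊢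
    have : 0 ≤ ‖z‖^6 := by positivity
    linarith

lemma cosh_strict_small (h : ℝ) (hh : |h| ≤ 4) :
    Real.cosh h ≤ Real.exp (h^2/2 - h^4/400) := by
  set a := h^2/4 with ha
  have ha0 : 0 ≤ a := by positivity
  have ha4 : a ≤ 4 := by
    have := sq_le_sq' (abs_le.1 hh).1 (abs_le.1 hh).2
    rw [ha]; linarith
  have h1 : Real.cosh (h/2) ≤ Real.exp (a/2) := by
    refine (Real.cosh_le_exp_half_sq _).trans (le_of_eq ?_)
    rw [ha]; ring_nf
  have h2 : Real.cosh h = 2 * Real.cosh (h/2)^2 - 1 := by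
    have := Real.cosh_two_mul (h/2)
    have h3 := Real.cosh_sq (h/2)
    rw [show 2 * (h/2) = h by ring] at this
    linarith
  have h3 : Real.cosh (h/2)^2 ≤ Real.exp a := by
    have := pow_le_pow_left₀ (Real.cosh_pos _).le h1 2
    refine this.trans (le_of_eq ?_)
    rw [← Real.exp_nat_mul]; push_cast; ring_nf
  have e0 : 0 < Real.exp a := Real.exp_pos a
  have h4 : Real.cosh h ≤ Real.exp (2*a) * (1 - (1 - Real.exp (-a))^2) := by
    rw [Real.exp_neg, two_mul, Real.exp_add]
    have : Real.exp a * Real.exp a * (1 - (1 - (Real.exp a)⁻¹)^2) = 2 * Real.exp a - 1 := by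
      field_simp; ring
    rw [this]; linarith
  have h5 : Real.exp (-a) ≤ 1 / (1+a) := by
    rw [Real.exp_neg, inv_eq_one_div]
    exact one_div_le_one_div_of_le (by linarith) (by linarith [Real.add_one_le_exp a])
  have h6 : a/5 ≤ 1 - Real.exp (-a) := by
    have : 1/(1+a) ≤ 1 - a/5 := by
      rw [div_le_iff₀ (by linarith)]
      nlinarith
    linarith
  have h7 : h^4/400 ≤ (1 - Real.exp (-a))^2 := by
    have := pow_le_pow_left₀ (by positivity) h6 2
    refine le_trans (le_of_eq ?_) this
    rw [ha]; ring
  have h8 : 1 - (1 - Real.exp (-a))^2 ≤ Real.exp (-(h^4/400)) := by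
    have := Real.add_one_le_exp (-(h^4/400))
    linarith
  refine h4.trans ((mul_le_mul_of_nonneg_left h8 (Real.exp_pos _).le).trans (le_of_eq ?_))
  rw [← Real.exp_add, ha]; ring_nf

lemma cosh_strict_large (h : ℝ) (hh : 4 ≤ |h|) :
    Real.cosh h ≤ Real.exp (h^2/2 - h^2/4) := by
  have : Real.cosh h ≤ Real.exp |h| := by
    rw [← Real.cosh_abs, Real.cosh_eq]
    have : Real.exp (-|h|) ≤ Real.exp |h| := Real.exp_le_exp.2 (by linarith [abs_nonneg h])
    linarith
  refine this.trans (Real.exp_le_exp.2 ?_)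
  have := sq_abs h
  nlinarith

lemma sq_sub_sin_sq (η : ℝ) : η^2 - Real.sin η^2 ≤ 4 * η^4 := by
  rcases le_or_gt |η| (1/2) with h | h
  · have := Real.cos_bound (x := 2*η) (by rw [abs_mul]; norm_num; linarith)
    have h1 := (abs_le.1 this).2
    have h2 := Real.cos_two_mul' η
    have h3 := Real.sin_sq_add_cos_sq η
    have h4 : |2*η|^4 = 16 * η^4 := by
      rw [← abs_pow, abs_of_nonneg (by positivity)]; ring
    rw [h4] at h1
    have : 0 ≤ η^4 := by positivity
    nlinarith
  · have h1 : 1 ≤ 4 * η^2 := by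
      have := sq_abs η
      nlinarith
    nlinarith [sq_nonneg (Real.sin η), sq_nonneg η]

lemma norm_cosh_sq (h η : ℝ) :
    ‖Complex.cosh (h + η * Complex.I)‖^2 = Real.cosh h^2 - Real.sin η^2 := by
  rw [Complex.cosh_add, Complex.cosh_mul_I, Complex.sinh_mul_I, ← Complex.ofReal_cosh,
    ← Complex.ofReal_sinh, ← Complex.ofReal_cos, ← Complex.ofReal_sin, ← Complex.normSq_eq_norm_sq,
    Complex.normSq_apply]
  simp
  have h1 := Real.cosh_sq h
  have h2 := Real.sin_sq_add_cos_sq η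
  have h3 : Real.sinh h ^2 = Real.cosh h^2 - 1 := by linarith
  have h4 : Real.cos η^2 = 1 - Real.sin η^2 := by linarith
  rw [Complex.cos_ofReal_re, Complex.sinh_ofReal_re, Complex.sin_ofReal_re]
  calc _ = Real.cosh h^2 * Real.cos η^2 + Real.sinh h^2 * Real.sin η^2 := by ring
    _ = _ := by rw [h3, h4]; ring

lemma norm_cosh_exp (h η : ℝ) :
    ‖Complex.cosh (h + η * Complex.I)‖ ≤
      Real.cosh h * Real.exp (-(Real.sin η^2 / (2 * Real.cosh h^2))) := by
  have c0 := Real.cosh_pos h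
  rw [← pow_le_pow_iff_left₀ (norm_nonneg _) (by positivity) two_ne_zero]
  rw [norm_cosh_sq, mul_pow, ← Real.exp_nat_mul]
  have := Real.add_one_le_exp (-(Real.sin η^2 / Real.cosh h^2))
  have e : ((2:ℕ):ℝ) * -(Real.sin η^2 / (2 * Real.cosh h^2)) = -(Real.sin η^2 / Real.cosh h^2) := by
    push_cast; field_simp
  rw [e]
  calc _ = Real.cosh h^2 * (-(Real.sin η^2 / Real.cosh h^2) + 1) := by field_simp; ring
    _ ≤ _ := mul_le_mul_of_nonneg_left this (by positivity)

lemma cosh_large_aux (s h η : ℝ) (hs : |s| ≤ 1/1000) :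
    ‖Complex.cosh (h + η * Complex.I)‖ * Real.exp (-((1-s)/2 * (h^2 - η^2))) ≤
      Real.exp (200 * s^2 + (1 + |s|)/2 * η^2) ∧
    ‖Complex.cosh (h + η * Complex.I)‖ * Real.exp (-((1-s)/2 * (h^2 - η^2))) ≤
      Real.exp (200 * s^2 + 1000 * η^4) := by
  have c0 := Real.cosh_pos h
  have c1 := Real.one_le_cosh h
  have hN := norm_cosh_exp h η
  set m := Real.sin η^2 / (2 * Real.cosh h^2) with hm
  have hm0 : 0 ≤ m := by positivity
  have s1 := abs_le.1 hs
  have sa : s ≤ |s| := le_abs_self s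
  have sb : -s ≤ |s| := neg_le_abs s
  have s2 : s^2 = |s|^2 := (sq_abs s).symm
  have s0 := abs_nonneg s
  have s3 := sq_nonneg |s|
  have h20 := sq_nonneg h
  have e20 := sq_nonneg η
  have key : ∀ θ : ℝ, Real.cosh h ≤ Real.exp (h^2/2 - θ) → ∀ X : ℝ,
      (s/2 * h^2 - θ - m + (1-s)/2*η^2 ≤ X) →
      ‖Complex.cosh (h + η * Complex.I)‖ * Real.exp (-((1-s)/2 * (h^2 - η^2))) ≤ Real.exp X := by
    intro θ hθ X hX
    calc _ ≤ Real.exp (h^2/2 - θ) * Real.exp (-m) * Real.exp (-((1-s)/2 * (h^2 - η^2))) := by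
          apply mul_le_mul_of_nonneg_right _ (Real.exp_pos _).le
          exact hN.trans (mul_le_mul_of_nonneg_right hθ (Real.exp_pos _).le)
      _ ≤ _ := by
          rw [← Real.exp_add, ← Real.exp_add]
          apply Real.exp_le_exp.2
          linarith
  rcases le_or_gt |h| 4 with hh | hh
  · have hθ := cosh_strict_small h hh
    have q1 : |s| * h^2 ≤ h^4/800 + 200*|s|^2 := by nlinarith [sq_nonneg (h^2 - 400*|s|)]
    have q2 : s * h^2 ≤ |s| * h^2 := mul_le_mul_of_nonneg_right sa h20
    have q3 : -s * η^2 ≤ |s| * η^2 := mul_le_mul_of_nonneg_right sb e20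
    have q4 : 0 ≤ h^4 := by positivity
    constructor
    · apply key _ hθ
      linarith
    · apply key _ hθ
      have m1 : Real.sin η^2 * (1 - h^2)/2 ≤ m := by
        have : 1 - h^2 ≤ 1 / Real.cosh h^2 := by
          have u1 : Real.cosh h^2 ≤ Real.exp (h^2) := by
            have := pow_le_pow_left₀ c0.le (Real.cosh_le_exp_half_sq h) 2
            refine this.trans (le_of_eq ?_)
            rw [← Real.exp_nat_mul]; push_cast; ring_nf
          have u2 : 1 - h^2 ≤ Real.exp (-h^2) := by
            have := Real.add_one_le_exp (-h^2); linarith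
          refine u2.trans ?_
          rw [Real.exp_neg, inv_eq_one_div]
          exact one_div_le_one_div_of_le (by positivity) u1
        have := mul_le_mul_of_nonneg_left this (sq_nonneg (Real.sin η))
        rw [hm]
        calc _ ≤ Real.sin η^2 * (1 / Real.cosh h^2) / 2 := by linarith
          _ = _ := by field_simp
      have m2 := sq_sub_sin_sq η
      have m3 : Real.sin η^2 ≤ η^2 := by
        have := Real.abs_sin_le_abs (x := η)
        exact sq_le_sq.2 this
      have m4 : Real.sin η^2 * h^2 ≤ η^2 * h^2 := mul_le_mul_of_nonneg_right m3 h20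
      have m5 : η^2 * h^2 ≤ h^4/800 + 200 * η^4 := by nlinarith [sq_nonneg (h^2 - 400*η^2)]
      have m6 : |s| * η^2 ≤ |s|^2/2 + η^4/2 := by nlinarith [sq_nonneg (|s| - η^2)]
      have : 0 ≤ η^4 := by positivity
      linarith
  · have hθ := cosh_strict_large h hh.le
    have q0 : 16 ≤ h^2 := by have := sq_abs h; nlinarith
    have q2 : s * h^2 ≤ |s| * h^2 := mul_le_mul_of_nonneg_right sa h20
    have q5 : |s| * h^2 ≤ 1/1000 * h^2 := mul_le_mul_of_nonneg_right hs h20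
    have q3 : -s * η^2 ≤ |s| * η^2 := mul_le_mul_of_nonneg_right sb e20
    have q6 : |s| * η^2 ≤ 1/1000 * η^2 := mul_le_mul_of_nonneg_right hs e20
    constructor
    · apply key _ hθ
      linarith
    · apply key _ hθ
      have : η^2 ≤ 1/2 + η^4/2 := by nlinarith [sq_nonneg (η^2 - 1)]
      have : 0 ≤ η^4 := by positivity
      linarith

lemma cosh_large (s h a b : ℝ) (hs : |s| ≤ 1/1000) :
    ‖Complex.cosh (h + ((a + b : ℝ) : ℂ) * Complex.I)‖ *
      Real.exp (-((1-s)/2 * (h^2 - (a+b)^2))) ≤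
      Real.exp (200 * s^2 + 5/8 * b^2 + 10000000 * a^4) := by
  obtain ⟨h1, h2⟩ := cosh_large_aux s h (a+b) hs
  rcases le_or_gt (9*|a|) |b| with hab | hab
  · refine h1.trans (Real.exp_le_exp.2 ?_)
    have e1 : |a+b| ≤ 10/9*|b| := (abs_add_le a b).trans (by linarith)
    have e2 : (a+b)^2 ≤ (10/9)^2*b^2 := by
      rw [← sq_abs (a+b), ← sq_abs b, ← mul_pow]
      exact pow_le_pow_left₀ (abs_nonneg _) e1 2
    have : 0 ≤ a^4 := by positivity
    have : (1+|s|)/2 * (a+b)^2 ≤ (1+1/1000)/2 * (a+b)^2 :=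
      mul_le_mul_of_nonneg_right (by linarith) (sq_nonneg _)
    nlinarith [sq_nonneg b]
  · refine h2.trans (Real.exp_le_exp.2 ?_)
    have e1 : |a+b| ≤ 10*|a| := (abs_add_le a b).trans (by linarith)
    have e2 : (a+b)^4 ≤ 10^4*a^4 := by
      have := pow_le_pow_left₀ (abs_nonneg _) e1 4
      rw [mul_pow] at this
      have ev : Even 4 := by decide
      rwa [ev.pow_abs, ev.pow_abs] at this
    have := sq_nonneg b
    linarith

/-! ### Part B: Gaussian polynomials and Wick powers -/

open ProbabilityTheory in
lemma integrable_pow_gauss (n : ℕ) : Integrable (fun x : ℝ => x ^ n) (gaussianReal 0 1) := by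
  rcases Nat.eq_zero_or_pos n with rfl | hn
  · simp
  have h := (memLp_id_gaussianReal (μ := 0) (v := 1) (n : NNReal))
  have h2 := MemLp.integrable_norm_pow (p := n) (by exact_mod_cast h) hn.ne'
  refine h2.mono' (by fun_prop) (Filter.Eventually.of_forall (fun x => ?_))
  simp

open ProbabilityTheory in
lemma integrable_pdf_pow (n : ℕ) : Integrable (fun x : ℝ => x ^ n * gaussianPDFReal 0 1 x) := by
  have h := integrable_pow_gauss n
  rw [gaussianReal_of_var_ne_zero 0 one_ne_zero, integrable_withDensity_iff_integrable_smul'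
    (measurable_gaussianPDF 0 1) (Filter.Eventually.of_forall (fun _ => gaussianPDF_lt_top))] at h
  refine h.congr (Filter.Eventually.of_forall (fun x => ?_))
  simp only [toReal_gaussianPDF, smul_eq_mul]
  ring

open ProbabilityTheory in
lemma gauss_moment_rec (n : ℕ) :
    ∫ x, x ^ (n + 1) ∂(gaussianReal 0 1) = n * ∫ x, x ^ (n - 1) ∂(gaussianReal 0 1) := by
  rw [integral_gaussianReal_eq_integral_smul one_ne_zero,
    integral_gaussianReal_eq_integral_smul one_ne_zero]
  have hd : ∀ x : ℝ, HasDerivAt (gaussianPDFReal 0 1) (-x * gaussianPDFReal 0 1 x) x := by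
    intro x
    unfold gaussianPDFReal
    have h1 : HasDerivAt (fun x : ℝ => -(x - 0) ^ 2 / (2 * ((1:NNReal):ℝ))) (-x) x := by
      have := (((hasDerivAt_id x).sub_const 0).pow 2).neg.div_const (2 * ((1:NNReal):ℝ))
      refine this.congr_deriv ?_
      simp
      try ring
    have h2 := (h1.exp).const_mul (√(2 * Real.pi * ((1 : NNReal) : ℝ)))⁻¹
    refine h2.congr_deriv ?_
    ring
  have key := integral_mul_deriv_eq_deriv_mul_of_integrable (A := ℝ)
    (u := fun x => x ^ n) (u' := fun x => n * x ^ (n-1)) (v := gaussianPDFReal 0 1)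
    (v' := fun x => -x * gaussianPDFReal 0 1 x) (fun x _ => by
      simpa using hasDerivAt_pow n x) (fun x _ => hd x)
    (by
      refine (integrable_pdf_pow (n+1)).neg.congr (Filter.Eventually.of_forall (fun x => ?_))
      simp only [Pi.neg_apply, Pi.mul_apply]; ring)
    (by
      refine ((integrable_pdf_pow (n-1)).const_mul (n:ℝ)).congr
        (Filter.Eventually.of_forall (fun x => ?_))
      simp only [Pi.mul_apply]; ring)
    (integrable_pdf_pow n)
  have e1 : ∫ x, gaussianPDFReal 0 1 x • x ^ (n+1) =
      - ∫ x, x ^ n * (-x * gaussianPDFReal 0 1 x) := by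
    rw [← integral_neg]
    congr 1; ext x; simp only [smul_eq_mul]; ring
  rw [e1, key, neg_neg, ← integral_const_mul]
  congr 1; ext x; simp only [smul_eq_mul]; ring

/-- Evaluation of a complex polynomial at a real point. -/
def pev {ι : Type} (g : ι → ℝ) (p : MvPolynomial ι ℂ) : ℂ :=
  MvPolynomial.eval (fun i => (g i : ℂ)) p

section poly
variable {ι : Type} [Fintype ι]

lemma pev_continuous (p : MvPolynomial ι ℂ) : Continuous (fun g : ι → ℝ => pev g p) := by
  have h := MvPolynomial.continuous_eval p
  exact h.comp (by fun_prop)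

lemma pev_monomial (g : ι → ℝ) (u : ι →₀ ℕ) (a : ℂ) :
    pev g (MvPolynomial.monomial u a) = a * ∏ i, (g i : ℂ) ^ (u i) := by
  rw [pev, MvPolynomial.eval_monomial, Finsupp.prod_fintype _ _ (by simp)]

lemma integrable_pow_gaussC (n : ℕ) :
    Integrable (fun x : ℝ => (x : ℂ) ^ n) (ProbabilityTheory.gaussianReal 0 1) := by
  have := (integrable_pow_gauss n).ofReal (𝕜 := ℂ)
  simpa using this

lemma pev_integrable (p : MvPolynomial ι ℂ) : Integrable (fun g => pev g p) (gpi ι) := by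
  induction p using MvPolynomial.induction_on' with
  | monomial u a =>
    simp only [pev_monomial]
    exact (Integrable.fintype_prod (f := fun i (x : ℝ) => (x : ℂ) ^ (u i))
      (fun i => integrable_pow_gaussC (u i))).const_mul a
  | add p q hp hq =>
    simp only [pev, map_add] at *
    exact hp.add hq

/-- Gaussian expectation of a polynomial. -/
def gEx (p : MvPolynomial ι ℂ) : ℂ := ∫ g, pev g p ∂(gpi ι)

lemma gEx_add (p q : MvPolynomial ι ℂ) : gEx (p + q) = gEx p + gEx q := by
  unfold gEx
  rw [← integral_add (pev_integrable p) (pev_integrable q)]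
  simp [pev]

lemma gEx_C_mul (a : ℂ) (p : MvPolynomial ι ℂ) : gEx (MvPolynomial.C a * p) = a * gEx p := by
  unfold gEx
  rw [← integral_const_mul]
  simp [pev]

lemma gEx_sub (p q : MvPolynomial ι ℂ) : gEx (p - q) = gEx p - gEx q := by
  have : p - q = p + MvPolynomial.C (-1) * q := by simp [sub_eq_add_neg]
  rw [this, gEx_add, gEx_C_mul]; ring

lemma gEx_sum {κ : Type*} (s : Finset κ) (p : κ → MvPolynomial ι ℂ) :
    gEx (∑ k ∈ s, p k) = ∑ k ∈ s, gEx (p k) := by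
  unfold gEx
  rw [← integral_finsetSum _ (fun k _ => pev_integrable (p k))]
  simp [pev]

lemma gEx_one : gEx (1 : MvPolynomial ι ℂ) = 1 := by
  simp [gEx, pev]

lemma gEx_ibp (i : ι) (p : MvPolynomial ι ℂ) :
    gEx (MvPolynomial.X i * p) = gEx (MvPolynomial.pderiv i p) := by
  classical
  induction p using MvPolynomial.induction_on' with
  | monomial u a =>
    have hm : ∀ (v : ι →₀ ℕ) (b : ℂ), gEx (MvPolynomial.monomial v b) =
        b * ∏ j, ∫ x : ℝ, (x : ℂ) ^ (v j) ∂(ProbabilityTheory.gaussianReal 0 1) := by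
      intro v b
      unfold gEx
      simp only [pev_monomial]
      rw [integral_const_mul]
      congr 1
      exact integral_fintype_prod_eq_prod (𝕜 := ℂ) (fun j (x : ℝ) => (x : ℂ) ^ (v j))
    have hX : MvPolynomial.X i * MvPolynomial.monomial u a =
        MvPolynomial.monomial (Finsupp.single i 1 + u) a := by
      rw [MvPolynomial.X, MvPolynomial.monomial_mul, one_mul]
    rw [MvPolynomial.pderiv_monomial, hX, hm, hm, mul_assoc]
    congr 1
    rw [← Finset.mul_prod_erase Finset.univ _ (Finset.mem_univ i),
      ← Finset.mul_prod_erase Finset.univ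
        (fun j => ∫ x : ℝ, (x : ℂ) ^ ((u - Finsupp.single i 1 : ι →₀ ℕ) j)
          ∂(ProbabilityTheory.gaussianReal 0 1)) (Finset.mem_univ i),
      ← mul_assoc]
    congr 1
    · simp only [Finsupp.add_apply, Finsupp.single_eq_same, Finsupp.tsub_apply]
      have h := gauss_moment_rec (u i)
      have h2 : ∀ n : ℕ, ∫ x : ℝ, (x : ℂ) ^ n ∂(ProbabilityTheory.gaussianReal 0 1) =
          ((∫ x : ℝ, x ^ n ∂(ProbabilityTheory.gaussianReal 0 1) : ℝ) : ℂ) := by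
        intro n
        rw [← integral_complex_ofReal]
        simp
      rw [h2, h2, add_comm 1, h]
      push_cast
      ring
    · apply Finset.prod_congr rfl
      intro j hj
      have hji : j ≠ i := (Finset.mem_erase.1 hj).1
      simp [hji]
  | add p q hp hq => rw [mul_add, gEx_add, hp, hq, map_add, gEx_add]

/-- linear form with complex coefficients -/
def lf (α : ι → ℂ) (g : ι → ℝ) : ℂ := ∑ i, α i * (g i : ℂ)

/-- bilinear pairing -/
def bq (α β : ι → ℂ) : ℂ := ∑ i, α i * β i

def linP (α : ι → ℂ) : MvPolynomial ι ℂ := ∑ i, MvPolynomial.C (α i) * MvPolynomial.X i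

lemma pev_linP (α : ι → ℂ) (g : ι → ℝ) : pev g (linP α) = lf α g := by
  simp [pev, linP, lf]

/-- directional derivative -/
def dirD (α : ι → ℂ) : Derivation ℂ (MvPolynomial ι ℂ) (MvPolynomial ι ℂ) :=
  ∑ i, α i • MvPolynomial.pderiv i

lemma dirD_apply (α : ι → ℂ) (p : MvPolynomial ι ℂ) :
    dirD α p = ∑ i, MvPolynomial.C (α i) * MvPolynomial.pderiv i p := by
  have h : ∀ s : Finset ι, (∑ i ∈ s, α i • MvPolynomial.pderiv i :
      Derivation ℂ (MvPolynomial ι ℂ) (MvPolynomial ι ℂ)) p =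
      ∑ i ∈ s, MvPolynomial.C (α i) * MvPolynomial.pderiv i p := by
    classical
    intro s
    induction s using Finset.induction_on with
    | empty => simp
    | insert i s hi ih =>
      rw [Finset.sum_insert hi, Finset.sum_insert hi, Derivation.add_apply, ih,
        Derivation.smul_apply, MvPolynomial.smul_eq_C_mul]
  exact h Finset.univ

lemma dirD_linP (α β : ι → ℂ) : dirD α (linP β) = MvPolynomial.C (bq α β) := by
  classical
  rw [dirD_apply, bq, map_sum]
  apply Finset.sum_congr rfl
  intro i _
  rw [map_mul]
  congr 1
  simp [linP, MvPolynomial.pderiv_X, Pi.single_apply]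

lemma gEx_linP_mul (α : ι → ℂ) (p : MvPolynomial ι ℂ) : gEx (linP α * p) = gEx (dirD α p) := by
  rw [linP, Finset.sum_mul, gEx_sum, dirD_apply, gEx_sum]
  apply Finset.sum_congr rfl
  intro i _
  rw [mul_assoc, gEx_C_mul, gEx_C_mul, gEx_ibp]

end poly

/-- Wick powers (Hermite polynomials with variance `a`). -/
def wick {R : Type*} [CommRing R] (a : R) : ℕ → R → R
  | 0, _ => 1
  | 1, x => x
  | (n+2), x => x * wick a (n+1) x - (n+1) * a * wick a n x

lemma wick_map {R S : Type*} [CommRing R] [CommRing S] (f : R →+* S) (a x : R) (n : ℕ) :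
    f (wick a n x) = wick (f a) n (f x) := by
  induction n using Nat.twoStepInduction with
  | zero => simp [wick]
  | one => simp [wick]
  | more n h1 h2 => simp [wick, h1, h2]

section poly2
variable {ι : Type} [Fintype ι]

lemma dirD_wick (α : ι → ℂ) (a : ℂ) (x : MvPolynomial ι ℂ) (n : ℕ) :
    dirD α (wick (MvPolynomial.C a) (n+1) x) =
      (n+1) * wick (MvPolynomial.C a) n x * dirD α x := by
  induction n using Nat.twoStepInduction with
  | zero => simp [wick]
  | one =>
    simp only [wick, map_sub, Derivation.leibniz, Derivation.map_natCast, smul_eq_mul]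
    have : dirD α (MvPolynomial.C a) = 0 := by
      simpa using (dirD α).map_algebraMap a
    simp [this]; ring
  | more n h1 h2 =>
    rw [wick]
    have hc : dirD α (MvPolynomial.C a) = 0 := by
      simpa using (dirD α).map_algebraMap a
    have hn : dirD α ((((n + 1 : ℕ) : MvPolynomial ι ℂ) + 1)) = 0 := by
      rw [map_add, Derivation.map_natCast, Derivation.map_one_eq_zero, add_zero]
    rw [map_sub, Derivation.leibniz, Derivation.leibniz, Derivation.leibniz, h1, h2, hc, hn]
    simp only [smul_eq_mul]
    rw [show n + 1 + 1 = n + 2 from rfl, wick]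
    push_cast
    ring

lemma gEx_wick (α β : ι → ℂ) (b : ℂ) (m : ℕ) :
    gEx (wick (MvPolynomial.C (bq α α)) m (linP α) * wick (MvPolynomial.C b) m (linP β)) =
      m.factorial * (bq α β) ^ m := by
  induction m with
  | zero => simp [wick, gEx_one]
  | succ m ih =>
    cases m with
    | zero => 
      simp only [wick]
      rw [gEx_linP_mul, dirD_linP]
      have := gEx_C_mul (ι := ι) (bq α β) 1
      rw [mul_one, gEx_one] at this
      simp [this]
    | succ m =>
      set X := linP α
      set Y := linP β
      set P := wick (MvPolynomial.C b) (m+1+1) Y with hP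
      have e1 : wick (MvPolynomial.C (bq α α)) (m+1+1) X * P =
          X * (wick (MvPolynomial.C (bq α α)) (m+1) X * P) -
            MvPolynomial.C ((m+1) * bq α α) * (wick (MvPolynomial.C (bq α α)) m X * P) := by
        rw [show m + 1 + 1 = m + 2 from rfl, wick]
        simp only [map_mul, map_add, map_one, map_natCast]
        ring
      rw [e1, gEx_sub, gEx_linP_mul, Derivation.leibniz, dirD_wick, hP, dirD_wick, dirD_linP,
        dirD_linP, ← hP]
      simp only [smul_eq_mul]
      have e2 : wick (MvPolynomial.C (bq α α)) (m+1) X *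
          ((((m + 1 : ℕ) : MvPolynomial ι ℂ) + 1) * wick (MvPolynomial.C b) (m+1) Y *
            MvPolynomial.C (bq α β)) + P * (((m : MvPolynomial ι ℂ) + 1) * wick (MvPolynomial.C (bq α α)) m X *
            MvPolynomial.C (bq α α)) =
          MvPolynomial.C ((m+1+1) * bq α β) * (wick (MvPolynomial.C (bq α α)) (m+1) X *
            wick (MvPolynomial.C b) (m+1) Y) + MvPolynomial.C ((m+1) * bq α α) *
              (wick (MvPolynomial.C (bq α α)) m X * P) := by
        simp only [map_mul, map_add, map_one, map_natCast]
        push_cast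
        ring
      rw [e2, gEx_add, gEx_C_mul, gEx_C_mul, ih]
      rw [Nat.factorial_succ (m+1)]
      push_cast
      ring

end poly2

/-! ### Part B2: tensor estimates -/

section poly3
variable {ι : Type} [Fintype ι]

/-- conjugated coefficients -/
def cj (α : ι → ℂ) : ι → ℂ := fun i => (starRingEnd ℂ) (α i)

lemma lf_cj (α : ι → ℂ) (g : ι → ℝ) : lf (cj α) g = (starRingEnd ℂ) (lf α g) := by
  simp [lf, cj]

lemma bq_cj (α : ι → ℂ) : bq (cj α) (cj α) = (starRingEnd ℂ) (bq α α) := by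
  simp [bq, cj]

lemma lf_add (α : ι → ℂ) (g h : ι → ℝ) : lf α (g + h) = lf α g + lf α h := by
  simp [lf, mul_add, Finset.sum_add_distrib]

lemma lf_continuous (α : ι → ℂ) : Continuous (lf α) := by
  unfold lf; fun_prop

lemma pev_wick (g : ι → ℝ) (a : ℂ) (m : ℕ) (p : MvPolynomial ι ℂ) :
    pev g (wick (MvPolynomial.C a) m p) = wick a m (pev g p) := by
  unfold pev
  rw [wick_map]; simp

variable {Z : Type} [Fintype Z]

/-- the tensor polynomial -/
def tp (c : Z → ℝ) (α : Z → ι → ℂ) (j m : ℕ) (i : Fin j → ι) (g : ι → ℝ) : ℂ :=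
  ∑ z, (c z : ℂ) * (∏ k, α z (i k)) * wick (bq (α z) (α z)) m (lf (α z) g)

def TT (c : Z → ℝ) (α : Z → ι → ℂ) (j m : ℕ) (g : ι → ℝ) : ℝ :=
  ∑ i : Fin j → ι, ‖tp c α j m i g‖ ^ 2

lemma TT_nonneg (c : Z → ℝ) (α : Z → ι → ℂ) (j m : ℕ) (g : ι → ℝ) : 0 ≤ TT c α j m g :=
  Finset.sum_nonneg (fun _ _ => by positivity)

def tpP (c : Z → ℝ) (α : Z → ι → ℂ) (j m : ℕ) (i : Fin j → ι) : MvPolynomial ι ℂ :=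
  ∑ z, MvPolynomial.C ((c z : ℂ) * (∏ k, α z (i k))) *
    wick (MvPolynomial.C (bq (α z) (α z))) m (linP (α z))

lemma pev_mul (g : ι → ℝ) (p q : MvPolynomial ι ℂ) : pev g (p * q) = pev g p * pev g q := by
  simp [pev]
lemma pev_C (g : ι → ℝ) (a : ℂ) : pev g (MvPolynomial.C a) = a := by
  simp [pev]
lemma pev_sum {κ : Type*} (g : ι → ℝ) (s : Finset κ) (p : κ → MvPolynomial ι ℂ) :
    pev g (∑ k ∈ s, p k) = ∑ k ∈ s, pev g (p k) := by
  simp [pev]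

lemma pev_tpP (c : Z → ℝ) (α : Z → ι → ℂ) (j m : ℕ) (i : Fin j → ι) (g : ι → ℝ) :
    pev g (tpP c α j m i) = tp c α j m i g := by
  simp only [tpP, tp, pev_sum, pev_mul, pev_C, pev_wick, pev_linP]

lemma tp_conj (c : Z → ℝ) (α : Z → ι → ℂ) (j m : ℕ) (i : Fin j → ι) (g : ι → ℝ) :
    (starRingEnd ℂ) (tp c α j m i g) = tp c (fun z => cj (α z)) j m i g := by
  unfold tp
  rw [map_sum]
  apply Finset.sum_congr rfl
  intro z _
  rw [map_mul, map_mul, wick_map, lf_cj, bq_cj, map_prod, Complex.conj_ofReal]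
  rfl

lemma tp_norm_sq (c : Z → ℝ) (α : Z → ι → ℂ) (j m : ℕ) (i : Fin j → ι) (g : ι → ℝ) :
    ((‖tp c α j m i g‖ ^ 2 : ℝ) : ℂ) =
      pev g (tpP c α j m i * tpP c (fun z => cj (α z)) j m i) := by
  rw [pev_mul, pev_tpP, pev_tpP, ← tp_conj, Complex.mul_conj, Complex.normSq_eq_norm_sq]

lemma tp_continuous (c : Z → ℝ) (α : Z → ι → ℂ) (j m : ℕ) (i : Fin j → ι) :
    Continuous (tp c α j m i) := by
  have : tp c α j m i = fun g => pev g (tpP c α j m i) := by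
    ext g; rw [pev_tpP]
  rw [this]; exact pev_continuous _

lemma TT_continuous (c : Z → ℝ) (α : Z → ι → ℂ) (j m : ℕ) : Continuous (TT c α j m) := by
  unfold TT
  exact continuous_finset_sum _ (fun i _ => (tp_continuous c α j m i).norm.pow 2)

lemma tp_sq_integrable (c : Z → ℝ) (α : Z → ι → ℂ) (j m : ℕ) (i : Fin j → ι) :
    Integrable (fun g => ‖tp c α j m i g‖ ^ 2) (gpi ι) := by
  have h := (pev_integrable (tpP c α j m i * tpP c (fun z => cj (α z)) j m i)).norm
  refine h.congr (Filter.Eventually.of_forall (fun g => ?_))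
  simp only
  rw [← tp_norm_sq, Complex.norm_real]
  simp

lemma TT_integrable (c : Z → ℝ) (α : Z → ι → ℂ) (j m : ℕ) :
    Integrable (TT c α j m) (gpi ι) := by
  unfold TT
  exact integrable_finsetSum _ (fun i _ => tp_sq_integrable c α j m i)

lemma TT_integral (c : Z → ℝ) (α : Z → ι → ℂ) (j m : ℕ) :
    ((∫ g, TT c α j m g ∂(gpi ι) : ℝ) : ℂ) =
      m.factorial * ∑ z, ∑ z', (c z : ℂ) * (c z' : ℂ) * (bq (α z) (cj (α z'))) ^ (j + m) := by
  classical
  have e1 : ((∫ g, TT c α j m g ∂(gpi ι) : ℝ) : ℂ) =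
      ∑ i : Fin j → ι, gEx (tpP c α j m i * tpP c (fun z => cj (α z)) j m i) := by
    unfold TT
    rw [integral_finsetSum _ (fun i _ => tp_sq_integrable c α j m i)]
    push_cast
    apply Finset.sum_congr rfl
    intro i _
    rw [← integral_complex_ofReal]
    unfold gEx
    congr 1; ext g
    rw [← tp_norm_sq]
  rw [e1]
  have e2 : ∀ i : Fin j → ι, gEx (tpP c α j m i * tpP c (fun z => cj (α z)) j m i) =
      ∑ z, ∑ z', (m.factorial : ℂ) * ((c z : ℂ) * (c z' : ℂ) * (bq (α z) (cj (α z'))) ^ m) *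
        ∏ k, (α z (i k) * cj (α z') (i k)) := by
    intro i
    unfold tpP
    rw [Finset.sum_mul_sum, gEx_sum]
    apply Finset.sum_congr rfl
    intro z _
    rw [gEx_sum]
    apply Finset.sum_congr rfl
    intro z' _
    rw [mul_mul_mul_comm, ← map_mul, gEx_C_mul, gEx_wick, Finset.prod_mul_distrib]
    ring
  simp only [e2]
  rw [Finset.sum_comm, Finset.mul_sum]
  apply Finset.sum_congr rfl
  intro z _
  rw [Finset.sum_comm, Finset.mul_sum]
  apply Finset.sum_congr rfl
  intro z' _
  rw [← Finset.mul_sum, pow_add]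
  have : bq (α z) (cj (α z')) ^ j = ∑ i : Fin j → ι, ∏ k, (α z (i k) * cj (α z') (i k)) := by
    rw [bq, Fintype.sum_pow]
  rw [this]; ring

lemma tp_bound (c : Z → ℝ) (α : Z → ι → ℂ) (j m : ℕ) (g w : ι → ℝ) :
    ‖∑ z, (c z : ℂ) * (lf (α z) w) ^ j * wick (bq (α z) (α z)) m (lf (α z) g)‖ ^ 2 ≤
      (∑ i, w i ^ 2) ^ j * TT c α j m g := by
  classical
  have e1 : ∑ z, (c z : ℂ) * (lf (α z) w) ^ j * wick (bq (α z) (α z)) m (lf (α z) g) =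
      ∑ i : Fin j → ι, ((∏ k, w (i k) : ℝ) : ℂ) * tp c α j m i g := by
    unfold tp
    simp only [Finset.mul_sum]
    rw [Finset.sum_comm]
    apply Finset.sum_congr rfl
    intro z _
    rw [lf, Fintype.sum_pow, Finset.mul_sum, Finset.sum_mul]
    apply Finset.sum_congr rfl
    intro i _
    rw [Finset.prod_mul_distrib]
    push_cast
    ring
  rw [e1]
  have h1 : ‖∑ i : Fin j → ι, ((∏ k, w (i k) : ℝ) : ℂ) * tp c α j m i g‖ ≤
      ∑ i : Fin j → ι, |∏ k, w (i k)| * ‖tp c α j m i g‖ := by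
    refine (norm_sum_le _ _).trans (le_of_eq ?_)
    apply Finset.sum_congr rfl
    intro i _
    rw [norm_mul, Complex.norm_real, Real.norm_eq_abs]
  calc _ ≤ (∑ i : Fin j → ι, |∏ k, w (i k)| * ‖tp c α j m i g‖) ^ 2 := by gcongr
    _ ≤ (∑ i : Fin j → ι, |∏ k, w (i k)| ^ 2) * ∑ i : Fin j → ι, ‖tp c α j m i g‖ ^ 2 :=
      Finset.sum_mul_sq_le_sq_mul_sq _ _ _
    _ = _ := by
      rw [TT, Fintype.sum_pow]
      congr 1
      apply Finset.sum_congr rfl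
      intro i _
      rw [sq_abs, Finset.prod_pow]

/-- The Wick sum. -/
def wS (c : Z → ℝ) (α : Z → ι → ℂ) (m : ℕ) (g : ι → ℝ) : ℂ :=
  ∑ z, (c z : ℂ) * wick (bq (α z) (α z)) m (lf (α z) g)

lemma wS_continuous (c : Z → ℝ) (α : Z → ι → ℂ) (m : ℕ) : Continuous (wS c α m) := by
  have : wS c α m = tp c α 0 m (fun i => i.elim0) := by
    ext g; simp [wS, tp]
  rw [this]; exact tp_continuous _ _ _ _ _

lemma wS_TT (c : Z → ℝ) (α : Z → ι → ℂ) (m : ℕ) (g : ι → ℝ) :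
    ‖wS c α m g‖ ^ 2 = TT c α 0 m g := by
  simp [TT, tp, wS]

lemma half_sq (a b : ℝ) (x : ℝ) (h : x ^ 2 ≤ a) (hb : a ≤ b) : x ≤ 1 / 2 + b / 2 := by
  nlinarith [sq_nonneg (x - 1)]

lemma wS4_shift (c : Z → ℝ) (α : Z → ι → ℂ) (x y : ι → ℝ) (t : ℝ) (ht : 1 ≤ t)
    (h : ∑ i, (x i - y i) ^ 2 ≤ t) :
    ‖wS c α 4 x‖ ≤ 8 + 3 * t ^ 4 * (TT c α 0 4 y + TT c α 1 3 y + TT c α 2 2 y + TT c α 3 1 y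
      + TT c α 4 0 y) := by
  set w : ι → ℝ := fun i => x i - y i with hw
  have hx : x = y + w := by ext i; simp [hw]
  set s : ℕ → ℕ → ℂ := fun j m =>
    ∑ z, (c z : ℂ) * (lf (α z) w) ^ j * wick (bq (α z) (α z)) m (lf (α z) y) with hs
  have e : wS c α 4 x = s 0 4 + 4 * s 1 3 + 6 * s 2 2 + 4 * s 3 1 + s 4 0 := by
    simp only [wS, hs, Finset.mul_sum, ← Finset.sum_add_distrib]
    apply Finset.sum_congr rfl
    intro z _
    rw [hx, lf_add]
    simp only [wick]
    push_cast
    ring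
  have hb : ∀ j m, j ≤ 4 → ‖s j m‖ ≤ 1 / 2 + t ^ 4 * TT c α j m y / 2 := by
    intro j m hj
    refine half_sq _ _ _ (tp_bound c α j m y w) ?_
    have h0 : 0 ≤ ∑ i, w i ^ 2 := Finset.sum_nonneg (fun _ _ => sq_nonneg _)
    apply mul_le_mul_of_nonneg_right _ (TT_nonneg _ _ _ _ _)
    exact (pow_le_pow_left₀ h0 h j).trans (pow_le_pow_right₀ ht hj)
  have n1 := norm_add_le (s 0 4 + 4 * s 1 3 + 6 * s 2 2 + 4 * s 3 1) (s 4 0)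
  have n2 := norm_add_le (s 0 4 + 4 * s 1 3 + 6 * s 2 2) (4 * s 3 1)
  have n3 := norm_add_le (s 0 4 + 4 * s 1 3) (6 * s 2 2)
  have n4 := norm_add_le (s 0 4) (4 * s 1 3)
  simp only [norm_mul, RCLike.norm_ofNat] at n1 n2 n3 n4
  have b0 := hb 0 4 (by norm_num)
  have b1 := hb 1 3 (by norm_num)
  have b2 := hb 2 2 (by norm_num)
  have b3 := hb 3 1 (by norm_num)
  have b4 := hb 4 0 (by norm_num)
  have ht4 : 0 ≤ t ^ 4 := by positivity
  have p0 := mul_nonneg ht4 (TT_nonneg c α 0 4 y)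
  have p1 := mul_nonneg ht4 (TT_nonneg c α 1 3 y)
  have p3 := mul_nonneg ht4 (TT_nonneg c α 3 1 y)
  have p4 := mul_nonneg ht4 (TT_nonneg c α 4 0 y)
  rw [e]
  linarith

lemma wS2_shift (c : Z → ℝ) (α : Z → ι → ℂ) (x y : ι → ℝ) (t b : ℝ) (ht : 1 ≤ t)
    (h : ∑ i, (x i - y i) ^ 2 ≤ t) :
    |b| * ‖wS c α 2 x‖ ≤ 2 + t ^ 2 * b ^ 2 * (TT c α 0 2 y + TT c α 1 1 y + TT c α 2 0 y) := by
  set w : ι → ℝ := fun i => x i - y i with hw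
  have hx : x = y + w := by ext i; simp [hw]
  set s : ℕ → ℕ → ℂ := fun j m =>
    ∑ z, (c z : ℂ) * (lf (α z) w) ^ j * wick (bq (α z) (α z)) m (lf (α z) y) with hs
  have e : wS c α 2 x = s 0 2 + 2 * s 1 1 + s 2 0 := by
    simp only [wS, hs, Finset.mul_sum, ← Finset.sum_add_distrib]
    apply Finset.sum_congr rfl
    intro z _
    rw [hx, lf_add]
    simp only [wick]
    push_cast
    ring
  have hb : ∀ j m, j ≤ 2 → |b| * ‖s j m‖ ≤ 1 / 2 + t ^ 2 * b ^ 2 * TT c α j m y / 2 := by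
    intro j m hj
    refine half_sq (b ^ 2 * ((∑ i, w i ^ 2) ^ j * TT c α j m y)) _ _ ?_ ?_
    · rw [mul_pow, sq_abs]
      exact mul_le_mul_of_nonneg_left (tp_bound c α j m y w) (sq_nonneg b)
    have h0 : 0 ≤ ∑ i, w i ^ 2 := Finset.sum_nonneg (fun _ _ => sq_nonneg _)
    rw [mul_comm (t ^ 2), mul_assoc]
    apply mul_le_mul_of_nonneg_left _ (sq_nonneg b)
    apply mul_le_mul_of_nonneg_right _ (TT_nonneg _ _ _ _ _)
    exact (pow_le_pow_left₀ h0 h j).trans (pow_le_pow_right₀ ht hj)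
  have n1 := norm_add_le (s 0 2 + 2 * s 1 1) (s 2 0)
  have n2 := norm_add_le (s 0 2) (2 * s 1 1)
  simp only [norm_mul, RCLike.norm_ofNat] at n1 n2
  have n3 : |b| * ‖wS c α 2 x‖ ≤ |b| * ‖s 0 2‖ + 2 * (|b| * ‖s 1 1‖) + |b| * ‖s 2 0‖ := by
    rw [e]
    calc _ ≤ |b| * (‖s 0 2‖ + 2 * ‖s 1 1‖ + ‖s 2 0‖) :=
          mul_le_mul_of_nonneg_left (by linarith) (abs_nonneg b)
      _ = _ := by ring
  have b0 := hb 0 2 (by norm_num)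
  have b1 := hb 1 1 (by norm_num)
  have b2 := hb 2 0 (by norm_num)
  have ht4 : 0 ≤ t ^ 2 * b ^ 2 := by positivity
  have p0 := mul_nonneg ht4 (TT_nonneg c α 0 2 y)
  have p3 := mul_nonneg ht4 (TT_nonneg c α 2 0 y)
  linarith

/-- moments of complex linear forms -/
lemma linP_moment (α : ι → ℂ) (n : ℕ) :
    gEx (linP α ^ (n + 2)) = (n + 1) * bq α α * gEx (linP α ^ n) := by
  rw [pow_succ', gEx_linP_mul, Derivation.leibniz_pow, dirD_linP]
  rw [smul_eq_mul, nsmul_eq_mul, Nat.add_sub_cancel]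
  have : ((n + 1 : ℕ) : MvPolynomial ι ℂ) * (linP α ^ n * MvPolynomial.C (bq α α)) =
      MvPolynomial.C ((n + 1) * bq α α) * linP α ^ n := by
    simp only [map_mul, map_add, map_one, map_natCast]
    push_cast; ring
  rw [this, gEx_C_mul]

lemma real_moment (v : ι → ℝ) :
    ∫ g, (∑ i, v i * g i) ^ 6 ∂(gpi ι) = 15 * (∑ i, v i ^ 2) ^ 3 ∧
    ∫ g, (∑ i, v i * g i) ^ 8 ∂(gpi ι) = 105 * (∑ i, v i ^ 2) ^ 4 ∧
    (∀ n : ℕ, Integrable (fun g => (∑ i, v i * g i) ^ n) (gpi ι)) := by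
  set α : ι → ℂ := fun i => (v i : ℂ) with hα
  have hl : ∀ n g, pev g (linP α ^ n) = (((∑ i, v i * g i) ^ n : ℝ) : ℂ) := by
    intro n g
    have : pev g (linP α ^ n) = (pev g (linP α)) ^ n := by simp [pev]
    rw [this, pev_linP, lf]; push_cast; rfl
  have hE : ∀ n, ((∫ g, (∑ i, v i * g i) ^ n ∂(gpi ι) : ℝ) : ℂ) = gEx (linP α ^ n) := by
    intro n
    rw [← integral_complex_ofReal]
    unfold gEx
    congr 1; ext g; rw [hl]
  have hb : bq α α = ((∑ i, v i ^ 2 : ℝ) : ℂ) := by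
    simp [bq, hα, sq]
  have e0 : gEx (linP α ^ 0) = 1 := by rw [pow_zero, gEx_one]
  have e2 := linP_moment α 0
  have e4 := linP_moment α 2
  have e6 := linP_moment α 4
  have e8 := linP_moment α 6
  norm_num at e2 e4 e6 e8
  rw [gEx_one] at e2
  refine ⟨?_, ?_, ?_⟩
  · have := hE 6
    rw [e6, e4, e2, hb] at this
    have h2 : ((∫ g, (∑ i, v i * g i) ^ 6 ∂(gpi ι) : ℝ) : ℂ) =
      ((15 * (∑ i, v i ^ 2) ^ 3 : ℝ) : ℂ) := by rw [this]; push_cast; ring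
    exact_mod_cast h2
  · have := hE 8
    rw [e8, e6, e4, e2, hb] at this
    have h2 : ((∫ g, (∑ i, v i * g i) ^ 8 ∂(gpi ι) : ℝ) : ℂ) =
      ((105 * (∑ i, v i ^ 2) ^ 4 : ℝ) : ℂ) := by rw [this]; push_cast; ring
    exact_mod_cast h2
  · intro n
    refine (pev_integrable (linP α ^ n)).re.congr (Filter.Eventually.of_forall (fun g => ?_))
    simp only [hl]
    simp [← Complex.ofReal_pow]

lemma lf_norm_sq (α : ι → ℂ) (g : ι → ℝ) :
    ‖lf α g‖ ^ 2 = (∑ i, (α i).re * g i) ^ 2 + (∑ i, (α i).im * g i) ^ 2 := by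
  have h1 : (lf α g).re = ∑ i, (α i).re * g i := by simp [lf]
  have h2 : (lf α g).im = ∑ i, (α i).im * g i := by simp [lf]
  rw [← Complex.normSq_eq_norm_sq, Complex.normSq_apply, h1, h2]; ring

lemma sq_sum (α : ι → ℂ) : ∑ i, ‖α i‖ ^ 2 = ∑ i, (α i).re ^ 2 + ∑ i, (α i).im ^ 2 := by
  rw [← Finset.sum_add_distrib]
  apply Finset.sum_congr rfl
  intro i _
  rw [← Complex.normSq_eq_norm_sq, Complex.normSq_apply]; ring

lemma lf_moment6 (α : ι → ℂ) :
    Integrable (fun g => ‖lf α g‖ ^ 6) (gpi ι) ∧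
    ∫ g, ‖lf α g‖ ^ 6 ∂(gpi ι) ≤ 120 * (∑ i, ‖α i‖ ^ 2) ^ 3 := by
  obtain ⟨a6, -, ai⟩ := real_moment (fun i => (α i).re)
  obtain ⟨b6, -, bi⟩ := real_moment (fun i => (α i).im)
  have hle : ∀ g, ‖lf α g‖ ^ 6 ≤ 4 * ((∑ i, (α i).re * g i) ^ 6 + (∑ i, (α i).im * g i) ^ 6) := by
    intro g
    have : ‖lf α g‖ ^ 6 = (‖lf α g‖ ^ 2) ^ 3 := by ring
    rw [this, lf_norm_sq]
    set u := (∑ i, (α i).re * g i) ^ 2 with hu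
    set v := (∑ i, (α i).im * g i) ^ 2 with hv
    have e1 : (∑ i, (α i).re * g i) ^ 6 = u ^ 3 := by rw [hu]; ring
    have e2 : (∑ i, (α i).im * g i) ^ 6 = v ^ 3 := by rw [hv]; ring
    rw [e1, e2]
    have hu0 : 0 ≤ u := sq_nonneg _
    have hv0 : 0 ≤ v := sq_nonneg _
    nlinarith [mul_nonneg (add_nonneg hu0 hv0) (sq_nonneg (u - v))]
  have hI := ((ai 6).add (bi 6)).const_mul 4
  have hi1 : Integrable (fun g => ‖lf α g‖ ^ 6) (gpi ι) := by
    refine hI.mono' ((lf_continuous α).norm.pow 6).aestronglyMeasurable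
      (Filter.Eventually.of_forall (fun g => ?_))
    rw [Real.norm_of_nonneg (by positivity)]
    exact hle g
  refine ⟨hi1, ?_⟩
  calc _ ≤ ∫ g, 4 * ((∑ i, (α i).re * g i) ^ 6 + (∑ i, (α i).im * g i) ^ 6) ∂(gpi ι) :=
        integral_mono hi1 hI hle
    _ = 4 * (15 * (∑ i, (α i).re ^ 2) ^ 3 + 15 * (∑ i, (α i).im ^ 2) ^ 3) := by
        rw [integral_const_mul, integral_add (ai 6) (bi 6), a6, b6]
    _ ≤ _ := by
        rw [sq_sum]
        have hp : 0 ≤ ∑ i, (α i).re ^ 2 := Finset.sum_nonneg (fun _ _ => sq_nonneg _)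
        have hq : 0 ≤ ∑ i, (α i).im ^ 2 := Finset.sum_nonneg (fun _ _ => sq_nonneg _)
        set p := ∑ i, (α i).re ^ 2
        set q := ∑ i, (α i).im ^ 2
        have : 0 ≤ p ^ 2 * q := by positivity
        have : 0 ≤ p * q ^ 2 := by positivity
        have : 0 ≤ p ^ 3 := by positivity
        have : 0 ≤ q ^ 3 := by positivity
        nlinarith

lemma lf_moment8 (α : ι → ℂ) :
    Integrable (fun g => ‖lf α g‖ ^ 8) (gpi ι) ∧
    ∫ g, ‖lf α g‖ ^ 8 ∂(gpi ι) ≤ 1680 * (∑ i, ‖α i‖ ^ 2) ^ 4 := by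
  obtain ⟨-, a6, ai⟩ := real_moment (fun i => (α i).re)
  obtain ⟨-, b6, bi⟩ := real_moment (fun i => (α i).im)
  have hle : ∀ g, ‖lf α g‖ ^ 8 ≤ 8 * ((∑ i, (α i).re * g i) ^ 8 + (∑ i, (α i).im * g i) ^ 8) := by
    intro g
    have : ‖lf α g‖ ^ 8 = (‖lf α g‖ ^ 2) ^ 4 := by ring
    rw [this, lf_norm_sq]
    set u := (∑ i, (α i).re * g i) ^ 2 with hu
    set v := (∑ i, (α i).im * g i) ^ 2 with hv
    have e1 : (∑ i, (α i).re * g i) ^ 8 = u ^ 4 := by rw [hu]; ring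
    have e2 : (∑ i, (α i).im * g i) ^ 8 = v ^ 4 := by rw [hv]; ring
    rw [e1, e2]
    have h1 : (u + v) ^ 2 ≤ 2 * (u ^ 2 + v ^ 2) := by nlinarith [sq_nonneg (u - v)]
    have h2 : ((u + v) ^ 2) ^ 2 ≤ (2 * (u ^ 2 + v ^ 2)) ^ 2 := by gcongr
    nlinarith [sq_nonneg (u ^ 2 - v ^ 2)]
  have hI := ((ai 8).add (bi 8)).const_mul 8
  have hi1 : Integrable (fun g => ‖lf α g‖ ^ 8) (gpi ι) := by
    refine hI.mono' ((lf_continuous α).norm.pow 8).aestronglyMeasurable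
      (Filter.Eventually.of_forall (fun g => ?_))
    rw [Real.norm_of_nonneg (by positivity)]
    exact hle g
  refine ⟨hi1, ?_⟩
  calc _ ≤ ∫ g, 8 * ((∑ i, (α i).re * g i) ^ 8 + (∑ i, (α i).im * g i) ^ 8) ∂(gpi ι) :=
        integral_mono hi1 hI hle
    _ = 8 * (105 * (∑ i, (α i).re ^ 2) ^ 4 + 105 * (∑ i, (α i).im ^ 2) ^ 4) := by
        rw [integral_const_mul, integral_add (ai 8) (bi 8), a6, b6]
    _ ≤ _ := by
        rw [sq_sum]
        have hp : 0 ≤ ∑ i, (α i).re ^ 2 := Finset.sum_nonneg (fun _ _ => sq_nonneg _)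
        have hq : 0 ≤ ∑ i, (α i).im ^ 2 := Finset.sum_nonneg (fun _ _ => sq_nonneg _)
        set p := ∑ i, (α i).re ^ 2
        set q := ∑ i, (α i).im ^ 2
        have h1 : p ^ 4 ≤ (p + q) ^ 4 := by gcongr; linarith
        have h2 : q ^ 4 ≤ (p + q) ^ 4 := by gcongr; linarith
        linarith

end poly3

/-! ### Part D: stability estimate -/

section stab
variable {Λ ι : Type} [Fintype Λ] [Fintype ι]

/-- signs on the doubled lattice -/
def dsg : Λ ⊕ Λ → ℝ := Sum.elim (fun _ => 1) (fun _ => -1)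

/-- doubled coefficients -/
def dal (α β : Λ → ι → ℂ) : Λ ⊕ Λ → ι → ℂ := Sum.elim α β

/-- difference of covariances -/
def dcov (α β : Λ → ι → ℂ) (n : ℕ) : ℂ :=
  ∑ z, ∑ z', ((dsg z : ℝ) : ℂ) * ((dsg z' : ℝ) : ℂ) * (bq (dal α β z) (cj (dal α β z'))) ^ n

structure Stab (α : Λ → ι → ℂ) (αk : ℕ → Λ → ι → ℂ) (s B a astar K : ℝ) (kmax : ℕ) : Prop where
  hK : 1 ≤ K
  hast0 : 0 ≤ astar
  ha : ∀ x, bq (α x) (α x) = (a : ℂ)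
  hs : s = a + B
  hast : ∀ x, ∑ i, ‖α x i‖ ^ 2 ≤ astar
  hreal : ∀ k ≤ kmax, ∀ x i, (αk k x i).im = 0
  hak : ∀ k ≤ kmax, ∀ x, (Fintype.card Λ : ℝ) * (∑ i, ‖αk k x i‖ ^ 2) ^ 2 ≤ K * √(2 ^ k)
  hT4 : ∀ k ≤ kmax, (dcov α (αk k) 4).re ≤ K / (2 ^ k) ^ 8
  hT2 : ∀ k ≤ kmax, B ^ 2 * (dcov α (αk k) 2).re ≤ K / (2 ^ k) ^ 8
  hLa : (Fintype.card Λ : ℝ) * astar ^ 2 ≤ K * √(2 ^ kmax)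
  hLs : (Fintype.card Λ : ℝ) * s ^ 2 ≤ K * √(2 ^ kmax)
  hs1 : |s| ≤ 1 / 1000
  hLB : (Fintype.card Λ : ℝ) * B ^ 2 ≤ K
  h6 : (Fintype.card Λ : ℝ) * astar ^ 3 * (2 ^ kmax) ^ 3 ≤ K
  hg : ∀ w : ι → ℝ, ∑ x, (∑ i, (α x i).im * w i) ^ 2 ≤ 0.52 * ∑ i, w i ^ 2

/-- The (renormalised) weight. -/
def Wf (α : Λ → ι → ℂ) (s e0 : ℝ) (g : ι → ℝ) : ℂ :=
  ((Real.exp (-(Fintype.card Λ * e0)) : ℝ) : ℂ) *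
    ∏ x, (Complex.cosh (lf (α x) g) * Complex.exp (-(((1 - s) / 2 : ℝ) : ℂ) * (lf (α x) g) ^ 2))

lemma Wf_continuous (α : Λ → ι → ℂ) (s e0 : ℝ) : Continuous (Wf α s e0) := by
  unfold Wf
  refine continuous_const.mul (continuous_finset_prod _ (fun x _ => ?_))
  have h := lf_continuous (α x)
  exact (Complex.continuous_cosh.comp h).mul
    (Complex.continuous_exp.comp (continuous_const.mul (h.pow 2)))

lemma Wf_norm (α : Λ → ι → ℂ) (s e0 : ℝ) (g : ι → ℝ) :
    ‖Wf α s e0 g‖ = Real.exp (-(Fintype.card Λ * e0)) *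
      ∏ x, (‖Complex.cosh (lf (α x) g)‖ *
        Real.exp (-((1 - s) / 2 * ((lf (α x) g) ^ 2).re))) := by
  unfold Wf
  rw [norm_mul, norm_prod, Complex.norm_real, Real.norm_of_nonneg (Real.exp_pos _).le]
  congr 1
  apply Finset.prod_congr rfl
  intro x _
  rw [norm_mul, Complex.norm_exp]
  congr 2
  rw [neg_mul, Complex.neg_re, Complex.re_ofReal_mul]

lemma Wf_upper (α : Λ → ι → ℂ) (s B a : ℝ) (ha : ∀ x, bq (α x) (α x) = (a : ℂ))
    (hs : s = a + B) (g : ι → ℝ) :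
    ‖Wf α s (a ^ 2 / 4 + B * a / 2) g‖ ≤
      Real.exp ((-(wS (fun _ : Λ => (1:ℝ)) α 4 g) / 12
        + (B / 2 : ℝ) * wS (fun _ : Λ => (1:ℝ)) α 2 g).re + 2000 * ∑ x, ‖lf (α x) g‖ ^ 6) := by
  rw [Wf_norm]
  have h1 : ∏ x, (‖Complex.cosh (lf (α x) g)‖ *
        Real.exp (-((1 - s) / 2 * ((lf (α x) g) ^ 2).re))) ≤
      ∏ x, Real.exp (((lf (α x) g) ^ 2 / 2 - (lf (α x) g) ^ 4 / 12).re + 2000 * ‖lf (α x) g‖ ^ 6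
        - ((1 - s) / 2 * ((lf (α x) g) ^ 2).re)) := by
    apply Finset.prod_le_prod
    · intro x _; positivity
    · intro x _
      rw [sub_eq_add_neg _ ((1 - s) / 2 * ((lf (α x) g) ^ 2).re), Real.exp_add]
      exact mul_le_mul_of_nonneg_right (cosh_upper _) (Real.exp_pos _).le
  refine (mul_le_mul_of_nonneg_left h1 (Real.exp_pos _).le).trans ?_
  rw [← Real.exp_sum, ← Real.exp_add]
  apply le_of_eq
  congr 1
  have h2 : (Fintype.card Λ : ℝ) * (a ^ 2 / 4 + B * a / 2) = ∑ x : Λ, (a ^ 2 / 4 + B * a / 2) := by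
    rw [Finset.sum_const, nsmul_eq_mul, Finset.card_univ]
  rw [h2, ← Finset.sum_neg_distrib, ← Finset.sum_add_distrib]
  unfold wS
  rw [← Finset.sum_neg_distrib, Finset.sum_div, Finset.mul_sum, ← Finset.sum_add_distrib,
    Complex.re_sum, Finset.mul_sum, ← Finset.sum_add_distrib]
  apply Finset.sum_congr rfl
  intro x _
  rw [ha x]
  set z := lf (α x) g
  have e : -(((1:ℝ) : ℂ) * wick (a:ℂ) 4 z) / 12 + ((B / 2 : ℝ) : ℂ) * (((1:ℝ) : ℂ) * wick (a:ℂ) 2 z)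
      = z ^ 2 / 2 - z ^ 4 / 12 - (((1 - s) / 2 : ℝ) : ℂ) * z ^ 2
        - ((a ^ 2 / 4 + B * a / 2 : ℝ) : ℂ) := by
    rw [hs]
    simp only [wick]
    push_cast
    ring
  rw [e, Complex.sub_re (_ - _) ((a ^ 2 / 4 + B * a / 2 : ℝ) : ℂ),
    Complex.sub_re (_ - _) ((((1 - s) / 2 : ℝ) : ℂ) * z ^ 2), Complex.re_ofReal_mul,
    Complex.ofReal_re]
  ring

lemma wS_real_bound (β : ι → ℂ) (B : ℝ) (hr : ∀ i, (β i).im = 0) (g : ι → ℝ) :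
    (-(wick (bq β β) 4 (lf β g)) / 12 + (B / 2 : ℝ) * wick (bq β β) 2 (lf β g)).re ≤
      2 * (∑ i, ‖β i‖ ^ 2) ^ 2 + 2 * B ^ 2 := by
  set v : ι → ℝ := fun i => (β i).re
  have hβ : ∀ i, β i = (v i : ℂ) := fun i => Complex.ext (by simp [v]) (by simp [hr])
  have h1 : bq β β = ((∑ i, ‖β i‖ ^ 2 : ℝ) : ℂ) := by
    simp only [bq, hβ, Complex.norm_real, Real.norm_eq_abs, sq_abs]
    push_cast
    exact Finset.sum_congr rfl (fun i _ => by ring)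
  have h2 : lf β g = ((∑ i, v i * g i : ℝ) : ℂ) := by
    simp only [lf, hβ]
    push_cast; rfl
  have ha0 : 0 ≤ ∑ i, ‖β i‖ ^ 2 := Finset.sum_nonneg (fun _ _ => by positivity)
  rw [h1, h2]
  set a := ∑ i, ‖β i‖ ^ 2
  set r := ∑ i, v i * g i
  have e : (-(wick (a:ℂ) 4 (r:ℂ)) / 12 + ((B / 2 : ℝ) : ℂ) * wick (a:ℂ) 2 (r:ℂ)) =
      ((-(r^4 - 6 * a * r ^ 2 + 3 * a ^ 2) / 12 + B / 2 * (r ^ 2 - a) : ℝ) : ℂ) := by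
    simp only [wick]; push_cast; ring
  rw [e, Complex.ofReal_re]
  nlinarith [sq_nonneg (r ^ 2 / 6 - (a + B) / 2), sq_nonneg (a - B), sq_nonneg a, sq_nonneg B,
    sq_nonneg (a + B)]

lemma wS_dal (α β : Λ → ι → ℂ) (n : ℕ) (g : ι → ℝ) :
    wS (dsg (Λ := Λ)) (dal α β) n g =
      wS (fun _ : Λ => (1:ℝ)) α n g - wS (fun _ : Λ => (1:ℝ)) β n g := by
  simp [wS, dsg, dal, Fintype.sum_sum_type, sub_eq_add_neg]

lemma lf_cs (α : ι → ℂ) (w : ι → ℝ) :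
    ‖lf α w‖ ^ 2 ≤ (∑ i, ‖α i‖ ^ 2) * ∑ i, w i ^ 2 := by
  have h1 : ‖lf α w‖ ≤ ∑ i, ‖α i‖ * |w i| := by
    refine (norm_sum_le _ _).trans (le_of_eq (Finset.sum_congr rfl (fun i _ => ?_)))
    rw [norm_mul, Complex.norm_real, Real.norm_eq_abs]
  calc _ ≤ (∑ i, ‖α i‖ * |w i|) ^ 2 := by gcongr
    _ ≤ (∑ i, ‖α i‖ ^ 2) * ∑ i, |w i| ^ 2 := Finset.sum_mul_sq_le_sq_mul_sq _ _ _
    _ = _ := by simp [sq_abs]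

lemma six_add (a b : ℝ) (ha : 0 ≤ a) (hb : 0 ≤ b) : (a + b) ^ 6 ≤ 32 * (a ^ 6 + b ^ 6) := by
  have := add_pow_le ha hb 6
  norm_num at this
  linarith

/-- tensor sums -/
def TT4 {Z : Type} [Fintype Z] (c : Z → ℝ) (α : Z → ι → ℂ) (y : ι → ℝ) : ℝ :=
  TT c α 0 4 y + TT c α 1 3 y + TT c α 2 2 y + TT c α 3 1 y + TT c α 4 0 y
def TT2 {Z : Type} [Fintype Z] (c : Z → ℝ) (α : Z → ι → ℂ) (y : ι → ℝ) : ℝ :=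
  TT c α 0 2 y + TT c α 1 1 y + TT c α 2 0 y

lemma TT4_nonneg {Z : Type} [Fintype Z] (c : Z → ℝ) (α : Z → ι → ℂ) (y : ι → ℝ) :
    0 ≤ TT4 c α y := by
  have := fun j m => TT_nonneg c α j m y
  unfold TT4
  linarith [this 0 4, this 1 3, this 2 2, this 3 1, this 4 0]
lemma TT2_nonneg {Z : Type} [Fintype Z] (c : Z → ℝ) (α : Z → ι → ℂ) (y : ι → ℝ) :
    0 ≤ TT2 c α y := by
  have := fun j m => TT_nonneg c α j m y
  unfold TT2
  linarith [this 0 2, this 1 1, this 2 0]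

lemma TT_int_re {Z : Type} [Fintype Z] (c : Z → ℝ) (α : Z → ι → ℂ) (j m : ℕ) :
    ∫ g, TT c α j m g ∂(gpi ι) = m.factorial *
      (∑ z, ∑ z', (c z : ℂ) * (c z' : ℂ) * (bq (α z) (cj (α z'))) ^ (j + m)).re := by
  have h := TT_integral c α j m
  have h2 := congrArg Complex.re h
  rw [Complex.ofReal_re] at h2
  rw [h2, ← Complex.ofReal_natCast, Complex.re_ofReal_mul]

lemma int_add {f g : (ι → ℝ) → ℝ} (hf : Integrable f (gpi ι)) (hg : Integrable g (gpi ι)) :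
    Integrable (fun x => f x + g x) (gpi ι) := hf.add hg

lemma TT4_int (α β : Λ → ι → ℂ) :
    Integrable (TT4 (dsg (Λ := Λ)) (dal α β)) (gpi ι) ∧
    ∫ g, TT4 (dsg (Λ := Λ)) (dal α β) g ∂(gpi ι) = 34 * (dcov α β 4).re := by
  have hi := fun j m => TT_integrable (dsg (Λ := Λ)) (dal α β) j m
  refine ⟨((((hi 0 4).add (hi 1 3)).add (hi 2 2)).add (hi 3 1)).add (hi 4 0), ?_⟩
  unfold TT4
  rw [integral_add (int_add (int_add (int_add (hi 0 4) (hi 1 3)) (hi 2 2)) (hi 3 1)) (hi 4 0),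
    integral_add (int_add (int_add (hi 0 4) (hi 1 3)) (hi 2 2)) (hi 3 1),
    integral_add (int_add (hi 0 4) (hi 1 3)) (hi 2 2), integral_add (hi 0 4) (hi 1 3)]
  have h := fun j m => TT_int_re (dsg (Λ := Λ)) (dal α β) j m
  rw [h, h, h, h, h]
  change _ * (dcov α β 4).re + _ * (dcov α β 4).re + _ * (dcov α β 4).re + _ * (dcov α β 4).re
    + _ * (dcov α β 4).re = _
  simp only [Nat.factorial]
  push_cast
  ring

lemma TT2_int (α β : Λ → ι → ℂ) :
    Integrable (TT2 (dsg (Λ := Λ)) (dal α β)) (gpi ι) ∧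
    ∫ g, TT2 (dsg (Λ := Λ)) (dal α β) g ∂(gpi ι) = 4 * (dcov α β 2).re := by
  have hi := fun j m => TT_integrable (dsg (Λ := Λ)) (dal α β) j m
  refine ⟨((hi 0 2).add (hi 1 1)).add (hi 2 0), ?_⟩
  unfold TT2
  rw [integral_add (int_add (hi 0 2) (hi 1 1)) (hi 2 0), integral_add (hi 0 2) (hi 1 1)]
  have h := fun j m => TT_int_re (dsg (Λ := Λ)) (dal α β) j m
  rw [h, h, h]
  change _ * (dcov α β 2).re + _ * (dcov α β 2).re + _ * (dcov α β 2).re = _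
  simp only [Nat.factorial]
  push_cast
  ring

/-- The dominating function. -/
def stF (α : Λ → ι → ℂ) (αk : ℕ → Λ → ι → ℂ) (B K : ℝ) (kmax : ℕ) (y : ι → ℝ) : ℝ :=
  10 ^ 7 * K ^ 2 + ∑ k ∈ Finset.range (kmax + 1),
    ((2 ^ k) ^ 4 * TT4 (dsg (Λ := Λ)) (dal α (αk k)) y
      + (2 ^ k) ^ 2 * (B ^ 2 * TT2 (dsg (Λ := Λ)) (dal α (αk k)) y))
  + 80000 * ∑ x, ‖lf (α x) y‖ ^ 6
  + 4 * 10 ^ 15 / 2 ^ kmax * (Fintype.card Λ * ∑ x, ‖lf (α x) y‖ ^ 8)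

lemma sqrt_bd (t d : ℝ) (ht : 0 ≤ t) (hd : 0 < d) : √t ≤ d * t + 1 / (4 * d) := by
  have h := Real.sq_sqrt ht
  set r := √t
  have : d * r ^ 2 + 1 / (4 * d) - r = d * (r - 1 / (2 * d)) ^ 2 := by field_simp; ring
  nlinarith [mul_nonneg hd.le (sq_nonneg (r - 1 / (2 * d)))]

lemma stab_small {α : Λ → ι → ℂ} {αk : ℕ → Λ → ι → ℂ} {s B a astar K : ℝ} {kmax : ℕ}
    (H : Stab α αk s B a astar K kmax) [Nonempty Λ] (x y : ι → ℝ) (k : ℕ) (hk : k ≤ kmax)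
    (hR : ∑ i, (x i - y i) ^ 2 ≤ 2 ^ k) (hR2 : (2:ℝ) ^ k ≤ 2 * (1 + ∑ i, (x i - y i) ^ 2)) :
    ‖Wf α s (a ^ 2 / 4 + B * a / 2) x‖ ≤
      Real.exp ((4/5) * (stF α αk B K kmax y + 0.45 * ∑ i, (x i - y i) ^ 2)) := by
  refine (Wf_upper α s B a H.ha H.hs x).trans (Real.exp_le_exp.2 ?_)
  set R := ∑ i, (x i - y i) ^ 2 with hRdef
  have hR0 : 0 ≤ R := Finset.sum_nonneg (fun _ _ => sq_nonneg _)
  have hK := H.hK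
  set t : ℝ := 2 ^ k with ht
  have ht1 : 1 ≤ t := one_le_pow₀ (by norm_num)
  have htT : t ≤ 2 ^ kmax := pow_le_pow_right₀ (by norm_num) hk
  set L : ℝ := (Fintype.card Λ : ℝ) with hL
  have hL0 : 0 ≤ L := Nat.cast_nonneg _
  -- decomposition
  have e4 := wS_dal α (αk k) 4 x
  have e2 := wS_dal α (αk k) 2 x
  have b4 := wS4_shift (dsg (Λ := Λ)) (dal α (αk k)) x y t ht1 hR
  have b2 := wS2_shift (dsg (Λ := Λ)) (dal α (αk k)) x y t B ht1 hR
  change _ ≤ 8 + 3 * t ^ 4 * TT4 _ _ y at b4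
  change _ ≤ 2 + t ^ 2 * B ^ 2 * TT2 _ _ y at b2
  set D4 := wS (dsg (Λ := Λ)) (dal α (αk k)) 4 x
  set D2 := wS (dsg (Λ := Λ)) (dal α (αk k)) 2 x
  have hdec : (-(wS (fun _ : Λ => (1:ℝ)) α 4 x) / 12
        + (B / 2 : ℝ) * wS (fun _ : Λ => (1:ℝ)) α 2 x) =
      (-D4 / 12 + (B / 2 : ℝ) * D2) + (-(wS (fun _ : Λ => (1:ℝ)) (αk k) 4 x) / 12
        + (B / 2 : ℝ) * wS (fun _ : Λ => (1:ℝ)) (αk k) 2 x) := by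
    rw [e4, e2]; ring
  have h1 : (-D4 / 12 + (B / 2 : ℝ) * D2).re ≤ ‖D4‖ / 12 + |B| / 2 * ‖D2‖ := by
    refine (Complex.re_le_norm _).trans ((norm_add_le _ _).trans (le_of_eq ?_))
    rw [norm_div, norm_neg, norm_mul, Complex.norm_real]
    simp [abs_div]
  have h2 : (-(wS (fun _ : Λ => (1:ℝ)) (αk k) 4 x) / 12
        + (B / 2 : ℝ) * wS (fun _ : Λ => (1:ℝ)) (αk k) 2 x).re ≤ 2 * (K * √t) + 2 * K := by
    unfold wS
    rw [← Finset.sum_neg_distrib, Finset.sum_div, Finset.mul_sum, ← Finset.sum_add_distrib,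
      Complex.re_sum]
    have hx : ∀ z : Λ, (-(((1:ℝ):ℂ) * wick (bq (αk k z) (αk k z)) 4 (lf (αk k z) x)) / 12
        + ((B / 2 : ℝ) : ℂ) * (((1:ℝ):ℂ) * wick (bq (αk k z) (αk k z)) 2 (lf (αk k z) x))).re ≤
        (2 * (K * √t) + 2 * K) / L := by
      intro z
      have := wS_real_bound (αk k z) B (H.hreal k hk z) x
      have hLp : 0 < L := by
        rw [hL]; exact_mod_cast Fintype.card_pos
      rw [le_div_iff₀ hLp]
      simp only [Complex.ofReal_one, one_mul]
      calc _ ≤ (2 * (∑ i, ‖αk k z i‖ ^ 2) ^ 2 + 2 * B ^ 2) * L :=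
            mul_le_mul_of_nonneg_right this hL0
        _ ≤ _ := by
            have q1 := H.hak k hk z
            have q2 := H.hLB
            linarith
    refine (Finset.sum_le_sum (fun z _ => hx z)).trans ?_
    rw [Finset.sum_const, nsmul_eq_mul, Finset.card_univ, ← hL]
    have hLp : 0 < L := by
      rw [hL]; exact_mod_cast Fintype.card_pos
    rw [mul_div_cancel₀ _ hLp.ne']
  have h3 : ∑ z, ‖lf (α z) x‖ ^ 6 ≤ 32 * (∑ z, ‖lf (α z) y‖ ^ 6) + 32 * K := by
    have hz : ∀ z, ‖lf (α z) x‖ ^ 6 ≤ 32 * ‖lf (α z) y‖ ^ 6 + 32 * (astar * 2 ^ kmax) ^ 3 := by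
      intro z
      have hxy : x = y + (fun i => x i - y i) := by ext i; simp
      have n1 : ‖lf (α z) x‖ ≤ ‖lf (α z) y‖ + ‖lf (α z) (fun i => x i - y i)‖ := by
        conv_lhs => rw [hxy]
        rw [lf_add]; exact norm_add_le _ _
      have n2 := lf_cs (α z) (fun i => x i - y i)
      have n3 : ‖lf (α z) (fun i => x i - y i)‖ ^ 2 ≤ astar * 2 ^ kmax := by
        refine n2.trans ?_
        exact mul_le_mul (H.hast z) (hR.trans htT) hR0 H.hast0
      have n4 : ‖lf (α z) (fun i => x i - y i)‖ ^ 6 ≤ (astar * 2 ^ kmax) ^ 3 := by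
        have : ‖lf (α z) (fun i => x i - y i)‖ ^ 6 = (‖lf (α z) (fun i => x i - y i)‖ ^ 2) ^ 3 := by
          ring
        rw [this]; gcongr
      calc _ ≤ (‖lf (α z) y‖ + ‖lf (α z) (fun i => x i - y i)‖) ^ 6 := by gcongr
        _ ≤ 32 * (‖lf (α z) y‖ ^ 6 + ‖lf (α z) (fun i => x i - y i)‖ ^ 6) :=
          six_add _ _ (norm_nonneg _) (norm_nonneg _)
        _ ≤ _ := by linarith
    refine (Finset.sum_le_sum (fun z _ => hz z)).trans ?_
    rw [Finset.sum_add_distrib, ← Finset.mul_sum, Finset.sum_const, nsmul_eq_mul, Finset.card_univ]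
    have := H.h6
    rw [← hL] at this ⊢
    have e : L * (32 * (astar * 2 ^ kmax) ^ 3) = 32 * (L * astar ^ 3 * (2 ^ kmax) ^ 3) := by ring
    rw [e]; linarith
  -- TT part of f
  have hterm : t ^ 4 * TT4 (dsg (Λ := Λ)) (dal α (αk k)) y
      + t ^ 2 * (B ^ 2 * TT2 (dsg (Λ := Λ)) (dal α (αk k)) y) ≤
      ∑ k ∈ Finset.range (kmax + 1),
    ((2 ^ k) ^ 4 * TT4 (dsg (Λ := Λ)) (dal α (αk k)) y
      + (2 ^ k) ^ 2 * (B ^ 2 * TT2 (dsg (Λ := Λ)) (dal α (αk k)) y)) := by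
    refine Finset.single_le_sum (f := fun k : ℕ => (((2:ℝ) ^ k) ^ 4 *
      TT4 (dsg (Λ := Λ)) (dal α (αk k)) y
      + (2 ^ k) ^ 2 * (B ^ 2 * TT2 (dsg (Λ := Λ)) (dal α (αk k)) y))) (fun j _ => ?_)
      (Finset.mem_range.2 (Nat.lt_succ_of_le hk))
    have := TT4_nonneg (dsg (Λ := Λ)) (dal α (αk j)) y
    have := TT2_nonneg (dsg (Λ := Λ)) (dal α (αk j)) y
    positivity
  have p4 : 0 ≤ t ^ 4 * TT4 (dsg (Λ := Λ)) (dal α (αk k)) y :=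
    mul_nonneg (by positivity) (TT4_nonneg _ _ _)
  have p2 : 0 ≤ t ^ 2 * (B ^ 2 * TT2 (dsg (Λ := Λ)) (dal α (αk k)) y) :=
    mul_nonneg (by positivity) (mul_nonneg (sq_nonneg _) (TT2_nonneg _ _ _))
  have p6 : 0 ≤ ∑ z, ‖lf (α z) y‖ ^ 6 := Finset.sum_nonneg (fun _ _ => by positivity)
  have p8 : 0 ≤ 4 * 10 ^ 15 / 2 ^ kmax * (L * ∑ z, ‖lf (α z) y‖ ^ 8) := by
    have : 0 ≤ ∑ z, ‖lf (α z) y‖ ^ 8 := Finset.sum_nonneg (fun _ _ => by positivity)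
    positivity
  have hsq := sqrt_bd t (1 / (100 * K)) (by linarith) (by positivity)
  have hsq2 : K * √t ≤ t / 100 + 25 * K ^ 2 := by
    calc K * √t ≤ K * (1 / (100 * K) * t + 1 / (4 * (1 / (100 * K)))) :=
          mul_le_mul_of_nonneg_left hsq (by linarith)
      _ = _ := by field_simp; ring
  have hKK : K ≤ K ^ 2 := by nlinarith
  have hK1 : 1 ≤ K ^ 2 := by nlinarith
  rw [hdec, Complex.add_re]
  unfold stF
  linarith

lemma stab_large {α : Λ → ι → ℂ} {αk : ℕ → Λ → ι → ℂ} {s B a astar K : ℝ} {kmax : ℕ}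
    (H : Stab α αk s B a astar K kmax) (x y : ι → ℝ)
    (hR : (2:ℝ) ^ kmax ≤ 1 + ∑ i, (x i - y i) ^ 2) :
    ‖Wf α s (a ^ 2 / 4 + B * a / 2) x‖ ≤
      Real.exp ((4/5) * (stF α αk B K kmax y + 0.45 * ∑ i, (x i - y i) ^ 2)) := by
  rw [Wf_norm]
  set R := ∑ i, (x i - y i) ^ 2 with hRdef
  have hR0 : 0 ≤ R := Finset.sum_nonneg (fun _ _ => sq_nonneg _)
  have hK := H.hK
  set T : ℝ := 2 ^ kmax with hT
  have hT1 : 1 ≤ T := one_le_pow₀ (by norm_num)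
  set L : ℝ := (Fintype.card Λ : ℝ) with hL
  have hL0 : 0 ≤ L := Nat.cast_nonneg _
  set w : ι → ℝ := fun i => x i - y i with hw
  have hxy : x = y + w := by ext i; simp [hw]
  have hsite : ∀ z, ‖Complex.cosh (lf (α z) x)‖ *
        Real.exp (-((1 - s) / 2 * ((lf (α z) x) ^ 2).re)) ≤
      Real.exp (200 * s ^ 2 + 5 / 8 * (∑ i, (α z i).im * w i) ^ 2
        + 10000000 * ‖lf (α z) y‖ ^ 4) := by
    intro z
    have him : (lf (α z) x).im = (lf (α z) y).im + ∑ i, (α z i).im * w i := by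
      rw [hxy, lf_add, Complex.add_im]
      congr 1
      simp [lf]
    have hc := cosh_large s (lf (α z) x).re (lf (α z) y).im (∑ i, (α z i).im * w i) H.hs1
    rw [← him] at hc
    rw [Complex.re_add_im] at hc
    have hre : ((lf (α z) x) ^ 2).re = (lf (α z) x).re ^ 2 - (lf (α z) x).im ^ 2 := by
      rw [sq, Complex.mul_re]; ring
    rw [hre]
    refine hc.trans (Real.exp_le_exp.2 ?_)
    have : (lf (α z) y).im ^ 4 ≤ ‖lf (α z) y‖ ^ 4 := by
      have h := Complex.abs_im_le_norm (lf (α z) y)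
      calc (lf (α z) y).im ^ 4 = |(lf (α z) y).im| ^ 4 := by
            rw [show (4:ℕ) = 2 * 2 from rfl, pow_mul, pow_mul, sq_abs]
        _ ≤ _ := by gcongr
    linarith
  have hprod := Finset.prod_le_prod (s := Finset.univ) (fun z _ => by positivity)
    (fun z _ => hsite z)
  refine (mul_le_mul_of_nonneg_left hprod (Real.exp_pos _).le).trans ?_
  rw [← Real.exp_sum, ← Real.exp_add]
  refine Real.exp_le_exp.2 ?_
  rw [Finset.sum_add_distrib, Finset.sum_add_distrib, Finset.sum_const, nsmul_eq_mul,
    Finset.card_univ, ← Finset.mul_sum, ← Finset.mul_sum, ← hL]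
  have hg := H.hg w
  change _ ≤ 0.52 * R at hg
  set Q := ∑ z, ‖lf (α z) y‖ ^ 4 with hQ
  have hQ2 : Q ^ 2 ≤ L * ∑ z, ‖lf (α z) y‖ ^ 8 := by
    have := sq_sum_le_card_mul_sum_sq (s := (Finset.univ : Finset Λ))
      (f := fun z => ‖lf (α z) y‖ ^ 4)
    rw [Finset.card_univ, ← hL] at this
    refine this.trans (le_of_eq ?_)
    congr 1
    exact Finset.sum_congr rfl (fun z _ => by ring)
  have hQ3 : 12500000 * Q ≤ 0.01 * T + 4 * 10 ^ 15 / T * (L * ∑ z, ‖lf (α z) y‖ ^ 8) := by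
    have h1 : 4 * 10 ^ 15 / T * Q ^ 2 ≤ 4 * 10 ^ 15 / T * (L * ∑ z, ‖lf (α z) y‖ ^ 8) :=
      mul_le_mul_of_nonneg_left hQ2 (by positivity)
    have h2 : 0.01 * T + 4 * 10 ^ 15 / T * Q ^ 2 - 12500000 * Q =
        (0.01 * (T - 625000000 * Q) ^ 2 + (4 * 10 ^ 15 - 0.01 * 625000000 ^ 2) * Q ^ 2) / T := by
      field_simp; ring
    have h3 : 0 ≤ (0.01 * (T - 625000000 * Q) ^ 2 +
        (4 * 10 ^ 15 - 0.01 * 625000000 ^ 2) * Q ^ 2) / T := by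
      apply div_nonneg _ (by linarith)
      norm_num
      positivity
    linarith
  have hTTs : 0 ≤ ∑ k ∈ Finset.range (kmax + 1),
    (((2:ℝ) ^ k) ^ 4 * TT4 (dsg (Λ := Λ)) (dal α (αk k)) y
      + (2 ^ k) ^ 2 * (B ^ 2 * TT2 (dsg (Λ := Λ)) (dal α (αk k)) y)) := by
    apply Finset.sum_nonneg
    intro j _
    have := TT4_nonneg (dsg (Λ := Λ)) (dal α (αk j)) y
    have := TT2_nonneg (dsg (Λ := Λ)) (dal α (αk j)) y
    positivity
  have p6 : 0 ≤ ∑ z, ‖lf (α z) y‖ ^ 6 := Finset.sum_nonneg (fun _ _ => by positivity)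
  have hsq := sqrt_bd T (1 / (25000 * K)) (by linarith) (by positivity)
  have hsq2 : 250 * (K * √T) ≤ 0.01 * T + 1562500 * K ^ 2 := by
    calc 250 * (K * √T) ≤ 250 * (K * (1 / (25000 * K) * T + 1 / (4 * (1 / (25000 * K))))) := by
          gcongr
      _ = _ := by field_simp; ring
  have hKK : K ≤ K ^ 2 := by nlinarith
  have hK1 : 1 ≤ K ^ 2 := by nlinarith
  have hLs := H.hLs
  have hLe : -(L * (a ^ 2 / 4 + B * a / 2)) ≤ K := by
    have h1 := H.hLB
    have : 0 ≤ L * ((a + B) ^ 2) := by positivity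
    have : 0 ≤ L * B ^ 2 := by positivity
    linarith
  rw [← hL] at hLs
  unfold stF
  rw [← hL, ← hT]
  linarith

lemma stF_int {α : Λ → ι → ℂ} {αk : ℕ → Λ → ι → ℂ} {s B a astar K : ℝ} {kmax : ℕ}
    (H : Stab α αk s B a astar K kmax) :
    Integrable (stF α αk B K kmax) (gpi ι) ∧
    ∫ y, stF α αk B K kmax y ∂(gpi ι) ≤ 10 ^ 20 * K ^ 2 := by
  have hK := H.hK
  set L : ℝ := (Fintype.card Λ : ℝ) with hL
  have hL0 : 0 ≤ L := Nat.cast_nonneg _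
  set T : ℝ := 2 ^ kmax with hT
  have hT1 : 1 ≤ T := one_le_pow₀ (by norm_num)
  have i1 : Integrable (fun _ : ι → ℝ => 10 ^ 7 * K ^ 2) (gpi ι) := integrable_const _
  have i2k : ∀ k ∈ Finset.range (kmax + 1), Integrable (fun y =>
    ((2:ℝ) ^ k) ^ 4 * TT4 (dsg (Λ := Λ)) (dal α (αk k)) y
      + (2 ^ k) ^ 2 * (B ^ 2 * TT2 (dsg (Λ := Λ)) (dal α (αk k)) y)) (gpi ι) := fun k _ =>
    ((TT4_int α (αk k)).1.const_mul _).add (((TT2_int α (αk k)).1.const_mul _).const_mul _)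
  have i2 := integrable_finsetSum _ i2k
  have i3 : Integrable (fun y => 80000 * ∑ x, ‖lf (α x) y‖ ^ 6) (gpi ι) :=
    (integrable_finsetSum _ (fun x _ => (lf_moment6 (α x)).1)).const_mul _
  have i4 : Integrable (fun y => 4 * 10 ^ 15 / 2 ^ kmax * (Fintype.card Λ *
      ∑ x, ‖lf (α x) y‖ ^ 8)) (gpi ι) :=
    ((integrable_finsetSum _ (fun x _ => (lf_moment8 (α x)).1)).const_mul _).const_mul _
  refine ⟨((i1.add i2).add i3).add i4, ?_⟩
  unfold stF
  have b1 : ∫ _ : ι → ℝ, 10 ^ 7 * K ^ 2 ∂(gpi ι) = 10 ^ 7 * K ^ 2 := by simp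
  rw [integral_add (int_add (int_add i1 i2) i3) i4, integral_add (int_add i1 i2) i3, integral_add i1 i2, b1,
    integral_finsetSum _ i2k, integral_const_mul, integral_const_mul, integral_const_mul,
    integral_finsetSum _ (fun x _ => (lf_moment6 (α x)).1),
    integral_finsetSum _ (fun x _ => (lf_moment8 (α x)).1)]
  have b2 : ∑ k ∈ Finset.range (kmax + 1), ∫ y, (((2:ℝ) ^ k) ^ 4 *
      TT4 (dsg (Λ := Λ)) (dal α (αk k)) y
      + (2 ^ k) ^ 2 * (B ^ 2 * TT2 (dsg (Λ := Λ)) (dal α (αk k)) y)) ∂(gpi ι) ≤ 76 * K := by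
    have hk : ∀ k ∈ Finset.range (kmax + 1), ∫ y, (((2:ℝ) ^ k) ^ 4 *
      TT4 (dsg (Λ := Λ)) (dal α (αk k)) y
      + (2 ^ k) ^ 2 * (B ^ 2 * TT2 (dsg (Λ := Λ)) (dal α (αk k)) y)) ∂(gpi ι) ≤
        38 * K * (1 / 2) ^ k := by
      intro k hk
      have hk' : k ≤ kmax := Nat.lt_succ_iff.1 (Finset.mem_range.1 hk)
      rw [integral_add ((TT4_int α (αk k)).1.const_mul _)
        (((TT2_int α (αk k)).1.const_mul _).const_mul _), integral_const_mul, integral_const_mul,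
        integral_const_mul, (TT4_int α (αk k)).2, (TT2_int α (αk k)).2]
      have q4 := H.hT4 k hk'
      have q2 := H.hT2 k hk'
      set t : ℝ := 2 ^ k with ht
      have ht1 : 1 ≤ t := one_le_pow₀ (by norm_num)
      have e : ((1:ℝ) / 2) ^ k = 1 / t := by rw [ht]; simp
      rw [e]
      have r4 : t ^ 4 * (34 * (dcov α (αk k) 4).re) ≤ 34 * K * (1 / t) := by
        calc _ ≤ t ^ 4 * (34 * (K / t ^ 8)) := by gcongr
          _ = 34 * K * (1 / t ^ 4) := by field_simp
          _ ≤ _ := by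
            gcongr
            exact le_self_pow₀ ht1 (by norm_num)
      have r2 : t ^ 2 * (B ^ 2 * (4 * (dcov α (αk k) 2).re)) ≤ 4 * K * (1 / t) := by
        calc _ = t ^ 2 * (4 * (B ^ 2 * (dcov α (αk k) 2).re)) := by ring
          _ ≤ t ^ 2 * (4 * (K / t ^ 8)) := by gcongr
          _ = 4 * K * (1 / t ^ 6) := by field_simp
          _ ≤ _ := by
            gcongr
            exact le_self_pow₀ ht1 (by norm_num)
      linarith
    refine (Finset.sum_le_sum hk).trans ?_
    rw [← Finset.mul_sum]
    have hgeo : ∑ k ∈ Finset.range (kmax + 1), ((1:ℝ) / 2) ^ k ≤ 2 := sum_geometric_two_le _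
    nlinarith
  have hLa3 : L * astar ^ 3 ≤ K := by
    have h6 := H.h6
    rw [← hL, ← hT] at h6
    have : (1:ℝ) ≤ T ^ 3 := one_le_pow₀ hT1
    have h0 : 0 ≤ L * astar ^ 3 := mul_nonneg hL0 (pow_nonneg H.hast0 3)
    nlinarith
  have b3 : ∑ x, ∫ y, ‖lf (α x) y‖ ^ 6 ∂(gpi ι) ≤ 120 * K := by
    have : ∀ x, ∫ y, ‖lf (α x) y‖ ^ 6 ∂(gpi ι) ≤ 120 * astar ^ 3 := fun x => by
      refine (lf_moment6 (α x)).2.trans ?_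
      have h0 : 0 ≤ ∑ i, ‖α x i‖ ^ 2 := Finset.sum_nonneg (fun _ _ => by positivity)
      have := H.hast x
      gcongr
    refine (Finset.sum_le_sum (fun x _ => this x)).trans ?_
    rw [Finset.sum_const, nsmul_eq_mul, Finset.card_univ, ← hL]
    linarith
  have b4 : L * ∑ x, ∫ y, ‖lf (α x) y‖ ^ 8 ∂(gpi ι) ≤ 1680 * (K ^ 2 * T) := by
    have : ∀ x, ∫ y, ‖lf (α x) y‖ ^ 8 ∂(gpi ι) ≤ 1680 * astar ^ 4 := fun x => by
      refine (lf_moment8 (α x)).2.trans ?_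
      have h0 : 0 ≤ ∑ i, ‖α x i‖ ^ 2 := Finset.sum_nonneg (fun _ _ => by positivity)
      have := H.hast x
      gcongr
    have h2 := Finset.sum_le_sum (s := Finset.univ) (fun x _ => this x)
    rw [Finset.sum_const, nsmul_eq_mul, Finset.card_univ, ← hL] at h2
    have hLa := H.hLa
    rw [← hL, ← hT] at hLa
    have h3 : (L * astar ^ 2) ^ 2 ≤ (K * √T) ^ 2 := by
      have h0 : 0 ≤ L * astar ^ 2 := by positivity
      gcongr
    rw [mul_pow K, Real.sq_sqrt (by linarith)] at h3
    have h4 := mul_le_mul_of_nonneg_left h2 hL0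
    linarith
  have b5 : 4 * 10 ^ 15 / T * (L * ∑ x, ∫ y, ‖lf (α x) y‖ ^ 8 ∂(gpi ι)) ≤
      4 * 10 ^ 15 * 1680 * K ^ 2 := by
    calc _ ≤ 4 * 10 ^ 15 / T * (1680 * (K ^ 2 * T)) := by gcongr
      _ = _ := by field_simp
  have hKK : K ≤ K ^ 2 := by nlinarith
  linarith

theorem stab_main {α : Λ → ι → ℂ} {αk : ℕ → Λ → ι → ℂ} {s B a astar K : ℝ} {kmax : ℕ}
    (H : Stab α αk s B a astar K kmax) [Nonempty Λ] :
    ∫⁻ g, ENNReal.ofReal (‖Wf α s (a ^ 2 / 4 + B * a / 2) g‖ ^ (5/4 : ℝ)) ∂(gpi ι) ≤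
      ENNReal.ofReal (Real.exp (10 ^ 20 * K ^ 2)) := by
  set W := Wf α s (a ^ 2 / 4 + B * a / 2) with hW
  set u : (ι → ℝ) → ℝ := fun x => 5 / 4 * max 0 (Real.log ‖W x‖) with hu
  have hWm : Measurable W := (Wf_continuous _ _ _).measurable
  have hbd : ∀ x y, ‖W x‖ ≤
      Real.exp ((4/5) * (stF α αk B K kmax y + 0.45 * ∑ i, (x i - y i) ^ 2)) := by
    intro x y
    set R := ∑ i, (x i - y i) ^ 2 with hR
    have hR0 : 0 ≤ R := Finset.sum_nonneg (fun _ _ => sq_nonneg _)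
    by_cases h : 1 + R ≤ 2 ^ kmax
    · have hex : ∃ k : ℕ, 1 + R ≤ 2 ^ k := ⟨kmax, h⟩
      classical
      set k := Nat.find hex with hk
      have h1 : 1 + R ≤ 2 ^ k := Nat.find_spec hex
      have h2 : k ≤ kmax := Nat.find_min' hex h
      refine stab_small H x y k h2 (by linarith) ?_
      rcases Nat.eq_zero_or_pos k with h0 | h0
      · rw [h0]; simp only [pow_zero]; linarith
      · have h3 := Nat.find_min hex (m := k - 1) (by omega)
        push Not at h3
        have h4 : (2:ℝ) ^ k = 2 * 2 ^ (k - 1) := by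
          rw [← pow_succ']; congr 1; omega
        rw [h4]; linarith
    · push Not at h
      exact stab_large H x y h.le
  have hpos : ∀ y, 0 ≤ stF α αk B K kmax y := by
    intro y
    have hTTs : 0 ≤ ∑ k ∈ Finset.range (kmax + 1),
      (((2:ℝ) ^ k) ^ 4 * TT4 (dsg (Λ := Λ)) (dal α (αk k)) y
        + (2 ^ k) ^ 2 * (B ^ 2 * TT2 (dsg (Λ := Λ)) (dal α (αk k)) y)) := by
      apply Finset.sum_nonneg
      intro j _
      have := TT4_nonneg (dsg (Λ := Λ)) (dal α (αk j)) y
      have := TT2_nonneg (dsg (Λ := Λ)) (dal α (αk j)) y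
      positivity
    unfold stF
    positivity
  have hmain := gauss_dual (ι := ι) (t := 0.1) (by norm_num) (by norm_num) (u := u)
    (f := stF α αk B K kmax) (by
      exact (measurable_const.max (Real.measurable_log.comp hWm.norm)).const_mul _) (by
      unfold stF TT4 TT2
      have := fun k j m => (TT_continuous (dsg (Λ := Λ)) (dal α (αk k)) j m).measurable
      have := fun x => (lf_continuous (α x)).measurable
      fun_prop)
    (fun x => by simp only [hu]; positivity) (stF_int H).1 (by
      intro x y
      have h := hbd x y
      have hR0 : 0 ≤ ∑ i, (x i - y i) ^ 2 := Finset.sum_nonneg (fun _ _ => sq_nonneg _)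
      have h0 := hpos y
      have hm : max 0 (Real.log ‖W x‖) ≤
          (4/5) * (stF α αk B K kmax y + 0.45 * ∑ i, (x i - y i) ^ 2) := by
        apply max_le (by positivity)
        by_cases hz : ‖W x‖ = 0
        · rw [hz, Real.log_zero]; positivity
        · rw [Real.log_le_iff_le_exp (lt_of_le_of_ne (norm_nonneg _) (Ne.symm hz))]
          exact h
      simp only [hu]
      have e1 : (1 - (0.1:ℝ)) / 2 = 0.45 := by norm_num
      rw [e1]
      linarith)
  refine le_trans (lintegral_mono (fun g => ?_)) (hmain.trans ?_)
  · apply ENNReal.ofReal_le_ofReal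
    by_cases hz : ‖W g‖ = 0
    · rw [hz, Real.zero_rpow (by norm_num)]; positivity
    · have hp : 0 < ‖W g‖ := lt_of_le_of_ne (norm_nonneg _) (Ne.symm hz)
      rw [Real.rpow_def_of_pos hp]
      apply Real.exp_le_exp.2
      simp only [hu]
      have := le_max_right 0 (Real.log ‖W g‖)
      linarith
  · exact ENNReal.ofReal_le_ofReal (Real.exp_le_exp.2 (stF_int H).2)

end stab

/-! ### Part E: lower bound for the partition function -/

section lower
variable {Λ ι : Type} [Fintype Λ] [Fintype ι]

lemma Wf_exact (α : Λ → ι → ℂ) (s B a : ℝ) (ha : ∀ x, bq (α x) (α x) = (a : ℂ))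
    (hs : s = a + B) (g : ι → ℝ) (hsm : ∀ x, ‖lf (α x) g‖ ≤ 1 / 4) :
    ∃ r : ℂ, ‖r‖ ≤ 6 * ∑ x, ‖lf (α x) g‖ ^ 6 ∧
    Wf α s (a ^ 2 / 4 + B * a / 2) g =
      Complex.exp (-(wS (fun _ : Λ => (1:ℝ)) α 4 g) / 12
        + (B / 2 : ℝ) * wS (fun _ : Λ => (1:ℝ)) α 2 g + r) := by
  choose r hr1 hr2 using fun x => cosh_expansion (lf (α x) g) (hsm x)
  refine ⟨∑ x, r x, ?_, ?_⟩
  · rw [Finset.mul_sum]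
    exact (norm_sum_le _ _).trans (Finset.sum_le_sum (fun x _ => hr2 x))
  · unfold Wf
    rw [Complex.ofReal_exp]
    simp only [hr1, ← Complex.exp_add]
    rw [← Complex.exp_sum, ← Complex.exp_add]
    congr 1
    have h2 : (Fintype.card Λ : ℝ) * (a ^ 2 / 4 + B * a / 2) =
        ∑ x : Λ, (a ^ 2 / 4 + B * a / 2) := by
      rw [Finset.sum_const, nsmul_eq_mul, Finset.card_univ]
    rw [h2, ← Finset.sum_neg_distrib, Complex.ofReal_sum, ← Finset.sum_add_distrib]
    unfold wS
    rw [← Finset.sum_neg_distrib, Finset.sum_div, Finset.mul_sum, ← Finset.sum_add_distrib,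
      ← Finset.sum_add_distrib]
    apply Finset.sum_congr rfl
    intro x _
    rw [ha x, hs]
    simp only [wick]
    push_cast
    ring

lemma wS_im_real (β : ι → ℂ) (hr : ∀ i, (β i).im = 0) (g : ι → ℝ) (n : ℕ) :
    (wick (bq β β) n (lf β g)).im = 0 := by
  set v : ι → ℝ := fun i => (β i).re
  have hβ : ∀ i, β i = (v i : ℂ) := fun i => Complex.ext (by simp [v]) (by simp [hr])
  have h1 : bq β β = ((∑ i, v i * v i : ℝ) : ℂ) := by
    simp only [bq, hβ]
    push_cast; rfl
  have h2 : lf β g = ((∑ i, v i * g i : ℝ) : ℂ) := by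
    simp only [lf, hβ]
    push_cast; rfl
  rw [h1, h2]
  have := wick_map Complex.ofRealHom (∑ i, v i * v i) (∑ i, v i * g i) n
  change ((wick _ n _ : ℝ) : ℂ) = wick ((_ : ℝ) : ℂ) n ((_ : ℝ) : ℂ) at this
  rw [← this, Complex.ofReal_im]

lemma wS_dal_im (α β : Λ → ι → ℂ) (hr : ∀ x i, (β x i).im = 0) (n : ℕ) (g : ι → ℝ) :
    (wS (fun _ : Λ => (1:ℝ)) α n g).im = (wS (dsg (Λ := Λ)) (dal α β) n g).im := by
  rw [wS_dal, Complex.sub_im]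
  have : (wS (fun _ : Λ => (1:ℝ)) β n g).im = 0 := by
    unfold wS
    rw [Complex.im_sum]
    apply Finset.sum_eq_zero
    intro x _
    rw [Complex.ofReal_one, one_mul, wS_im_real _ (hr x)]
  rw [this, sub_zero]

lemma young_eps (w e : ℝ) (hw : 0 ≤ w) (he : 0 < e) : w ≤ e * w ^ (5/4 : ℝ) + 1 / e ^ 4 := by
  have h0 : 0 ≤ w ^ (1/4 : ℝ) := Real.rpow_nonneg hw _
  have h1 : w ^ (5/4 : ℝ) = w * w ^ (1/4 : ℝ) := by
    rcases hw.eq_or_lt with h | h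
    · rw [← h, Real.zero_rpow (by norm_num)]; simp
    · rw [show (5/4 : ℝ) = 1 + 1/4 by norm_num, Real.rpow_add h, Real.rpow_one]
  have h2 : w = (w ^ (1/4 : ℝ)) ^ 4 := by
    rw [← Real.rpow_natCast, ← Real.rpow_mul hw]; norm_num
  rw [h1]
  set q := w ^ (1/4 : ℝ)
  by_cases hq : 1 ≤ e * q
  · have : w ≤ e * (w * q) := by nlinarith
    have : 0 < 1 / e ^ 4 := by positivity
    linarith
  · push Not at hq
    have h3 : (e * q) ^ 4 ≤ 1 := pow_le_one₀ (by positivity) hq.le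
    have h4 : w ≤ 1 / e ^ 4 := by
      rw [le_div_iff₀ (by positivity), h2]
      calc q ^ 4 * e ^ 4 = (e * q) ^ 4 := by ring
        _ ≤ 1 := h3
    have : 0 ≤ e * (w * q) := by positivity
    linarith

lemma stab_integrable {α : Λ → ι → ℂ} {αk : ℕ → Λ → ι → ℂ} {s B a astar K : ℝ} {kmax : ℕ}
    (H : Stab α αk s B a astar K kmax) [Nonempty Λ] :
    Integrable (fun g => ‖Wf α s (a ^ 2 / 4 + B * a / 2) g‖ ^ (5/4 : ℝ)) (gpi ι) ∧
    ∫ g, ‖Wf α s (a ^ 2 / 4 + B * a / 2) g‖ ^ (5/4 : ℝ) ∂(gpi ι) ≤ Real.exp (10 ^ 20 * K ^ 2) ∧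
    Integrable (Wf α s (a ^ 2 / 4 + B * a / 2)) (gpi ι) := by
  set W := Wf α s (a ^ 2 / 4 + B * a / 2) with hW
  have hc : Continuous W := Wf_continuous _ _ _
  have hm := stab_main H
  rw [← hW] at hm
  have hc2 : Continuous (fun g => ‖W g‖ ^ (5/4 : ℝ)) :=
    hc.norm.rpow_const (fun _ => Or.inr (by norm_num))
  have hi : Integrable (fun g => ‖W g‖ ^ (5/4 : ℝ)) (gpi ι) := by
    refine ⟨hc2.aestronglyMeasurable, ?_⟩
    rw [hasFiniteIntegral_iff_ofReal (Filter.Eventually.of_forall (fun g => by positivity))]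
    exact hm.trans_lt ENNReal.ofReal_lt_top
  refine ⟨hi, ?_, ?_⟩
  · rw [integral_eq_lintegral_of_nonneg_ae (Filter.Eventually.of_forall (fun g => by positivity))
      hc2.aestronglyMeasurable]
    exact ENNReal.toReal_le_of_le_ofReal (Real.exp_pos _).le hm
  · refine (hi.add (integrable_const (1:ℝ))).mono' hc.aestronglyMeasurable
      (Filter.Eventually.of_forall (fun g => ?_))
    have := young_eps ‖W g‖ 1 (norm_nonneg _) one_pos
    simpa using this

lemma exp_lower (y M : ℝ) (hy : 0 ≤ y) (hM : 0 < M) :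
    Real.exp (-M) * (1 - y ^ 2 / M ^ 2) ≤ Real.exp (-y) := by
  by_cases h : y ≤ M
  · calc _ ≤ Real.exp (-M) * 1 := by
          apply mul_le_mul_of_nonneg_left _ (Real.exp_pos _).le
          have : 0 ≤ y ^ 2 / M ^ 2 := by positivity
          linarith
      _ ≤ _ := by rw [mul_one]; exact Real.exp_le_exp.2 (by linarith)
  · push Not at h
    have : 1 ≤ y ^ 2 / M ^ 2 := by
      rw [le_div_iff₀ (by positivity)]; nlinarith
    have h2 : Real.exp (-M) * (1 - y ^ 2 / M ^ 2) ≤ 0 :=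
      mul_nonpos_of_nonneg_of_nonpos (Real.exp_pos _).le (by linarith)
    exact h2.trans (Real.exp_pos _).le

lemma stab_pointwise {α : Λ → ι → ℂ} {αk : ℕ → Λ → ι → ℂ} {s B a astar K : ℝ} {kmax : ℕ}
    (H : Stab α αk s B a astar K kmax) (e M : ℝ) (he : 0 < e) (hM : 0 < M) (g : ι → ℝ)
    (D y2 : ℝ)
    (hD : D = 4096 * ∑ x, ‖lf (α x) g‖ ^ 6 + TT (dsg (Λ := Λ)) (dal α (αk kmax)) 0 4 g
      + B ^ 2 * TT (dsg (Λ := Λ)) (dal α (αk kmax)) 0 2 g)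
    (hy2 : y2 = TT (fun _ : Λ => (1:ℝ)) α 0 4 g + B ^ 2 * TT (fun _ : Λ => (1:ℝ)) α 0 2 g + 1) :
    1 / 2 * (Real.exp (-M) * (1 - y2 / M ^ 2)) - D * (1 / 2 + 1 / e ^ 4)
      - e * ‖Wf α s (a ^ 2 / 4 + B * a / 2) g‖ ^ (5/4 : ℝ) ≤
      (Wf α s (a ^ 2 / 4 + B * a / 2) g).re := by
  set W := Wf α s (a ^ 2 / 4 + B * a / 2) with hW
  rw [← wS_TT, ← wS_TT] at hD hy2
  set D4 := wS (dsg (Λ := Λ)) (dal α (αk kmax)) 4 g with hD4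
  set D2 := wS (dsg (Λ := Λ)) (dal α (αk kmax)) 2 g with hD2
  set S4 := wS (fun _ : Λ => (1:ℝ)) α 4 g with hS4
  set S2 := wS (fun _ : Λ => (1:ℝ)) α 2 g with hS2
  set Q := ∑ x, ‖lf (α x) g‖ ^ 6 with hQ
  have hQ0 : 0 ≤ Q := Finset.sum_nonneg (fun _ _ => by positivity)
  have hrp : 0 ≤ ‖W g‖ ^ (5/4 : ℝ) := by positivity
  have hB2 : 0 ≤ B ^ 2 * ‖D2‖ ^ 2 := by positivity
  have hD40 : 0 ≤ ‖D4‖ ^ 2 := by positivity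
  have hD0 : 0 ≤ D := by rw [hD]; positivity
  have he4 : 0 < 1 / e ^ 4 := by positivity
  by_cases hd : D ≤ 1
  · have hQs : Q ≤ 1 / 4096 := by linarith
    have hd4 : ‖D4‖ ≤ 1 := by
      have : ‖D4‖ ^ 2 ≤ 1 := by linarith
      nlinarith [norm_nonneg D4]
    have hd2 : |B| * ‖D2‖ ≤ 1 := by
      have : (|B| * ‖D2‖) ^ 2 ≤ 1 := by rw [mul_pow, sq_abs]; linarith
      nlinarith [mul_nonneg (abs_nonneg B) (norm_nonneg D2)]
    have hsm : ∀ x, ‖lf (α x) g‖ ≤ 1 / 4 := by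
      intro x
      have h1 : ‖lf (α x) g‖ ^ 6 ≤ Q :=
        Finset.single_le_sum (f := fun x => ‖lf (α x) g‖ ^ 6) (fun _ _ => by positivity)
          (Finset.mem_univ x)
      have h2 : ‖lf (α x) g‖ ^ 6 ≤ (1 / 4) ^ 6 := by
        norm_num at hQs ⊢; linarith
      exact le_of_pow_le_pow_left₀ (by norm_num) (by norm_num) h2
    obtain ⟨r, hr, hexp⟩ := Wf_exact α s B a H.ha H.hs g hsm
    rw [← hW, ← hS4, ← hS2] at hexp
    rw [← hQ] at hr
    set E := -S4 / 12 + ((B / 2 : ℝ) : ℂ) * S2 + r with hE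
    have him : |E.im| ≤ 1 := by
      have i4 := wS_dal_im α (αk kmax) (H.hreal kmax le_rfl) 4 g
      have i2 := wS_dal_im α (αk kmax) (H.hreal kmax le_rfl) 2 g
      rw [← hS4, ← hD4] at i4
      rw [← hS2, ← hD2] at i2
      have : E.im = -D4.im / 12 + B / 2 * D2.im + r.im := by
        rw [hE, Complex.add_im, Complex.add_im, Complex.im_ofReal_mul, ← i4, ← i2]
        have : (-S4 / 12).im = -S4.im / 12 := by
          have h := Complex.im_mul_ofReal (-S4) (1/12)
          push_cast at h
          rw [div_eq_mul_one_div, h, Complex.neg_im]; ring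
        rw [this]
      have a4 := (Complex.abs_im_le_norm D4).trans hd4
      have a2 : |B * D2.im| ≤ 1 := by
        rw [abs_mul]
        exact (mul_le_mul_of_nonneg_left (Complex.abs_im_le_norm D2) (abs_nonneg B)).trans hd2
      have ar := (Complex.abs_im_le_norm r).trans hr
      rw [abs_le] at *
      rw [this]
      constructor <;> linarith [a4.1, a4.2, a2.1, a2.2, ar.1, ar.2]
    have hcos : 1 / 2 ≤ Real.cos E.im := by
      have := Real.one_sub_sq_div_two_le_cos (x := E.im)
      have h2 : E.im ^ 2 ≤ 1 := by rw [← sq_abs]; nlinarith [abs_nonneg E.im]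
      linarith
    set y := ‖S4‖ / 12 + |B| / 2 * ‖S2‖ + 6 * Q with hy
    have hy0 : 0 ≤ y := by positivity
    have hre : -y ≤ E.re := by
      have h1 : ‖E‖ ≤ y := by
        rw [hE, hy]
        refine (norm_add₃_le).trans ?_
        gcongr
        · rw [norm_div, norm_neg]; simp
        · rw [norm_mul, Complex.norm_real]; simp [abs_div]
      have h2 := Complex.abs_re_le_norm E
      have h3 := abs_le.1 (h2.trans h1)
      exact h3.1
    have hWre : (W g).re = Real.exp E.re * Real.cos E.im := by
      rw [hexp, Complex.exp_re]
    have h1 : 1 / 2 * Real.exp (-y) ≤ (W g).re := by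
      rw [hWre]
      have := Real.exp_le_exp.2 hre
      nlinarith [Real.exp_pos (-y), Real.exp_pos E.re]
    have hyy : y ^ 2 ≤ y2 := by
      have h6 : 6 * Q ≤ 1 / 100 := by linarith
      have hb : (|B| * ‖S2‖) ^ 2 = B ^ 2 * ‖S2‖ ^ 2 := by rw [mul_pow, sq_abs]
      set p := ‖S4‖
      set q := |B| * ‖S2‖ with hq
      set z := 6 * Q with hz
      have hp0 : 0 ≤ p := norm_nonneg _
      have hq0 : 0 ≤ q := by positivity
      have hz0 : 0 ≤ z := by positivity
      have e1 : y = p / 12 + q / 2 + z := by rw [hy, hq, hz]; ring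
      rw [e1, hy2, ← hb]
      nlinarith [sq_nonneg (p / 12 - q / 2), sq_nonneg (p / 12 - z), sq_nonneg (q / 2 - z),
        sq_nonneg p, sq_nonneg q]
    have h2 := exp_lower y M hy0 hM
    have h3 : Real.exp (-M) * (1 - y2 / M ^ 2) ≤ Real.exp (-M) * (1 - y ^ 2 / M ^ 2) := by
      gcongr
    have h4 : 0 ≤ D * (1 / 2 + 1 / e ^ 4) := by positivity
    have h5 : 0 ≤ e * ‖W g‖ ^ (5/4 : ℝ) := by positivity
    linarith
  · push Not at hd
    have h1 := young_eps ‖W g‖ e (norm_nonneg _) he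
    have h2 := (abs_le.1 (Complex.abs_re_le_norm (W g))).1
    have h3 : 0 ≤ y2 / M ^ 2 := by
      rw [hy2]; positivity
    have h4 : Real.exp (-M) * (1 - y2 / M ^ 2) ≤ 1 := by
      have : Real.exp (-M) ≤ 1 := Real.exp_le_one_iff.2 (by linarith)
      calc _ ≤ Real.exp (-M) * 1 := by gcongr; linarith
        _ ≤ 1 := by linarith
    have h5 : 1 / 2 + 1 / e ^ 4 ≤ D * (1 / 2 + 1 / e ^ 4) := by
      nlinarith
    linarith

theorem stab_lower (K : ℝ) : ∃ c > 0, ∃ T0 : ℝ, ∀ {Λ ι : Type} [Fintype Λ] [Fintype ι]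
    [Nonempty Λ] {α : Λ → ι → ℂ} {αk : ℕ → Λ → ι → ℂ} {s B a astar : ℝ} {kmax : ℕ},
    Stab α αk s B a astar K kmax → T0 ≤ 2 ^ kmax →
    (∑ x, ∑ y, (bq (α x) (cj (α y))) ^ 4).re ≤ K →
    B ^ 2 * (∑ x, ∑ y, (bq (α x) (cj (α y))) ^ 2).re ≤ K →
    c ≤ (∫ g, Wf α s (a ^ 2 / 4 + B * a / 2) g ∂(gpi ι)).re := by
  set M : ℝ := 8 * K with hM
  set e : ℝ := Real.exp (-M) / (16 * Real.exp (10 ^ 20 * K ^ 2)) with he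
  have he0 : 0 < e := by positivity
  have hem := Real.exp_pos (-M)
  set T0 : ℝ := 10 ^ 6 * K * (1 / 2 + 1 / e ^ 4) * 16 / Real.exp (-M) with hT0
  refine ⟨Real.exp (-M) / 8, by positivity, T0, ?_⟩
  intro Λ ι _ _ _ α αk s B a astar kmax H hT hC4 hC2
  have hK := H.hK
  have hM0 : 0 < M := by rw [hM]; linarith
  obtain ⟨i1, i2, i3⟩ := stab_integrable H
  set W := Wf α s (a ^ 2 / 4 + B * a / 2) with hW
  set L : ℝ := (Fintype.card Λ : ℝ) with hL
  have hL0 : 0 ≤ L := Nat.cast_nonneg _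
  set T : ℝ := 2 ^ kmax with hTd
  have hT1 : 1 ≤ T := one_le_pow₀ (by norm_num)
  set D : (ι → ℝ) → ℝ := fun g => 4096 * ∑ x, ‖lf (α x) g‖ ^ 6
    + TT (dsg (Λ := Λ)) (dal α (αk kmax)) 0 4 g
      + B ^ 2 * TT (dsg (Λ := Λ)) (dal α (αk kmax)) 0 2 g with hD
  set Y : (ι → ℝ) → ℝ := fun g => TT (fun _ : Λ => (1:ℝ)) α 0 4 g
    + B ^ 2 * TT (fun _ : Λ => (1:ℝ)) α 0 2 g + 1 with hY
  have hp : ∀ g, 1 / 2 * (Real.exp (-M) * (1 - Y g / M ^ 2)) - D g * (1 / 2 + 1 / e ^ 4)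
      - e * ‖W g‖ ^ (5/4 : ℝ) ≤ (W g).re := fun g =>
    stab_pointwise H e M he0 hM0 g (D g) (Y g) rfl rfl
  have j6 : Integrable (fun g => 4096 * ∑ x, ‖lf (α x) g‖ ^ 6) (gpi ι) :=
    (integrable_finsetSum _ (fun x _ => (lf_moment6 (α x)).1)).const_mul _
  have j4 := TT_integrable (dsg (Λ := Λ)) (dal α (αk kmax)) 0 4
  have j2 := (TT_integrable (dsg (Λ := Λ)) (dal α (αk kmax)) 0 2).const_mul (B ^ 2)
  have jD : Integrable D (gpi ι) := int_add (int_add j6 j4) j2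
  have k4 := TT_integrable (fun _ : Λ => (1:ℝ)) α 0 4
  have k2 := (TT_integrable (fun _ : Λ => (1:ℝ)) α 0 2).const_mul (B ^ 2)
  have k0 : Integrable (fun _ : ι → ℝ => (1:ℝ)) (gpi ι) := integrable_const _
  have jY : Integrable Y (gpi ι) := int_add (int_add k4 k2) k0
  have ID : ∫ g, D g ∂(gpi ι) ≤ 10 ^ 6 * K / T := by
    simp only [hD]
    rw [integral_add (int_add j6 j4) j2, integral_add j6 j4, integral_const_mul,
      integral_const_mul, integral_finsetSum _ (fun x _ => (lf_moment6 (α x)).1),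
      TT_int_re, TT_int_re]
    have b6 : ∑ x, ∫ y, ‖lf (α x) y‖ ^ 6 ∂(gpi ι) ≤ 120 * (K / T) := by
      have : ∀ x, ∫ y, ‖lf (α x) y‖ ^ 6 ∂(gpi ι) ≤ 120 * astar ^ 3 := fun x => by
        refine (lf_moment6 (α x)).2.trans ?_
        have h0 : 0 ≤ ∑ i, ‖α x i‖ ^ 2 := Finset.sum_nonneg (fun _ _ => by positivity)
        have := H.hast x
        gcongr
      refine (Finset.sum_le_sum (fun x _ => this x)).trans ?_
      rw [Finset.sum_const, nsmul_eq_mul, Finset.card_univ, ← hL]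
      have h6 := H.h6
      rw [← hL, ← hTd] at h6
      have h7 : L * astar ^ 3 ≤ K / T := by
        rw [le_div_iff₀ (by linarith)]
        refine le_trans ?_ h6
        have h0 : 0 ≤ L * astar ^ 3 := mul_nonneg hL0 (pow_nonneg H.hast0 3)
        gcongr
        exact le_self_pow₀ hT1 (by norm_num)
      linarith
    have b4 := H.hT4 kmax le_rfl
    have b2 := H.hT2 kmax le_rfl
    rw [← hTd] at b4 b2
    have hT8 : K / T ^ 8 ≤ K / T := by
      gcongr
      exact le_self_pow₀ hT1 (by norm_num)
    change _ + _ * (dcov α (αk kmax) 4).re + B ^ 2 * (_ * (dcov α (αk kmax) 2).re) ≤ _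
    have f4 : ((Nat.factorial 4 : ℕ) : ℝ) = 24 := by norm_num [Nat.factorial]
    have f2 : ((Nat.factorial 2 : ℕ) : ℝ) = 2 := by norm_num [Nat.factorial]
    rw [f4, f2]
    have hKT : 0 ≤ K / T := by positivity
    have e1 : 10 ^ 6 * K / T = 10 ^ 6 * (K / T) := by ring
    rw [e1]
    linarith
  have IY : ∫ g, Y g ∂(gpi ι) ≤ 27 * K := by
    simp only [hY]
    rw [integral_add (int_add k4 k2) k0, integral_add k4 k2, integral_const_mul,
      TT_int_re, TT_int_re]
    simp only [Complex.ofReal_one, one_mul, mul_one, zero_add]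
    have f4 : ((Nat.factorial 4 : ℕ) : ℝ) = 24 := by norm_num [Nat.factorial]
    have f2 : ((Nat.factorial 2 : ℕ) : ℝ) = 2 := by norm_num [Nat.factorial]
    have f1 : ∫ _ : ι → ℝ, (1:ℝ) ∂(gpi ι) = 1 := by simp
    rw [f4, f2, f1]
    linarith
  have hWre : ∫ g, (W g).re ∂(gpi ι) = (∫ g, W g ∂(gpi ι)).re := integral_re i3
  rw [← hWre]
  have l1 : Integrable (fun g => 1 / 2 * (Real.exp (-M) * (1 - Y g / M ^ 2))) (gpi ι) :=
    ((((integrable_const (1:ℝ)).sub (jY.div_const _)).const_mul _).const_mul _)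
  have l2 : Integrable (fun g => D g * (1 / 2 + 1 / e ^ 4)) (gpi ι) := jD.mul_const _
  have l3 : Integrable (fun g => e * ‖W g‖ ^ (5/4 : ℝ)) (gpi ι) := i1.const_mul _
  have l12 : Integrable (fun g => 1 / 2 * (Real.exp (-M) * (1 - Y g / M ^ 2))
    - D g * (1 / 2 + 1 / e ^ 4)) (gpi ι) := l1.sub l2
  have hInt0 := integral_mono (l12.sub l3) i3.re hp
  refine le_trans ?_ hInt0
  have m1 : ∫ g, 1 / 2 * (Real.exp (-M) * (1 - Y g / M ^ 2)) ∂(gpi ι) =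
      1 / 2 * (Real.exp (-M) * (1 - (∫ g, Y g ∂(gpi ι)) / M ^ 2)) := by
    rw [integral_const_mul, integral_const_mul, integral_sub (integrable_const (1:ℝ))
      (jY.div_const _), integral_div]
    simp
  have m0 : ∫ g, (1 / 2 * (Real.exp (-M) * (1 - Y g / M ^ 2)) - D g * (1 / 2 + 1 / e ^ 4)
      - e * ‖W g‖ ^ (5/4 : ℝ)) ∂(gpi ι) =
      1 / 2 * (Real.exp (-M) * (1 - (∫ g, Y g ∂(gpi ι)) / M ^ 2))
        - (∫ g, D g ∂(gpi ι)) * (1 / 2 + 1 / e ^ 4)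
        - e * ∫ g, ‖W g‖ ^ (5/4 : ℝ) ∂(gpi ι) := by
    rw [integral_sub l12 l3, integral_sub l1 l2, m1, integral_mul_const, integral_const_mul]
  change _ ≤ ∫ g, (1 / 2 * (Real.exp (-M) * (1 - Y g / M ^ 2)) - D g * (1 / 2 + 1 / e ^ 4)
      - e * ‖W g‖ ^ (5/4 : ℝ)) ∂(gpi ι)
  rw [m0]
  have r1 : (∫ g, Y g ∂(gpi ι)) / M ^ 2 ≤ 1 / 2 := by
    rw [div_le_iff₀ (by positivity), hM]
    nlinarith
  have r2 : (∫ g, D g ∂(gpi ι)) * (1 / 2 + 1 / e ^ 4) ≤ Real.exp (-M) / 16 := by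
    have : (∫ g, D g ∂(gpi ι)) * (1 / 2 + 1 / e ^ 4) ≤ (10 ^ 6 * K / T) * (1 / 2 + 1 / e ^ 4) := by
      gcongr
    refine this.trans ?_
    have hT' : 10 ^ 6 * K * (1 / 2 + 1 / e ^ 4) * 16 ≤ Real.exp (-M) * T := by
      rw [hT0, div_le_iff₀ hem] at hT
      linarith
    rw [div_mul_eq_mul_div, div_le_div_iff₀ (by linarith) (by norm_num)]
    linarith
  have r3 : e * ∫ g, ‖W g‖ ^ (5/4 : ℝ) ∂(gpi ι) ≤ Real.exp (-M) / 16 := by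
    calc _ ≤ e * Real.exp (10 ^ 20 * K ^ 2) := by gcongr
      _ = _ := by rw [he]; field_simp
  have r4 : Real.exp (-M) * (1 / 2) ≤ Real.exp (-M) * (1 - (∫ g, Y g ∂(gpi ι)) / M ^ 2) := by
    gcongr; linarith
  linarith

end lower

/-! ### Part F: Hubbard-Stratonovich transform -/

section HS
open ProbabilityTheory

/-- normalising constant -/
def gD (c : ℝ) : ℂ := ((√(2 * Real.pi))⁻¹ : ℝ) * ((Real.pi : ℂ) / ((1 + c : ℝ) / 2 : ℂ)) ^ (1 / 2 : ℂ)

lemma gD_ne (c : ℝ) (hc : -1 < c) : gD c ≠ 0 := by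
  unfold gD
  refine mul_ne_zero ?_ ?_
  · rw [Complex.ofReal_ne_zero]; positivity
  · rw [Complex.cpow_def_of_ne_zero]
    · exact Complex.exp_ne_zero _
    · apply div_ne_zero
      · exact_mod_cast Real.pi_ne_zero
      · apply div_ne_zero _ two_ne_zero
        rw [Complex.ofReal_ne_zero]; linarith

lemma g1_aux (c : ℝ) (a : ℂ) (x : ℝ) :
    gaussianPDFReal 0 1 x • Complex.exp (a * x - (c / 2 : ℝ) * (x:ℂ) ^ 2) =
      ((√(2 * Real.pi))⁻¹ : ℝ) * Complex.exp (-((1 + c : ℝ) / 2 : ℂ) * (x:ℂ) ^ 2 + a * x + 0) := by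
  rw [gaussianPDFReal, Complex.real_smul]
  simp only [NNReal.coe_one, mul_one, sub_zero]
  push_cast
  rw [mul_assoc, ← Complex.exp_add]
  congr 2
  ring

lemma g1 (c : ℝ) (hc : -1 < c) (a : ℂ) :
    ∫ x, Complex.exp (a * x - (c / 2 : ℝ) * (x:ℂ) ^ 2) ∂(gaussianReal 0 1) =
      gD c * Complex.exp (a ^ 2 / (2 * (1 + c : ℝ))) := by
  rw [integral_gaussianReal_eq_integral_smul one_ne_zero]
  simp_rw [g1_aux]
  rw [integral_const_mul, integral_cexp_quadratic]
  · unfold gD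
    rw [neg_neg, mul_assoc]
    congr 3
    have : ((1 + c : ℝ) : ℂ) ≠ 0 := by rw [Complex.ofReal_ne_zero]; linarith
    field_simp
    ring
  · have : (-(((1 + c : ℝ) : ℂ) / 2)) = ((-((1 + c) / 2) : ℝ) : ℂ) := by push_cast; ring
    rw [this, Complex.ofReal_re]; linarith

lemma g1_int (c : ℝ) (hc : -1 < c) (a : ℂ) :
    Integrable (fun x : ℝ => Complex.exp (a * x - (c / 2 : ℝ) * (x:ℂ) ^ 2)) (gaussianReal 0 1) := by
  have h0 : Continuous (fun x : ℝ => Complex.exp (a * x - (c / 2 : ℝ) * (x:ℂ) ^ 2)) := by fun_prop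
  rw [gaussianReal_of_var_ne_zero _ one_ne_zero, gaussianPDF_def]
  rw [integrable_withDensity_iff_integrable_smul' (by fun_prop) (by simp)]
  simp_rw [ENNReal.toReal_ofReal (gaussianPDFReal_nonneg 0 1 _), g1_aux]
  apply Integrable.const_mul
  apply integrable_cexp_quadratic
  have : ((((1 + c : ℝ) : ℂ) / 2)) = ((((1 + c) / 2) : ℝ) : ℂ) := by push_cast; ring
  rw [this, Complex.ofReal_re]; linarith

variable {Λ ι : Type} [Fintype Λ] [Fintype ι]

lemma gn_eq (c : ι → ℝ) (a : ι → ℂ) (g : ι → ℝ) :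
    Complex.exp (lf a g - ∑ i, (c i / 2 : ℝ) * (g i : ℂ) ^ 2) =
      ∏ i, Complex.exp (a i * g i - (c i / 2 : ℝ) * (g i:ℂ) ^ 2) := by
  rw [← Complex.exp_sum, Finset.sum_sub_distrib]; rfl

lemma gn (c : ι → ℝ) (hc : ∀ i, -1 < c i) (a : ι → ℂ) :
    ∫ g, Complex.exp (lf a g - ∑ i, (c i / 2 : ℝ) * (g i : ℂ) ^ 2) ∂(gpi ι) =
      (∏ i, gD (c i)) * Complex.exp (∑ i, a i ^ 2 / (2 * (1 + c i : ℝ))) := by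
  simp_rw [gn_eq]
  rw [integral_fintype_prod_eq_prod (fun i (x : ℝ) => Complex.exp (a i * x - (c i / 2 : ℝ) * (x:ℂ) ^ 2))]
  rw [Complex.exp_sum, ← Finset.prod_mul_distrib]
  exact Finset.prod_congr rfl (fun i _ => g1 (c i) (hc i) (a i))

lemma gn_int (c : ι → ℝ) (hc : ∀ i, -1 < c i) (a : ι → ℂ) :
    Integrable (fun g => Complex.exp (lf a g - ∑ i, (c i / 2 : ℝ) * (g i : ℂ) ^ 2)) (gpi ι) := by
  simp_rw [gn_eq]
  exact Integrable.fintype_prod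
    (f := fun i (x : ℝ) => Complex.exp (a i * x - (c i / 2 : ℝ) * (x:ℂ) ^ 2))
    (fun i => g1_int (c i) (hc i) (a i))

lemma gn_real (v : ι → ℝ) :
    Integrable (fun g : ι → ℝ => Real.exp (∑ i, v i * g i)) (gpi ι) ∧
    ∫ g : ι → ℝ, Real.exp (∑ i, v i * g i) ∂(gpi ι) = Real.exp (∑ i, v i ^ 2 / 2) := by
  have e : ∀ g : ι → ℝ, Complex.exp (lf (fun i => (v i : ℂ)) g -
      ∑ i, ((((0:ℝ)) / 2 : ℝ) : ℂ) * (g i : ℂ) ^ 2) = ((Real.exp (∑ i, v i * g i) : ℝ) : ℂ) := by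
    intro g; simp [lf]
  have hD : gD 0 = 1 := by
    have := g1 0 (by norm_num) 0
    simpa using this.symm
  have h1 := gn_int (fun _ : ι => (0:ℝ)) (fun _ => by norm_num) (fun i => (v i : ℂ))
  have h2 := gn (fun _ : ι => (0:ℝ)) (fun _ => by norm_num) (fun i => (v i : ℂ))
  simp_rw [e] at h1 h2
  constructor
  · exact h1.re.congr (Filter.Eventually.of_forall (fun g => Complex.ofReal_re _))
  · rw [integral_complex_ofReal] at h2
    rw [hD] at h2
    simp only [Finset.prod_const_one, one_mul, add_zero, Complex.ofReal_one, mul_one] at h2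
    exact_mod_cast h2

lemma young54 (A L q : ℝ) (hA : 0 ≤ A) :
    A * Real.exp L ≤ Real.exp (5 / 2 * q) * (A ^ (5/4 : ℝ) + Real.exp (-(25 / 2 * q)) * Real.exp (5 * L)) := by
  have h := Real.young_inequality_of_nonneg hA (Real.exp_pos (L - 5 / 2 * q)).le
    (p := 5/4) (q := 5) (by constructor <;> norm_num)
  have e1 : A * Real.exp L = Real.exp (5 / 2 * q) * (A * Real.exp (L - 5 / 2 * q)) := by
    rw [mul_left_comm, ← Real.exp_add]; ring_nf
  rw [e1]
  apply mul_le_mul_of_nonneg_left _ (Real.exp_pos _).le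
  refine h.trans ?_
  rw [← Real.exp_mul, ← Real.exp_add]
  have h2 : 0 ≤ A ^ (5/4:ℝ) := Real.rpow_nonneg hA _
  have h3 := Real.exp_pos ((L - 5 / 2 * q) * 5)
  have e2 : -(25 / 2 * q) + 5 * L = (L - 5 / 2 * q) * 5 := by ring
  rw [e2]
  linarith

lemma W_tilt {W : (ι → ℝ) → ℂ} (hc : Continuous W) {M : ℝ}
    (hi : Integrable (fun g => ‖W g‖ ^ (5/4 : ℝ)) (gpi ι))
    (hM : ∫ g, ‖W g‖ ^ (5/4 : ℝ) ∂(gpi ι) ≤ M) (l : ι → ℂ) :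
    Integrable (fun g => W g * Complex.exp (lf l g)) (gpi ι) ∧
    ‖∫ g, W g * Complex.exp (lf l g) ∂(gpi ι)‖ ≤
      Real.exp (5 / 2 * ∑ i, (l i).re ^ 2) * (M + 1) := by
  set q := ∑ i, (l i).re ^ 2 with hq
  obtain ⟨hi2, hv2⟩ := gn_real (fun i => 5 * (l i).re)
  have e5 : ∑ i, (5 * (l i).re) ^ 2 / 2 = 25 / 2 * q := by
    rw [hq, Finset.mul_sum]; apply Finset.sum_congr rfl; intros; ring
  rw [e5] at hv2
  have hre : ∀ g : ι → ℝ, (lf l g).re = ∑ i, (l i).re * g i := by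
    intro g; simp [lf]
  have hnorm : ∀ g, ‖W g * Complex.exp (lf l g)‖ ≤ Real.exp (5 / 2 * q) * (‖W g‖ ^ (5/4 : ℝ) +
      Real.exp (-(25 / 2 * q)) * Real.exp (∑ i, 5 * (l i).re * g i)) := by
    intro g
    rw [norm_mul, Complex.norm_exp, hre]
    refine (young54 _ _ q (norm_nonneg _)).trans (le_of_eq ?_)
    have e6 : 5 * ∑ i, (l i).re * g i = ∑ i, 5 * (l i).re * g i := by
      rw [Finset.mul_sum]
      exact Finset.sum_congr rfl (fun i _ => by ring)
    rw [e6]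
  have hib : Integrable (fun g => Real.exp (5 / 2 * q) * (‖W g‖ ^ (5/4 : ℝ) +
      Real.exp (-(25 / 2 * q)) * Real.exp (∑ i, 5 * (l i).re * g i))) (gpi ι) :=
    (int_add hi (hi2.const_mul _)).const_mul _
  have hcont : Continuous (fun g => W g * Complex.exp (lf l g)) :=
    hc.mul (Complex.continuous_exp.comp (lf_continuous l))
  refine ⟨hib.mono' hcont.aestronglyMeasurable (Filter.Eventually.of_forall hnorm), ?_⟩
  refine (norm_integral_le_of_norm_le hib (Filter.Eventually.of_forall hnorm)).trans ?_
  rw [integral_const_mul, integral_add hi (hi2.const_mul _), integral_const_mul, hv2, ← Real.exp_add]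
  apply mul_le_mul_of_nonneg_left _ (Real.exp_pos _).le
  simp
  exact hM

/-- Fourier type coefficient of a configuration. -/
def shat (u : ι → Λ → ℝ) (σ : Λ → ℝ) (i : ι) : ℝ := ∑ x, u i x * σ x

lemma lf_sq_sum {u : ι → Λ → ℝ} {ρ : ι → ℂ} [DecidableEq ι]
    (hu : ∀ i j, ∑ x, u i x * u j x = if i = j then 1 else 0) (g : ι → ℝ) :
    ∑ x, (lf (fun i => (u i x : ℂ) * ρ i) g) ^ 2 = ∑ i, ρ i ^ 2 * (g i : ℂ) ^ 2 := by
  have e : ∀ x, (lf (fun i => (u i x : ℂ) * ρ i) g) ^ 2 =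
      ∑ i, ∑ j, (ρ i * g i * ρ j * g j) * ((u i x * u j x : ℝ) : ℂ) := by
    intro x
    rw [sq]
    unfold lf
    rw [Finset.sum_mul_sum]
    refine Finset.sum_congr rfl (fun i _ => Finset.sum_congr rfl (fun j _ => ?_))
    push_cast; ring
  simp_rw [e]
  rw [Finset.sum_comm]
  refine Finset.sum_congr rfl (fun i _ => ?_)
  rw [Finset.sum_comm]
  have e2 : ∀ j, ∑ x, (ρ i * g i * ρ j * g j) * ((u i x * u j x : ℝ) : ℂ) =
      (ρ i * g i * ρ j * g j) * (if i = j then 1 else 0) := by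
    intro j
    rw [← Finset.mul_sum, ← Complex.ofReal_sum, hu]
    split_ifs <;> simp
  rw [Finset.sum_congr rfl (fun j _ => e2 j)]
  simp only [mul_ite, mul_one, mul_zero, Finset.sum_ite_eq, Finset.mem_univ, if_true]
  ring

lemma spin_sum (z : ℂ) : ∑ b : Bool, Complex.exp ((spin b : ℂ) * z) = 2 * Complex.cosh z := by
  rw [Complex.two_cosh]
  simp [spin]

lemma spin_prod (ζ : Λ → ℂ) [DecidableEq Λ] :
    ∑ s : Λ → Bool, Complex.exp (∑ x, (spin (s x) : ℂ) * ζ x) =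
      2 ^ (Fintype.card Λ) * ∏ x, Complex.cosh (ζ x) := by
  simp_rw [Complex.exp_sum]
  have := Finset.prod_univ_sum (fun _ : Λ => (Finset.univ : Finset Bool))
    (fun x b => Complex.exp ((spin b : ℂ) * ζ x))
  rw [Fintype.piFinset_univ] at this
  rw [← this]
  simp_rw [spin_sum]
  rw [Finset.prod_mul_distrib]
  simp

lemma hs_identity [DecidableEq Λ] [DecidableEq ι] {u : ι → Λ → ℝ} {ρ : ι → ℂ} {lam : ι → ℝ} {β τ e0 : ℝ}
    (hβ : 1 / 2 ≤ β) (hl : ∀ i, |lam i| ≤ 1) (hτ0 : 0 ≤ τ) (hτ1 : τ < 1)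
    (hu : ∀ i j, ∑ x, u i x * u j x = if i = j then 1 else 0)
    (hρ : ∀ i, ρ i ^ 2 = ((β * lam i / (1 - τ * lam i) : ℝ) : ℂ))
    (η : ι → ℝ) :
    (2:ℂ) ^ (Fintype.card Λ) * ((Real.exp (Fintype.card Λ * e0) : ℝ) : ℂ) *
      ∫ g, Wf (fun x i => (u i x : ℂ) * ρ i) (1 - τ / β) e0 g *
        Complex.exp (lf (fun i => (η i / β : ℝ) * ρ i) g) ∂(gpi ι) =
    (∏ i, gD (τ * lam i / (1 - τ * lam i))) * ((Real.exp (∑ i, lam i * η i ^ 2 / (2 * β)) : ℝ) : ℂ) *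
      ((∑ s : Λ → Bool, Real.exp (β / 2 * ∑ i, lam i * shat u (fun x => spin (s x)) i ^ 2 +
        ∑ i, lam i * η i * shat u (fun x => spin (s x)) i) : ℝ) : ℂ) := by
  have hpos : ∀ i, 0 < 1 - τ * lam i := by
    intro i
    have := (abs_le.1 (hl i)).2
    nlinarith
  have hβ0 : 0 < β := by linarith
  have hc : ∀ i, 1 + τ * lam i / (1 - τ * lam i) = 1 / (1 - τ * lam i) := by
    intro i
    have := (hpos i).ne'
    field_simp; ring
  have hc1 : ∀ i, -1 < τ * lam i / (1 - τ * lam i) := by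
    intro i
    have := hc i
    have h2 : 0 < 1 / (1 - τ * lam i) := one_div_pos.2 (hpos i)
    linarith
  -- pointwise
  have hpt : ∀ g : ι → ℝ, (2:ℂ) ^ (Fintype.card Λ) * ((Real.exp (Fintype.card Λ * e0) : ℝ) : ℂ) *
      (Wf (fun x i => (u i x : ℂ) * ρ i) (1 - τ / β) e0 g *
        Complex.exp (lf (fun i => (η i / β : ℝ) * ρ i) g)) =
      ∑ s : Λ → Bool, Complex.exp (lf (fun i =>
        ((shat u (fun x => spin (s x)) i + η i / β : ℝ) : ℂ) * ρ i) g
        - ∑ i, ((τ * lam i / (1 - τ * lam i) / 2 : ℝ) : ℂ) * (g i : ℂ) ^ 2) := by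
    intro g
    have e1 : ∏ x, Complex.exp (-(((1 - (1 - τ / β)) / 2 : ℝ) : ℂ) *
        (lf (fun i => (u i x : ℂ) * ρ i) g) ^ 2) =
        Complex.exp (- ∑ i, ((τ * lam i / (1 - τ * lam i) / 2 : ℝ) : ℂ) * (g i : ℂ) ^ 2) := by
      rw [← Complex.exp_sum, ← Finset.mul_sum, lf_sq_sum hu, neg_mul, Finset.mul_sum]
      congr 2
      refine Finset.sum_congr rfl (fun i _ => ?_)
      rw [hρ i, ← mul_assoc, ← Complex.ofReal_mul]
      congr 2
      have := (hpos i).ne'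
      field_simp
      ring
    unfold Wf
    rw [Finset.prod_mul_distrib, e1]
    have e2 : ((Real.exp (Fintype.card Λ * e0) : ℝ) : ℂ) *
        ((Real.exp (-(Fintype.card Λ * e0)) : ℝ) : ℂ) = 1 := by
      rw [← Complex.ofReal_mul, ← Real.exp_add]; simp
    have e3 := spin_prod (fun x => lf (fun i => (u i x : ℂ) * ρ i) g)
    have e4 : ∀ s : Λ → Bool, ∑ x, (spin (s x) : ℂ) * lf (fun i => (u i x : ℂ) * ρ i) g =
        lf (fun i => (shat u (fun x => spin (s x)) i : ℂ) * ρ i) g := by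
      intro s
      unfold lf shat
      simp_rw [Finset.mul_sum]
      rw [Finset.sum_comm]
      refine Finset.sum_congr rfl (fun i _ => ?_)
      push_cast
      rw [Finset.sum_mul, Finset.sum_mul]
      exact Finset.sum_congr rfl (fun x _ => by ring)
    simp_rw [e4] at e3
    have e5 : ∀ s : Λ → Bool, lf (fun i =>
        ((shat u (fun x => spin (s x)) i + η i / β : ℝ) : ℂ) * ρ i) g =
        lf (fun i => (shat u (fun x => spin (s x)) i : ℂ) * ρ i) g +
        lf (fun i => (η i / β : ℝ) * ρ i) g := by
      intro s
      unfold lf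
      rw [← Finset.sum_add_distrib]
      exact Finset.sum_congr rfl (fun x _ => by push_cast; ring)
    simp_rw [e5, sub_eq_add_neg, Complex.exp_add]
    rw [← Finset.sum_mul, ← Finset.sum_mul, e3]
    linear_combination (2:ℂ) ^ (Fintype.card Λ) * (∏ x, Complex.cosh (lf (fun i => (u i x : ℂ) * ρ i) g))
      * Complex.exp (lf (fun i => (η i / β : ℝ) * ρ i) g) *
      Complex.exp (- ∑ i, ((τ * lam i / (1 - τ * lam i) / 2 : ℝ) : ℂ) * (g i : ℂ) ^ 2) * e2
  rw [← integral_const_mul]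
  simp_rw [hpt]
  rw [integral_finsetSum _ (fun s _ => gn_int (fun i => τ * lam i / (1 - τ * lam i)) hc1 _)]
  rw [Complex.ofReal_sum, Finset.mul_sum]
  refine Finset.sum_congr rfl (fun s _ => ?_)
  rw [gn (fun i => τ * lam i / (1 - τ * lam i)) hc1, mul_assoc]
  congr 1
  rw [← Complex.ofReal_mul, ← Real.exp_add, Complex.ofReal_exp]
  congr 1
  push_cast
  rw [Finset.mul_sum, ← Finset.sum_add_distrib, ← Finset.sum_add_distrib]
  refine Finset.sum_congr rfl (fun i _ => ?_)
  rw [mul_pow, hρ i]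
  have h1 := (hpos i).ne'
  have h2 : (shat u (fun x => spin (s x)) i + η i / β) ^ 2 * (β * lam i / (1 - τ * lam i)) /
      (2 * (1 + τ * lam i / (1 - τ * lam i))) =
      lam i * η i ^ 2 / (2 * β) + (β / 2 * (lam i * shat u (fun x => spin (s x)) i ^ 2) +
        lam i * η i * shat u (fun x => spin (s x)) i) := by
    rw [hc i]
    generalize 1 - τ * lam i = d at h1 ⊢
    field_simp
    ring
  have h3 := congrArg (fun t : ℝ => (t : ℂ)) h2
  push_cast at h3
  push_cast
  linear_combination h3

theorem hs_main [DecidableEq Λ] [DecidableEq ι] {u : ι → Λ → ℝ} {ρ : ι → ℂ} {lam : ι → ℝ} {β τ e0 M c0 : ℝ}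
    (hβ : 1 / 2 ≤ β) (hl : ∀ i, |lam i| ≤ 1) (hτ0 : 0 ≤ τ) (hτ1 : τ < 1)
    (hu : ∀ i j, ∑ x, u i x * u j x = if i = j then 1 else 0)
    (hρ : ∀ i, ρ i ^ 2 = ((β * lam i / (1 - τ * lam i) : ℝ) : ℂ))
    (hi : Integrable (fun g => ‖Wf (fun x i => (u i x : ℂ) * ρ i) (1 - τ / β) e0 g‖ ^ (5/4 : ℝ)) (gpi ι))
    (hM : ∫ g, ‖Wf (fun x i => (u i x : ℂ) * ρ i) (1 - τ / β) e0 g‖ ^ (5/4 : ℝ) ∂(gpi ι) ≤ M)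
    (hc0 : 0 < c0)
    (hlow : c0 ≤ (∫ g, Wf (fun x i => (u i x : ℂ) * ρ i) (1 - τ / β) e0 g ∂(gpi ι)).re)
    (η : ι → ℝ) :
    ∑ s : Λ → Bool, Real.exp (β / 2 * ∑ i, lam i * shat u (fun x => spin (s x)) i ^ 2 +
        ∑ i, lam i * η i * shat u (fun x => spin (s x)) i) ≤
      (M + 1) / c0 * Real.exp (14 * ∑ i, η i ^ 2 * ‖ρ i‖ ^ 2) *
      ∑ s : Λ → Bool, Real.exp (β / 2 * ∑ i, lam i * shat u (fun x => spin (s x)) i ^ 2) := by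
  have hβ0 : 0 < β := by linarith
  have hpos : ∀ i, 0 < 1 - τ * lam i := by
    intro i
    have := (abs_le.1 (hl i)).2
    nlinarith
  have I1 := hs_identity (e0 := e0) hβ hl hτ0 hτ1 hu hρ η
  have I0 := hs_identity (e0 := e0) hβ hl hτ0 hτ1 hu hρ (fun _ => 0)
  have hz : ∀ g : ι → ℝ, lf (fun i => ((0:ℝ) : ℂ) * ρ i) g = 0 := by
    intro g; simp [lf]
  simp only [hz, Complex.exp_zero, mul_one, mul_zero, zero_mul, ne_eq, OfNat.ofNat_ne_zero,
    not_false_eq_true, zero_pow, zero_div, Finset.sum_const_zero, Real.exp_zero, Complex.ofReal_one,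
    add_zero] at I0
  have hD : (∏ i, gD (τ * lam i / (1 - τ * lam i))) ≠ 0 := by
    rw [Finset.prod_ne_zero_iff]
    intro i _
    apply gD_ne
    have := (hpos i)
    rw [lt_div_iff₀ this]; linarith
  obtain ⟨_, hb⟩ := W_tilt (Wf_continuous _ _ _) hi hM (fun i => (η i / β : ℝ) * ρ i)
  set Z1 := ∑ s : Λ → Bool, Real.exp (β / 2 * ∑ i, lam i * shat u (fun x => spin (s x)) i ^ 2 +
        ∑ i, lam i * η i * shat u (fun x => spin (s x)) i) with hZ1
  set Z0 := ∑ s : Λ → Bool, Real.exp (β / 2 * ∑ i, lam i * shat u (fun x => spin (s x)) i ^ 2) with hZ0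
  set J1 := ∫ g, Wf (fun x i => (u i x : ℂ) * ρ i) (1 - τ / β) e0 g *
        Complex.exp (lf (fun i => (η i / β : ℝ) * ρ i) g) ∂(gpi ι)
  set J0 := ∫ g, Wf (fun x i => (u i x : ℂ) * ρ i) (1 - τ / β) e0 g ∂(gpi ι)
  have hZ0p : 0 ≤ Z0 := Finset.sum_nonneg (fun _ _ => (Real.exp_pos _).le)
  have hZ1p : 0 ≤ Z1 := Finset.sum_nonneg (fun _ _ => (Real.exp_pos _).le)
  have hM0 : 0 ≤ M := le_trans (integral_nonneg (fun g => Real.rpow_nonneg (norm_nonneg _) _)) hM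
  set E := Real.exp (∑ i, lam i * η i ^ 2 / (2 * β)) with hE
  have key : (E : ℂ) * Z1 * J0 = Z0 * J1 := by
    apply mul_left_cancel₀ hD
    linear_combination (-J0) * I1 + J1 * I0
  have keyn : E * Z1 * ‖J0‖ = Z0 * ‖J1‖ := by
    have := congrArg norm key
    rw [norm_mul, norm_mul, norm_mul, Complex.norm_real, Complex.norm_real, Complex.norm_real,
      Real.norm_of_nonneg (Real.exp_pos _).le, Real.norm_of_nonneg hZ1p, Real.norm_of_nonneg hZ0p] at this
    exact this
  have hJ0 : c0 ≤ ‖J0‖ := hlow.trans (Complex.re_le_norm _)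
  set S := ∑ i, η i ^ 2 * ‖ρ i‖ ^ 2 with hS
  have hβ4 : 1 / β ≤ 2 := by rw [div_le_iff₀ hβ0]; linarith
  have hq : ∑ i, (((η i / β : ℝ) : ℂ) * ρ i).re ^ 2 ≤ 4 * S := by
    rw [hS, Finset.mul_sum]
    apply Finset.sum_le_sum
    intro i _
    have h1 : (((η i / β : ℝ) : ℂ) * ρ i).re ^ 2 ≤ ‖((η i / β : ℝ) : ℂ) * ρ i‖ ^ 2 := by
      rw [← sq_abs]; exact pow_le_pow_left₀ (abs_nonneg _) (Complex.abs_re_le_norm _) 2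
    refine h1.trans ?_
    rw [norm_mul, Complex.norm_real, mul_pow, Real.norm_eq_abs, sq_abs, div_pow]
    have h2 : η i ^ 2 / β ^ 2 ≤ 4 * η i ^ 2 := by
      have : 1 / β ^ 2 ≤ 4 := by
        rw [div_le_iff₀ (by positivity)]; nlinarith
      calc η i ^ 2 / β ^ 2 = (1 / β ^ 2) * η i ^ 2 := by ring
        _ ≤ _ := mul_le_mul_of_nonneg_right this (sq_nonneg _)
    calc _ ≤ (4 * η i ^ 2) * ‖ρ i‖ ^ 2 := mul_le_mul_of_nonneg_right h2 (sq_nonneg _)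
      _ = _ := by ring
  have hEl : Real.exp (-(4 * S)) ≤ E := by
    rw [hE]
    apply Real.exp_le_exp.2
    rw [hS, Finset.mul_sum, ← Finset.sum_neg_distrib]
    apply Finset.sum_le_sum
    intro i _
    have h1 : ‖ρ i‖ ^ 2 = β * |lam i| / (1 - τ * lam i) := by
      rw [← norm_pow, hρ i, Complex.norm_real, Real.norm_eq_abs, abs_div, abs_mul, abs_of_pos hβ0,
        abs_of_pos (hpos i)]
    have h2 : β * |lam i| / 2 ≤ ‖ρ i‖ ^ 2 := by
      rw [h1]
      apply div_le_div_of_nonneg_left (by positivity) (hpos i)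
      have := (abs_le.1 (hl i)).1
      nlinarith
    have h3 : |lam i| / (2 * β) ≤ 4 * ‖ρ i‖ ^ 2 := by
      have : |lam i| / (2 * β) ≤ 4 * (β * |lam i| / 2) := by
        rw [div_le_iff₀ (by positivity)]
        have : 1 ≤ 4 * β ^ 2 := by nlinarith
        have h5 := abs_nonneg (lam i)
        nlinarith
      linarith
    have h4 : -(|lam i| / (2 * β)) ≤ lam i / (2 * β) := by
      rw [← neg_div]
      exact div_le_div_of_nonneg_right (neg_abs_le _) (by positivity)
    calc -(4 * (η i ^ 2 * ‖ρ i‖ ^ 2)) = -(4 * ‖ρ i‖ ^ 2) * η i ^ 2 := by ring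
      _ ≤ lam i / (2 * β) * η i ^ 2 := mul_le_mul_of_nonneg_right (by linarith) (sq_nonneg _)
      _ = _ := by ring
  have hfin : Real.exp (-(4 * S)) * Z1 * c0 ≤ Z0 * (Real.exp (10 * S) * (M + 1)) := by
    calc _ ≤ E * Z1 * ‖J0‖ := by
          apply mul_le_mul _ hJ0 hc0.le (by positivity)
          exact mul_le_mul_of_nonneg_right hEl hZ1p
      _ = Z0 * ‖J1‖ := keyn
      _ ≤ _ := by
          apply mul_le_mul_of_nonneg_left _ hZ0p
          refine hb.trans ?_
          apply mul_le_mul_of_nonneg_right _ (by linarith)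
          apply Real.exp_le_exp.2
          linarith
  have e14 : Real.exp (14 * S) = Real.exp (4 * S) * Real.exp (10 * S) := by
    rw [← Real.exp_add]; ring_nf
  have e4 : Real.exp (4 * S) * Real.exp (-(4 * S)) = 1 := by
    rw [← Real.exp_add]; simp
  rw [e14, div_mul_eq_mul_div, div_mul_eq_mul_div, le_div_iff₀ hc0]
  calc Z1 * c0 = Real.exp (4 * S) * (Real.exp (-(4 * S)) * Z1 * c0) := by
        linear_combination (-(Z1 * c0)) * e4
    _ ≤ Real.exp (4 * S) * (Z0 * (Real.exp (10 * S) * (M + 1))) :=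
        mul_le_mul_of_nonneg_left hfin (Real.exp_pos _).le
    _ = _ := by ring

end HS

/-! ### Part G1: Fourier analysis on the discrete torus -/

section Four
variable {N : ℕ} [NeZero N]

lemma latRep_cast (v : ZMod (2*N)) : ((latRep N v : ℤ) : ZMod (2*N)) = v := by
  unfold latRep
  split_ifs
  · simp
  · have : ((2 * N : ℕ) : ZMod (2*N)) = 0 := ZMod.natCast_self _
    push_cast at this ⊢
    rw [this]; simp

lemma N_pos : 0 < N := Nat.pos_of_ne_zero (NeZero.ne N)

lemma latRep_bounds (v : ZMod (2*N)) : -(N:ℤ) < latRep N v ∧ latRep N v ≤ N := by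
  have h := ZMod.val_lt v
  have := N_pos (N := N)
  unfold latRep
  split_ifs <;> constructor <;> omega

lemma latRep_of (n : ℤ) (h1 : -(N:ℤ) < n) (h2 : n ≤ N) : latRep N (n : ZMod (2*N)) = n := by
  have h := latRep_bounds (n : ZMod (2*N))
  have e := latRep_cast (n : ZMod (2*N))
  rw [ZMod.intCast_eq_intCast_iff_dvd_sub] at e
  obtain ⟨k, hk⟩ := e
  have hN := N_pos (N := N)
  push_cast at hk
  have h3 : (N:ℤ) * (2 * k) < N * 2 := by nlinarith
  have h4 : (N:ℤ) * (-2) < N * (2 * k) := by nlinarith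
  have hN' : (0:ℤ) < N := by exact_mod_cast hN
  have h5 := lt_of_mul_lt_mul_left h3 hN'.le
  have h6 := lt_of_mul_lt_mul_left h4 hN'.le
  have : k = 0 := by omega
  rw [this] at hk; linarith

lemma latRep_zero : latRep N 0 = 0 := by
  have hN := N_pos (N := N)
  have := latRep_of (N := N) 0 (by omega) (by omega)
  simpa using this

lemma latRep_neg (v : ZMod (2*N)) : latRep N (-v) = - latRep N v ∨ latRep N (-v) = latRep N v := by
  have h := latRep_bounds v
  by_cases h1 : latRep N v = N
  · right
    congr 1
    have e := latRep_cast v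
    rw [h1] at e
    rw [← e]
    have : ((2 * N : ℕ) : ZMod (2*N)) = 0 := ZMod.natCast_self _
    push_cast at this ⊢
    linear_combination -this
  · left
    have := latRep_of (N := N) (-latRep N v) (by omega) (by omega)
    push_cast at this
    rwa [latRep_cast] at this

lemma latRep_neg_sq (v : ZMod (2*N)) : ((latRep N (-v) : ℤ) : ℝ) ^ 2 = ((latRep N v : ℤ) : ℝ) ^ 2 := by
  rcases latRep_neg v with h | h <;> rw [h]
  push_cast; ring

lemma latRep_eq_zero {v : ZMod (2*N)} (h : latRep N v = 0) : v = 0 := by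
  have := latRep_cast v
  rw [h] at this
  simpa using this.symm

/-- squared length of a frequency -/
def nsq (N : ℕ) (w : Lat N) : ℝ := (latRep N w.1 : ℝ) ^ 2 + (latRep N w.2 : ℝ) ^ 2

lemma nsq_nonneg (w : Lat N) : 0 ≤ nsq N w := by unfold nsq; positivity

lemma nsq_neg (w : Lat N) : nsq N (-w) = nsq N w := by
  unfold nsq
  rw [Prod.fst_neg, Prod.snd_neg, latRep_neg_sq, latRep_neg_sq]

/-- characters -/
def chw (w x : Lat N) : ℂ := ZMod.stdAddChar (w.1 * x.1 + w.2 * x.2)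

lemma chw_symm (w x : Lat N) : chw w x = chw x w := by
  unfold chw; congr 1; ring

lemma chw_add (w x y : Lat N) : chw w (x + y) = chw w x * chw w y := by
  unfold chw
  rw [← AddChar.map_add_eq_mul]; congr 1; simp; ring

lemma chw_add_left (w v x : Lat N) : chw (w + v) x = chw w x * chw v x := by
  rw [chw_symm, chw_add, chw_symm x, chw_symm x]

lemma chw_norm (w x : Lat N) : ‖chw w x‖ = 1 := by
  unfold chw; exact AddChar.norm_apply _ _

lemma chw_zero (w : Lat N) : chw w 0 = 1 := by
  unfold chw; simp

lemma chw_neg (w x : Lat N) : chw w (-x) = (starRingEnd ℂ) (chw w x) := by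
  have h : chw w (-x) * chw w x = 1 := by rw [← chw_add]; simp [chw_zero]
  have h2 : (starRingEnd ℂ) (chw w x) * chw w x = 1 := by
    rw [mul_comm, Complex.mul_conj, Complex.normSq_eq_norm_sq, chw_norm]; simp
  have h3 : chw w x ≠ 0 := by
    intro h0
    have := chw_norm w x
    rw [h0] at this; simp at this
  exact mul_right_cancel₀ h3 (h.trans h2.symm)

lemma chw_neg_left (w x : Lat N) : chw (-w) x = (starRingEnd ℂ) (chw w x) := by
  rw [chw_symm, chw_neg, chw_symm]

lemma chw_eW (w x : Lat N) : chw w x = eW (latRep2 N w) (latPt N x) := by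
  unfold chw eW latRep2 latPt
  have hN : (N:ℂ) ≠ 0 := by exact_mod_cast NeZero.ne N
  conv_lhs => rw [← latRep_cast w.1, ← latRep_cast w.2, ← latRep_cast x.1, ← latRep_cast x.2]
  norm_cast
  rw [ZMod.stdAddChar_coe]
  congr 1
  push_cast
  field_simp

lemma card_lat : Fintype.card (Lat N) = 4 * N ^ 2 := by
  rw [Fintype.card_prod, ZMod.card]; ring

lemma chw_sum (w : Lat N) : ∑ x, chw w x = if w = 0 then (4 * N ^ 2 : ℂ) else 0 := by
  have hp := ZMod.isPrimitive_stdAddChar (2*N)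
  have e : ∑ x, chw w x = (∑ x1 : ZMod (2*N), ZMod.stdAddChar (x1 * w.1)) *
      (∑ x2 : ZMod (2*N), (ZMod.stdAddChar (x2 * w.2) : ℂ)) := by
    rw [Finset.sum_mul_sum, ← Finset.sum_product']
    refine Finset.sum_congr rfl (fun x _ => ?_)
    unfold chw
    rw [← AddChar.map_add_eq_mul]; congr 1; ring
  rw [e, AddChar.sum_mulShift _ hp, AddChar.sum_mulShift _ hp, ZMod.card]
  by_cases h1 : w.1 = 0 <;> by_cases h2 : w.2 = 0 <;> simp [h1, h2, Prod.ext_iff]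
  ring

/-- Hartley basis -/
def hart (w x : Lat N) : ℝ := ((chw w x).re + (chw w x).im) / (2 * N)

lemma hart_mul (w v x y : Lat N) : hart w x * hart v y =
    ((chw w x * (starRingEnd ℂ) (chw v y)).re + (chw w x * chw v y).im) / (4 * N ^ 2) := by
  have hN : (N:ℝ) ≠ 0 := by exact_mod_cast NeZero.ne N
  unfold hart
  simp only [Complex.mul_re, Complex.mul_im, Complex.conj_re, Complex.conj_im]
  field_simp
  ring

lemma hart_orth (w v : Lat N) : ∑ x, hart w x * hart v x = if w = v then 1 else 0 := by
  have hN : (N:ℝ) ≠ 0 := by exact_mod_cast NeZero.ne N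
  simp_rw [hart_mul, ← chw_neg_left, ← chw_add_left]
  rw [← Finset.sum_div, Finset.sum_add_distrib, ← Complex.re_sum, ← Complex.im_sum, chw_sum, chw_sum]
  have him : (if w + v = 0 then (4 * N ^ 2 : ℂ) else 0).im = 0 := by
    split_ifs
    · have : (4 * N ^ 2 : ℂ) = ((4 * N ^ 2 : ℝ) : ℂ) := by push_cast; rfl
      rw [this, Complex.ofReal_im]
    · simp
  rw [him, ← sub_eq_add_neg, add_zero]
  by_cases h : w = v
  · rw [if_pos h, if_pos (by rw [h]; simp)]
    have : (4 * N ^ 2 : ℂ) = ((4 * N ^ 2 : ℝ) : ℂ) := by push_cast; rfl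
    rw [this, Complex.ofReal_re]
    field_simp
  · rw [if_neg h, if_neg (fun h2 => h (sub_eq_zero.1 h2))]; simp

lemma hart_sq_le (w x : Lat N) : hart w x ^ 2 ≤ 1 / (2 * N ^ 2) := by
  have hN : (0:ℝ) < N := by exact_mod_cast N_pos (N := N)
  have h := chw_norm w x
  rw [← sq_eq_sq₀ (norm_nonneg _) zero_le_one, ← Complex.normSq_eq_norm_sq, Complex.normSq_apply] at h
  unfold hart
  rw [div_pow, div_le_div_iff₀ (by positivity) (by positivity)]
  nlinarith [sq_nonneg ((chw w x).re - (chw w x).im), mul_pos hN hN]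

/-- covariance kernel of an even multiplier -/
lemma hart_even (d : Lat N → ℝ) (hd : ∀ w, d (-w) = d w) (x y : Lat N) :
    ∑ w, d w * (hart w x * hart w y) = (∑ w, d w * (chw w (x - y)).re) / (4 * N ^ 2) := by
  simp_rw [hart_mul, ← chw_neg, ← chw_add]
  rw [Finset.sum_div]
  have h0 : ∑ w, d w * (chw w (x + y)).im = 0 := by
    have : ∑ w, d w * (chw w (x + y)).im = - ∑ w, d w * (chw w (x + y)).im := by
      rw [← Finset.sum_neg_distrib]
      refine Fintype.sum_equiv (Equiv.neg _) _ _ (fun w => ?_)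
      simp [chw_neg_left, hd]
    linarith
  have e : ∀ w, d w * (((chw w (x + -y)).re + (chw w (x + y)).im) / (4 * N ^ 2)) =
      d w * (chw w (x - y)).re / (4 * N ^ 2) + d w * (chw w (x + y)).im / (4 * N ^ 2) := by
    intro w; rw [sub_eq_add_neg]; ring
  simp_rw [e]
  rw [Finset.sum_add_distrib, ← Finset.sum_div Finset.univ (fun w => d w * (chw w (x + y)).im), h0]
  simp

/-- Eigenvalues of the kernel -/
def lamW (k : Lat N → ℝ) (w : Lat N) : ℝ := ∑ z, k z * (chw w z).re

lemma kHat_eq (k : Lat N → ℝ) (w : Lat N) : kHat N k (latRep2 N w) = lamW k w := by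
  unfold kHat lamW
  refine Finset.sum_congr rfl (fun z _ => ?_)
  congr 1
  rw [chw_eW]
  unfold eW latPt latRep2
  rw [Complex.exp_re]
  have : ((Real.pi : ℂ) * Complex.I * ((latRep N w.1 : ℂ) * ((latRep N z.1 / N : ℝ) : ℂ) +
      (latRep N w.2 : ℂ) * ((latRep N z.2 / N : ℝ) : ℂ))) =
      ((Real.pi * ((latRep N w.1 : ℝ) * (latRep N z.1 : ℝ) / N +
        (latRep N w.2 : ℝ) * (latRep N z.2 : ℝ) / N) : ℝ) : ℂ) * Complex.I := by
    push_cast; ring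
  simp only
  rw [this]
  simp

lemma lamW_neg (k : Lat N → ℝ) (w : Lat N) : lamW k (-w) = lamW k w := by
  unfold lamW
  simp [chw_neg_left]

lemma lamW_abs (k : Lat N → ℝ) (hk : ∀ z, 0 ≤ k z) (h1 : ∑ z, k z = 1) (w : Lat N) : |lamW k w| ≤ 1 := by
  unfold lamW
  refine (Finset.abs_sum_le_sum_abs _ _).trans ?_
  rw [← h1]
  apply Finset.sum_le_sum
  intro z _
  rw [abs_mul, abs_of_nonneg (hk z)]
  have := (Complex.abs_re_le_norm (chw w z)).trans (chw_norm w z).le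
  exact mul_le_of_le_one_right (hk z) this

lemma lamW_zero (k : Lat N → ℝ) (h1 : ∑ z, k z = 1) : lamW k 0 = 1 := by
  unfold lamW
  rw [← h1]
  refine Finset.sum_congr rfl (fun z _ => ?_)
  rw [chw_symm, chw_zero]; simp

lemma cs_prod (w z z' : Lat N) : (chw w z).re * (chw w z').re =
    ((chw w (z + z')).re + (chw w (z - z')).re) / 2 := by
  rw [sub_eq_add_neg, chw_add, chw_add, chw_neg]
  simp

lemma chw_re_sum (x : Lat N) : ∑ w : Lat N, (chw w x).re = if x = 0 then (4 * N ^ 2 : ℝ) else 0 := by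
  simp_rw [chw_symm _ x]
  rw [← Complex.re_sum, chw_sum]
  split_ifs
  · have : (4 * N ^ 2 : ℂ) = ((4 * N ^ 2 : ℝ) : ℂ) := by push_cast; rfl
    rw [this, Complex.ofReal_re]
  · simp

lemma lamW_inv (k : Lat N → ℝ) (hk : ∀ z, k (-z) = k z) (z : Lat N) :
    (∑ w, lamW k w * (chw w z).re) / (4 * N ^ 2) = k z := by
  have hN : (N:ℝ) ≠ 0 := by exact_mod_cast NeZero.ne N
  unfold lamW
  simp_rw [Finset.sum_mul]
  rw [Finset.sum_comm]
  have e : ∀ z', ∑ w, k z' * (chw w z').re * (chw w z).re =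
      k z' * ((if z' + z = 0 then (4 * N ^ 2 : ℝ) else 0) + (if z' - z = 0 then (4 * N ^ 2 : ℝ) else 0)) / 2 := by
    intro z'
    rw [← chw_re_sum, ← chw_re_sum, ← Finset.sum_add_distrib, Finset.mul_sum, Finset.sum_div]
    refine Finset.sum_congr rfl (fun w _ => ?_)
    rw [mul_assoc, cs_prod]; ring
  simp_rw [e, sub_eq_zero, add_eq_zero_iff_eq_neg, mul_add, add_div]
  rw [Finset.sum_add_distrib]
  simp only [mul_ite, mul_zero, ite_div, zero_div, Finset.sum_ite_eq', Finset.mem_univ, if_true]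
  rw [hk]
  field_simp
  ring

lemma lamW_hart (k : Lat N → ℝ) (hk : ∀ z, k (-z) = k z) (x y : Lat N) :
    ∑ w, lamW k w * (hart w x * hart w y) = k (x - y) := by
  rw [hart_even _ (lamW_neg k), lamW_inv k hk]

lemma lamW_sum (k : Lat N → ℝ) (hk : ∀ z, k (-z) = k z) (h0 : k 0 = 0) : ∑ w, lamW k w = 0 := by
  have hN : (N:ℝ) ≠ 0 := by exact_mod_cast NeZero.ne N
  have := lamW_inv k hk 0
  simp_rw [chw_zero, h0] at this
  rw [div_eq_zero_iff] at this
  rcases this with h | h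
  · simpa using h
  · exfalso; apply hN; simpa using h

lemma conv_hart (k : Lat N → ℝ) (hk : ∀ z, k (-z) = k z) (σ : Lat N → ℝ) (x : Lat N) :
    ∑ y, k (x - y) * σ y = ∑ w, lamW k w * hart w x * shat hart σ w := by
  simp_rw [← lamW_hart k hk]
  unfold shat
  simp_rw [Finset.sum_mul, Finset.mul_sum]
  rw [Finset.sum_comm]
  refine Finset.sum_congr rfl (fun w _ => Finset.sum_congr rfl (fun y _ => by ring))

lemma hamil_hart (k : Lat N → ℝ) (hk : ∀ z, k (-z) = k z) (β : ℝ) (σ : Lat N → ℝ) :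
    hamil N k β 0 σ = β / 2 * ∑ w, lamW k w * shat hart σ w ^ 2 := by
  unfold hamil
  rw [zero_mul, add_zero]
  congr 1
  have e : ∀ x, ∑ y, k (x - y) * σ x * σ y = ∑ w, lamW k w * shat hart σ w * (hart w x * σ x) := by
    intro x
    have := congrArg (fun t => σ x * t) (conv_hart k hk σ x)
    simp only [Finset.mul_sum] at this
    calc _ = ∑ y, σ x * (k (x - y) * σ y) := Finset.sum_congr rfl (fun y _ => by ring)
      _ = _ := this
      _ = _ := Finset.sum_congr rfl (fun y _ => by ring)
  simp_rw [e]
  rw [Finset.sum_comm]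
  refine Finset.sum_congr rfl (fun w _ => ?_)
  rw [← Finset.mul_sum]
  change _ * shat hart σ w = _
  ring

end Four

/-! ### Part G2: bounds on the Kac kernel -/

section Kern
variable {N : ℕ} [NeZero N]

/-- All facts about the kernel that are used later. -/
structure KB (N : ℕ) [NeZero N] (k : Lat N → ℝ) (C0 c1 : ℝ) : Prop where
  knn : ∀ z, 0 ≤ k z
  keven : ∀ z, k (-z) = k z
  k0 : k 0 = 0
  ksum : ∑ z, k z = 1
  up : ∀ w, 1 - lamW k w ≤ 45 * nsq N w / N
  lo : ∀ w, c1 * min 1 (nsq N w / N) ≤ 1 - lamW k w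
  dec : ∀ w, |lamW k w| * nsq N w ≤ C0 * N

lemma gam_sq : gam N ^ 2 = (N:ℝ)⁻¹ := by
  unfold gam
  rw [Real.sq_sqrt (by positivity)]

lemma gam_pos : 0 < gam N := by
  have := N_pos (N := N)
  unfold gam; positivity

lemma gam_sqrt : gam N = (√(N:ℝ))⁻¹ := by
  unfold gam; rw [Real.sqrt_inv]

lemma kG_nn (𝔎 : KacProfile) {c : ℝ} (hc : 0 < c) (z : Lat N) : 0 ≤ kGamma 𝔎 N c (gam N) z := by
  unfold kGamma
  split_ifs
  · exact le_rfl
  · have := (𝔎.mem (gam N * (latRep N z.1 : ℝ), gam N * (latRep N z.2 : ℝ))).1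
    positivity

lemma kG_even (𝔎 : KacProfile) (c : ℝ) (z : Lat N) : kGamma 𝔎 N c (gam N) (-z) = kGamma 𝔎 N c (gam N) z := by
  unfold kGamma
  simp only [neg_eq_zero]
  congr 2
  apply 𝔎.radial
  unfold enorm2
  simp only [Prod.fst_neg, Prod.snd_neg, mul_pow, latRep_neg_sq]

/-- the unpunctured kernel on integer points -/
def kI (𝔎 : KacProfile) (N : ℕ) (c : ℝ) (n : ℤ × ℤ) : ℝ := c * (N:ℝ)⁻¹ * 𝔎.f (gam N * (n.1:ℝ), gam N * (n.2:ℝ))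

lemma kI_supp (𝔎 : KacProfile) (c : ℝ) (n : ℤ × ℤ) (h : 9 * (N:ℝ) < (n.1:ℝ)^2 + (n.2:ℝ)^2) : kI 𝔎 N c n = 0 := by
  unfold kI
  rw [𝔎.supp, mul_zero]
  unfold enorm2
  have hN : (0:ℝ) < N := by exact_mod_cast N_pos (N := N)
  simp only [mul_pow, gam_sq, ← mul_add]
  rw [Real.lt_sqrt (by norm_num)]
  rw [inv_mul_eq_div, lt_div_iff₀ hN]
  linarith

lemma kI_nn (𝔎 : KacProfile) {c : ℝ} (hc : 0 < c) (n : ℤ × ℤ) : 0 ≤ kI 𝔎 N c n := by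
  unfold kI
  have := (𝔎.mem (gam N * (n.1:ℝ), gam N * (n.2:ℝ))).1
  positivity

lemma kI_le (𝔎 : KacProfile) {c : ℝ} (hc : 0 < c) (n : ℤ × ℤ) : kI 𝔎 N c n ≤ c * (N:ℝ)⁻¹ := by
  unfold kI
  have := (𝔎.mem (gam N * (n.1:ℝ), gam N * (n.2:ℝ))).2
  exact mul_le_of_le_one_right (by positivity) this

lemma kG_eq (𝔎 : KacProfile) (c : ℝ) (z : Lat N) : kGamma 𝔎 N c (gam N) z =
    if z = 0 then 0 else kI 𝔎 N c (latRep2 N z) := by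
  unfold kGamma kI latRep2
  rw [gam_sq]

lemma kG_supp (𝔎 : KacProfile) (c : ℝ) (z : Lat N) (h : 9 * (N:ℝ) < nsq N z) : kGamma 𝔎 N c (gam N) z = 0 := by
  rw [kG_eq, kI_supp]
  · simp
  · exact h

lemma chw_re_cos (w z : Lat N) : (chw w z).re =
    Real.cos (Real.pi * ((latRep N w.1 : ℝ) * (latRep N z.1 : ℝ) + (latRep N w.2 : ℝ) * (latRep N z.2 : ℝ)) / N) := by
  rw [chw_eW]
  unfold eW latPt latRep2
  have : ((Real.pi : ℂ) * Complex.I * ((latRep N w.1 : ℂ) * ((latRep N z.1 / N : ℝ) : ℂ) +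
      (latRep N w.2 : ℂ) * ((latRep N z.2 / N : ℝ) : ℂ))) =
      ((Real.pi * ((latRep N w.1 : ℝ) * (latRep N z.1 : ℝ) +
        (latRep N w.2 : ℝ) * (latRep N z.2 : ℝ)) / N : ℝ) : ℂ) * Complex.I := by
    push_cast; ring
  simp only
  rw [this, Complex.exp_ofReal_mul_I_re]

lemma one_sub_lam (k : Lat N → ℝ) (h1 : ∑ z, k z = 1) (w : Lat N) :
    1 - lamW k w = ∑ z, k z * (1 - (chw w z).re) := by
  unfold lamW
  simp_rw [mul_sub, mul_one]
  rw [Finset.sum_sub_distrib, h1]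

lemma chw_re_le (w z : Lat N) : (chw w z).re ≤ 1 :=
  ((le_abs_self _).trans (Complex.abs_re_le_norm (chw w z))).trans (chw_norm w z).le

lemma kG_up (𝔎 : KacProfile) {c : ℝ} (hc : 0 < c) (h1 : ∑ z, kGamma 𝔎 N c (gam N) z = 1) (w : Lat N) :
    1 - lamW (kGamma 𝔎 N c (gam N)) w ≤ 45 * nsq N w / N := by
  have hN : (0:ℝ) < N := by exact_mod_cast N_pos (N := N)
  rw [one_sub_lam _ h1]
  have : ∀ z ∈ Finset.univ, kGamma 𝔎 N c (gam N) z * (1 - (chw w z).re) ≤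
      kGamma 𝔎 N c (gam N) z * (45 * nsq N w / N) := by
    intro z _
    by_cases h : 9 * (N:ℝ) < nsq N z
    · rw [kG_supp 𝔎 c z h]; simp
    push Not at h
    apply mul_le_mul_of_nonneg_left _ (kG_nn 𝔎 hc z)
    rw [chw_re_cos]
    set X := (latRep N w.1 : ℝ) * (latRep N z.1 : ℝ) + (latRep N w.2 : ℝ) * (latRep N z.2 : ℝ)
    have hX : X ^ 2 ≤ nsq N w * (9 * N) := by
      refine le_trans ?_ (mul_le_mul_of_nonneg_left h (nsq_nonneg w))
      unfold nsq X
      nlinarith [sq_nonneg ((latRep N w.1 : ℝ) * (latRep N z.2 : ℝ) - (latRep N w.2 : ℝ) * (latRep N z.1 : ℝ))]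
    have hcos := Real.one_sub_sq_div_two_le_cos (x := Real.pi * X / N)
    have hpi : Real.pi ^ 2 ≤ 10 := by
      have := Real.pi_lt_d2
      have := Real.pi_pos
      nlinarith
    have h2 : (Real.pi * X / N) ^ 2 / 2 ≤ 45 * nsq N w / N := by
      rw [div_pow, mul_pow, div_div, div_le_div_iff₀ (by positivity) hN]
      have : Real.pi ^ 2 * X ^ 2 ≤ 10 * (nsq N w * (9 * N)) :=
        mul_le_mul hpi hX (sq_nonneg _) (by norm_num)
      nlinarith
    linarith
  refine (Finset.sum_le_sum this).trans ?_
  rw [← Finset.sum_mul, h1, one_mul]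

lemma box_card (R : ℝ) (hR : 0 ≤ R) (S : Finset (Lat N))
    (hS : ∀ z ∈ S, |(latRep N z.1 : ℝ)| ≤ R ∧ |(latRep N z.2 : ℝ)| ≤ R) : (S.card : ℝ) ≤ (2 * R + 1) ^ 2 := by
  have hinj : S.card ≤ ((Finset.Icc (-⌊R⌋) ⌊R⌋) ×ˢ (Finset.Icc (-⌊R⌋) ⌊R⌋)).card := by
    apply Finset.card_le_card_of_injOn (fun z => latRep2 N z)
    · intro z hz
      have h := hS z hz
      have key : ∀ n : ℤ, |(n:ℝ)| ≤ R → -⌊R⌋ ≤ n ∧ n ≤ ⌊R⌋ := by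
        intro n hn
        rw [abs_le] at hn
        constructor
        · have : -n ≤ ⌊R⌋ := Int.le_floor.2 (by push_cast; linarith)
          linarith
        · exact Int.le_floor.2 hn.2
      simp only [latRep2, Finset.coe_product, Finset.coe_Icc, Set.mem_prod, Set.mem_Icc]
      exact ⟨key _ h.1, key _ h.2⟩
    · intro z _ z' _ h
      simp only [latRep2, Prod.mk.injEq] at h
      ext
      · rw [← latRep_cast z.1, h.1, latRep_cast]
      · rw [← latRep_cast z.2, h.2, latRep_cast]
  have h0 : 0 ≤ ⌊R⌋ := Int.floor_nonneg.2 hR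
  have hc : (((Finset.Icc (-⌊R⌋) ⌊R⌋).card : ℕ) : ℝ) ≤ 2 * R + 1 := by
    rw [Int.card_Icc]
    have : (((⌊R⌋ + 1 - -⌊R⌋).toNat : ℤ) : ℝ) = ((⌊R⌋ + 1 - -⌊R⌋ : ℤ) : ℝ) := by
      rw [Int.toNat_of_nonneg (by omega)]
    rw [Int.cast_natCast] at this
    rw [this]
    push_cast
    linarith [Int.floor_le R]
  calc (S.card : ℝ) ≤ (((Finset.Icc (-⌊R⌋) ⌊R⌋) ×ˢ (Finset.Icc (-⌊R⌋) ⌊R⌋)).card : ℝ) := by exact_mod_cast hinj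
    _ = ((Finset.Icc (-⌊R⌋) ⌊R⌋).card : ℝ) ^ 2 := by rw [Finset.card_product]; push_cast; ring
    _ ≤ _ := by gcongr

/-- lower bound on the normalising constant -/
lemma kG_clow (𝔎 : KacProfile) {c : ℝ} (hc : 0 < c) (h1 : ∑ z, kGamma 𝔎 N c (gam N) z = 1) : 1 / 49 ≤ c := by
  have hN : (0:ℝ) < N := by exact_mod_cast N_pos (N := N)
  have hN1 : (1:ℝ) ≤ N := by exact_mod_cast N_pos (N := N)
  set S : Finset (Lat N) := Finset.univ.filter (fun z => nsq N z ≤ 9 * N)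
  have hs : ∑ z ∈ S, kGamma 𝔎 N c (gam N) z = 1 := by
    rw [← h1]
    apply Finset.sum_subset (Finset.subset_univ _)
    intro z _ hz
    apply kG_supp
    simpa [S] using hz
  have hle : ∑ z ∈ S, kGamma 𝔎 N c (gam N) z ≤ S.card * (c * (N:ℝ)⁻¹) := by
    rw [← nsmul_eq_mul]
    apply Finset.sum_le_card_nsmul
    intro z _
    rw [kG_eq]
    split_ifs
    · positivity
    · exact kI_le 𝔎 hc _
  have hcard : (S.card : ℝ) ≤ (2 * (3 * √N) + 1) ^ 2 := by
    apply box_card _ (by positivity)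
    intro z hz
    have hz' : nsq N z ≤ 9 * N := by simpa [S] using hz
    unfold nsq at hz'
    have e : (3 * √(N:ℝ)) ^ 2 = 9 * N := by rw [mul_pow, Real.sq_sqrt hN.le]; norm_num
    constructor <;> apply abs_le_of_sq_le_sq _ (by positivity) <;> rw [e]
    · nlinarith [sq_nonneg (latRep N z.2 : ℝ)]
    · nlinarith [sq_nonneg (latRep N z.1 : ℝ)]
  have hsq : (2 * (3 * √(N:ℝ)) + 1) ^ 2 ≤ 49 * N := by
    have h1 : 1 ≤ √(N:ℝ) := Real.one_le_sqrt.2 hN1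
    have h2 : √(N:ℝ) ^ 2 = N := Real.sq_sqrt hN.le
    nlinarith
  have : 1 ≤ 49 * N * (c * (N:ℝ)⁻¹) := by
    rw [← hs]
    refine hle.trans ?_
    gcongr
    exact hcard.trans hsq
  have e : 49 * N * (c * (N:ℝ)⁻¹) = 49 * c := by field_simp
  linarith

end Kern

section Kern2

lemma kac_square (𝔎 : KacProfile) : ∃ (x0 : ℝ × ℝ) (r δ0 : ℝ), 0 < r ∧ 0 < δ0 ∧
    ∀ y : ℝ × ℝ, |y.1 - x0.1| < r → |y.2 - x0.2| < r → δ0 ≤ 𝔎.f y ∧ y ≠ 0 := by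
  obtain ⟨x, hx⟩ := 𝔎.nontriv
  have hcont : Continuous 𝔎.f := 𝔎.smooth.continuous
  have hx0 : 0 < 𝔎.f x := lt_of_le_of_ne (𝔎.mem x).1 (Ne.symm hx)
  have hU : IsOpen {y | 𝔎.f x / 2 < 𝔎.f y} := isOpen_lt continuous_const hcont
  have hV : IsOpen ({y | 𝔎.f x / 2 < 𝔎.f y} \ {0}) := hU.sdiff isClosed_singleton
  have hne : ({y | 𝔎.f x / 2 < 𝔎.f y} \ {0}).Nonempty := by
    by_contra h
    rw [Set.not_nonempty_iff_eq_empty, Set.diff_eq_empty] at h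
    have hinf := infinite_of_mem_nhds x (hU.mem_nhds (show 𝔎.f x / 2 < 𝔎.f x by linarith))
    exact hinf ((Set.finite_singleton _).subset h)
  obtain ⟨x0, hx0'⟩ := hne
  obtain ⟨r, hr, hball⟩ := Metric.isOpen_iff.1 hV x0 hx0'
  refine ⟨x0, r, 𝔎.f x / 2, hr, by positivity, fun y h1 h2 => ?_⟩
  have hy : y ∈ Metric.ball x0 r := by
    rw [Metric.mem_ball, Prod.dist_eq, max_lt_iff, Real.dist_eq, Real.dist_eq]
    exact ⟨h1, h2⟩
  have := hball hy
  exact ⟨this.1.le, this.2⟩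

variable {N : ℕ} [NeZero N]

lemma F_shift (w z e : Lat N) : 1 - (chw w e).re ≤ 2 * (1 - (chw w (z + e)).re) + 2 * (1 - (chw w z).re) := by
  have key : ∀ u v : ℂ, ‖u‖ = 1 → ‖v‖ = 1 → 1 - v.re ≤ 2 * (1 - (u * v).re) + 2 * (1 - u.re) := by
    intro u v hu hv
    rw [← sq_eq_sq₀ (norm_nonneg _) zero_le_one, ← Complex.normSq_eq_norm_sq, Complex.normSq_apply] at hu hv
    simp only [Complex.mul_re]
    have h1 : (u.re * v.re - u.im * v.im) ^ 2 + (u.re * v.im + u.im * v.re) ^ 2 = 1 := by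
      have : (u.re * v.re - u.im * v.im) ^ 2 + (u.re * v.im + u.im * v.re) ^ 2 =
        (u.re * u.re + u.im * u.im) * (v.re * v.re + v.im * v.im) := by ring
      rw [this, hu, hv]; norm_num
    -- |uv - 1 + 1 - u|^2 ≤ 2|uv-1|^2 + 2|1-u|^2
    set p := u.re * v.re - u.im * v.im with hp
    set q := u.re * v.im + u.im * v.re with hq
    have h2 : (p - u.re) ^ 2 + (q - u.im) ^ 2 = 2 * (1 - v.re) := by
      have : (p - u.re) ^ 2 + (q - u.im) ^ 2 = (u.re * u.re + u.im * u.im) * ((v.re * v.re + v.im * v.im) + 1 - 2 * v.re) := by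
        rw [hp, hq]; ring
      rw [this, hu, hv]; norm_num; ring
    have h3 := sq_nonneg (p + u.re - 2)
    have h4 := sq_nonneg (q + u.im)
    nlinarith
  rw [chw_add]
  exact key _ _ (chw_norm w z) (chw_norm w e)

lemma latRep_int (n : ℤ) (h : |n| < N) : latRep N (n : ZMod (2*N)) = n := by
  rw [abs_lt] at h
  exact latRep_of n h.1 h.2.le

/-- the lower bound, discrete version -/
lemma lo_disc (k : Lat N → ℝ) (hk : ∀ z, 0 ≤ k z) (h1 : ∑ z, k z = 1) (a : ℤ × ℤ) (M : ℕ) (κ : ℝ) (hκ : 0 ≤ κ)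
    (ha : ∀ i j : ℕ, i < 2 * M → j < 2 * M → |a.1 + i| < N ∧ |a.2 + j| < N ∧
      κ ≤ k (((a.1 + i : ℤ) : ZMod (2*N)), ((a.2 + j : ℤ) : ZMod (2*N))))
    (w : Lat N) (m1 m2 : ℕ) (hm1 : m1 ≤ M) (hm2 : m2 ≤ M) :
    κ * M ^ 2 * (1 - (chw w ((m1 : ZMod (2*N)), (m2 : ZMod (2*N)))).re) ≤ 4 * (1 - lamW k w) := by
  set Pt : ℕ × ℕ → Lat N := fun p => (((a.1 + p.1 : ℤ) : ZMod (2*N)), ((a.2 + p.2 : ℤ) : ZMod (2*N))) with hPt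
  set F : Lat N → ℝ := fun z => 1 - (chw w z).re with hF
  have hF0 : ∀ z, 0 ≤ F z := fun z => by have := chw_re_le w z; simp only [hF]; linarith
  set Q := (Finset.range M) ×ˢ (Finset.range M)
  have hsub : ∀ e1 e2 : ℕ, e1 ≤ M → e2 ≤ M → κ * ∑ p ∈ Q, F (Pt (p.1 + e1, p.2 + e2)) ≤ 1 - lamW k w := by
    intro e1 e2 he1 he2
    rw [one_sub_lam k h1, Finset.mul_sum]
    have hin : Set.InjOn (fun p : ℕ × ℕ => Pt (p.1 + e1, p.2 + e2)) (Q : Set (ℕ × ℕ)) := by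
      intro p hp p' hp' h
      simp only [Q, Finset.coe_product, Finset.coe_range, Set.mem_prod, Set.mem_Iio] at hp hp'
      simp only [hPt, Prod.mk.injEq] at h
      have b1 := ha (p.1 + e1) (p.2 + e2) (by omega) (by omega)
      have b2 := ha (p'.1 + e1) (p'.2 + e2) (by omega) (by omega)
      have l1 := latRep_int _ b1.1
      have l2 := latRep_int _ b2.1
      have l3 := latRep_int _ b1.2.1
      have l4 := latRep_int _ b2.2.1
      rw [h.1, l2] at l1
      rw [h.2, l4] at l3
      ext <;> push_cast at l1 l3 <;> omega
    calc ∑ p ∈ Q, κ * F (Pt (p.1 + e1, p.2 + e2))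
        ≤ ∑ p ∈ Q, k (Pt (p.1 + e1, p.2 + e2)) * F (Pt (p.1 + e1, p.2 + e2)) := by
          apply Finset.sum_le_sum
          intro p hp
          simp only [Q, Finset.mem_product, Finset.mem_range] at hp
          exact mul_le_mul_of_nonneg_right (ha _ _ (by omega) (by omega)).2.2 (hF0 _)
      _ = ∑ z ∈ Q.image (fun p : ℕ × ℕ => Pt (p.1 + e1, p.2 + e2)), k z * F z := by
          rw [Finset.sum_image hin]
      _ ≤ _ := Finset.sum_le_sum_of_subset_of_nonneg (Finset.subset_univ _)
          (fun z _ _ => mul_nonneg (hk z) (hF0 z))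
  have hA := hsub m1 m2 hm1 hm2
  have hB := hsub 0 0 (Nat.zero_le _) (Nat.zero_le _)
  have hC : (M:ℝ) ^ 2 * F ((m1 : ZMod (2*N)), (m2 : ZMod (2*N))) ≤
      2 * ∑ p ∈ Q, F (Pt (p.1 + m1, p.2 + m2)) + 2 * ∑ p ∈ Q, F (Pt (p.1 + 0, p.2 + 0)) := by
    have : (M:ℝ) ^ 2 * F ((m1 : ZMod (2*N)), (m2 : ZMod (2*N))) =
        ∑ p ∈ Q, F ((m1 : ZMod (2*N)), (m2 : ZMod (2*N))) := by
      rw [Finset.sum_const, nsmul_eq_mul, Finset.card_product, Finset.card_range]; push_cast; ring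
    rw [this, Finset.mul_sum, Finset.mul_sum, ← Finset.sum_add_distrib]
    apply Finset.sum_le_sum
    intro p _
    have := F_shift w (Pt (p.1 + 0, p.2 + 0)) ((m1 : ZMod (2*N)), (m2 : ZMod (2*N)))
    have e : Pt (p.1 + 0, p.2 + 0) + ((m1 : ZMod (2*N)), (m2 : ZMod (2*N))) = Pt (p.1 + m1, p.2 + m2) := by
      simp only [hPt, Prod.mk_add_mk, Prod.mk.injEq]
      constructor <;> push_cast <;> ring
    rw [e] at this
    exact this
  have := mul_le_mul_of_nonneg_left hC hκ
  rw [mul_add, mul_left_comm κ 2, mul_left_comm κ 2] at this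
  simp only [hF] at this hA hB ⊢
  rw [mul_assoc]
  linarith

/-- one dimensional choice of the shift -/
lemma shift_choice (n : ℤ) (hn : |n| ≤ N) (M : ℕ) (hM : 1 ≤ M) : ∃ m ≤ M,
    min 1 (2 * (M:ℝ) ^ 2 * (n:ℝ) ^ 2 / N ^ 2) ≤ 1 - Real.cos (Real.pi * ((n:ℝ) * m) / N) := by
  have hN : (0:ℝ) < N := by exact_mod_cast N_pos (N := N)
  have hM0 : (1:ℝ) ≤ M := by exact_mod_cast hM
  have hn' : |(n:ℝ)| ≤ N := by exact_mod_cast hn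
  by_cases h : |(n:ℝ)| * M ≤ N
  · refine ⟨M, le_rfl, (min_le_right _ _).trans ?_⟩
    have hx : |Real.pi * ((n:ℝ) * M) / N| ≤ Real.pi := by
      rw [abs_div, abs_mul, abs_mul, abs_of_pos Real.pi_pos, abs_of_pos hN, div_le_iff₀ hN,
        abs_of_nonneg (by positivity : (0:ℝ) ≤ M)]
      exact mul_le_mul_of_nonneg_left h Real.pi_pos.le
    have hc := Real.cos_le_one_sub_mul_cos_sq hx
    have e : 2 / Real.pi ^ 2 * (Real.pi * ((n:ℝ) * M) / N) ^ 2 = 2 * (M:ℝ) ^ 2 * (n:ℝ) ^ 2 / N ^ 2 := by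
      have := Real.pi_ne_zero
      field_simp
    rw [e] at hc
    linarith
  · push Not at h
    have hn0 : 0 < |(n:ℝ)| := by
      rcases (abs_nonneg (n:ℝ)).eq_or_lt with h0 | h0
      · rw [← h0] at h; linarith
      · exact h0
    refine ⟨⌈(N:ℝ) / (2 * |(n:ℝ)|)⌉₊, ?_, (min_le_left _ _).trans ?_⟩
    · apply Nat.ceil_le.2
      rw [div_le_iff₀ (by positivity)]
      nlinarith
    · set m := ⌈(N:ℝ) / (2 * |(n:ℝ)|)⌉₊
      have h1 : (N:ℝ) / (2 * |(n:ℝ)|) ≤ m := Nat.le_ceil _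
      have h2 : (m:ℝ) < (N:ℝ) / (2 * |(n:ℝ)|) + 1 := Nat.ceil_lt_add_one (by positivity)
      rw [div_le_iff₀ (by positivity)] at h1
      have h2' : (m:ℝ) * (2 * |(n:ℝ)|) < N + 2 * |(n:ℝ)| := by
        have := mul_lt_mul_of_pos_right h2 (by positivity : 0 < 2 * |(n:ℝ)|)
        rw [add_mul, div_mul_cancel₀ _ (by positivity)] at this
        linarith
      have hcos : Real.cos (Real.pi * ((n:ℝ) * m) / N) = Real.cos (Real.pi * ((|(n:ℝ)| * m) / N)) := by
        rw [← Real.cos_abs]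
        congr 1
        rw [abs_div, abs_mul, abs_mul, abs_of_pos Real.pi_pos, abs_of_pos hN, 
          abs_of_nonneg (by positivity : (0:ℝ) ≤ m)]
        ring
      rw [hcos]
      have : Real.cos (Real.pi * ((|(n:ℝ)| * m) / N)) ≤ 0 := by
        apply Real.cos_nonpos_of_pi_div_two_le_of_le
        · have : 1 / 2 ≤ (|(n:ℝ)| * m) / N := by rw [le_div_iff₀ hN]; linarith
          nlinarith [Real.pi_pos]
        · have : (|(n:ℝ)| * m) / N ≤ 3 / 2 := by rw [div_le_iff₀ hN]; linarith
          nlinarith [Real.pi_pos]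
      linarith

end Kern2

section Kern3

lemma kac_diff2 (𝔎 : KacProfile) : ∃ D : ℝ, 0 ≤ D ∧ ∀ x h : ℝ × ℝ,
    |𝔎.f (x + h) + 𝔎.f (x - h) - 2 * 𝔎.f x| ≤ D * ‖h‖ ^ 2 := by
  have hcs : HasCompactSupport 𝔎.f := by
    apply HasCompactSupport.of_support_subset_isCompact (isCompact_closedBall (0:ℝ × ℝ) 3)
    intro x hx
    have h3 : enorm2 x ≤ 3 := by
      by_contra h
      exact hx (𝔎.supp x (not_le.1 h))
    unfold enorm2 at h3
    have h9 : x.1 ^ 2 + x.2 ^ 2 ≤ 9 := by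
      have := (Real.sqrt_le_left (by norm_num)).1 h3
      norm_num at this; exact this
    rw [mem_closedBall_zero_iff, Prod.norm_def, max_le_iff, Real.norm_eq_abs, Real.norm_eq_abs]
    constructor <;> apply abs_le_of_sq_le_sq _ (by norm_num) <;> nlinarith [sq_nonneg x.1, sq_nonneg x.2]
  have hd1 : ContDiff ℝ 1 (fderiv ℝ 𝔎.f) := 𝔎.smooth.fderiv_right (by norm_num)
  obtain ⟨D, hD⟩ := ContDiff.lipschitzWith_of_hasCompactSupport (hcs.fderiv ℝ) hd1 (by norm_num)
  have hdiff : Differentiable ℝ 𝔎.f := 𝔎.smooth.differentiable (by norm_num)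
  refine ⟨2 * D, by positivity, fun x h => ?_⟩
  have key : ∀ v : ℝ × ℝ, ‖𝔎.f (x + v) - 𝔎.f x - fderiv ℝ 𝔎.f x v‖ ≤ D * ‖v‖ * ‖v‖ := by
    intro v
    have := (convex_closedBall x ‖v‖).norm_image_sub_le_of_norm_fderiv_le' (𝕜 := ℝ) (f := 𝔎.f)
      (C := D * ‖v‖) (φ := fderiv ℝ 𝔎.f x) (x := x) (y := x + v) (fun z _ => hdiff z)
      (fun z hz => by
        rw [← dist_eq_norm]
        refine (hD.dist_le_mul z x).trans ?_
        exact mul_le_mul_of_nonneg_left (Metric.mem_closedBall.1 hz) D.2)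
      (Metric.mem_closedBall_self (norm_nonneg v)) (by simp)
    simpa using this
  have h1 := key h
  have h2 := key (-h)
  rw [Real.norm_eq_abs, abs_le] at h1 h2
  rw [norm_neg, map_neg, ← sub_eq_add_neg] at h2
  rw [abs_le]
  constructor <;> nlinarith

variable {N : ℕ} [NeZero N]

/-- second difference sum bound implies decay -/
lemma dec_disc (k : Lat N → ℝ) (e : Lat N) (w : Lat N) :
    2 * (1 - (chw w e).re) * |lamW k w| ≤ ∑ z, |k (z + e) + k (z - e) - 2 * k z| := by
  have h1 : ∑ z, k (z + e) * (chw w z).re = ∑ z, k z * (chw w (z - e)).re := by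
    refine Fintype.sum_equiv (Equiv.addRight e) _ _ (fun z => ?_)
    simp
  have h2 : ∑ z, k (z - e) * (chw w z).re = ∑ z, k z * (chw w (z + e)).re := by
    refine Fintype.sum_equiv (Equiv.subRight e) _ _ (fun z => ?_)
    simp
  have h3 : ∑ z, (k (z + e) + k (z - e) - 2 * k z) * (chw w z).re = -(2 * (1 - (chw w e).re)) * lamW k w := by
    simp_rw [sub_mul, add_mul]
    rw [Finset.sum_sub_distrib, Finset.sum_add_distrib, h1, h2, lamW, Finset.mul_sum,
      ← Finset.sum_add_distrib, ← Finset.sum_sub_distrib]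
    refine Finset.sum_congr rfl (fun z _ => ?_)
    have := cs_prod w z e
    linear_combination (-2 * k z) * this
  have h4 : 0 ≤ 2 * (1 - (chw w e).re) := by have := chw_re_le w e; linarith
  calc 2 * (1 - (chw w e).re) * |lamW k w| = |∑ z, (k (z + e) + k (z - e) - 2 * k z) * (chw w z).re| := by
        rw [h3, abs_mul, abs_neg, abs_of_nonneg h4]
    _ ≤ ∑ z, |(k (z + e) + k (z - e) - 2 * k z) * (chw w z).re| := Finset.abs_sum_le_sum_abs _ _
    _ ≤ _ := by
        apply Finset.sum_le_sum
        intro z _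
        rw [abs_mul]
        exact mul_le_of_le_one_right (abs_nonneg _) ((Complex.abs_re_le_norm _).trans (chw_norm w z).le)

lemma latRep_add_int (v : ZMod (2*N)) (e : ℤ) (h : |latRep N v + e| < N) : latRep N (v + e) = latRep N v + e := by
  have := latRep_int _ h
  push_cast at this
  rwa [latRep_cast] at this

/-- second differences of the sampled kernel -/
lemma kI_diff2 (𝔎 : KacProfile) {D : ℝ} (hD : ∀ x h : ℝ × ℝ,
    |𝔎.f (x + h) + 𝔎.f (x - h) - 2 * 𝔎.f x| ≤ D * ‖h‖ ^ 2) {c : ℝ} (hc : 0 < c) (n e : ℤ × ℤ)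
    (he : |e.1| ≤ 1 ∧ |e.2| ≤ 1) (hD0 : 0 ≤ D) :
    |kI 𝔎 N c (n + e) + kI 𝔎 N c (n - e) - 2 * kI 𝔎 N c n| ≤ c * D * (N:ℝ)⁻¹ ^ 2 := by
  have h := hD (gam N * (n.1:ℝ), gam N * (n.2:ℝ)) (gam N * (e.1:ℝ), gam N * (e.2:ℝ))
  have hn : ‖((gam N * (e.1:ℝ), gam N * (e.2:ℝ)) : ℝ × ℝ)‖ ≤ gam N := by
    have hg := gam_pos (N := N)
    rw [Prod.norm_def, max_le_iff]
    simp only [Real.norm_eq_abs, abs_mul, abs_of_pos hg]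
    have h1 : |(e.1:ℝ)| ≤ 1 := by exact_mod_cast he.1
    have h2 : |(e.2:ℝ)| ≤ 1 := by exact_mod_cast he.2
    exact ⟨mul_le_of_le_one_right hg.le h1, mul_le_of_le_one_right hg.le h2⟩
  have h2 : D * ‖((gam N * (e.1:ℝ), gam N * (e.2:ℝ)) : ℝ × ℝ)‖ ^ 2 ≤ D * (N:ℝ)⁻¹ := by
    rw [← gam_sq]
    gcongr
  have h3 := h.trans h2
  have e1 : ∀ s t : ℝ × ℝ, s + t = (s.1 + t.1, s.2 + t.2) := fun s t => rfl
  unfold kI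
  have : c * (N:ℝ)⁻¹ * 𝔎.f (gam N * ((n + e).1:ℝ), gam N * ((n + e).2:ℝ)) + c * (N:ℝ)⁻¹ * 𝔎.f (gam N * ((n - e).1:ℝ), gam N * ((n - e).2:ℝ)) - 2 * (c * (N:ℝ)⁻¹ * 𝔎.f (gam N * (n.1:ℝ), gam N * (n.2:ℝ)))
    = c * (N:ℝ)⁻¹ * (𝔎.f ((gam N * (n.1:ℝ), gam N * (n.2:ℝ)) + (gam N * (e.1:ℝ), gam N * (e.2:ℝ))) + 𝔎.f ((gam N * (n.1:ℝ), gam N * (n.2:ℝ)) - (gam N * (e.1:ℝ), gam N * (e.2:ℝ))) - 2 * 𝔎.f (gam N * (n.1:ℝ), gam N * (n.2:ℝ))) := by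
    simp only [Prod.fst_add, Prod.snd_add, Prod.fst_sub, Prod.snd_sub]
    push_cast
    have e2 : ((gam N * (n.1:ℝ), gam N * (n.2:ℝ)) : ℝ × ℝ) + (gam N * (e.1:ℝ), gam N * (e.2:ℝ)) =
      (gam N * ((n.1:ℝ) + e.1), gam N * ((n.2:ℝ) + e.2)) := by
      ext <;> simp <;> ring
    have e3 : ((gam N * (n.1:ℝ), gam N * (n.2:ℝ)) : ℝ × ℝ) - (gam N * (e.1:ℝ), gam N * (e.2:ℝ)) =
      (gam N * ((n.1:ℝ) - e.1), gam N * ((n.2:ℝ) - e.2)) := by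
      ext <;> simp <;> ring
    rw [e2, e3]
    ring
  rw [this, abs_mul, abs_of_pos (by have := N_pos (N := N); positivity)]
  calc c * (N:ℝ)⁻¹ * _ ≤ c * (N:ℝ)⁻¹ * (D * (N:ℝ)⁻¹) := by gcongr
    _ = _ := by ring

lemma kI_lat_shift (𝔎 : KacProfile) (hN : 25 ≤ N) (c : ℝ) (z : Lat N) (e : ℤ × ℤ) (he : |e.1| ≤ 1 ∧ |e.2| ≤ 1) :
    kI 𝔎 N c (latRep2 N (z + ((e.1 : ZMod (2*N)), (e.2 : ZMod (2*N))))) = kI 𝔎 N c (latRep2 N z + e) := by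
  have hNr : (25:ℝ) ≤ N := by exact_mod_cast hN
  have hsupp : ∀ n : ℤ × ℤ, (N:ℤ) - 1 ≤ |n.1| ∨ (N:ℤ) - 1 ≤ |n.2| → kI 𝔎 N c n = 0 := by
    intro n hn
    apply kI_supp
    rw [← sq_abs (n.1:ℝ), ← sq_abs (n.2:ℝ)]
    rcases hn with h | h
    · have : (N:ℝ) - 1 ≤ |(n.1:ℝ)| := by exact_mod_cast h
      nlinarith [sq_nonneg |(n.2:ℝ)|]
    · have : (N:ℝ) - 1 ≤ |(n.2:ℝ)| := by exact_mod_cast h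
      nlinarith [sq_nonneg |(n.1:ℝ)|]
  have wrap : ∀ (v : ZMod (2*N)) (a : ℤ), |a| ≤ 1 → ¬ |latRep N v + a| < N →
      (N:ℤ) - 1 ≤ |latRep N (v + a)| ∧ (N:ℤ) - 1 ≤ |latRep N v + a| := by
    intro v a ha h
    refine ⟨?_, by omega⟩
    have hv := latRep_bounds v
    have hz : ((2 * N : ℕ) : ZMod (2*N)) = 0 := ZMod.natCast_self _
    push_cast at hz
    rw [abs_le] at ha
    rw [abs_lt, not_and_or] at h
    rcases h with h | h
    · have : latRep N (v + a) = latRep N v + a + 2 * N := by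
        have := latRep_of (N := N) (latRep N v + a + 2 * N) (by omega) (by omega)
        push_cast at this
        rwa [latRep_cast, hz, add_zero] at this
      rw [this, le_abs]; omega
    · by_cases h5 : latRep N v + a = N
      · have : latRep N (v + a) = latRep N v + a := by
          have := latRep_of (N := N) (latRep N v + a) (by omega) (by omega)
          push_cast at this
          rwa [latRep_cast] at this
        rw [this, le_abs]; omega
      · have : latRep N (v + a) = latRep N v + a - 2 * N := by
          have := latRep_of (N := N) (latRep N v + a - 2 * N) (by omega) (by omega)
          push_cast at this
          rwa [latRep_cast, hz, sub_zero] at this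
        rw [this, le_abs]; omega
  by_cases h1 : |latRep N z.1 + e.1| < N
  · by_cases h2 : |latRep N z.2 + e.2| < N
    · congr 1
      simp only [latRep2, Prod.fst_add, Prod.snd_add]
      rw [latRep_add_int _ _ h1, latRep_add_int _ _ h2]
      rfl
    · have := wrap z.2 e.2 he.2 h2
      rw [hsupp, hsupp]
      · right; exact this.2
      · right; exact this.1
  · have := wrap z.1 e.1 he.1 h1
    rw [hsupp, hsupp]
    · left; exact this.2
    · left; exact this.1

lemma kG_diff2_sum (𝔎 : KacProfile) {D : ℝ} (hD0 : 0 ≤ D) (hD : ∀ x h : ℝ × ℝ,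
    |𝔎.f (x + h) + 𝔎.f (x - h) - 2 * 𝔎.f x| ≤ D * ‖h‖ ^ 2) {c : ℝ} (hc : 0 < c) (hN : 25 ≤ N) (e : ℤ × ℤ)
    (he : |e.1| ≤ 1 ∧ |e.2| ≤ 1) :
    ∑ z : Lat N, |kGamma 𝔎 N c (gam N) (z + ((e.1 : ZMod (2*N)), (e.2 : ZMod (2*N)))) +
      kGamma 𝔎 N c (gam N) (z - ((e.1 : ZMod (2*N)), (e.2 : ZMod (2*N)))) - 2 * kGamma 𝔎 N c (gam N) z| ≤
      c * (81 * D + 4) / N := by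
  have hNr : (25:ℝ) ≤ N := by exact_mod_cast hN
  set E : Lat N := ((e.1 : ZMod (2*N)), (e.2 : ZMod (2*N))) with hE
  set P : Lat N → ℝ := fun z => if z = 0 then c * (N:ℝ)⁻¹ else 0 with hP
  have hP0 : ∀ z, 0 ≤ P z := by intro z; simp only [hP]; split_ifs <;> positivity
  have hPs : ∀ v : Lat N, ∑ z, P (z + v) = c * (N:ℝ)⁻¹ := by
    intro v
    have h := Fintype.sum_equiv (Equiv.addRight v) (fun z => P (z + v)) P (fun z => rfl)
    rw [h]
    simp [hP]
  set G : Lat N → ℝ := fun z => if nsq N z ≤ 16 * N then c * D * (N:ℝ)⁻¹ ^ 2 else 0 with hG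
  have hkP : ∀ z, |kGamma 𝔎 N c (gam N) z - kI 𝔎 N c (latRep2 N z)| ≤ P z := by
    intro z
    rw [kG_eq]
    simp only [hP]
    split_ifs
    · rw [zero_sub, abs_neg, abs_of_nonneg (kI_nn 𝔎 hc _)]; exact kI_le 𝔎 hc _
    · simp
  have hne : |(-e).1| ≤ 1 ∧ |(-e).2| ≤ 1 := by simpa using he
  have hEn : (((-e).1 : ZMod (2*N)), ((-e).2 : ZMod (2*N))) = -E := by
    rw [hE]; simp
  have key : ∀ z, |kGamma 𝔎 N c (gam N) (z + E) + kGamma 𝔎 N c (gam N) (z - E) - 2 * kGamma 𝔎 N c (gam N) z| ≤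
      G z + (P (z + E) + P (z + -E) + 2 * P (z + 0)) := by
    intro z
    have a1 := hkP (z + E)
    have a2 := hkP (z + -E)
    have a3 := hkP z
    rw [kI_lat_shift 𝔎 hN c z e he] at a1
    have s2 := kI_lat_shift 𝔎 hN c z (-e) hne
    rw [hEn] at s2
    rw [s2, ← sub_eq_add_neg (latRep2 N z)] at a2
    have hg : |kI 𝔎 N c (latRep2 N z + e) + kI 𝔎 N c (latRep2 N z - e) - 2 * kI 𝔎 N c (latRep2 N z)| ≤ G z := by
      simp only [hG]
      split_ifs with h
      · exact kI_diff2 𝔎 hD hc _ e he hD0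
      · push Not at h
        have hz : ∀ n e : ℤ × ℤ, |e.1| ≤ 1 ∧ |e.2| ≤ 1 → 16 * (N:ℝ) < (n.1:ℝ)^2 + (n.2:ℝ)^2 → kI 𝔎 N c (n + e) = 0 := by
          intro n e he hn
          apply kI_supp
          simp only [Prod.fst_add, Prod.snd_add]
          push_cast
          have q1 : (e.1:ℝ) ^ 2 ≤ 1 := by
            rw [← sq_abs]; have : |(e.1:ℝ)| ≤ 1 := by exact_mod_cast he.1
            nlinarith [abs_nonneg (e.1:ℝ)]
          have q2 : (e.2:ℝ) ^ 2 ≤ 1 := by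
            rw [← sq_abs]; have : |(e.2:ℝ)| ≤ 1 := by exact_mod_cast he.2
            nlinarith [abs_nonneg (e.2:ℝ)]
          nlinarith [sq_nonneg ((n.1:ℝ) + 8 * e.1), sq_nonneg ((n.2:ℝ) + 8 * e.2)]
        have z1 := hz (latRep2 N z) e he h
        have z2 := hz (latRep2 N z) (-e) hne h
        have z3 := hz (latRep2 N z) 0 (by simp) h
        rw [add_zero] at z3
        rw [← sub_eq_add_neg] at z2
        rw [z1, z2, z3]; simp
    rw [abs_le] at a1 a2 a3 hg ⊢
    rw [add_zero, sub_eq_add_neg z E]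
    constructor <;> linarith [a1.1, a1.2, a2.1, a2.2, a3.1, a3.2, hg.1, hg.2]
  refine (Finset.sum_le_sum (fun z _ => key z)).trans ?_
  rw [Finset.sum_add_distrib, Finset.sum_add_distrib, Finset.sum_add_distrib, ← Finset.mul_sum, hPs, hPs, hPs]
  have hGs : ∑ z, G z ≤ 81 * N * (c * D * (N:ℝ)⁻¹ ^ 2) := by
    simp only [hG]
    rw [← Finset.sum_filter, Finset.sum_const, nsmul_eq_mul]
    have hs2 : √(N:ℝ) ^ 2 = N := Real.sq_sqrt (by positivity)
    gcongr
    refine (box_card (4 * √(N:ℝ)) (by positivity) _ ?_).trans ?_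
    · intro z hz
      have hz' : nsq N z ≤ 16 * N := by simpa using hz
      unfold nsq at hz'
      constructor <;> apply abs_le_of_sq_le_sq _ (by positivity) <;> 
        nlinarith [sq_nonneg (latRep N z.2 : ℝ), sq_nonneg (latRep N z.1 : ℝ)]
    · have h1 : 1 ≤ √(N:ℝ) := Real.one_le_sqrt.2 (by linarith)
      nlinarith
  have e1 : 81 * N * (c * D * (N:ℝ)⁻¹ ^ 2) = c * (81 * D) / N := by field_simp
  rw [e1] at hGs
  have : c * (81 * D + 4) / N = c * (81 * D) / N + (c * (N:ℝ)⁻¹ + c * (N:ℝ)⁻¹ + 2 * (c * (N:ℝ)⁻¹)) := by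
    field_simp; ring
  rw [this]
  linarith

end Kern3

section Kern4

lemma kac_points (𝔎 : KacProfile) : ∃ (κ : ℝ) (N₀ : ℕ), 0 < κ ∧ 25 ≤ N₀ ∧ ∀ (N : ℕ) [NeZero N], N₀ ≤ N → ∀ c : ℝ, 0 < c →
    ∃ (a : ℤ × ℤ) (M : ℕ), 1 ≤ M ∧ κ * N ≤ (M:ℝ) ^ 2 ∧
    ∀ i j : ℕ, i < 2 * M → j < 2 * M → |a.1 + i| < N ∧ |a.2 + j| < N ∧
      c * κ / N ≤ kGamma 𝔎 N c (gam N) (((a.1 + i : ℤ) : ZMod (2*N)), ((a.2 + j : ℤ) : ZMod (2*N))) := by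
  obtain ⟨x0, r, δ0, hr, hδ, hf⟩ := kac_square 𝔎
  refine ⟨min δ0 (r ^ 2 / 64), ⌈(8 / r + 5) ^ 2⌉₊ + 25, by positivity, by omega, ?_⟩
  intro N _ hN c hc
  have hNr : (8 / r + 5) ^ 2 ≤ (N:ℝ) := by
    refine (Nat.le_ceil _).trans ?_
    exact_mod_cast (by omega : ⌈(8 / r + 5) ^ 2⌉₊ ≤ N)
  have hN0 : (0:ℝ) < N := by exact_mod_cast N_pos (N := N)
  set S := √(N:ℝ) with hS
  have hS2 : S ^ 2 = N := Real.sq_sqrt hN0.le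
  have hSl : 8 / r + 5 ≤ S := Real.le_sqrt_of_sq_le hNr
  have h8 : 0 < 8 / r := by positivity
  have hS5 : 5 < S := by linarith
  have hrS : 8 ≤ r * S := by
    have : 8 / r ≤ S := by linarith
    rw [div_le_iff₀ hr] at this; linarith
  set M := ⌊r * S / 4⌋₊ with hM
  have hM1 : (M:ℝ) ≤ r * S / 4 := Nat.floor_le (by positivity)
  have hM2 : r * S / 4 < M + 1 := Nat.lt_floor_add_one _
  have hM8 : r * S / 8 ≤ M := by linarith
  have hg : gam N = S⁻¹ := gam_sqrt
  refine ⟨(⌊S * x0.1⌋ + 1, ⌊S * x0.2⌋ + 1), M, ?_, ?_, ?_⟩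
  · have : (1:ℝ) ≤ M := by linarith
    exact_mod_cast this
  · have h1 : (r * S / 8) ^ 2 ≤ (M:ℝ) ^ 2 := by gcongr
    have h2 : min δ0 (r ^ 2 / 64) * N ≤ r ^ 2 / 64 * N := by gcongr; exact min_le_right _ _
    calc _ ≤ _ := h2
      _ = (r * S / 8) ^ 2 := by rw [← hS2]; ring
      _ ≤ _ := h1
  · intro i j hi hj
    simp only
    have near : ∀ (t : ℝ) (i : ℕ), i < 2 * M → |gam N * ((⌊S * t⌋ + 1 + i : ℤ) : ℝ) - t| < r := by
      intro t i hi
      have hi' : (i:ℝ) + 1 ≤ 2 * M := by exact_mod_cast hi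
      have f1 := Int.floor_le (S * t)
      have f2 := Int.lt_floor_add_one (S * t)
      push_cast
      have hS0 : 0 < S := by linarith
      have : gam N * ((⌊S * t⌋:ℝ) + 1 + i) - t = S⁻¹ * ((⌊S * t⌋:ℝ) + 1 + i - S * t) := by
        rw [hg]; field_simp
      rw [this, abs_mul, abs_of_pos (by positivity), inv_mul_lt_iff₀ hS0, abs_lt]
      have : (0:ℝ) ≤ i := by positivity
      constructor <;> nlinarith
    have n1 := near x0.1 i hi
    have n2 := near x0.2 j hj
    obtain ⟨hfy, hy0⟩ := hf (gam N * ((⌊S * x0.1⌋ + 1 + i : ℤ) : ℝ), gam N * ((⌊S * x0.2⌋ + 1 + j : ℤ) : ℝ)) n1 n2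
    have hsup : ((⌊S * x0.1⌋ + 1 + i : ℤ) : ℝ) ^ 2 + ((⌊S * x0.2⌋ + 1 + j : ℤ) : ℝ) ^ 2 ≤ 9 * N := by
      by_contra h
      have := kI_supp 𝔎 1 (N := N) (⌊S * x0.1⌋ + 1 + i, ⌊S * x0.2⌋ + 1 + j) (not_le.1 h)
      unfold kI at this
      simp only at this
      have hp : 0 < 1 * (N:ℝ)⁻¹ * 𝔎.f (gam N * ((⌊S * x0.1⌋ + 1 + i : ℤ) : ℝ), gam N * ((⌊S * x0.2⌋ + 1 + j : ℤ) : ℝ)) := by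
        have := lt_of_lt_of_le hδ hfy
        positivity
      linarith
    have b : ∀ n : ℤ, (n:ℝ) ^ 2 ≤ 9 * N → |n| < N := by
      intro n hn
      have : |(n:ℝ)| < N := by
        apply abs_lt_of_sq_lt_sq _ hN0.le
        have h25 : (25:ℝ) ≤ N := by exact_mod_cast (by omega : 25 ≤ N)
        nlinarith
      exact_mod_cast this
    have b1 := b _ (by nlinarith [sq_nonneg ((⌊S * x0.2⌋ + 1 + j : ℤ) : ℝ)] : ((⌊S * x0.1⌋ + 1 + i : ℤ) : ℝ) ^ 2 ≤ 9 * N)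
    have b2 := b _ (by nlinarith [sq_nonneg ((⌊S * x0.1⌋ + 1 + i : ℤ) : ℝ)] : ((⌊S * x0.2⌋ + 1 + j : ℤ) : ℝ) ^ 2 ≤ 9 * N)
    refine ⟨b1, b2, ?_⟩
    have l1 := latRep_int _ b1
    have l2 := latRep_int _ b2
    rw [kG_eq, if_neg]
    · unfold latRep2 kI
      simp only [l1, l2]
      have : min δ0 (r ^ 2 / 64) ≤ 𝔎.f (gam N * ((⌊S * x0.1⌋ + 1 + i : ℤ) : ℝ), gam N * ((⌊S * x0.2⌋ + 1 + j : ℤ) : ℝ)) :=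
        (min_le_left _ _).trans hfy
      calc c * min δ0 (r ^ 2 / 64) / N = c * (N:ℝ)⁻¹ * min δ0 (r ^ 2 / 64) := by ring
        _ ≤ _ := by gcongr
    · intro h
      rw [Prod.mk_eq_zero] at h
      rw [h.1, latRep_zero] at l1
      rw [h.2, latRep_zero] at l2
      apply hy0
      rw [← l1, ← l2]; simp

lemma latRep_le_abs {N : ℕ} [NeZero N] (v : ZMod (2*N)) : |latRep N v| ≤ N := by
  have := latRep_bounds v
  rw [abs_le]; omega

theorem kernel_KB (𝔎 : KacProfile) : ∃ (C0 c1 : ℝ) (N₀ : ℕ), 1 ≤ C0 ∧ 0 < c1 ∧ c1 ≤ 1 ∧ ∀ (N : ℕ) [NeZero N], N₀ ≤ N → ∀ c : ℝ, 0 < c →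
    (∑ z : Lat N, kGamma 𝔎 N c (gam N) z) = 1 → KB N (kGamma 𝔎 N c (gam N)) C0 c1 := by
  obtain ⟨κ, N₀, hκ, hN25, hpts⟩ := kac_points 𝔎
  obtain ⟨D, hD0, hD⟩ := kac_diff2 𝔎
  have hc1 : 0 < κ ^ 2 / 196 * min 1 κ := by positivity
  refine ⟨max 1 (4 / κ ^ 2 * (81 * D + 4)), min 1 (κ ^ 2 / 196 * min 1 κ), N₀, le_max_left _ _, by positivity,
    min_le_left _ _, ?_⟩
  intro N _ hN c hc h1
  have hN0 : (0:ℝ) < N := by exact_mod_cast N_pos (N := N)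
  obtain ⟨a, M, hM1, hMN, hpt⟩ := hpts N hN c hc
  have hdisc := lo_disc (kGamma 𝔎 N c (gam N)) (kG_nn 𝔎 hc) h1 a M (c * κ / N) (by positivity) hpt
  have hclo := kG_clow 𝔎 hc h1
  have hkM : c * κ ^ 2 ≤ c * κ / N * M ^ 2 := by
    calc c * κ ^ 2 = c * κ / N * (κ * N) := by field_simp
      _ ≤ _ := by gcongr
  have hchw1 : ∀ (w : Lat N) (m : ℕ), (chw w ((m : ZMod (2*N)), ((0:ℕ) : ZMod (2*N)))).re =
      Real.cos (Real.pi * ((latRep N w.1 : ℝ) * m) / N) := by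
    intro w m
    unfold chw
    have : w.1 * (m : ZMod (2*N)) + w.2 * ((0:ℕ) : ZMod (2*N)) = ((latRep N w.1 * m : ℤ) : ZMod (2*N)) := by
      push_cast; rw [latRep_cast]; simp
    simp only [this]
    rw [ZMod.stdAddChar_coe]
    have : (2 * Real.pi * Complex.I * ((latRep N w.1 * m : ℤ) : ℂ) / ((2 * N : ℕ) : ℂ)) =
      ((Real.pi * ((latRep N w.1 : ℝ) * m) / N : ℝ) : ℂ) * Complex.I := by
      push_cast; field_simp
    rw [this, Complex.exp_ofReal_mul_I_re]
  have hchw2 : ∀ (w : Lat N) (m : ℕ), (chw w (((0:ℕ) : ZMod (2*N)), (m : ZMod (2*N)))).re =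
      Real.cos (Real.pi * ((latRep N w.2 : ℝ) * m) / N) := by
    intro w m
    have := hchw1 (w.2, w.1) m
    rw [← this]
    unfold chw
    simp only [add_comm]
  have hcup : c ≤ 4 / κ ^ 2 := by
    set w : Lat N := (((N:ℤ) : ZMod (2*N)), 0) with hw
    have l : latRep N w.1 = N := by rw [hw]; exact latRep_of _ (by omega) le_rfl
    have := hdisc w 1 0 hM1 (Nat.zero_le _)
    rw [hchw1, l] at this
    have e : Real.pi * (((N:ℤ):ℝ) * ((1:ℕ):ℝ)) / N = Real.pi := by push_cast; field_simp
    rw [e, Real.cos_pi] at this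
    have hl := abs_le.1 (lamW_abs _ (kG_nn 𝔎 hc) h1 w)
    rw [le_div_iff₀ (by positivity)]
    linarith [hl.1]
  refine ⟨kG_nn 𝔎 hc, kG_even 𝔎 c, by simp [kGamma], h1, kG_up 𝔎 hc h1, ?_, ?_⟩
  · intro w
    have hmin0 : 0 ≤ min 1 (nsq N w / N) := le_min zero_le_one (div_nonneg (nsq_nonneg w) hN0.le)
    refine (mul_le_mul_of_nonneg_right (min_le_right _ _) hmin0).trans ?_
    have main : ∀ n : ℤ, |n| ≤ N → nsq N w ≤ 2 * (n:ℝ) ^ 2 →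
        (∀ m ≤ M, c * κ / N * M ^ 2 * (1 - Real.cos (Real.pi * ((n:ℝ) * m) / N)) ≤ 4 * (1 - lamW (kGamma 𝔎 N c (gam N)) w)) →
        κ ^ 2 / 196 * min 1 κ * min 1 (nsq N w / N) ≤ 1 - lamW (kGamma 𝔎 N c (gam N)) w := by
      intro n hn hns hm
      obtain ⟨m, hmM, hmin⟩ := shift_choice n hn M hM1
      have h2 := hm m hmM
      have h3 : min 1 κ * min 1 (nsq N w / N) ≤ min 1 (2 * (M:ℝ) ^ 2 * (n:ℝ) ^ 2 / N ^ 2) := by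
        apply le_min
        · exact mul_le_one₀ (min_le_left _ _) hmin0 (min_le_left _ _)
        · calc min 1 κ * min 1 (nsq N w / N) ≤ κ * (nsq N w / N) := by
                gcongr
                · exact min_le_right _ _
                · exact min_le_right _ _
            _ ≤ κ * (2 * (n:ℝ) ^ 2 / N) := by gcongr
            _ = κ * N * (2 * (n:ℝ) ^ 2 / N ^ 2) := by field_simp
            _ ≤ (M:ℝ) ^ 2 * (2 * (n:ℝ) ^ 2 / N ^ 2) := by gcongr
            _ = _ := by ring
      have h4 := h3.trans hmin
      have h5 : κ ^ 2 / 49 * (min 1 κ * min 1 (nsq N w / N)) ≤ c * κ / N * M ^ 2 * (1 - Real.cos (Real.pi * ((n:ℝ) * m) / N)) := by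
        apply mul_le_mul _ h4 (by positivity) (by positivity)
        refine le_trans ?_ hkM
        nlinarith [sq_nonneg κ]
      linarith
    rcases le_total ((latRep N w.2 : ℝ) ^ 2) ((latRep N w.1 : ℝ) ^ 2) with h | h
    · apply main (latRep N w.1) (latRep_le_abs _) (by unfold nsq; linarith)
      intro m hm
      have := hdisc w m 0 hm (Nat.zero_le _)
      rwa [hchw1] at this
    · apply main (latRep N w.2) (latRep_le_abs _) (by unfold nsq; linarith)
      intro m hm
      have := hdisc w 0 m (Nat.zero_le _) hm
      rwa [hchw2] at this
  · intro w
    have hcosb : ∀ n : ℤ, |n| ≤ N → 2 * (n:ℝ) ^ 2 / N ^ 2 ≤ 1 - Real.cos (Real.pi * ((n:ℝ) * (1:ℕ)) / N) := by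
      intro n hn
      have hn' : |(n:ℝ)| ≤ N := by exact_mod_cast hn
      have hx : |Real.pi * ((n:ℝ) * (1:ℕ)) / N| ≤ Real.pi := by
        rw [abs_div, abs_mul, abs_of_pos Real.pi_pos, abs_of_pos hN0, div_le_iff₀ hN0, Nat.cast_one, mul_one]
        exact mul_le_mul_of_nonneg_left hn' Real.pi_pos.le
      have hcc := Real.cos_le_one_sub_mul_cos_sq hx
      have e : 2 / Real.pi ^ 2 * (Real.pi * ((n:ℝ) * (1:ℕ)) / N) ^ 2 = 2 * (n:ℝ) ^ 2 / N ^ 2 := by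
        have := Real.pi_ne_zero
        push_cast
        field_simp
      rw [e] at hcc
      linarith
    have hS : ∀ e : ℤ × ℤ, |e.1| ≤ 1 ∧ |e.2| ≤ 1 → 2 * (1 - (chw w ((e.1 : ZMod (2*N)), (e.2 : ZMod (2*N)))).re) * |lamW (kGamma 𝔎 N c (gam N)) w| ≤ 4 / κ ^ 2 * (81 * D + 4) / N := by
      intro e he
      refine (dec_disc _ _ w).trans ((kG_diff2_sum 𝔎 hD0 hD hc (hN25.trans hN) e he).trans ?_)
      gcongr
    have h1' := hS (1, 0) (by simp)
    have h2' := hS (0, 1) (by simp)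
    have e1 := hchw1 w 1
    have e2 := hchw2 w 1
    push_cast at h1' h2' e1 e2
    rw [e1] at h1'
    rw [e2] at h2'
    have g1 := hcosb _ (latRep_le_abs w.1)
    have g2 := hcosb _ (latRep_le_abs w.2)
    push_cast at g1 g2
    set L := |lamW (kGamma 𝔎 N c (gam N)) w| with hL
    have hL0 : 0 ≤ L := abs_nonneg _
    have k1 := mul_le_mul_of_nonneg_right g1 hL0
    have k2 := mul_le_mul_of_nonneg_right g2 hL0
    set C := 4 / κ ^ 2 * (81 * D + 4)
    have k3 : 2 * (2 * (nsq N w) / N ^ 2) * L ≤ 2 * (C / N) := by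
      unfold nsq
      have : 2 * (2 * ((latRep N w.1:ℝ) ^ 2 + (latRep N w.2:ℝ) ^ 2) / N ^ 2) * L = 2 * (2 * (latRep N w.1:ℝ) ^ 2 / N ^ 2 * L) + 2 * (2 * (latRep N w.2:ℝ) ^ 2 / N ^ 2 * L) := by ring
      rw [this]
      linarith
    have k4 : L * nsq N w * 2 ≤ C * N := by
      have := mul_le_mul_of_nonneg_right k3 (by positivity : 0 ≤ (N:ℝ) ^ 2 / 2)
      have e3 : 2 * (2 * (nsq N w) / N ^ 2) * L * ((N:ℝ) ^ 2 / 2) = L * nsq N w * 2 := by field_simp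
      have e4 : 2 * (C / N) * ((N:ℝ) ^ 2 / 2) = C * N := by field_simp
      rw [e3, e4] at this
      exact this
    have : 0 ≤ L * nsq N w := mul_nonneg hL0 (nsq_nonneg w)
    calc L * nsq N w ≤ C * N := by linarith
      _ ≤ _ := by gcongr; exact le_max_right _ _

end Kern4

/-! ### Part G6: lattice sums -/

section Sums

/-- inverse squared length weight -/
def ew (N : ℕ) (w : Lat N) : ℝ := (1 + nsq N w)⁻¹

variable {N : ℕ} [NeZero N]

lemma ew_pos (w : Lat N) : 0 < ew N w := by
  unfold ew; have := nsq_nonneg w; positivity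

lemma ew_le_one (w : Lat N) : ew N w ≤ 1 := by
  unfold ew; have := nsq_nonneg w
  exact inv_le_one_of_one_le₀ (by linarith)

lemma ew_neg (w : Lat N) : ew N (-w) = ew N w := by
  unfold ew; rw [nsq_neg]

lemma int_sum_bound (p : ℝ) (hp : 1 < p) : ∃ C : ℝ, 0 ≤ C ∧ ∀ (N : ℕ) [NeZero N],
    ∑ v : ZMod (2*N), (1 + (latRep N v : ℝ) ^ 2) ^ (-(p / 2)) ≤ C := by
  set g : ℤ → ℝ := fun n => |(n:ℝ)| ^ (-p) + if n = 0 then 1 else 0 with hg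
  have hs : Summable g := by
    apply Summable.add (Real.summable_abs_int_rpow hp)
    exact (hasSum_ite_eq (0:ℤ) (1:ℝ)).summable
  have hg0 : ∀ n, 0 ≤ g n := by intro n; simp only [hg]; positivity
  refine ⟨∑' n, g n, tsum_nonneg hg0, ?_⟩
  intro N _
  have hinj : Function.Injective (latRep N) := by
    intro v v' h
    rw [← latRep_cast v, h, latRep_cast]
  calc ∑ v : ZMod (2*N), (1 + (latRep N v : ℝ) ^ 2) ^ (-(p / 2)) ≤ ∑ v : ZMod (2*N), g (latRep N v) := by
        apply Finset.sum_le_sum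
        intro v _
        simp only [hg]
        by_cases h : latRep N v = 0
        · rw [h]; simp
          positivity
        · rw [if_neg h, add_zero]
          have hpos : 0 < |(latRep N v : ℝ)| := abs_pos.2 (by exact_mod_cast h)
          have e : |(latRep N v : ℝ)| ^ (-p) = ((latRep N v : ℝ) ^ 2) ^ (-(p/2)) := by
            rw [← sq_abs, ← Real.rpow_natCast, ← Real.rpow_mul hpos.le]
            congr 1; push_cast; ring
          rw [e]
          apply Real.rpow_le_rpow_of_nonpos
          · rw [← sq_abs]; positivity
          · linarith
          · linarith
    _ = ∑ n ∈ Finset.univ.image (latRep N), g n := by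
        rw [Finset.sum_image (fun x _ y _ h => hinj h)]
    _ ≤ ∑' n, g n := hs.sum_le_tsum _ (fun n _ => hg0 n)

lemma ew_sum (p : ℝ) (hp : 1 < p) : ∃ C : ℝ, 1 ≤ C ∧ ∀ (N : ℕ) [NeZero N], ∑ w : Lat N, ew N w ^ p ≤ C := by
  obtain ⟨C, hC0, hC⟩ := int_sum_bound p hp
  refine ⟨max 1 (C ^ 2), le_max_left _ _, ?_⟩
  intro N _
  refine le_trans ?_ (le_max_right _ _)
  calc ∑ w : Lat N, ew N w ^ p ≤ ∑ w : Lat N, (1 + (latRep N w.1 : ℝ) ^ 2) ^ (-(p / 2)) * (1 + (latRep N w.2 : ℝ) ^ 2) ^ (-(p / 2)) := by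
        apply Finset.sum_le_sum
        intro w _
        unfold ew nsq
        rw [← Real.mul_rpow (by positivity) (by positivity), Real.inv_rpow (by positivity), ← Real.rpow_neg (by positivity)]
        have e : (1 + ((latRep N w.1 : ℝ) ^ 2 + (latRep N w.2 : ℝ) ^ 2)) ^ (-p) =
            ((1 + ((latRep N w.1 : ℝ) ^ 2 + (latRep N w.2 : ℝ) ^ 2)) ^ 2) ^ (-(p/2)) := by
          rw [← Real.rpow_natCast (1 + ((latRep N w.1 : ℝ) ^ 2 + (latRep N w.2 : ℝ) ^ 2)) 2, ← Real.rpow_mul (by positivity)]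
          congr 1; push_cast; ring
        rw [e]
        apply Real.rpow_le_rpow_of_nonpos (by positivity) _ (by linarith)
        nlinarith [sq_nonneg (latRep N w.1 : ℝ), sq_nonneg (latRep N w.2 : ℝ), mul_nonneg (sq_nonneg (latRep N w.1 : ℝ)) (sq_nonneg (latRep N w.2 : ℝ))]
    _ = (∑ v : ZMod (2*N), (1 + (latRep N v : ℝ) ^ 2) ^ (-(p / 2))) ^ 2 := by
        rw [sq, Finset.sum_mul_sum, ← Finset.sum_product']
        rfl
    _ ≤ C ^ 2 := by
        have := hC N
        gcongr

lemma ew_sum_cut (δ : ℝ) (hδ : 0 < δ) : ∃ C : ℝ, 1 ≤ C ∧ ∀ (N : ℕ) [NeZero N] (R : ℝ), 0 ≤ R →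
    ∑ w : Lat N, (if nsq N w ≤ R then ew N w else 0) ≤ C * (1 + R) ^ δ := by
  obtain ⟨C, hC1, hC⟩ := ew_sum (1 + δ) (by linarith)
  refine ⟨C, hC1, ?_⟩
  intro N _ R hR
  calc ∑ w : Lat N, (if nsq N w ≤ R then ew N w else 0) ≤ ∑ w : Lat N, ew N w ^ (1 + δ) * (1 + R) ^ δ := by
        apply Finset.sum_le_sum
        intro w _
        have hw := ew_pos w
        split_ifs with h
        · rw [Real.rpow_add hw, Real.rpow_one, mul_assoc, ← Real.mul_rpow hw.le (by positivity)]
          have : 1 ≤ ew N w * (1 + R) := by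
            unfold ew
            have := nsq_nonneg w
            rw [inv_mul_eq_div, one_le_div (by positivity)]; linarith
          have := Real.one_le_rpow this hδ.le
          nlinarith
        · positivity
    _ = (∑ w : Lat N, ew N w ^ (1 + δ)) * (1 + R) ^ δ := by rw [Finset.sum_mul]
    _ ≤ _ := by have := hC N; gcongr

lemma nsq_le (w : Lat N) : nsq N w ≤ 2 * N ^ 2 := by
  have h1 : |(latRep N w.1 : ℝ)| ≤ N := by exact_mod_cast latRep_le_abs w.1
  have h2 : |(latRep N w.2 : ℝ)| ≤ N := by exact_mod_cast latRep_le_abs w.2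
  have h3 := sq_le_sq' (by linarith [abs_nonneg (latRep N w.1 : ℝ)]) h1
  have h4 := sq_le_sq' (by linarith [abs_nonneg (latRep N w.2 : ℝ)]) h2
  rw [sq_abs] at h3 h4
  unfold nsq; linarith

lemma nsq_ge_one {w : Lat N} (hw : w ≠ 0) : 1 ≤ nsq N w := by
  have key : ∀ n : ℤ, n ≠ 0 → (1:ℝ) ≤ (n:ℝ) ^ 2 := by
    intro n hn
    have : 1 ≤ |n| := Int.one_le_abs hn
    have h : (1:ℝ) ≤ |(n:ℝ)| := by exact_mod_cast this
    rw [← sq_abs]; nlinarith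
  unfold nsq
  by_cases h : latRep N w.1 = 0
  · have h2 : latRep N w.2 ≠ 0 := by
      intro h2
      exact hw (Prod.ext (latRep_eq_zero h) (latRep_eq_zero h2))
    have := key _ h2
    nlinarith [sq_nonneg (latRep N w.1 : ℝ)]
  · have := key _ h
    nlinarith [sq_nonneg (latRep N w.2 : ℝ)]

lemma ew_zero : ew N (0 : Lat N) = 1 := by
  unfold ew nsq; simp [latRep_zero]

/-- four-fold Parseval -/
lemma parseval4 (f : Lat N → ℂ) :
    ∑ z, (∑ w, f w * chw w z) ^ 4 = 4 * N ^ 2 * ∑ w1, ∑ w2, ∑ w3, f w1 * f w2 * f w3 * f (-(w1 + w2 + w3)) := by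
  have e : ∀ z, (∑ w, f w * chw w z) ^ 4 = ∑ w1, ∑ w2, ∑ w3, ∑ w4, f w1 * f w2 * f w3 * f w4 * chw (w1 + w2 + w3 + w4) z := by
    intro z
    rw [show (∑ w, f w * chw w z) ^ 4 = (∑ w, f w * chw w z) * ((∑ w, f w * chw w z) * ((∑ w, f w * chw w z) * (∑ w, f w * chw w z))) by ring]
    rw [Finset.sum_mul_sum]
    rw [Finset.sum_mul]
    refine Finset.sum_congr rfl (fun w1 _ => ?_)
    rw [Finset.sum_mul, Finset.mul_sum]
    refine Finset.sum_congr rfl (fun w2 _ => ?_)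
    rw [Finset.mul_sum, Finset.mul_sum]
    refine Finset.sum_congr rfl (fun w3 _ => ?_)
    rw [Finset.mul_sum, Finset.mul_sum]
    refine Finset.sum_congr rfl (fun w4 _ => ?_)
    rw [chw_add_left, chw_add_left, chw_add_left]; ring
  simp_rw [e]
  rw [Finset.sum_comm, Finset.mul_sum]
  refine Finset.sum_congr rfl (fun w1 _ => ?_)
  rw [Finset.sum_comm, Finset.mul_sum]
  refine Finset.sum_congr rfl (fun w2 _ => ?_)
  rw [Finset.sum_comm, Finset.mul_sum]
  refine Finset.sum_congr rfl (fun w3 _ => ?_)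
  rw [Finset.sum_comm]
  simp_rw [← Finset.mul_sum, chw_sum]
  have : ∀ w4, (w1 + w2 + w3 + w4 = 0) ↔ (w4 = -(w1 + w2 + w3)) := fun w4 => by
    rw [eq_neg_iff_add_eq_zero, add_comm]
  simp_rw [this, mul_ite, mul_zero]
  rw [Finset.sum_ite_eq']
  simp
  ring

lemma parseval2 (f : Lat N → ℂ) :
    ∑ z, (∑ w, f w * chw w z) ^ 2 = 4 * N ^ 2 * ∑ w, f w * f (-w) := by
  have e : ∀ z, (∑ w, f w * chw w z) ^ 2 = ∑ w1, ∑ w2, f w1 * f w2 * chw (w1 + w2) z := by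
    intro z
    rw [sq, Finset.sum_mul_sum]
    refine Finset.sum_congr rfl (fun w1 _ => Finset.sum_congr rfl (fun w2 _ => ?_))
    rw [chw_add_left]; ring
  simp_rw [e]
  rw [Finset.sum_comm, Finset.mul_sum]
  refine Finset.sum_congr rfl (fun w1 _ => ?_)
  rw [Finset.sum_comm]
  simp_rw [← Finset.mul_sum, chw_sum]
  have : ∀ w4, (w1 + w4 = 0) ↔ (w4 = -w1) := fun w4 => by
    rw [eq_neg_iff_add_eq_zero, add_comm]
  simp_rw [this, mul_ite, mul_zero]
  rw [Finset.sum_ite_eq']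
  simp
  ring

/-- covariance associated with a multiplier -/
def Cf (f : Lat N → ℝ) (x y : Lat N) : ℝ := ∑ w, f w * (hart w x * hart w y)

lemma Cf_eq (f : Lat N → ℝ) (hf : ∀ w, f (-w) = f w) (x y : Lat N) :
    ((Cf f x y : ℝ) : ℂ) = (∑ w, (f w : ℂ) * chw w (x - y)) / (4 * N ^ 2) := by
  unfold Cf
  rw [hart_even f hf]
  push_cast
  congr 1
  have h0 : ∑ w, f w * (chw w (x - y)).im = 0 := by
    have : ∑ w, f w * (chw w (x - y)).im = - ∑ w, f w * (chw w (x - y)).im := by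
      rw [← Finset.sum_neg_distrib]
      refine Fintype.sum_equiv (Equiv.neg _) _ _ (fun w => ?_)
      simp [chw_neg_left, hf]
    linarith
  apply Complex.ext
  · rw [Complex.re_sum, Complex.re_sum]
    refine Finset.sum_congr rfl (fun w _ => ?_)
    rw [← Complex.ofReal_mul, Complex.ofReal_re, Complex.re_ofReal_mul]
  · rw [Complex.im_sum, Complex.im_sum]
    simp_rw [Complex.im_ofReal_mul]
    rw [h0]
    simp

lemma Cf4 (f : Lat N → ℝ) (hf : ∀ w, f (-w) = f w) :
    ∑ x, ∑ y, Cf f x y ^ 4 = (∑ w1, ∑ w2, ∑ w3, f w1 * f w2 * f w3 * f (-(w1 + w2 + w3))) / (16 * N ^ 4) := by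
  have hN : (N:ℂ) ≠ 0 := by exact_mod_cast NeZero.ne N
  have h := parseval4 (fun w => (f w : ℂ))
  have : ((∑ x, ∑ y, Cf f x y ^ 4 : ℝ) : ℂ) = ((∑ w1, ∑ w2, ∑ w3, f w1 * f w2 * f w3 * f (-(w1 + w2 + w3))) / (16 * N ^ 4) : ℝ) := by
    push_cast
    simp_rw [Cf_eq f hf, div_pow]
    have e : ∀ x : Lat N, ∑ y, (∑ w, (f w : ℂ) * chw w (x - y)) ^ 4 / (4 * (N:ℂ) ^ 2) ^ 4 =
      (∑ z, (∑ w, (f w : ℂ) * chw w z) ^ 4) / (4 * (N:ℂ) ^ 2) ^ 4 := by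
      intro x
      rw [Finset.sum_div]
      exact Fintype.sum_equiv (Equiv.subLeft x) _ _ (fun y => by simp)
    simp_rw [e, h]
    rw [Finset.sum_const, Finset.card_univ, card_lat, nsmul_eq_mul]
    push_cast
    generalize (∑ w1, ∑ w2, ∑ w3, (f w1 : ℂ) * f w2 * f w3 * f (-(w1 + w2 + w3))) = Y
    field_simp
    norm_num
    ring
  exact_mod_cast this

lemma Cf2 (f : Lat N → ℝ) (hf : ∀ w, f (-w) = f w) :
    ∑ x, ∑ y, Cf f x y ^ 2 = ∑ w, f w ^ 2 := by
  have hN : (N:ℂ) ≠ 0 := by exact_mod_cast NeZero.ne N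
  have h := parseval2 (fun w => (f w : ℂ))
  have : ((∑ x, ∑ y, Cf f x y ^ 2 : ℝ) : ℂ) = ((∑ w, f w ^ 2 : ℝ) : ℂ) := by
    push_cast
    simp_rw [Cf_eq f hf, div_pow]
    have e : ∀ x : Lat N, ∑ y, (∑ w, (f w : ℂ) * chw w (x - y)) ^ 2 / (4 * (N:ℂ) ^ 2) ^ 2 =
      (∑ z, (∑ w, (f w : ℂ) * chw w z) ^ 2) / (4 * (N:ℂ) ^ 2) ^ 2 := by
      intro x
      rw [Finset.sum_div]
      exact Fintype.sum_equiv (Equiv.subLeft x) _ _ (fun y => by simp)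
    simp_rw [e, h]
    rw [Finset.sum_const, Finset.card_univ, card_lat, nsmul_eq_mul]
    simp_rw [hf, ← sq]
    push_cast
    field_simp
  exact_mod_cast this

/-- the quartic convolution bound -/
lemma quart_bound (S : ℝ) (hS : ∑ w : Lat N, ew N w ^ (7/6 : ℝ) ≤ S) :
    ∑ w1 : Lat N, ∑ w2, ∑ w3, ew N w1 ^ (7/8 : ℝ) * ew N w2 ^ (7/8 : ℝ) * ew N w3 ^ (7/8 : ℝ) * ew N (-(w1 + w2 + w3)) ^ (7/8 : ℝ)
      ≤ S ^ 3 := by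
  set s := ∑ w : Lat N, ew N w ^ (7/6 : ℝ) with hs
  have hs0 : 0 ≤ s := Finset.sum_nonneg (fun w _ => Real.rpow_nonneg (ew_pos w).le _)
  set g : Lat N → ℝ := fun w => ew N w ^ (7/6 : ℝ) with hg
  have amgm : ∀ a b c d : ℝ, 0 ≤ a → 0 ≤ b → 0 ≤ c → 0 ≤ d →
      a^3*b^3*c^3*d^3 ≤ (a^4*b^4*c^4 + a^4*b^4*d^4 + a^4*c^4*d^4 + b^4*c^4*d^4)/4 := by
    intro a b c d ha hb hc hd
    have h1 := two_mul_le_add_sq (a^2*b^2*c^2) (a^2*b^2*d^2)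
    have h2 := two_mul_le_add_sq (a^2*c^2*d^2) (b^2*c^2*d^2)
    have h3 := two_mul_le_add_sq (a^2*b^2*c*d) (a*b*c^2*d^2)
    nlinarith
  have hpt : ∀ w1 w2 w3 : Lat N, ew N w1 ^ (7/8 : ℝ) * ew N w2 ^ (7/8 : ℝ) * ew N w3 ^ (7/8 : ℝ) * ew N (-(w1 + w2 + w3)) ^ (7/8 : ℝ)
      ≤ (g w1 * g w2 * g w3 + g w1 * g w2 * g (-(w1+w2+w3)) + g w1 * g w3 * g (-(w1+w2+w3)) + g w2 * g w3 * g (-(w1+w2+w3))) / 4 := by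
    intro w1 w2 w3
    have e3 : ∀ w : Lat N, ew N w ^ (7/8 : ℝ) = (ew N w ^ (7/24 : ℝ)) ^ 3 := by
      intro w
      rw [← Real.rpow_natCast, ← Real.rpow_mul (ew_pos w).le]; norm_num
    have e4 : ∀ w : Lat N, g w = (ew N w ^ (7/24 : ℝ)) ^ 4 := by
      intro w
      simp only [hg]
      rw [← Real.rpow_natCast, ← Real.rpow_mul (ew_pos w).le]; norm_num
    rw [e3, e3, e3, e3, e4, e4, e4, e4]
    exact amgm _ _ _ _ (Real.rpow_nonneg (ew_pos _).le _) (Real.rpow_nonneg (ew_pos _).le _) (Real.rpow_nonneg (ew_pos _).le _) (Real.rpow_nonneg (ew_pos _).le _)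
  refine (Finset.sum_le_sum (fun w1 _ => Finset.sum_le_sum (fun w2 _ => Finset.sum_le_sum (fun w3 _ => hpt w1 w2 w3)))).trans ?_
  have sh3 : ∀ u : Lat N, ∑ w3, g (-(u + w3)) = s := fun u =>
    Fintype.sum_equiv ((Equiv.addLeft u).trans (Equiv.neg _)) _ _ (fun w => by simp [hg])
  have t1 : ∑ w1, ∑ w2, ∑ w3, g w1 * g w2 * g w3 = s ^ 3 := by
    simp_rw [← Finset.mul_sum, ← Finset.sum_mul, ← Finset.mul_sum]
    rw [← Finset.sum_mul]
    change s * s * s = _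
    ring
  have t2 : ∑ w1, ∑ w2, ∑ w3, g w1 * g w2 * g (-(w1+w2+w3)) = s ^ 3 := by
    simp_rw [← Finset.mul_sum, sh3, ← Finset.sum_mul, ← Finset.mul_sum]
    rw [← Finset.sum_mul]
    change s * s * s = _
    ring
  have t3 : ∑ w1, ∑ w2, ∑ w3, g w1 * g w3 * g (-(w1+w2+w3)) = s ^ 3 := by
    rw [← t2]
    refine Finset.sum_congr rfl (fun w1 _ => ?_)
    rw [Finset.sum_comm]
    refine Finset.sum_congr rfl (fun w2 _ => Finset.sum_congr rfl (fun w3 _ => ?_))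
    rw [add_right_comm]
  have t4 : ∑ w1, ∑ w2, ∑ w3, g w2 * g w3 * g (-(w1+w2+w3)) = s ^ 3 := by
    rw [← t2, Finset.sum_comm]
    refine Finset.sum_congr rfl (fun w1 _ => ?_)
    rw [Finset.sum_comm]
    refine Finset.sum_congr rfl (fun w2 _ => Finset.sum_congr rfl (fun w3 _ => ?_))
    rw [add_assoc, add_comm w3]
  simp_rw [← Finset.sum_div, Finset.sum_add_distrib]
  rw [t1, t2, t3, t4]
  have : s ^ 3 ≤ S ^ 3 := by gcongr
  linarith

end Sums

/-! ### Part G7: verification of the stability hypotheses -/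

section Verif

/-- complex square root of a real -/
def csq (v : ℝ) : ℂ := if 0 ≤ v then ((√v : ℝ) : ℂ) else Complex.I * ((√(-v) : ℝ) : ℂ)

lemma csq_sq (v : ℝ) : csq v ^ 2 = (v : ℂ) := by
  unfold csq
  split_ifs with h
  · rw [← Complex.ofReal_pow, Real.sq_sqrt h]
  · rw [mul_pow, Complex.I_sq, ← Complex.ofReal_pow, Real.sq_sqrt (by linarith)]
    push_cast; ring

lemma csq_norm (v : ℝ) : ‖csq v‖ ^ 2 = |v| := by
  rw [← norm_pow, csq_sq, Complex.norm_real, Real.norm_eq_abs]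

lemma csq_conj (v : ℝ) : csq v * (starRingEnd ℂ) (csq v) = ((|v| : ℝ) : ℂ) := by
  rw [Complex.mul_conj, Complex.normSq_eq_norm_sq, csq_norm]

lemma csq_im (v : ℝ) : (csq v).im = if 0 ≤ v then 0 else √(-v) := by
  unfold csq
  split_ifs <;> simp

variable {N : ℕ} [NeZero N]

/-- the Gaussian field coefficients -/
def alW (r : Lat N → ℝ) (x w : Lat N) : ℂ := ((hart w x : ℝ) : ℂ) * csq (r w)

/-- cut-off coefficients -/
def alK (r : Lat N → ℝ) (k : ℕ) (x w : Lat N) : ℂ := if nsq N w ≤ (2 ^ k) ^ 64 then alW r x w else 0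

/-- cut-off multiplier -/
def rK (r : Lat N → ℝ) (k : ℕ) (w : Lat N) : ℝ := if nsq N w ≤ (2 ^ k) ^ 64 then |r w| else 0

lemma rK_even (r : Lat N → ℝ) (hr : ∀ w, r (-w) = r w) (k : ℕ) (w : Lat N) : rK r k (-w) = rK r k w := by
  unfold rK; rw [nsq_neg, hr]

lemma bq_aa (r : Lat N → ℝ) (x y : Lat N) : bq (alW r x) (cj (alW r y)) = ((Cf (fun w => |r w|) x y : ℝ) : ℂ) := by
  unfold bq cj alW Cf
  push_cast
  refine Finset.sum_congr rfl (fun w _ => ?_)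
  rw [map_mul, Complex.conj_ofReal, ← csq_conj]; ring

lemma bq_ak (r : Lat N → ℝ) (k : ℕ) (x y : Lat N) : bq (alW r x) (cj (alK r k y)) = ((Cf (rK r k) x y : ℝ) : ℂ) := by
  unfold bq cj alK alW Cf rK
  push_cast
  refine Finset.sum_congr rfl (fun w _ => ?_)
  split_ifs
  · rw [map_mul, Complex.conj_ofReal, ← csq_conj]; ring
  · simp

lemma bq_ka (r : Lat N → ℝ) (k : ℕ) (x y : Lat N) : bq (alK r k x) (cj (alW r y)) = ((Cf (rK r k) x y : ℝ) : ℂ) := by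
  unfold bq cj alK alW Cf rK
  push_cast
  refine Finset.sum_congr rfl (fun w _ => ?_)
  split_ifs
  · rw [map_mul, Complex.conj_ofReal, ← csq_conj]; ring
  · simp

lemma bq_kk (r : Lat N → ℝ) (k : ℕ) (x y : Lat N) : bq (alK r k x) (cj (alK r k y)) = ((Cf (rK r k) x y : ℝ) : ℂ) := by
  unfold bq cj alK alW Cf rK
  push_cast
  refine Finset.sum_congr rfl (fun w _ => ?_)
  split_ifs
  · rw [map_mul, Complex.conj_ofReal, ← csq_conj]; ring
  · simp

lemma dcov_eq (r : Lat N → ℝ) (k n : ℕ) : dcov (alW r) (alK r k) n =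
    (((∑ x, ∑ y, Cf (fun w => |r w|) x y ^ n) - ∑ x, ∑ y, Cf (rK r k) x y ^ n : ℝ) : ℂ) := by
  unfold dcov dsg dal
  simp only [Fintype.sum_sum_type, Sum.elim_inl, Sum.elim_inr, bq_aa, bq_ak, bq_ka, bq_kk]
  push_cast
  simp only [Finset.sum_add_distrib, one_mul, mul_one, neg_mul, mul_neg, neg_neg, Finset.sum_neg_distrib]
  ring

/-- quartic tail -/
lemma quart_tail (r : Lat N → ℝ) (hr : ∀ w, r (-w) = r w) {Q : ℝ} (hQ : 1 ≤ Q)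
    (hb : ∀ w, |r w| ≤ Q * N * ew N w) (hS : ∑ w : Lat N, ew N w ^ (7/6 : ℝ) ≤ Q) (k : ℕ) :
    (∑ x, ∑ y, Cf (fun w => |r w|) x y ^ 4) - ∑ x, ∑ y, Cf (rK r k) x y ^ 4 ≤ Q ^ 7 / 16 / (2 ^ k) ^ 8 := by
  have hN : (0:ℝ) < N := by exact_mod_cast N_pos (N := N)
  rw [Cf4 _ (fun w => by rw [hr]), Cf4 _ (rK_even r hr k), ← sub_div]
  set T : ℝ := (2 ^ k) ^ 64 with hT
  set t : ℝ := ((2:ℝ) ^ k) ^ 8 with ht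
  have ht1 : 1 ≤ t := by rw [ht]; exact one_le_pow₀ (one_le_pow₀ (by norm_num))
  have hTt : T = t ^ 8 := by rw [hT, ht]; ring
  have e8 : ∀ w : Lat N, ew N w = ew N w ^ (7/8 : ℝ) * ew N w ^ (1/8 : ℝ) := by
    intro w; rw [← Real.rpow_add (ew_pos w)]; norm_num
  have e1 : ∀ w : Lat N, ew N w ^ (1/8 : ℝ) ≤ 1 := fun w => Real.rpow_le_one (ew_pos w).le (ew_le_one w) (by norm_num)
  have et : ∀ w : Lat N, ¬ nsq N w ≤ T → ew N w ^ (1/8 : ℝ) ≤ 1 / t := by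
    intro w hw
    push Not at hw
    have : ew N w ≤ (1 / t) ^ 8 := by
      unfold ew
      rw [div_pow, one_pow, ← hTt, one_div]
      apply inv_anti₀
      · rw [hTt]; positivity
      · linarith
    calc ew N w ^ (1/8 : ℝ) ≤ ((1 / t) ^ 8) ^ (1/8 : ℝ) := Real.rpow_le_rpow (ew_pos w).le this (by norm_num)
      _ = 1 / t := by
        rw [← Real.rpow_natCast, ← Real.rpow_mul (by positivity)]; norm_num
  have hpt : ∀ w1 w2 w3 w4 : Lat N, |r w1| * |r w2| * |r w3| * |r w4| - rK r k w1 * rK r k w2 * rK r k w3 * rK r k w4 ≤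
      (Q * N) ^ 4 / t * (ew N w1 ^ (7/8 : ℝ) * ew N w2 ^ (7/8 : ℝ) * ew N w3 ^ (7/8 : ℝ) * ew N w4 ^ (7/8 : ℝ)) := by
    intro w1 w2 w3 w4
    have p : ∀ w : Lat N, 0 ≤ ew N w ^ (7/8 : ℝ) := fun w => Real.rpow_nonneg (ew_pos w).le _
    have p8 : ∀ w : Lat N, 0 ≤ ew N w ^ (1/8 : ℝ) := fun w => Real.rpow_nonneg (ew_pos w).le _
    by_cases h : nsq N w1 ≤ T ∧ nsq N w2 ≤ T ∧ nsq N w3 ≤ T ∧ nsq N w4 ≤ T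
    · unfold rK
      rw [if_pos h.1, if_pos h.2.1, if_pos h.2.2.1, if_pos h.2.2.2, sub_self]
      have := p w1; have := p w2; have := p w3; have := p w4
      positivity
    · have hrk : 0 ≤ rK r k w1 * rK r k w2 * rK r k w3 * rK r k w4 := by
        have hz : ∀ w, 0 ≤ rK r k w := by intro w; unfold rK; split_ifs <;> positivity
        have := hz w1; have := hz w2; have := hz w3; have := hz w4
        positivity
      have hprod : ew N w1 ^ (1/8 : ℝ) * ew N w2 ^ (1/8 : ℝ) * ew N w3 ^ (1/8 : ℝ) * ew N w4 ^ (1/8 : ℝ) ≤ 1 / t := by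
        have one : ∀ a b c d : ℝ, 0 ≤ a → 0 ≤ b → 0 ≤ c → 0 ≤ d → a ≤ 1 / t → b ≤ 1 → c ≤ 1 → d ≤ 1 → a * b * c * d ≤ 1 / t := by
          intro a b c d ha hb hc hd h1 h2 h3 h4
          have k1 : a * b ≤ a := mul_le_of_le_one_right ha h2
          have k2 : a * b * c ≤ a * b := mul_le_of_le_one_right (by positivity) h3
          have k3 : a * b * c * d ≤ a * b * c := mul_le_of_le_one_right (by positivity) h4
          linarith
        by_cases h1 : nsq N w1 ≤ T
        · by_cases h2 : nsq N w2 ≤ T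
          · by_cases h3 : nsq N w3 ≤ T
            · have h4 : ¬ nsq N w4 ≤ T := fun h4 => h ⟨h1, h2, h3, h4⟩
              have := one _ _ _ _ (p8 w4) (p8 w1) (p8 w2) (p8 w3) (et w4 h4) (e1 w1) (e1 w2) (e1 w3)
              linarith
            · have := one _ _ _ _ (p8 w3) (p8 w1) (p8 w2) (p8 w4) (et w3 h3) (e1 w1) (e1 w2) (e1 w4)
              linarith
          · have := one _ _ _ _ (p8 w2) (p8 w1) (p8 w3) (p8 w4) (et w2 h2) (e1 w1) (e1 w3) (e1 w4)
            linarith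
        · exact one _ _ _ _ (p8 w1) (p8 w2) (p8 w3) (p8 w4) (et w1 h1) (e1 w2) (e1 w3) (e1 w4)
      have q := fun w => ew_pos (N := N) w
      calc _ ≤ |r w1| * |r w2| * |r w3| * |r w4| := by linarith
        _ ≤ (Q * N * ew N w1) * (Q * N * ew N w2) * (Q * N * ew N w3) * (Q * N * ew N w4) := by
            have := q w1; have := q w2; have := q w3; have := q w4
            gcongr <;> apply hb
        _ = (Q * N) ^ 4 * (ew N w1 * ew N w2 * ew N w3 * ew N w4) := by ring
        _ = (Q * N) ^ 4 * ((ew N w1 ^ (7/8 : ℝ) * ew N w2 ^ (7/8 : ℝ) * ew N w3 ^ (7/8 : ℝ) * ew N w4 ^ (7/8 : ℝ)) *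
              (ew N w1 ^ (1/8 : ℝ) * ew N w2 ^ (1/8 : ℝ) * ew N w3 ^ (1/8 : ℝ) * ew N w4 ^ (1/8 : ℝ))) := by
            have e8' := fun w => (e8 w).symm
            have hre : ∀ a1 a2 a3 a4 b1 b2 b3 b4 : ℝ, (a1 * a2 * a3 * a4) * (b1 * b2 * b3 * b4) =
              (a1 * b1) * (a2 * b2) * (a3 * b3) * (a4 * b4) := fun a1 a2 a3 a4 b1 b2 b3 b4 => by ring
            rw [hre, e8', e8', e8', e8']
        _ ≤ (Q * N) ^ 4 * ((ew N w1 ^ (7/8 : ℝ) * ew N w2 ^ (7/8 : ℝ) * ew N w3 ^ (7/8 : ℝ) * ew N w4 ^ (7/8 : ℝ)) * (1 / t)) := by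
            have := p w1; have := p w2; have := p w3; have := p w4
            gcongr
        _ = _ := by ring
  have hsum : (∑ w1, ∑ w2, ∑ w3, |r w1| * |r w2| * |r w3| * |r (-(w1 + w2 + w3))|) -
      ∑ w1, ∑ w2, ∑ w3, rK r k w1 * rK r k w2 * rK r k w3 * rK r k (-(w1 + w2 + w3)) ≤ (Q * N) ^ 4 / t * Q ^ 3 := by
    refine le_trans ?_ (mul_le_mul_of_nonneg_left (quart_bound Q hS) (by positivity))
    simp only [Finset.mul_sum]
    simp only [← Finset.sum_sub_distrib]
    exact Finset.sum_le_sum (fun w1 _ => Finset.sum_le_sum (fun w2 _ => Finset.sum_le_sum (fun w3 _ => hpt _ _ _ _)))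
  rw [div_le_iff₀ (by positivity)]
  refine hsum.trans (le_of_eq ?_)
  field_simp

lemma quart_full (r : Lat N → ℝ) (hr : ∀ w, r (-w) = r w) {Q : ℝ} (hQ : 1 ≤ Q)
    (hb : ∀ w, |r w| ≤ Q * N * ew N w) (hS : ∑ w : Lat N, ew N w ^ (7/6 : ℝ) ≤ Q) :
    (∑ x, ∑ y, Cf (fun w => |r w|) x y ^ 4) ≤ Q ^ 7 / 16 := by
  have hN : (0:ℝ) < N := by exact_mod_cast N_pos (N := N)
  rw [Cf4 _ (fun w => by rw [hr])]
  have e8 : ∀ w : Lat N, ew N w ≤ ew N w ^ (7/8 : ℝ) := by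
    intro w
    conv_lhs => rw [← Real.rpow_one (ew N w)]
    exact Real.rpow_le_rpow_of_exponent_ge (ew_pos w) (ew_le_one w) (by norm_num)
  have hsum : (∑ w1, ∑ w2, ∑ w3, |r w1| * |r w2| * |r w3| * |r (-(w1 + w2 + w3))|) ≤ (Q * N) ^ 4 * Q ^ 3 := by
    refine le_trans ?_ (mul_le_mul_of_nonneg_left (quart_bound Q hS) (by positivity))
    simp only [Finset.mul_sum]
    refine Finset.sum_le_sum (fun w1 _ => Finset.sum_le_sum (fun w2 _ => Finset.sum_le_sum (fun w3 _ => ?_)))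
    have q := fun w => ew_pos (N := N) w
    have p : ∀ w : Lat N, 0 ≤ ew N w ^ (7/8 : ℝ) := fun w => Real.rpow_nonneg (ew_pos w).le _
    have hb2 : ∀ w, |r w| ≤ Q * N * ew N w ^ (7/8:ℝ) := fun w => (hb w).trans (mul_le_mul_of_nonneg_left (e8 w) (by positivity))
    calc _ ≤ (Q * N * ew N w1 ^ (7/8:ℝ)) * (Q * N * ew N w2 ^ (7/8:ℝ)) * (Q * N * ew N w3 ^ (7/8:ℝ)) * (Q * N * ew N (-(w1+w2+w3)) ^ (7/8:ℝ)) := by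
            have := p w1; have := p w2; have := p w3; have := p (-(w1+w2+w3))
            gcongr <;> apply hb2
        _ = _ := by ring
  rw [div_le_iff₀ (by positivity)]
  refine hsum.trans (le_of_eq ?_)
  field_simp

lemma quad_tail (r : Lat N → ℝ) (hr : ∀ w, r (-w) = r w) {Q : ℝ} (hQ : 1 ≤ Q)
    (hb : ∀ w, |r w| ≤ Q * N * ew N w) (hS : ∑ w : Lat N, ew N w ^ (7/6 : ℝ) ≤ Q) (k : ℕ) :
    (∑ x, ∑ y, Cf (fun w => |r w|) x y ^ 2) - ∑ x, ∑ y, Cf (rK r k) x y ^ 2 ≤ Q ^ 3 * N ^ 2 / (2 ^ k) ^ 8 := by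
  have hN : (0:ℝ) < N := by exact_mod_cast N_pos (N := N)
  rw [Cf2 _ (fun w => by rw [hr]), Cf2 _ (rK_even r hr k), ← Finset.sum_sub_distrib]
  set t : ℝ := ((2:ℝ) ^ k) ^ 8 with ht
  have ht1 : 1 ≤ t := by rw [ht]; exact one_le_pow₀ (one_le_pow₀ (by norm_num))
  have hpt : ∀ w, |r w| ^ 2 - rK r k w ^ 2 ≤ (Q * N) ^ 2 / t * ew N w ^ (7/6:ℝ) := by
    intro w
    have hp := Real.rpow_nonneg (ew_pos w).le (7/6)
    unfold rK
    split_ifs with h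
    · rw [sub_self]; positivity
    · push Not at h
      have h1 : ew N w ^ (1/8:ℝ) ≤ 1 / t := by
        have : ew N w ≤ (1 / t) ^ 8 := by
          unfold ew
          have hTt : ((2:ℝ) ^ k) ^ 64 = t ^ 8 := by rw [ht]; ring
          rw [div_pow, one_pow, ← hTt, one_div]
          apply inv_anti₀
          · positivity
          · linarith
        calc ew N w ^ (1/8 : ℝ) ≤ ((1 / t) ^ 8) ^ (1/8 : ℝ) := Real.rpow_le_rpow (ew_pos w).le this (by norm_num)
          _ = 1 / t := by
            rw [← Real.rpow_natCast, ← Real.rpow_mul (by positivity)]; norm_num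
      have h2 : ew N w ^ 2 ≤ ew N w ^ (7/6:ℝ) * ew N w ^ (1/8:ℝ) := by
        rw [← Real.rpow_add (ew_pos w), ← Real.rpow_natCast]
        exact Real.rpow_le_rpow_of_exponent_ge (ew_pos w) (ew_le_one w) (by norm_num)
      have h3 : |r w| ^ 2 ≤ (Q * N * ew N w) ^ 2 := by
        have := hb w
        gcongr
      calc |r w| ^ 2 - 0 ^ 2 ≤ (Q * N) ^ 2 * ew N w ^ 2 := by rw [← mul_pow]; linarith
        _ ≤ (Q * N) ^ 2 * (ew N w ^ (7/6:ℝ) * (1 / t)) := by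
          gcongr
          exact h2.trans (by gcongr)
        _ = _ := by ring
  refine (Finset.sum_le_sum (fun w _ => hpt w)).trans ?_
  rw [← Finset.mul_sum]
  calc (Q * N) ^ 2 / t * _ ≤ (Q * N) ^ 2 / t * Q := by gcongr
    _ = _ := by ring

lemma quad_full (r : Lat N → ℝ) (hr : ∀ w, r (-w) = r w) {Q : ℝ} (hQ : 1 ≤ Q)
    (hb : ∀ w, |r w| ≤ Q * N * ew N w) (hS : ∑ w : Lat N, ew N w ^ (7/6 : ℝ) ≤ Q) :
    (∑ x, ∑ y, Cf (fun w => |r w|) x y ^ 2) ≤ Q ^ 3 * N ^ 2 := by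
  rw [Cf2 _ (fun w => by rw [hr])]
  have hpt : ∀ w, |r w| ^ 2 ≤ (Q * N) ^ 2 * ew N w ^ (7/6:ℝ) := by
    intro w
    have h2 : ew N w ^ 2 ≤ ew N w ^ (7/6:ℝ) := by
      rw [← Real.rpow_natCast]
      exact Real.rpow_le_rpow_of_exponent_ge (ew_pos w) (ew_le_one w) (by norm_num)
    calc |r w| ^ 2 ≤ (Q * N * ew N w) ^ 2 := by
          have := hb w
          gcongr
      _ = (Q * N) ^ 2 * ew N w ^ 2 := by ring
      _ ≤ _ := by gcongr
  refine (Finset.sum_le_sum (fun w _ => hpt w)).trans ?_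
  rw [← Finset.mul_sum]
  calc (Q * N) ^ 2 * _ ≤ (Q * N) ^ 2 * Q := by gcongr
    _ = _ := by ring

end Verif

/-! ### Part G8: the stability structure for the lattice field -/

section StabLat

variable {N : ℕ} [NeZero N]

/-- abstract hypotheses on the multiplier -/
structure RHyp (N : ℕ) [NeZero N] (r : Lat N → ℝ) (s B a Q : ℝ) (kmax : ℕ) : Prop where
  hQ : 1 ≤ Q
  hr : ∀ w, r (-w) = r w
  hb : ∀ w, |r w| ≤ Q * N * ew N w
  hneg : ∀ w, r w < 0 → |r w| ≤ 0.52
  hpos : ∀ w, nsq N w ≤ N / 90 → 0 ≤ r w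
  hS : ∑ w : Lat N, ew N w ^ (7/6 : ℝ) ≤ Q
  hcut : ∀ R : ℝ, 0 ≤ R → ∑ w : Lat N, (if nsq N w ≤ R then ew N w else 0) ≤ Q * (1 + R) ^ (1/2048 : ℝ)
  hk1 : ((2:ℝ) ^ kmax) ^ 128 ≤ N
  hk2 : (N : ℝ) ≤ (2 * (2:ℝ) ^ kmax) ^ 128
  hN : (8100 : ℝ) ≤ N
  ha : a = (∑ w, r w) / (4 * N ^ 2)
  hs : s = a + B
  hB : |B| ≤ Q / N
  hs1 : |s| ≤ 1 / 1000
  hs2 : |s| ≤ Q * (N : ℝ) ^ (1/512 : ℝ) / N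

lemma RHyp.ew_total {r : Lat N → ℝ} {s B a Q : ℝ} {kmax : ℕ} (H : RHyp N r s B a Q kmax) :
    ∑ w : Lat N, ew N w ≤ Q * (N:ℝ) ^ (1/512 : ℝ) := by
  have hN := H.hN
  have hQ := H.hQ
  have h := H.hcut (2 * N ^ 2) (by positivity)
  rw [Finset.sum_congr rfl (fun w _ => if_pos (nsq_le w))] at h
  refine h.trans ?_
  have : (1 + 2 * (N:ℝ) ^ 2) ^ (1/2048 : ℝ) ≤ (((N:ℝ) ^ 4)) ^ (1/2048:ℝ) := by
    apply Real.rpow_le_rpow (by positivity) _ (by norm_num)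
    have : (8100:ℝ)^2 ≤ (N:ℝ)^2 := by gcongr
    nlinarith
  have e : (((N:ℝ) ^ 4)) ^ (1/2048:ℝ) = (N:ℝ) ^ (1/512 : ℝ) := by
    rw [← Real.rpow_natCast, ← Real.rpow_mul (by positivity)]; norm_num
  rw [e] at this
  gcongr

lemma sum_hart_bound (r : Lat N → ℝ) {Q : ℝ} (hb : ∀ w, |r w| ≤ Q * N * ew N w) (p : Lat N → Prop) [DecidablePred p]
    (x : Lat N) : ∑ w, ‖(if p w then alW r x w else 0)‖ ^ 2 ≤ Q / (2 * N) * ∑ w, (if p w then ew N w else 0) := by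
  have hN : (0:ℝ) < N := by exact_mod_cast N_pos (N := N)
  rw [Finset.mul_sum]
  refine Finset.sum_le_sum (fun w _ => ?_)
  split_ifs
  · unfold alW
    rw [norm_mul, mul_pow, csq_norm, Complex.norm_real, Real.norm_eq_abs, sq_abs]
    calc hart w x ^ 2 * |r w| ≤ 1 / (2 * N ^ 2) * (Q * N * ew N w) :=
          mul_le_mul (hart_sq_le w x) (hb w) (abs_nonneg _) (by positivity)
      _ = _ := by field_simp
  · simp

lemma RHyp.stab {r : Lat N → ℝ} {s B a Q : ℝ} {kmax : ℕ} (H : RHyp N r s B a Q kmax) :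
    Stab (alW r) (alK r) s B a (Q / (2 * N) * ∑ w, ew N w) (32 * Q ^ 7) kmax := by
  have hN : (0:ℝ) < N := by exact_mod_cast N_pos (N := N)
  have hQ := H.hQ
  have hQ0 : 0 < Q := by linarith
  have hcard : ((Fintype.card (Lat N) : ℕ) : ℝ) = 4 * N ^ 2 := by rw [card_lat]; push_cast; ring
  have hE := H.ew_total
  have hE0 : 0 ≤ ∑ w : Lat N, ew N w := Finset.sum_nonneg (fun w _ => (ew_pos w).le)
  set n : ℝ := (N:ℝ) ^ (1/512 : ℝ) with hn
  have hn512 : n ^ 512 = N := by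
    rw [hn, ← Real.rpow_natCast, ← Real.rpow_mul hN.le]; norm_num
  have hn0 : 0 < n := by positivity
  have hn1 : 1 ≤ n := Real.one_le_rpow (by linarith [H.hN]) (by norm_num)
  set T : ℝ := (2:ℝ) ^ kmax with hT
  have hT1 : 1 ≤ T := one_le_pow₀ (by norm_num)
  have hTn : T ≤ n ^ 4 := by
    have h := H.hk1
    rw [← hn512, show (512:ℕ) = 4 * 128 by norm_num, pow_mul] at h
    exact (pow_le_pow_iff_left₀ (by positivity) (by positivity) (by norm_num)).1 h
  have hnT : n ^ 4 ≤ 2 * T := by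
    have h := H.hk2
    rw [← hn512, show (512:ℕ) = 4 * 128 by norm_num, pow_mul] at h
    exact (pow_le_pow_iff_left₀ (by positivity) (by positivity) (by norm_num)).1 h
  have hn2 : n ^ 2 ≤ 2 * √T := by
    apply (sq_le_sq₀ (by positivity) (by positivity)).1
    rw [mul_pow, Real.sq_sqrt (by linarith)]
    nlinarith
  have hQp : ∀ j, j ≤ 7 → Q ^ j ≤ Q ^ 7 := fun j hj => pow_le_pow_right₀ hQ hj
  have hB2 : B ^ 2 ≤ Q ^ 2 / N ^ 2 := by
    rw [← sq_abs, ← div_pow]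
    have := H.hB
    gcongr
  refine ⟨?_, by positivity, ?_, H.hs, ?_, ?_, ?_, ?_, ?_, ?_, ?_, H.hs1, ?_, ?_, ?_⟩
  · have := hQp 0 (by norm_num)
    norm_num at this; linarith
  · intro x
    have h := hart_even r H.hr x x
    simp only [sub_self, chw_zero, Complex.one_re, mul_one] at h
    rw [H.ha, ← h]
    unfold bq alW
    push_cast
    refine Finset.sum_congr rfl (fun w _ => ?_)
    rw [← csq_sq (r w)]; ring
  · intro x
    have := sum_hart_bound r H.hb (fun _ => True) x
    simpa using this
  · intro k hk x w
    unfold alK alW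
    split_ifs with h
    · have : nsq N w ≤ N / 90 := by
        have h1 : ((2:ℝ) ^ k) ^ 64 ≤ T ^ 64 := by
          rw [hT]; gcongr; norm_num
        have h2 : (T ^ 64) ^ 2 ≤ (N / 90 : ℝ) ^ 2 := by
          rw [← pow_mul]; refine H.hk1.trans ?_
          nlinarith [H.hN]
        have h3 := (sq_le_sq₀ (by positivity) (by positivity)).1 h2
        linarith
      have h0 := H.hpos w this
      rw [Complex.im_ofReal_mul, csq_im, if_pos h0, mul_zero]
    · simp
  · intro k hk x
    have h1 := sum_hart_bound r H.hb (fun w => nsq N w ≤ (2 ^ k) ^ 64) x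
    have h2 := H.hcut ((2 ^ k) ^ 64) (by positivity)
    set t : ℝ := (2:ℝ) ^ k with ht
    have ht1 : 1 ≤ t := one_le_pow₀ (by norm_num)
    have h3 : ((1 + t ^ 64) ^ (1/2048 : ℝ)) ^ 2 ≤ 2 * √t := by
      have e1 : (1 + t ^ 64) ≤ (2 * √t) ^ 512 := by
        have : √t ^ 512 = t ^ 256 := by
          rw [show (512:ℕ) = 2 * 256 by norm_num, pow_mul, Real.sq_sqrt (by linarith)]
        rw [mul_pow, this]
        have e2 : t ^ 64 ≤ t ^ 256 := pow_le_pow_right₀ ht1 (by norm_num)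
        have e3 : (1:ℝ) ≤ t ^ 256 := one_le_pow₀ ht1
        have e4 : (2:ℝ) ≤ 2 ^ 512 := le_self_pow₀ (by norm_num) (by norm_num)
        have e5 := mul_le_mul_of_nonneg_right e4 (show (0:ℝ) ≤ t ^ 256 by positivity)
        exact le_trans (by linarith) e5
      have e5 : 1 ≤ 2 * √t := by
        have : 1 ≤ √t := Real.one_le_sqrt.2 ht1
        linarith
      calc ((1 + t ^ 64) ^ (1/2048 : ℝ)) ^ 2 ≤ (((2 * √t) ^ 512) ^ (1/2048 : ℝ)) ^ 2 := by gcongr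
        _ = (2 * √t) ^ (1/2:ℝ) := by
          rw [← Real.rpow_natCast, ← Real.rpow_natCast, ← Real.rpow_mul (by positivity), ← Real.rpow_mul (by positivity)]
          norm_num
        _ ≤ (2 * √t) ^ (1:ℝ) := Real.rpow_le_rpow_of_exponent_le e5 (by norm_num)
        _ = _ := Real.rpow_one _
    have h4 : ∑ w, ‖alK r k x w‖ ^ 2 ≤ Q / (2 * N) * (Q * (1 + t ^ 64) ^ (1/2048 : ℝ)) := by
      refine h1.trans ?_
      gcongr
    rw [hcard]
    calc 4 * (N:ℝ) ^ 2 * (∑ w, ‖alK r k x w‖ ^ 2) ^ 2 ≤ 4 * (N:ℝ) ^ 2 * (Q / (2 * N) * (Q * (1 + t ^ 64) ^ (1/2048 : ℝ))) ^ 2 := by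
          gcongr
      _ = Q ^ 4 * ((1 + t ^ 64) ^ (1/2048 : ℝ)) ^ 2 := by
          generalize (1 + t ^ 64) ^ (1/2048 : ℝ) = v
          field_simp; ring
      _ ≤ Q ^ 4 * (2 * √t) := by gcongr
      _ ≤ 32 * Q ^ 7 * √t := by
          have := hQp 4 (by norm_num)
          have h5 := mul_le_mul_of_nonneg_right this (Real.sqrt_nonneg t)
          have h6 : 0 ≤ Q ^ 7 * √t := by positivity
          linarith
  · intro k _
    rw [dcov_eq, Complex.ofReal_re]
    refine (quart_tail r H.hr hQ H.hb H.hS k).trans ?_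
    gcongr
    linarith [hQp 0 (by norm_num), pow_pos hQ0 7]
  · intro k _
    rw [dcov_eq, Complex.ofReal_re]
    refine (mul_le_mul_of_nonneg_left (quad_tail r H.hr hQ H.hb H.hS k) (sq_nonneg B)).trans ?_
    calc B ^ 2 * (Q ^ 3 * N ^ 2 / (2 ^ k) ^ 8) ≤ Q ^ 2 / N ^ 2 * (Q ^ 3 * N ^ 2 / (2 ^ k) ^ 8) := by gcongr
      _ = Q ^ 5 / (2 ^ k) ^ 8 := by field_simp
      _ ≤ _ := by
        gcongr
        linarith [hQp 5 (by norm_num), pow_pos hQ0 7]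
  · rw [hcard]
    calc 4 * (N:ℝ) ^ 2 * (Q / (2 * N) * ∑ w : Lat N, ew N w) ^ 2 ≤ 4 * (N:ℝ) ^ 2 * (Q / (2 * N) * (Q * n)) ^ 2 := by gcongr
      _ = Q ^ 4 * n ^ 2 := by field_simp; ring
      _ ≤ Q ^ 4 * (2 * √T) := by gcongr
      _ ≤ 32 * Q ^ 7 * √T := by
          have := hQp 4 (by norm_num)
          have h5 := mul_le_mul_of_nonneg_right this (Real.sqrt_nonneg T)
          have h6 : 0 ≤ Q ^ 7 * √T := by positivity
          linarith
  · rw [hcard, ← sq_abs s]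
    have := H.hs2
    calc 4 * (N:ℝ) ^ 2 * |s| ^ 2 ≤ 4 * (N:ℝ) ^ 2 * (Q * n / N) ^ 2 := by gcongr
      _ = 4 * Q ^ 2 * n ^ 2 := by field_simp
      _ ≤ 4 * Q ^ 2 * (2 * √T) := by gcongr
      _ ≤ 32 * Q ^ 7 * √T := by
          have := hQp 2 (by norm_num)
          have h5 := mul_le_mul_of_nonneg_right this (Real.sqrt_nonneg T)
          have h6 : 0 ≤ Q ^ 7 * √T := by positivity
          linarith
  · rw [hcard]
    calc 4 * (N:ℝ) ^ 2 * B ^ 2 ≤ 4 * (N:ℝ) ^ 2 * (Q ^ 2 / N ^ 2) := by gcongr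
      _ = 4 * Q ^ 2 := by field_simp
      _ ≤ _ := by linarith [hQp 2 (by norm_num), pow_pos hQ0 7]
  · rw [hcard]
    calc 4 * (N:ℝ) ^ 2 * (Q / (2 * N) * ∑ w : Lat N, ew N w) ^ 3 * T ^ 3
        ≤ 4 * (N:ℝ) ^ 2 * (Q / (2 * N) * (Q * n)) ^ 3 * (n ^ 4) ^ 3 := by gcongr
      _ = Q ^ 6 / 2 * n ^ 15 / N := by field_simp; ring
      _ ≤ Q ^ 6 / 2 * n ^ 512 / N := by gcongr <;> norm_num
      _ = Q ^ 6 / 2 := by rw [hn512]; field_simp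
      _ ≤ _ := by linarith [hQp 6 (by norm_num), pow_pos hQ0 7]
  · intro g
    have e : ∀ x w, (alW r x w).im = hart w x * (csq (r w)).im := by
      intro x w; unfold alW; rw [Complex.im_ofReal_mul]
    simp only [e]
    have e2 : ∑ x : Lat N, (∑ w, hart w x * (csq (r w)).im * g w) ^ 2 = ∑ w, ((csq (r w)).im * g w) ^ 2 := by
      have : ∀ x : Lat N, (∑ w, hart w x * (csq (r w)).im * g w) ^ 2 =
          ∑ w, ∑ v, ((csq (r w)).im * g w) * ((csq (r v)).im * g v) * (hart w x * hart v x) := by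
        intro x
        rw [sq, Finset.sum_mul_sum]
        exact Finset.sum_congr rfl (fun w _ => Finset.sum_congr rfl (fun v _ => by ring))
      simp only [this]
      rw [Finset.sum_comm]
      refine Finset.sum_congr rfl (fun w _ => ?_)
      rw [Finset.sum_comm]
      simp only [← Finset.mul_sum, hart_orth]
      simp [sq]
    rw [e2, Finset.mul_sum]
    refine Finset.sum_le_sum (fun w _ => ?_)
    rw [mul_pow, csq_im]
    split_ifs with h
    · have := sq_nonneg (g w); norm_num; positivity
    · push Not at h
      rw [Real.sq_sqrt (by linarith)]
      have := H.hneg w h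
      rw [abs_of_neg h] at this
      gcongr

lemma RHyp.extra {r : Lat N → ℝ} {s B a Q : ℝ} {kmax : ℕ} (H : RHyp N r s B a Q kmax) :
    (∑ x, ∑ y, (bq (alW r x) (cj (alW r y))) ^ 4).re ≤ 32 * Q ^ 7 ∧
    B ^ 2 * (∑ x, ∑ y, (bq (alW r x) (cj (alW r y))) ^ 2).re ≤ 32 * Q ^ 7 := by
  have hN : (0:ℝ) < N := by exact_mod_cast N_pos (N := N)
  have hQ := H.hQ
  have hQ0 : 0 < Q := by linarith
  have hB2 : B ^ 2 ≤ Q ^ 2 / N ^ 2 := by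
    rw [← sq_abs, ← div_pow]
    have := H.hB
    gcongr
  have hQp : ∀ j, j ≤ 7 → Q ^ j ≤ Q ^ 7 := fun j hj => pow_le_pow_right₀ hQ hj
  have h4 := quart_full r H.hr hQ H.hb H.hS
  have h2 := quad_full r H.hr hQ H.hb H.hS
  have e : ∀ n : ℕ, (∑ x, ∑ y, (bq (alW r x) (cj (alW r y))) ^ n).re = ∑ x, ∑ y, Cf (fun w => |r w|) x y ^ n := by
    intro n
    simp only [bq_aa, ← Complex.ofReal_pow, ← Complex.ofReal_sum, Complex.ofReal_re]
  rw [e, e]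
  constructor
  · linarith [pow_pos hQ0 7]
  · calc _ ≤ B ^ 2 * (Q ^ 3 * N ^ 2) := by gcongr
      _ ≤ Q ^ 2 / N ^ 2 * (Q ^ 3 * N ^ 2) := by gcongr
      _ = Q ^ 5 := by field_simp
      _ ≤ _ := by linarith [hQp 5 (by norm_num), pow_pos hQ0 7]

end StabLat

/-! ### Part G9: scalar bounds at criticality -/

section Crit

variable {N : ℕ} [NeZero N]

lemma KB.one_sub_pos {k : Lat N → ℝ} {C0 c1 : ℝ} (H : KB N k C0 c1) (hc : 0 < c1) {w : Lat N} (hw : w ≠ 0) :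
    0 < 1 - lamW k w := by
  have hN : (0:ℝ) < N := by exact_mod_cast N_pos (N := N)
  have h1 := nsq_ge_one hw
  refine lt_of_lt_of_le ?_ (H.lo w)
  have : 0 < min 1 (nsq N w / N) := lt_min one_pos (by positivity)
  positivity

lemma KB.lam_abs {k : Lat N → ℝ} {C0 c1 : ℝ} (H : KB N k C0 c1) (w : Lat N) : |lamW k w| ≤ 1 :=
  lamW_abs k H.knn H.ksum w

lemma KB.f1 {k : Lat N → ℝ} {C0 c1 : ℝ} (H : KB N k C0 c1) (hC : 1 ≤ C0) (hc : 0 < c1) {w : Lat N} (hw : w ≠ 0) :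
    |lamW k w| / (1 - lamW k w) ≤ 2 * C0 / c1 * N * ew N w := by
  have hN : (0:ℝ) < N := by exact_mod_cast N_pos (N := N)
  have h1 := nsq_ge_one hw
  have hp := H.one_sub_pos hc hw
  have hl := H.lo w
  have hd := H.dec w
  have ha := H.lam_abs w
  have ha0 := abs_nonneg (lamW k w)
  unfold ew
  rw [div_le_iff₀ hp]
  have : |lamW k w| * (1 + nsq N w) * c1 ≤ 2 * C0 * N * (1 - lamW k w) := by
    rcases le_total (nsq N w / N) 1 with h | h
    · rw [min_eq_right h] at hl
      have e : c1 * nsq N w ≤ N * (1 - lamW k w) := by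
        have := mul_le_mul_of_nonneg_left hl hN.le
        calc c1 * nsq N w = N * (c1 * (nsq N w / N)) := by field_simp
          _ ≤ _ := this
      calc |lamW k w| * (1 + nsq N w) * c1 ≤ 1 * (nsq N w + nsq N w) * c1 := by gcongr
        _ = 2 * (c1 * nsq N w) := by ring
        _ ≤ 2 * (N * (1 - lamW k w)) := by gcongr
        _ ≤ C0 * (2 * (N * (1 - lamW k w))) := le_mul_of_one_le_left (by positivity) hC
        _ = _ := by ring
    · rw [min_eq_left h, mul_one] at hl
      calc |lamW k w| * (1 + nsq N w) * c1 ≤ |lamW k w| * (nsq N w + nsq N w) * c1 := by gcongr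
        _ = 2 * (|lamW k w| * nsq N w) * c1 := by ring
        _ ≤ 2 * (C0 * N) * (1 - lamW k w) := by gcongr
        _ = _ := by ring
  have hns := nsq_nonneg w
  rw [show 2 * C0 / c1 * N * (1 + nsq N w)⁻¹ * (1 - lamW k w) = (2 * C0 * N * (1 - lamW k w)) / (c1 * (1 + nsq N w)) by
    field_simp]
  rw [le_div_iff₀ (by positivity)]
  linarith

/-- half comparison of denominators -/
lemma KB.half {k : Lat N → ℝ} {C0 c1 : ℝ} (H : KB N k C0 c1) {τ : ℝ} (h0 : 0 ≤ τ) (h1 : τ ≤ 1) (w : Lat N) :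
    (1 - lamW k w) / 2 ≤ 1 - τ * lamW k w := by
  have ha := abs_le.1 (H.lam_abs w)
  rcases le_total 0 (lamW k w) with h | h
  · nlinarith
  · nlinarith

lemma KB.den_pos {k : Lat N → ℝ} {C0 c1 : ℝ} (H : KB N k C0 c1) {τ : ℝ} (h0 : 0 ≤ τ) (h1 : τ < 1) (w : Lat N) :
    0 < 1 - τ * lamW k w := by
  have ha := abs_le.1 (H.lam_abs w)
  nlinarith

lemma KB.f2 {k : Lat N → ℝ} {C0 c1 : ℝ} (H : KB N k C0 c1) (hC : 1 ≤ C0) (hc : 0 < c1) (hc1 : c1 ≤ 1) {τ : ℝ} (h0 : 0 ≤ τ)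
    (h1 : 1 ≤ N * (1 - τ)) (w : Lat N) :
    |lamW k w| / (1 - τ * lamW k w) ≤ 2 * (2 * C0 / c1) * N * ew N w := by
  have hN : (0:ℝ) < N := by exact_mod_cast N_pos (N := N)
  have ht : τ < 1 := by by_contra h; push Not at h; nlinarith
  by_cases hw : w = 0
  · subst hw
    rw [lamW_zero k H.ksum, ew_zero, abs_one, mul_one, mul_one]
    have e1 : 1 / (1 - τ) ≤ N := by
      rw [div_le_iff₀ (by linarith)]; exact h1
    have e2 : 1 ≤ C0 / c1 := by rw [le_div_iff₀ hc]; linarith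
    have e3 : 2 * C0 / c1 = 2 * (C0 / c1) := by ring
    rw [e3]
    nlinarith
  · have h := H.f1 hC hc hw
    have hp := H.one_sub_pos hc hw
    have hh := H.half h0 ht.le w
    calc |lamW k w| / (1 - τ * lamW k w) ≤ |lamW k w| / ((1 - lamW k w) / 2) := by gcongr
      _ = 2 * (|lamW k w| / (1 - lamW k w)) := by field_simp
      _ ≤ 2 * (2 * C0 / c1 * N * ew N w) := by gcongr
      _ = _ := by ring

/-- the multiplier -/
def rW (k : Lat N → ℝ) (β τ : ℝ) (w : Lat N) : ℝ := β * lamW k w / (1 - τ * lamW k w)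

lemma cGamma_eq (k : Lat N → ℝ) : cGamma N k (gam N) =
    (∑ w : Lat N, if w = 0 then 0 else lamW k w ^ 2 / (1 - lamW k w)) / (4 * N) := by
  have hN : (0:ℝ) < N := by exact_mod_cast N_pos (N := N)
  unfold cGamma
  rw [gam_sq, inv_inv, Finset.mul_sum, Finset.sum_div]
  refine Finset.sum_congr rfl (fun w _ => ?_)
  rw [kHat_eq]
  split_ifs
  · simp
  · rw [← div_div, div_div _ (N:ℝ), mul_comm (N:ℝ) (1 - lamW k w), ← div_div]
    ring

lemma KB.cG_nonneg {k : Lat N → ℝ} {C0 c1 : ℝ} (H : KB N k C0 c1) (hc : 0 < c1) : 0 ≤ cGamma N k (gam N) := by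
  rw [cGamma_eq]
  apply div_nonneg _ (by positivity)
  refine Finset.sum_nonneg (fun w _ => ?_)
  split_ifs with h
  · exact le_rfl
  · have := H.one_sub_pos hc h
    positivity

lemma KB.cG_le {k : Lat N → ℝ} {C0 c1 : ℝ} (H : KB N k C0 c1) (hC : 1 ≤ C0) (hc : 0 < c1) :
    cGamma N k (gam N) ≤ 2 * C0 / c1 * ∑ w : Lat N, ew N w := by
  have hN : (0:ℝ) < N := by exact_mod_cast N_pos (N := N)
  have hE0 : 0 ≤ ∑ w : Lat N, ew N w := Finset.sum_nonneg (fun w _ => (ew_pos w).le)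
  rw [cGamma_eq, div_le_iff₀ (by positivity)]
  have : (∑ w : Lat N, if w = 0 then 0 else lamW k w ^ 2 / (1 - lamW k w)) ≤ ∑ w : Lat N, 2 * C0 / c1 * N * ew N w := by
    refine Finset.sum_le_sum (fun w _ => ?_)
    have := ew_pos w
    split_ifs with h
    · positivity
    · refine le_trans ?_ (H.f1 hC hc h)
      have hp := H.one_sub_pos hc h
      have ha := H.lam_abs w
      gcongr
      rw [← sq_abs]
      nlinarith [abs_nonneg (lamW k w)]
  refine this.trans ?_
  rw [← Finset.mul_sum]
  have : 0 ≤ 2 * C0 / c1 * N * ∑ w : Lat N, ew N w := by positivity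
  nlinarith

/-- the diagonal of the covariance -/
lemma KB.a_bound {k : Lat N → ℝ} {C0 c1 : ℝ} (H : KB N k C0 c1) (hC : 1 ≤ C0) (hc : 0 < c1) (hc1 : c1 ≤ 1) {τ β m Qs : ℝ}
    (h0 : 0 ≤ τ) (hm : 1 ≤ m) (hτ : N * (1 - τ) = m) (hβ0 : 0 ≤ β) (hβ : β ≤ 2) (hQs : 1 ≤ Qs)
    (hS : ∑ w : Lat N, ew N w ^ (7/6 : ℝ) ≤ Qs) :
    |(∑ w, rW k β τ w) / (4 * N ^ 2) - β * (cGamma N k (gam N) / N)| ≤ (1 + m * (2 * C0 / c1) ^ 2 * Qs) / N := by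
  have hN : (0:ℝ) < N := by exact_mod_cast N_pos (N := N)
  have hN1 : (1:ℝ) ≤ N := by exact_mod_cast N_pos (N := N)
  have ht : τ < 1 := by by_contra h; push Not at h; nlinarith
  set R2 := ∑ w : Lat N, if w = 0 then 0 else lamW k w ^ 2 / ((1 - τ * lamW k w) * (1 - lamW k w)) with hR2
  set S1 := ∑ w : Lat N, if w = 0 then 0 else lamW k w ^ 2 / (1 - lamW k w) with hS1
  have hcG : cGamma N k (gam N) = S1 / (4 * N) := cGamma_eq k
  have hR0 : 0 ≤ R2 := by
    refine Finset.sum_nonneg (fun w _ => ?_)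
    split_ifs with h
    · exact le_rfl
    · have := H.one_sub_pos hc h
      have := H.den_pos h0 ht w
      positivity
  have hR1 : R2 ≤ 2 * (2 * C0 / c1) ^ 2 * N ^ 2 * Qs := by
    have hs2 : ∑ w : Lat N, ew N w ^ 2 ≤ Qs := by
      refine le_trans (Finset.sum_le_sum (fun w _ => ?_)) hS
      rw [← Real.rpow_natCast]
      exact Real.rpow_le_rpow_of_exponent_ge (ew_pos w) (ew_le_one w) (by norm_num)
    calc R2 ≤ ∑ w : Lat N, 2 * (2 * C0 / c1) ^ 2 * N ^ 2 * ew N w ^ 2 := by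
          refine Finset.sum_le_sum (fun w _ => ?_)
          split_ifs with h
          · positivity
          · have p1 := H.one_sub_pos hc h
            have p2 := H.den_pos h0 ht w
            have f1 := H.f1 hC hc h
            have f2 := H.f2 hC hc hc1 h0 (by linarith) w
            calc lamW k w ^ 2 / ((1 - τ * lamW k w) * (1 - lamW k w))
                = (|lamW k w| / (1 - τ * lamW k w)) * (|lamW k w| / (1 - lamW k w)) := by
                  rw [div_mul_div_comm, ← sq, sq_abs]
              _ ≤ (2 * (2 * C0 / c1) * N * ew N w) * (2 * C0 / c1 * N * ew N w) := by
                  have := ew_pos w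
                  gcongr
              _ = _ := by ring
      _ = 2 * (2 * C0 / c1) ^ 2 * N ^ 2 * ∑ w : Lat N, ew N w ^ 2 := by rw [Finset.mul_sum]
      _ ≤ _ := by gcongr
  have hid : ∑ w, rW k β τ w = β * (N / m + S1 - 1 - m / N * R2) := by
    have e : ∀ w : Lat N, rW k β τ w = β * ((if w = 0 then (N / m - 1 : ℝ) else 0) + (if w = 0 then 0 else lamW k w ^ 2 / (1 - lamW k w))
        + lamW k w - m / N * (if w = 0 then 0 else lamW k w ^ 2 / ((1 - τ * lamW k w) * (1 - lamW k w)))) := by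
      intro w
      unfold rW
      by_cases h : w = 0
      · subst h
        simp only [if_true, lamW_zero k H.ksum, mul_one, mul_zero]
        have : (1 - τ) ≠ 0 := by linarith
        rw [← hτ]; field_simp; ring
      · simp only [if_neg h]
        have p1 := H.one_sub_pos hc h
        have p2 := H.den_pos h0 ht w
        have e3 : m / N = 1 - τ := by rw [← hτ]; field_simp
        rw [e3]
        have q1 : (1 - lamW k w) ≠ 0 := p1.ne'
        have q2 : (1 - τ * lamW k w) ≠ 0 := p2.ne'
        have hd : ∀ l u v : ℝ, v ≠ 0 → u ≠ 0 → v = 1 - l → u = 1 - τ * l →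
            β * l / u = β * (0 + l ^ 2 / v + l - (1 - τ) * (l ^ 2 / (u * v))) := by
          intro l u v hv hu e1 e2
          field_simp
          rw [e1, e2]; ring
        exact hd _ _ _ q1 q2 rfl rfl
    simp only [e]
    rw [← Finset.mul_sum, Finset.sum_sub_distrib, Finset.sum_add_distrib, Finset.sum_add_distrib, ← Finset.mul_sum,
      lamW_sum k H.keven H.k0, ← hR2, ← hS1]
    simp only [Finset.sum_ite_eq', Finset.mem_univ, if_true]
    ring
  rw [hid, hcG]
  have e4 : β * (N / m + S1 - 1 - m / N * R2) / (4 * N ^ 2) - β * (S1 / (4 * N) / N) =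
      β / (4 * N ^ 2) * (N / m - 1 - m / N * R2) := by
    field_simp; ring
  rw [e4, abs_mul, abs_of_nonneg (by positivity)]
  have hNm : N / m ≤ N := div_le_self hN.le hm
  have hNm0 : 0 ≤ N / m := by positivity
  have hmR : m / N * R2 ≤ 2 * m * (2 * C0 / c1) ^ 2 * N * Qs := by
    calc m / N * R2 ≤ m / N * (2 * (2 * C0 / c1) ^ 2 * N ^ 2 * Qs) := by gcongr
      _ = _ := by field_simp
  have hmR0 : 0 ≤ m / N * R2 := by positivity
  have habs : |N / m - 1 - m / N * R2| ≤ 2 * N * (1 + m * (2 * C0 / c1) ^ 2 * Qs) := by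
    have : 2 * m * (2 * C0 / c1) ^ 2 * N * Qs = 2 * N * (m * (2 * C0 / c1) ^ 2 * Qs) := by ring
    rw [abs_le]
    constructor <;> nlinarith
  calc β / (4 * N ^ 2) * |N / m - 1 - m / N * R2| ≤ 2 / (4 * N ^ 2) * (2 * N * (1 + m * (2 * C0 / c1) ^ 2 * Qs)) := by gcongr
    _ = _ := by field_simp; ring

lemma log_pow_bounds : ((2:ℝ) ^ (Nat.log 2 N / 128)) ^ 128 ≤ N ∧ (N : ℝ) ≤ (2 * (2:ℝ) ^ (Nat.log 2 N / 128)) ^ 128 := by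
  have hN := N_pos (N := N)
  constructor
  · have h1 : 2 ^ (Nat.log 2 N / 128 * 128) ≤ N :=
      (Nat.pow_le_pow_right (by norm_num) (Nat.div_mul_le_self _ _)).trans (Nat.pow_log_le_self 2 hN.ne')
    rw [← pow_mul]
    exact_mod_cast h1
  · have h1 : N ≤ 2 ^ ((Nat.log 2 N / 128 + 1) * 128) := by
      refine (Nat.lt_pow_succ_log_self (by norm_num) N).le.trans (Nat.pow_le_pow_right (by norm_num) ?_)
      omega
    rw [← pow_succ', ← pow_mul]
    exact_mod_cast h1

/-- real-number part of the bound on `B` -/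
lemma B_real {n x G m A cG β τ aa K1 : ℝ} (hn : 1 ≤ n) (hx : x ^ 2 = n) (hx0 : 0 < x) (hG : 1 ≤ G) (hm : m = 1 + |A|)
    (hcG0 : 0 ≤ cG) (hcG : cG ≤ G * x) (hβ : β = 1 + n⁻¹ * (cG + A)) (hτ : n * (1 - τ) = m)
    (hbig : 10 ^ 4 * (G + 2 * m) ≤ x) (ha : |aa - β * (cG / n)| ≤ K1 / n) :
    |β - 1| ≤ 1 / 10 ^ 4 ∧ |1 - τ / β| ≤ 2 * (cG + 2 * m) / n ∧ |1 - τ / β| ≤ 1 / 1000 ∧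
      |1 - τ / β - aa| ≤ (K1 + 4 * m + 3 * (G ^ 2 + G * m)) / n := by
  have hA0 := abs_nonneg A
  have hm1 : 1 ≤ m := by linarith
  have hn0 : 0 < n := by linarith
  have hx1 : 1 ≤ x := by nlinarith
  have hA1 := abs_le.1 (le_refl |A|)
  have hd : |β - 1| ≤ (cG + m) / n := by
    have : β - 1 = (cG + A) / n := by rw [hβ]; field_simp; ring
    rw [this, abs_div, abs_of_pos hn0]
    gcongr
    rw [abs_le]; constructor <;> linarith
  have hd2 : (cG + 2 * m) / n ≤ 1 / 10 ^ 4 := by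
    rw [div_le_iff₀ hn0, ← hx]
    nlinarith
  have hd3 : |β - 1| ≤ 1 / 10 ^ 4 := hd.trans (le_trans (by gcongr; linarith) hd2)
  have hd4 := abs_le.1 hd3
  have hβ0 : 1/2 ≤ β := by norm_num at hd4 ⊢; linarith
  have hβp : 0 < β := by linarith
  have hs : 1 - τ / β = (cG + A + m) / n / β := by
    have e1 : τ = 1 - m / n := by rw [← hτ]; field_simp; ring
    have e2 : β * n = n + cG + A := by rw [hβ]; field_simp; ring
    rw [e1]
    field_simp
    linarith
  have hs2 : |1 - τ / β| ≤ 2 * (cG + 2 * m) / n := by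
    rw [hs, abs_div, abs_div, abs_of_pos hn0, abs_of_pos hβp, div_le_iff₀ hβp]
    have e3 : |cG + A + m| ≤ cG + 2 * m := by rw [abs_le]; constructor <;> linarith
    calc |cG + A + m| / n ≤ (cG + 2 * m) / n := by gcongr
      _ = 2 * (cG + 2 * m) / n * (1/2) := by ring
      _ ≤ _ := by gcongr
  refine ⟨hd3, hs2, ?_, ?_⟩
  · refine hs2.trans ?_
    rw [mul_div_assoc]
    norm_num at hd2 ⊢
    linarith
  · have e5 : 1 - τ / β - aa = (cG / n * ((1 - β) * (1 + β) / β) + (A + m) / n / β) - (aa - β * (cG / n)) := by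
      rw [hs]; field_simp; ring
    have e6 : |(1 - β) * (1 + β) / β| ≤ 3 * ((cG + m) / n) := by
      rw [abs_div, abs_mul, abs_of_pos hβp, abs_of_pos (by linarith : 0 < 1 + β), div_le_iff₀ hβp, abs_sub_comm]
      have e7 : 1 + β ≤ 3 * β := by linarith
      calc |β - 1| * (1 + β) ≤ ((cG + m) / n) * (3 * β) := by gcongr
        _ = _ := by ring
    have e8 : |cG / n * ((1 - β) * (1 + β) / β)| ≤ 3 * (G ^ 2 + G * m) / n := by
      rw [abs_mul, abs_of_nonneg (by positivity)]
      calc cG / n * |(1 - β) * (1 + β) / β| ≤ cG / n * (3 * ((cG + m) / n)) := by gcongr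
        _ = 3 * (cG * (cG + m)) / n / n := by field_simp
        _ ≤ 3 * ((G * x) * (G * x + m * x)) / n / n := by
            gcongr
            nlinarith
        _ = _ := by rw [← hx]; field_simp
    have e9 : |(A + m) / n / β| ≤ 4 * m / n := by
      rw [abs_div, abs_div, abs_of_pos hn0, abs_of_pos hβp, div_le_iff₀ hβp]
      have : |A + m| ≤ 2 * m := by rw [abs_le]; constructor <;> linarith
      calc |A + m| / n ≤ 2 * m / n := by gcongr
        _ = 4 * m / n * (1 / 2) := by ring
        _ ≤ _ := by gcongr
    rw [e5]
    calc _ ≤ |cG / n * ((1 - β) * (1 + β) / β) + (A + m) / n / β| + |aa - β * (cG / n)| := abs_sub _ _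
      _ ≤ |cG / n * ((1 - β) * (1 + β) / β)| + |(A + m) / n / β| + |aa - β * (cG / n)| := by gcongr; exact abs_add_le _ _
      _ ≤ 3 * (G ^ 2 + G * m) / n + 4 * m / n + K1 / n := by gcongr
      _ = _ := by ring

end Crit

/-! ### Part G10: exponential moments under the critical Gibbs measure -/

section ExpMom

lemma neg_real {β τ l : ℝ} (hβ : β ≤ 1.01) (hτ : 0.99 ≤ τ) (hl : l ≤ 0) (hl1 : -1 ≤ l) :
    -(β * l) ≤ 0.52 * (1 - τ * l) := by
  have h1 : β * (-l) ≤ 1.01 * (-l) := mul_le_mul_of_nonneg_right hβ (by linarith)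
  have h2 : 0.99 * (-l) ≤ τ * (-l) := mul_le_mul_of_nonneg_right hτ (by linarith)
  norm_num at h1 h2 ⊢
  linarith

set_option maxHeartbeats 1000000 in
lemma crit_hyp (A : ℝ) {C0 c1 : ℝ} (hC : 1 ≤ C0) (hc : 0 < c1) (hc1 : c1 ≤ 1) :
    ∃ Q : ℝ, ∃ N₀ : ℕ, 1 ≤ Q ∧ ∀ (N : ℕ) [NeZero N], N₀ ≤ N → ∀ k : Lat N → ℝ, KB N k C0 c1 →
      ∀ β τ : ℝ, β = 1 + (gam N) ^ 2 * (cGamma N k (gam N) + A) → τ = 1 - (1 + |A|) / N →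
      1/2 ≤ β ∧ 0 ≤ τ ∧ τ < 1 ∧
      RHyp N (rW k β τ) (1 - τ / β) (1 - τ / β - (∑ w, rW k β τ w) / (4 * N ^ 2)) ((∑ w, rW k β τ w) / (4 * N ^ 2)) Q
        (Nat.log 2 N / 128) := by
  obtain ⟨Qs, hQs, hS⟩ := ew_sum (7/6) (by norm_num)
  obtain ⟨Qc, hQc, hcut⟩ := ew_sum_cut (1/2048) (by norm_num)
  obtain ⟨q, hq⟩ : ∃ q : ℝ, q = 2 * C0 / c1 := ⟨_, rfl⟩
  have hq1 : 1 ≤ q := by rw [hq, le_div_iff₀ hc]; linarith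
  obtain ⟨G, hG⟩ : ∃ G : ℝ, G = q * Qc := ⟨_, rfl⟩
  have hG1 : 1 ≤ G := by rw [hG]; nlinarith
  obtain ⟨m, hm⟩ : ∃ m : ℝ, m = 1 + |A| := ⟨_, rfl⟩
  have hm1 : 1 ≤ m := by rw [hm]; linarith [abs_nonneg A]
  refine ⟨4 * q + Qs + Qc + ((1 + m * q ^ 2 * Qs) + 4 * m + 3 * (G ^ 2 + G * m)) + 2 * (G + 2 * m),
    ⌈(10 ^ 4 * (G + 2 * m)) ^ 2⌉₊ + 8100, ?_, ?_⟩
  · have : 0 ≤ ((1 + m * q ^ 2 * Qs) + 4 * m + 3 * (G ^ 2 + G * m)) + 2 * (G + 2 * m) := by positivity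
    linarith
  intro N _ hN0 k H β τ hβ hτ
  rw [← hm] at hτ
  have hN : (0:ℝ) < N := by exact_mod_cast N_pos (N := N)
  have hN0' : ((⌈(10 ^ 4 * (G + 2 * m)) ^ 2⌉₊ : ℕ) : ℝ) + 8100 ≤ N := by exact_mod_cast hN0
  have hceil := Nat.le_ceil ((10 ^ 4 * (G + 2 * m)) ^ 2)
  have hNbig : (10 ^ 4 * (G + 2 * m)) ^ 2 ≤ N := by linarith
  have hN8 : (8100:ℝ) ≤ N := by
    have : (0:ℝ) ≤ ((⌈(10 ^ 4 * (G + 2 * m)) ^ 2⌉₊ : ℕ) : ℝ) := by positivity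
    linarith
  have hx : √(N:ℝ) ^ 2 = N := Real.sq_sqrt hN.le
  have hx0 : 0 < √(N:ℝ) := Real.sqrt_pos.2 hN
  have hbig : 10 ^ 4 * (G + 2 * m) ≤ √(N:ℝ) := Real.le_sqrt_of_sq_le hNbig
  have hmN : m * 10 ^ 4 ≤ N := by nlinarith
  have hτm : N * (1 - τ) = m := by rw [hτ]; field_simp; ring
  have hτ1 : τ < 1 := by rw [hτ]; have : 0 < m / N := by positivity
                         linarith
  have hτ2 : 1 - 1 / 10 ^ 4 ≤ τ := by
    rw [hτ]
    have : m / N ≤ 1 / 10 ^ 4 := by rw [div_le_iff₀ hN]; linarith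
    linarith
  have hτ0 : 0 ≤ τ := by norm_num at hτ2; linarith
  have hcG0 := H.cG_nonneg hc
  have hEn : ∑ w : Lat N, ew N w ≤ Qc * (N:ℝ) ^ (1/512 : ℝ) := by
    have h := hcut N (2 * N ^ 2) (by positivity)
    rw [Finset.sum_congr rfl (fun w _ => if_pos (nsq_le w))] at h
    refine h.trans ?_
    have : (1 + 2 * (N:ℝ) ^ 2) ^ (1/2048 : ℝ) ≤ (((N:ℝ) ^ 4)) ^ (1/2048:ℝ) := by
      apply Real.rpow_le_rpow (by positivity) _ (by norm_num)
      have : (8100:ℝ)^2 ≤ (N:ℝ)^2 := by gcongr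
      nlinarith
    have e : (((N:ℝ) ^ 4)) ^ (1/2048:ℝ) = (N:ℝ) ^ (1/512 : ℝ) := by
      rw [← Real.rpow_natCast, ← Real.rpow_mul (by positivity)]; norm_num
    rw [e] at this
    gcongr
  have hcGn : cGamma N k (gam N) ≤ G * (N:ℝ) ^ (1/512 : ℝ) := by
    refine (H.cG_le hC hc).trans ?_
    rw [← hq, hG, mul_assoc]
    gcongr
  have hn1 : 1 ≤ (N:ℝ) ^ (1/512 : ℝ) := Real.one_le_rpow (by linarith) (by norm_num)
  have hnx : (N:ℝ) ^ (1/512 : ℝ) ≤ √(N:ℝ) := by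
    rw [Real.sqrt_eq_rpow]
    exact Real.rpow_le_rpow_of_exponent_le (by linarith) (by norm_num)
  have hcGx : cGamma N k (gam N) ≤ G * √(N:ℝ) := hcGn.trans (by gcongr)
  rw [gam_sq] at hβ
  -- first bounds on beta
  have hb0 := B_real (aa := β * (cGamma N k (gam N) / N)) (K1 := 0) (by linarith) hx hx0 hG1 hm hcG0 hcGx hβ hτm hbig (by simp)
  have hd4 := abs_le.1 hb0.1
  norm_num at hd4
  have hβ0 : 1/2 ≤ β := by norm_num; linarith
  have hβ2 : β ≤ 2 := by linarith
  have hab := H.a_bound hC hc hc1 hτ0 hm1 hτm (by linarith) hβ2 hQs (hS N)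
  rw [← hq] at hab
  obtain ⟨-, hs2, hs3, hs4⟩ := B_real (by linarith) hx hx0 hG1 hm hcG0 hcGx hβ hτm hbig hab
  have hX : 0 ≤ (1 + m * q ^ 2 * Qs) + 4 * m + 3 * (G ^ 2 + G * m) := by positivity
  have hY : 0 ≤ 2 * (G + 2 * m) := by positivity
  refine ⟨hβ0, hτ0, hτ1, ⟨by linarith, ?_, ?_, ?_, ?_, (hS N).trans (by linarith), ?_, log_pow_bounds.1, log_pow_bounds.2,
    hN8, rfl, by ring, ?_, hs3, ?_⟩⟩
  · intro w; unfold rW; rw [lamW_neg]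
  · intro w
    have h := H.f2 hC hc hc1 hτ0 (by linarith) w
    rw [← hq] at h
    unfold rW
    rw [abs_div, abs_mul, abs_of_pos (H.den_pos hτ0 hτ1 w), abs_of_pos (by linarith : 0 < β), mul_div_assoc]
    have := ew_pos w
    have hp : 0 ≤ N * ew N w := by positivity
    calc β * (|lamW k w| / (1 - τ * lamW k w)) ≤ 2 * (2 * q * N * ew N w) := by
          have := div_nonneg (abs_nonneg (lamW k w)) (H.den_pos hτ0 hτ1 w).le
          gcongr
      _ = (4 * q) * (N * ew N w) := by ring
      _ ≤ (4 * q + Qs + Qc + ((1 + m * q ^ 2 * Qs) + 4 * m + 3 * (G ^ 2 + G * m)) + 2 * (G + 2 * m)) * (N * ew N w) := by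
          apply mul_le_mul_of_nonneg_right _ hp
          linarith
      _ = _ := by ring
  · intro w hneg
    have hden := H.den_pos hτ0 hτ1 w
    have hl := abs_le.1 (H.lam_abs w)
    have hlam : lamW k w < 0 := by
      by_contra h
      push Not at h
      unfold rW at hneg
      have : 0 ≤ β * lamW k w / (1 - τ * lamW k w) := by positivity
      linarith
    rw [abs_of_neg hneg]
    unfold rW
    rw [← neg_div, div_le_iff₀ hden]
    exact neg_real (by norm_num at hd4 ⊢; linarith) (by norm_num at hτ2 ⊢; linarith) hlam.le hl.1
  · intro w hw
    have hden := H.den_pos hτ0 hτ1 w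
    have hup := H.up w
    have : 45 * nsq N w / N ≤ 1 / 2 := by
      rw [div_le_iff₀ hN]; linarith
    have hlam : 0 ≤ lamW k w := by linarith
    unfold rW
    positivity
  · intro R hR
    refine (hcut N R hR).trans ?_
    gcongr
    linarith
  · refine hs4.trans ?_
    apply div_le_div_of_nonneg_right _ hN.le
    linarith
  · refine hs2.trans ?_
    apply div_le_div_of_nonneg_right _ hN.le
    calc 2 * (cGamma N k (gam N) + 2 * m) ≤ 2 * (G * (N:ℝ) ^ (1/512 : ℝ) + 2 * m * (N:ℝ) ^ (1/512 : ℝ)) := by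
          have := le_mul_of_one_le_right (by linarith : 0 ≤ 2 * m) hn1
          linarith
      _ = 2 * (G + 2 * m) * (N:ℝ) ^ (1/512 : ℝ) := by ring
      _ ≤ _ := by
          apply mul_le_mul_of_nonneg_right _ (by linarith)
          linarith

/-- exponential moments -/
theorem exp_moment (𝔎 : KacProfile) (A : ℝ) : ∃ C1 Q : ℝ, ∃ N₀ : ℕ, 0 < C1 ∧ 1 ≤ Q ∧ ∀ (N : ℕ) [NeZero N], N₀ ≤ N →
    ∀ c : ℝ, 0 < c → (∑ z, kGamma 𝔎 N c (gam N) z) = 1 → KB N (kGamma 𝔎 N c (gam N)) (Q) (1/Q) ∧ ∀ η : Lat N → ℝ,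
      gibbsE N (kGamma 𝔎 N c (gam N)) (betaCrit 𝔎 N c A) 0
        (fun σ => Real.exp (∑ w, lamW (kGamma 𝔎 N c (gam N)) w * η w * shat hart σ w)) ≤
      C1 * Real.exp (Q * N * ∑ w, η w ^ 2 * ew N w) := by
  obtain ⟨C0, c1, N₁, hC, hc, hc1, hKB⟩ := kernel_KB 𝔎
  obtain ⟨Q, N₂, hQ, hcrit⟩ := crit_hyp A hC hc hc1
  obtain ⟨c0, hc0, T0, hlow⟩ := stab_lower (32 * Q ^ 7)
  obtain ⟨K0, hK0⟩ : ∃ K0 : ℕ, T0 ≤ (2:ℝ) ^ K0 := by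
    obtain ⟨n, hn⟩ := pow_unbounded_of_one_lt T0 (by norm_num : (1:ℝ) < 2)
    exact ⟨n, hn.le⟩
  set M := Real.exp (10 ^ 20 * (32 * Q ^ 7) ^ 2) with hM
  refine ⟨(M + 1) / c0, 14 * Q + C0 + 1 / c1, max N₁ (max N₂ (2 ^ (128 * K0))), by positivity, ?_, ?_⟩
  · have : 0 < 1 / c1 := by positivity
    linarith
  intro N _ hN c hcp hsum
  have hN' : (0:ℝ) < N := by exact_mod_cast N_pos (N := N)
  have H := hKB N (le_trans (le_max_left _ _) hN) c hcp hsum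
  set k := kGamma 𝔎 N c (gam N) with hk
  have hc1p : 0 < 1 / c1 := by positivity
  constructor
  · refine ⟨H.knn, H.keven, H.k0, H.ksum, H.up, fun w => le_trans ?_ (H.lo w), fun w => (H.dec w).trans ?_⟩
    · have : 0 ≤ min 1 (nsq N w / N) := le_min zero_le_one (by have := nsq_nonneg w; positivity)
      apply mul_le_mul_of_nonneg_right _ this
      rw [one_div, inv_le_comm₀ (by positivity) hc, ← one_div]
      linarith
    · gcongr
      linarith
  intro η
  obtain ⟨β, hβ⟩ : ∃ β, β = betaCrit 𝔎 N c A := ⟨_, rfl⟩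
  obtain ⟨τ, hτ⟩ : ∃ τ : ℝ, τ = 1 - (1 + |A|) / N := ⟨_, rfl⟩
  obtain ⟨hβ1, hτ0, hτ1, R⟩ := hcrit N (le_trans (le_trans (le_max_left _ _) (le_max_right _ _)) hN) k H β τ hβ hτ
  have S := R.stab
  have E := R.extra
  have hI := stab_integrable S
  have hT : T0 ≤ 2 ^ (Nat.log 2 N / 128) := by
    refine hK0.trans ?_
    apply pow_le_pow_right₀ (by norm_num)
    rw [Nat.le_div_iff_mul_le (by norm_num), mul_comm]
    exact Nat.le_log_of_pow_le (by norm_num) (le_trans (le_trans (le_max_right _ _) (le_max_right _ _)) hN)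
  have hL := hlow S hT E.1 E.2
  have hmain := hs_main (u := hart (N := N)) (ρ := fun w => csq (rW k β τ w)) (lam := lamW k) (β := β) (τ := τ)
    (M := M) hβ1 H.lam_abs hτ0 hτ1 hart_orth (fun i => csq_sq _) hI.1 hI.2.1 hc0 hL η
  unfold gibbsE
  simp only [hamil_hart k H.keven]
  rw [← hβ, div_le_iff₀ (Finset.sum_pos (fun s _ => Real.exp_pos _) Finset.univ_nonempty)]
  simp only [← Real.exp_add]
  refine hmain.trans ?_
  refine mul_le_mul_of_nonneg_right (mul_le_mul_of_nonneg_left (Real.exp_le_exp.2 ?_) (by positivity))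
    (Finset.sum_nonneg (fun s _ => (Real.exp_pos _).le))
  rw [Finset.mul_sum, Finset.mul_sum]
  refine Finset.sum_le_sum (fun w _ => ?_)
  rw [csq_norm]
  have hb := R.hb w
  have := ew_pos w
  calc 14 * (η w ^ 2 * |rW k β τ w|) ≤ 14 * (η w ^ 2 * (Q * N * ew N w)) := by gcongr
    _ = (14 * Q) * (N * (η w ^ 2 * ew N w)) := by ring
    _ ≤ (14 * Q + C0 + 1 / c1) * (N * (η w ^ 2 * ew N w)) := by
      gcongr
      linarith
    _ = _ := by ring

end ExpMom

/-! ### Part H1: moments of linear functionals of the field -/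

section Moments

variable {N : ℕ} [NeZero N]

lemma gibbsE_mono (k : Lat N → ℝ) (β b : ℝ) {F G : (Lat N → ℝ) → ℝ} (h : ∀ σ, F σ ≤ G σ) :
    gibbsE N k β b F ≤ gibbsE N k β b G := by
  unfold gibbsE
  apply div_le_div_of_nonneg_right _ (Finset.sum_nonneg (fun s _ => (Real.exp_pos _).le))
  exact Finset.sum_le_sum (fun s _ => mul_le_mul_of_nonneg_left (h _) (Real.exp_pos _).le)

lemma gibbsE_add (k : Lat N → ℝ) (β b : ℝ) (F G : (Lat N → ℝ) → ℝ) :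
    gibbsE N k β b (fun σ => F σ + G σ) = gibbsE N k β b F + gibbsE N k β b G := by
  unfold gibbsE
  rw [← add_div, ← Finset.sum_add_distrib]
  simp only [mul_add]

lemma gibbsE_mul (k : Lat N → ℝ) (β b : ℝ) (c : ℝ) (F : (Lat N → ℝ) → ℝ) :
    gibbsE N k β b (fun σ => c * F σ) = c * gibbsE N k β b F := by
  unfold gibbsE
  rw [← mul_div_assoc, Finset.mul_sum]
  congr 1
  exact Finset.sum_congr rfl (fun s _ => by ring)

lemma gibbsE_const (k : Lat N → ℝ) (β b : ℝ) (c : ℝ) : gibbsE N k β b (fun _ => c) = c := by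
  unfold gibbsE
  rw [← Finset.sum_mul, mul_div_assoc, mul_comm, div_mul_cancel₀]
  exact (Finset.sum_pos (fun s _ => Real.exp_pos _) Finset.univ_nonempty).ne'

lemma gibbsE_sum (k : Lat N → ℝ) (β b : ℝ) {J : Type*} (S : Finset J) (F : J → (Lat N → ℝ) → ℝ) :
    gibbsE N k β b (fun σ => ∑ j ∈ S, F j σ) = ∑ j ∈ S, gibbsE N k β b (F j) := by
  classical
  induction S using Finset.induction_on with
  | empty => simp [gibbsE_const]
  | insert a S ha ih =>
    simp only [Finset.sum_insert ha]
    rw [gibbsE_add, ih]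

lemma hart_chw_sum (w v : Lat N) : ∑ z, ((hart w z : ℝ) : ℂ) * (starRingEnd ℂ) (chw v z) =
    2 * N * ((1 - Complex.I) / 2 * (if v = w then 1 else 0) + (1 + Complex.I) / 2 * (if v = -w then 1 else 0)) := by
  have hN : (N:ℂ) ≠ 0 := by exact_mod_cast (N_pos (N := N)).ne'
  have e : ∀ z, ((hart w z : ℝ) : ℂ) * (starRingEnd ℂ) (chw v z) =
      (1 - Complex.I) / (4 * N) * chw (w - v) z + (1 + Complex.I) / (4 * N) * chw (-w - v) z := by
    intro z
    rw [sub_eq_add_neg w v, sub_eq_add_neg (-w) v, chw_add_left, chw_add_left, chw_neg_left, chw_neg_left]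
    have hh : ((hart w z : ℝ) : ℂ) = (1 - Complex.I) / (4 * N) * chw w z + (1 + Complex.I) / (4 * N) * (starRingEnd ℂ) (chw w z) := by
      unfold hart
      push_cast
      rw [Complex.re_eq_add_conj, Complex.im_eq_sub_conj]
      field_simp
      linear_combination (4:ℂ) * (chw w z - (starRingEnd ℂ) (chw w z)) * Complex.I_sq
    rw [hh]; ring
  simp only [e]
  rw [Finset.sum_add_distrib, ← Finset.mul_sum, ← Finset.mul_sum, chw_sum, chw_sum]
  have h1 : (w - v = 0) ↔ (v = w) := by rw [sub_eq_zero]; exact eq_comm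
  have h2 : (-w - v = 0) ↔ (v = -w) := by rw [sub_eq_zero]; exact eq_comm
  simp only [h1, h2]
  split_ifs <;> field_simp <;> ring

/-- coefficients of a linear functional in the Hartley basis -/
def zetaW (b : Lat N → ℂ) (w : Lat N) : ℂ :=
  ((2 / √(N:ℝ) : ℝ) : ℂ) * ((1 - Complex.I) / 2 * b w + (1 + Complex.I) / 2 * b (-w))

lemma zetaW_norm (b : Lat N → ℂ) (w : Lat N) : ‖zetaW b w‖ ^ 2 ≤ 4 / N * (‖b w‖ ^ 2 + ‖b (-w)‖ ^ 2) := by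
  have hN : (0:ℝ) < N := by exact_mod_cast N_pos (N := N)
  unfold zetaW
  rw [norm_mul, mul_pow, Complex.norm_real, Real.norm_eq_abs, sq_abs, div_pow, Real.sq_sqrt hN.le]
  have h1 : ‖(1 - Complex.I) / 2‖ ^ 2 = 1 / 2 := by
    rw [← Complex.normSq_eq_norm_sq, Complex.normSq_apply]; norm_num
  have h2 : ‖(1 + Complex.I) / 2‖ ^ 2 = 1 / 2 := by
    rw [← Complex.normSq_eq_norm_sq, Complex.normSq_apply]; norm_num
  have h3 := norm_add_le ((1 - Complex.I) / 2 * b w) ((1 + Complex.I) / 2 * b (-w))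
  have h4 : ‖(1 - Complex.I) / 2 * b w + (1 + Complex.I) / 2 * b (-w)‖ ^ 2 ≤ ‖b w‖ ^ 2 + ‖b (-w)‖ ^ 2 := by
    calc _ ≤ (‖(1 - Complex.I) / 2 * b w‖ + ‖(1 + Complex.I) / 2 * b (-w)‖) ^ 2 := by gcongr
      _ ≤ 2 * (‖(1 - Complex.I) / 2 * b w‖ ^ 2 + ‖(1 + Complex.I) / 2 * b (-w)‖ ^ 2) := add_sq_le
      _ = _ := by rw [norm_mul, norm_mul, mul_pow, mul_pow, h1, h2]; ring
  norm_num
  gcongr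

lemma lin_expand (k : Lat N → ℝ) (hk : ∀ z, k (-z) = k z) (b : Lat N → ℂ) (σ : Lat N → ℝ) :
    ∑ v, b v * dFT N (fun z => ((fluct N k (gam N) σ z : ℝ) : ℂ)) (latRep2 N v) =
      ∑ w, ((lamW k w * shat hart σ w : ℝ) : ℂ) * zetaW b w := by
  have hN : (0:ℝ) < N := by exact_mod_cast N_pos (N := N)
  have hNc : (N:ℂ) ≠ 0 := by exact_mod_cast (N_pos (N := N)).ne'
  have hg : (gam N)⁻¹ = √(N:ℝ) := by
    unfold gam; rw [Real.sqrt_inv, inv_inv]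
  have hd : ∀ v, dFT N (fun z => ((fluct N k (gam N) σ z : ℝ) : ℂ)) (latRep2 N v) =
      ∑ w, ((lamW k w * shat hart σ w : ℝ) : ℂ) * (((2 / √(N:ℝ) : ℝ) : ℂ) *
        ((1 - Complex.I) / 2 * (if v = w then 1 else 0) + (1 + Complex.I) / 2 * (if v = -w then 1 else 0))) := by
    intro v
    unfold dFT fluct
    simp only [conv_hart k hk, hg, ← chw_eW]
    push_cast
    simp only [Finset.mul_sum, Finset.sum_mul]
    rw [Finset.sum_comm]
    refine Finset.sum_congr rfl (fun w _ => ?_)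
    have := hart_chw_sum w v
    have e2 : ((2 : ℂ) / ((√(N:ℝ) : ℝ) : ℂ)) = ((N:ℂ) ^ 2)⁻¹ * ((√(N:ℝ) : ℝ) : ℂ) * (2 * N) := by
      have hs : ((√(N:ℝ) : ℝ) : ℂ) ^ 2 = (N : ℂ) := by
        rw [← Complex.ofReal_pow, Real.sq_sqrt hN.le]; simp
      have hs0 : ((√(N:ℝ) : ℝ) : ℂ) ≠ 0 := by
        intro h; rw [h] at hs; apply hNc; rw [← hs]; simp
      rw [← hs]
      field_simp
    calc _ = (((N:ℂ) ^ 2)⁻¹ * ((√(N:ℝ) : ℝ) : ℂ) * ((lamW k w : ℝ) : ℂ) * ((shat hart σ w : ℝ) : ℂ)) *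
          ∑ z, ((hart w z : ℝ) : ℂ) * (starRingEnd ℂ) (chw v z) := by
            rw [Finset.mul_sum]
            exact Finset.sum_congr rfl (fun z _ => by ring)
      _ = _ := by rw [this, e2]; ring
  simp only [hd, Finset.mul_sum]
  rw [Finset.sum_comm]
  refine Finset.sum_congr rfl (fun w _ => ?_)
  unfold zetaW
  have e3 : ∀ v, b v * (((lamW k w * shat hart σ w : ℝ) : ℂ) * (((2 / √(N:ℝ) : ℝ) : ℂ) *
        ((1 - Complex.I) / 2 * (if v = w then 1 else 0) + (1 + Complex.I) / 2 * (if v = -w then 1 else 0)))) =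
      (if v = w then ((lamW k w * shat hart σ w : ℝ) : ℂ) * (((2 / √(N:ℝ) : ℝ) : ℂ) * ((1 - Complex.I) / 2 * b v)) else 0) +
      (if v = -w then ((lamW k w * shat hart σ w : ℝ) : ℂ) * (((2 / √(N:ℝ) : ℝ) : ℂ) * ((1 + Complex.I) / 2 * b v)) else 0) := by
    intro v
    split_ifs <;> ring
  simp only [e3]
  rw [Finset.sum_add_distrib]
  simp only [Finset.sum_ite_eq', Finset.mem_univ, if_true]
  ring

lemma pow_le_exp_sym (y : ℝ) (n : ℕ) : y ^ (2 * n) ≤ (2 * n).factorial * (Real.exp y + Real.exp (-y)) := by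
  have hf : (0:ℝ) < (2 * n).factorial := by positivity
  have h1 := Real.pow_div_factorial_le_exp |y| (abs_nonneg y) (2 * n)
  rw [div_le_iff₀ hf] at h1
  have h2 : |y| ^ (2 * n) = y ^ (2 * n) := Even.pow_abs (even_two_mul n) y
  rw [h2] at h1
  have h3 : Real.exp |y| ≤ Real.exp y + Real.exp (-y) := by
    rcases abs_cases y with ⟨h, _⟩ | ⟨h, _⟩ <;> rw [h]
    · linarith [Real.exp_pos (-y)]
    · linarith [Real.exp_pos y]
  nlinarith

/-- moments of real linear functionals -/
lemma gibbs_real_moment (k : Lat N → ℝ) (β C1 Q : ℝ) (n : ℕ)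
    (h : ∀ η : Lat N → ℝ, gibbsE N k β 0 (fun σ => Real.exp (∑ w, lamW k w * η w * shat hart σ w)) ≤
      C1 * Real.exp (Q * N * ∑ w, η w ^ 2 * ew N w)) (hC1 : 0 < C1) (hQ : 0 ≤ Q)
    (η : Lat N → ℝ) (V : ℝ) (hV : 0 < V) (hη : N * ∑ w, η w ^ 2 * ew N w ≤ V) :
    gibbsE N k β 0 (fun σ => (∑ w, lamW k w * η w * shat hart σ w) ^ (2 * n)) ≤
      (2 * n).factorial * (2 * (C1 * Real.exp Q)) * V ^ n := by
  have hN : (0:ℝ) < N := by exact_mod_cast N_pos (N := N)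
  have hsq : √V ^ 2 = V := Real.sq_sqrt hV.le
  have hs0 : 0 < √V := Real.sqrt_pos.2 hV
  have key : ∀ t : ℝ, t ^ 2 = 1 → gibbsE N k β 0 (fun σ => Real.exp (∑ w, lamW k w * (t * η w / √V) * shat hart σ w)) ≤ C1 * Real.exp Q := by
    intro t ht
    refine (h _).trans ?_
    gcongr
    have e : ∑ w, (t * η w / √V) ^ 2 * ew N w = (∑ w, η w ^ 2 * ew N w) / V := by
      rw [Finset.sum_div]
      refine Finset.sum_congr rfl (fun w _ => ?_)
      rw [div_pow, hsq, mul_pow, ht]; ring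
    rw [e, mul_assoc]
    refine mul_le_of_le_one_right hQ ?_
    rw [← mul_div_assoc, div_le_one hV]
    exact hη
  have k1 := key 1 (by norm_num)
  have k2 := key (-1) (by norm_num)
  have hpt : ∀ σ : Lat N → ℝ, (∑ w, lamW k w * η w * shat hart σ w) ^ (2 * n) ≤ (V ^ n * (2 * n).factorial) *
      (Real.exp (∑ w, lamW k w * (1 * η w / √V) * shat hart σ w) + Real.exp (∑ w, lamW k w * (-1 * η w / √V) * shat hart σ w)) := by
    intro σ
    set Y := ∑ w, lamW k w * η w * shat hart σ w with hY
    have e1 : ∑ w, lamW k w * (1 * η w / √V) * shat hart σ w = Y / √V := by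
      rw [hY, Finset.sum_div]; exact Finset.sum_congr rfl (fun w _ => by ring)
    have e2 : ∑ w, lamW k w * (-1 * η w / √V) * shat hart σ w = -(Y / √V) := by
      rw [hY, Finset.sum_div, ← Finset.sum_neg_distrib]; exact Finset.sum_congr rfl (fun w _ => by ring)
    rw [e1, e2]
    have h3 := pow_le_exp_sym (Y / √V) n
    rw [div_pow, pow_mul (√V), hsq, div_le_iff₀ (by positivity)] at h3
    linarith
  refine (gibbsE_mono k β 0 hpt).trans ?_
  rw [gibbsE_mul, gibbsE_add]
  have : 0 ≤ V ^ n * (2 * n).factorial := by positivity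
  calc _ ≤ (V ^ n * (2 * n).factorial) * (C1 * Real.exp Q + C1 * Real.exp Q) := by gcongr
    _ = _ := by ring

lemma norm_pow_le (Z : ℂ) (n : ℕ) : ‖Z‖ ^ (2 * n) ≤ 2 ^ n * (Z.re ^ (2 * n) + Z.im ^ (2 * n)) := by
  rw [pow_mul, ← Complex.normSq_eq_norm_sq, Complex.normSq_apply, ← sq, ← sq, pow_mul, pow_mul]
  have h1 := sq_nonneg Z.re
  have h2 := sq_nonneg Z.im
  generalize Z.re ^ 2 = a at *
  generalize Z.im ^ 2 = b at *
  rcases le_total a b with h | h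
  · calc (a + b) ^ n ≤ (2 * b) ^ n := by gcongr; linarith
      _ = 2 ^ n * (b ^ n) := by rw [mul_pow]
      _ ≤ _ := by gcongr; have := pow_nonneg h1 n; linarith
  · calc (a + b) ^ n ≤ (2 * a) ^ n := by gcongr; linarith
      _ = 2 ^ n * (a ^ n) := by rw [mul_pow]
      _ ≤ _ := by gcongr; have := pow_nonneg h2 n; linarith

/-- moments of complex linear functionals of the Fourier modes -/
theorem moment_main (𝔎 : KacProfile) (A : ℝ) (n : ℕ) : ∃ C : ℝ, ∃ N₀ : ℕ, 0 < C ∧ ∀ (N : ℕ) [NeZero N], N₀ ≤ N →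
    ∀ c : ℝ, 0 < c → (∑ z, kGamma 𝔎 N c (gam N) z) = 1 → ∀ b : Lat N → ℂ, ∀ V : ℝ, 0 < V →
      ∑ v, ‖b v‖ ^ 2 * ew N v ≤ V →
      gibbsE N (kGamma 𝔎 N c (gam N)) (betaCrit 𝔎 N c A) 0
        (fun σ => ‖∑ v, b v * dFT N (fun z => ((fluct N (kGamma 𝔎 N c (gam N)) (gam N) σ z : ℝ) : ℂ)) (latRep2 N v)‖ ^ (2 * n)) ≤
      C * V ^ n := by
  obtain ⟨C1, Q, N₀, hC1, hQ, hmain⟩ := exp_moment 𝔎 A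
  refine ⟨2 ^ n * (2 * ((2 * n).factorial * (2 * (C1 * Real.exp Q)))) * 8 ^ n, N₀, by positivity, ?_⟩
  intro N _ hN c hc hsum b V hV hb
  obtain ⟨H, hexp⟩ := hmain N hN c hc hsum
  set k := kGamma 𝔎 N c (gam N)
  have hN' : (0:ℝ) < N := by exact_mod_cast N_pos (N := N)
  have hz : N * ∑ w, ‖zetaW b w‖ ^ 2 * ew N w ≤ 8 * V := by
    have h1 : ∑ w, ‖b (-w)‖ ^ 2 * ew N w = ∑ w, ‖b w‖ ^ 2 * ew N w := by
      refine Fintype.sum_equiv (Equiv.neg _) _ _ (fun w => ?_)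
      simp [ew_neg]
    calc N * ∑ w, ‖zetaW b w‖ ^ 2 * ew N w ≤ N * ∑ w, (4 / N * (‖b w‖ ^ 2 + ‖b (-w)‖ ^ 2)) * ew N w := by
          gcongr with w _
          · exact (ew_pos w).le
          · exact zetaW_norm b w
      _ = 4 * (∑ w, ‖b w‖ ^ 2 * ew N w + ∑ w, ‖b (-w)‖ ^ 2 * ew N w) := by
          rw [← Finset.sum_add_distrib, Finset.mul_sum, Finset.mul_sum]
          refine Finset.sum_congr rfl (fun w _ => ?_)
          field_simp
      _ ≤ _ := by rw [h1]; linarith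
  have hpart : ∀ η : Lat N → ℝ, (∀ w, η w ^ 2 ≤ ‖zetaW b w‖ ^ 2) → N * ∑ w, η w ^ 2 * ew N w ≤ 8 * V := by
    intro η hη
    refine le_trans ?_ hz
    exact mul_le_mul_of_nonneg_left (Finset.sum_le_sum (fun w _ => mul_le_mul_of_nonneg_right (hη w) (ew_pos w).le)) hN'.le
  have hre := gibbs_real_moment k (betaCrit 𝔎 N c A) C1 Q n hexp hC1 (by linarith) (fun w => (zetaW b w).re) (8 * V) (by positivity)
    (hpart _ (fun w => by rw [← sq_abs]; have := Complex.abs_re_le_norm (zetaW b w); gcongr))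
  have him := gibbs_real_moment k (betaCrit 𝔎 N c A) C1 Q n hexp hC1 (by linarith) (fun w => (zetaW b w).im) (8 * V) (by positivity)
    (hpart _ (fun w => by rw [← sq_abs]; have := Complex.abs_im_le_norm (zetaW b w); gcongr))
  have hpt : ∀ σ : Lat N → ℝ, ‖∑ v, b v * dFT N (fun z => ((fluct N k (gam N) σ z : ℝ) : ℂ)) (latRep2 N v)‖ ^ (2 * n) ≤
      2 ^ n * ((∑ w, lamW k w * (zetaW b w).re * shat hart σ w) ^ (2 * n) + (∑ w, lamW k w * (zetaW b w).im * shat hart σ w) ^ (2 * n)) := by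
    intro σ
    refine (norm_pow_le _ n).trans (le_of_eq ?_)
    rw [lin_expand k H.keven, Complex.re_sum, Complex.im_sum]
    simp only [Complex.re_ofReal_mul, Complex.im_ofReal_mul]
    congr 3 <;> exact Finset.sum_congr rfl (fun w _ => by ring)
  refine (gibbsE_mono k _ 0 hpt).trans ?_
  rw [gibbsE_mul, gibbsE_add]
  calc _ ≤ 2 ^ n * ((2 * n).factorial * (2 * (C1 * Real.exp Q)) * (8 * V) ^ n + (2 * n).factorial * (2 * (C1 * Real.exp Q)) * (8 * V) ^ n) := by
        gcongr
    _ = _ := by rw [mul_pow]; ring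

end Moments

/-! ### Part H2: from moments of modes to the Besov norm -/

section Blocks

lemma cexp_sub_le (s t : ℝ) : ‖Complex.exp ((Real.pi : ℂ) * Complex.I * (s : ℂ)) - Complex.exp ((Real.pi : ℂ) * Complex.I * (t : ℂ))‖ ≤
    Real.pi * |s - t| := by
  have e : Complex.exp ((Real.pi : ℂ) * Complex.I * (s : ℂ)) - Complex.exp ((Real.pi : ℂ) * Complex.I * (t : ℂ)) =
      Complex.exp (((Real.pi * t : ℝ) : ℂ) * Complex.I) * (Complex.exp (Complex.I * ((Real.pi * (s - t) : ℝ) : ℂ)) - 1) := by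
    rw [mul_sub, mul_one, ← Complex.exp_add]
    congr 2 <;> push_cast <;> ring
  rw [e, norm_mul, Complex.norm_exp_ofReal_mul_I, one_mul]
  refine Real.norm_exp_I_mul_ofReal_sub_one_le.trans (le_of_eq ?_)
  rw [Real.norm_eq_abs, abs_mul, abs_of_pos Real.pi_pos]

lemma cexp_norm_one (s : ℝ) : ‖Complex.exp ((Real.pi : ℂ) * Complex.I * (s : ℂ))‖ = 1 := by
  have : (Real.pi : ℂ) * Complex.I * (s : ℂ) = ((Real.pi * s : ℝ) : ℂ) * Complex.I := by push_cast; ring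
  rw [this, Complex.norm_exp_ofReal_mul_I]

lemma grid_one (m : ℕ) (hm : 0 < m) (x : ℝ) : ∃ a : ℕ, a < 2 * m ∧ ∀ w : ℤ,
    ‖Complex.exp ((Real.pi : ℂ) * Complex.I * ((w * x : ℝ) : ℂ)) - Complex.exp ((Real.pi : ℂ) * Complex.I * ((w * ((a:ℝ) / m) : ℝ) : ℂ))‖ ≤
      Real.pi * |(w:ℝ)| / m := by
  have hm' : (0:ℝ) < m := by exact_mod_cast hm
  set k : ℤ := ⌊x / 2⌋ with hk
  have h1 := Int.floor_le (x / 2)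
  have h2 := Int.lt_floor_add_one (x / 2)
  rw [← hk] at h1 h2
  set r : ℝ := x - 2 * k with hr
  have hr0 : 0 ≤ r := by rw [hr]; linarith
  have hr2 : r < 2 := by rw [hr]; linarith
  have h3 := Nat.floor_le (a := r * m) (by positivity)
  have h4 := Nat.lt_floor_add_one (r * m)
  refine ⟨⌊r * m⌋₊, ?_, fun w => ?_⟩
  · rw [Nat.floor_lt (by positivity)]; push_cast; nlinarith
  · have e : Complex.exp ((Real.pi : ℂ) * Complex.I * ((w * x : ℝ) : ℂ)) = Complex.exp ((Real.pi : ℂ) * Complex.I * ((w * r : ℝ) : ℂ)) := by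
      rw [Complex.exp_eq_exp_iff_exists_int]
      refine ⟨w * k, ?_⟩
      rw [hr]; push_cast; ring
    rw [e]
    refine (cexp_sub_le _ _).trans ?_
    rw [← mul_sub, abs_mul, mul_div_assoc, div_eq_mul_inv (|(w:ℝ)|) (m:ℝ)]
    have h5 : |r - (⌊r * m⌋₊ : ℝ) / m| ≤ (m : ℝ)⁻¹ := by
      rw [abs_le]
      constructor
      · have : (⌊r * m⌋₊ : ℝ) / m ≤ r := by rw [div_le_iff₀ hm']; exact h3
        have := inv_pos.2 hm'
        linarith
      · have : r ≤ (⌊r * m⌋₊ : ℝ) / m + (m : ℝ)⁻¹ := by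
          rw [inv_eq_one_div, ← add_div, le_div_iff₀ hm']; exact h4.le
        linarith
    have := Real.pi_pos
    gcongr

lemma eW_split (w : ℤ × ℤ) (x : ℝ × ℝ) : eW w x = Complex.exp ((Real.pi : ℂ) * Complex.I * ((w.1 * x.1 : ℝ) : ℂ)) *
    Complex.exp ((Real.pi : ℂ) * Complex.I * ((w.2 * x.2 : ℝ) : ℂ)) := by
  unfold eW
  rw [← Complex.exp_add]
  congr 1
  push_cast
  ring

lemma eW_norm (w : ℤ × ℤ) (x : ℝ × ℝ) : ‖eW w x‖ = 1 := by
  rw [eW_split, norm_mul, cexp_norm_one, cexp_norm_one, one_mul]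

lemma grid_two (m : ℕ) (hm : 0 < m) (x : ℝ × ℝ) : ∃ a b : ℕ, a < 2 * m ∧ b < 2 * m ∧ ∀ w : ℤ × ℤ,
    ‖eW w x - eW w ((a:ℝ) / m, (b:ℝ) / m)‖ ≤ Real.pi * (|(w.1:ℝ)| + |(w.2:ℝ)|) / m := by
  obtain ⟨a, ha, hA⟩ := grid_one m hm x.1
  obtain ⟨b, hb, hB⟩ := grid_one m hm x.2
  refine ⟨a, b, ha, hb, fun w => ?_⟩
  rw [eW_split, eW_split]
  have h1 := hA w.1
  have h2 := hB w.2
  have n1 := cexp_norm_one (w.2 * x.2)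
  have n2 := cexp_norm_one (w.1 * ((a:ℝ) / m))
  dsimp only
  generalize Complex.exp ((Real.pi : ℂ) * Complex.I * ((w.1 * x.1 : ℝ) : ℂ)) = p at *
  generalize Complex.exp ((Real.pi : ℂ) * Complex.I * ((w.2 * x.2 : ℝ) : ℂ)) = q at *
  generalize Complex.exp ((Real.pi : ℂ) * Complex.I * ((w.1 * ((a:ℝ) / m) : ℝ) : ℂ)) = p' at *
  generalize Complex.exp ((Real.pi : ℂ) * Complex.I * ((w.2 * ((b:ℝ) / m) : ℝ) : ℂ)) = q' at *
  have e : p * q - p' * q' = (p - p') * q + p' * (q - q') := by ring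
  rw [e]
  refine (norm_add_le _ _).trans ?_
  rw [norm_mul, norm_mul, n1, n2, mul_one, one_mul, mul_add, add_div]
  exact add_le_add h1 h2

variable {N : ℕ} [NeZero N]

lemma LPchi_mem (P : LPpartition) (k : ℤ) (r : ℝ × ℝ) : LPchi P k r ∈ Set.Icc (0:ℝ) 1 := by
  unfold LPchi
  split_ifs
  · exact P.mem_t r
  · exact P.mem _

lemma enorm2_smul (t : ℝ) (ht : 0 ≤ t) (r : ℝ × ℝ) : enorm2 (t • r) = t * enorm2 r := by
  unfold enorm2
  simp only [Prod.smul_fst, Prod.smul_snd, smul_eq_mul]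
  rw [show (t * r.1) ^ 2 + (t * r.2) ^ 2 = t ^ 2 * (r.1 ^ 2 + r.2 ^ 2) by ring, Real.sqrt_mul (by positivity), Real.sqrt_sq ht]

/-- the block multiplier -/
def blkChi (P : LPpartition) (j : ℕ) (v : Lat N) : ℝ := LPchi P ((j:ℤ) - 1) ((latRep N v.1 : ℝ), (latRep N v.2 : ℝ))

lemma blkChi_mem (P : LPpartition) (j : ℕ) (v : Lat N) : 0 ≤ blkChi P j v ∧ blkChi P j v ≤ 1 := LPchi_mem P _ _

lemma blkChi_supp (P : LPpartition) (j : ℕ) (v : Lat N) (h : 2 * (4:ℝ) ^ j < nsq N v) : blkChi P j v = 0 := by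
  have hn : nsq N v = enorm2 ((latRep N v.1 : ℝ), (latRep N v.2 : ℝ)) ^ 2 := by
    unfold enorm2 nsq; rw [Real.sq_sqrt (by positivity)]
  have h0 : 0 ≤ enorm2 ((latRep N v.1 : ℝ), (latRep N v.2 : ℝ)) := Real.sqrt_nonneg _
  unfold blkChi LPchi
  rw [hn] at h
  rcases Nat.eq_zero_or_pos j with rfl | hj
  · simp only [Nat.cast_zero, zero_sub, if_true]
    apply P.supp_t
    norm_num at h
    nlinarith
  · rw [if_neg (by omega)]
    apply P.supp
    right
    rw [enorm2_smul _ (by positivity)]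
    obtain ⟨i, rfl⟩ : ∃ i, j = i + 1 := ⟨j - 1, by omega⟩
    have e : -(((i + 1 : ℕ) : ℤ) - 1) = -(i : ℤ) := by push_cast; ring
    rw [e, zpow_neg, zpow_natCast, ← div_eq_inv_mul, lt_div_iff₀ (by positivity)]
    have e4 : (4:ℝ) ^ (i + 1) = 4 * (2 ^ i) ^ 2 := by rw [pow_succ, ← pow_mul, mul_comm i 2, pow_mul]; norm_num; ring
    rw [e4] at h
    have h2 : (0:ℝ) < 2 ^ i := by positivity
    apply lt_of_pow_lt_pow_left₀ 2 h0
    nlinarith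

lemma blkChi_large (P : LPpartition) (j : ℕ) (v : Lat N) (h : 2 * N + 3 ≤ j) : blkChi P j v = 0 := by
  unfold blkChi LPchi
  rw [if_neg (by omega)]
  apply P.supp
  left
  rw [enorm2_smul _ (by positivity)]
  obtain ⟨i, rfl⟩ : ∃ i, j = i + 1 := ⟨j - 1, by omega⟩
  have e : -(((i + 1 : ℕ) : ℤ) - 1) = -(i : ℤ) := by push_cast; ring
  rw [e, zpow_neg, zpow_natCast, ← div_eq_inv_mul, div_lt_iff₀ (by positivity)]
  have hn : enorm2 ((latRep N v.1 : ℝ), (latRep N v.2 : ℝ)) ≤ 2 * N := by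
    unfold enorm2
    rw [Real.sqrt_le_left (by positivity)]
    have h1 := latRep_le_abs v.1
    have h2 := latRep_le_abs v.2
    have h1' : |(latRep N v.1 : ℝ)| ≤ N := by exact_mod_cast h1
    have h2' : |(latRep N v.2 : ℝ)| ≤ N := by exact_mod_cast h2
    rw [← sq_abs (latRep N v.1 : ℝ), ← sq_abs (latRep N v.2 : ℝ)]
    nlinarith [abs_nonneg (latRep N v.1 : ℝ), abs_nonneg (latRep N v.2 : ℝ)]
  have h3 : i < 2 ^ i := Nat.lt_two_pow_self
  have h4 : (2 * N + 2 : ℝ) ≤ i := by exact_mod_cast (by omega : 2 * N + 2 ≤ i)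
  have h5 : (2:ℝ) ^ i = 4 * 2 ^ (i - 2) := by
    rw [show i = (i - 2) + 2 by omega, pow_add, Nat.add_sub_cancel]; norm_num; ring
  have h6 : (i - 2 : ℕ) < 2 ^ (i - 2) := Nat.lt_two_pow_self
  have h7 : (2 * N : ℝ) ≤ (2:ℝ) ^ (i - 2) := by exact_mod_cast (by omega : 2 * N ≤ 2 ^ (i - 2))
  have h8 : (0:ℝ) < 2 ^ (i - 2) := by positivity
  linarith

lemma dBlock_eq (P : LPpartition) (j : ℕ) (f : Lat N → ℂ) (x : ℝ × ℝ) : dBlock N P ((j:ℤ) - 1) f x =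
    ∑ v, ((1/4 : ℂ) * (blkChi P j v : ℂ) * eW (latRep2 N v) x) * dFT N f (latRep2 N v) := by
  unfold dBlock blkChi
  rw [Finset.mul_sum]
  exact Finset.sum_congr rfl (fun v _ => by ring)

/-- modes seen by block `j` -/
def modeS (N : ℕ) [NeZero N] (j : ℕ) : Finset (Lat N) := by
  classical exact Finset.univ.filter (fun v => nsq N v ≤ 2 * (4:ℝ) ^ j)

lemma mem_modeS (j : ℕ) (v : Lat N) : v ∈ modeS N j ↔ nsq N v ≤ 2 * (4:ℝ) ^ j := by
  unfold modeS; simp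

lemma modeS_card (Q : ℝ) (hQ : ∑ w, ew N w ^ (2:ℝ) ≤ Q) (j : ℕ) : ((modeS N j).card : ℝ) ≤ 9 * Q * 16 ^ j := by
  have h4 : (1:ℝ) ≤ 4 ^ j := one_le_pow₀ (by norm_num)
  have e16 : (16:ℝ) ^ j = 4 ^ j * 4 ^ j := by rw [← mul_pow]; norm_num
  have h1 : ∀ v ∈ modeS N j, (1:ℝ) ≤ 9 * 16 ^ j * ew N v ^ (2:ℝ) := by
    intro v hv
    rw [mem_modeS] at hv
    have h0 := nsq_nonneg v
    unfold ew
    rw [Real.rpow_two, inv_pow, ← div_eq_mul_inv, le_div_iff₀ (by positivity), e16]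
    nlinarith
  calc ((modeS N j).card : ℝ) = ∑ v ∈ modeS N j, (1:ℝ) := by simp
    _ ≤ ∑ v ∈ modeS N j, 9 * 16 ^ j * ew N v ^ (2:ℝ) := Finset.sum_le_sum h1
    _ ≤ ∑ v, 9 * 16 ^ j * ew N v ^ (2:ℝ) := by
        apply Finset.sum_le_sum_of_subset_of_nonneg (Finset.subset_univ _)
        intro v _ _
        have := Real.rpow_nonneg (ew_pos v).le 2
        positivity
    _ = 9 * 16 ^ j * ∑ v, ew N v ^ (2:ℝ) := by rw [Finset.mul_sum]
    _ ≤ 9 * 16 ^ j * Q := by gcongr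
    _ = _ := by ring

lemma mode_abs (j : ℕ) (v : Lat N) (h : v ∈ modeS N j) : |(latRep N v.1 : ℝ)| + |(latRep N v.2 : ℝ)| ≤ 4 * 2 ^ j := by
  rw [mem_modeS] at h
  unfold nsq at h
  rw [← sq_abs (latRep N v.1 : ℝ), ← sq_abs (latRep N v.2 : ℝ)] at h
  have e4 : (4:ℝ) ^ j = (2 ^ j) ^ 2 := by rw [← pow_mul, mul_comm j 2, pow_mul]; norm_num
  rw [e4] at h
  have h2 : (0:ℝ) < 2 ^ j := by positivity
  have a := abs_nonneg (latRep N v.1 : ℝ)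
  have b := abs_nonneg (latRep N v.2 : ℝ)
  nlinarith [sq_nonneg (|(latRep N v.1 : ℝ)| - |(latRep N v.2 : ℝ)|)]

lemma dBlock_grid (P : LPpartition) (j : ℕ) (f : Lat N → ℂ) (x : ℝ × ℝ) : ∃ a b : ℕ, a < 2 * 32 ^ j ∧ b < 2 * 32 ^ j ∧
    ‖dBlock N P ((j:ℤ) - 1) f x‖ ≤ ‖dBlock N P ((j:ℤ) - 1) f ((a:ℝ) / (32:ℝ) ^ j, (b:ℝ) / (32:ℝ) ^ j)‖ +
      4 / 16 ^ j * ∑ v ∈ modeS N j, ‖dFT N f (latRep2 N v)‖ := by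
  obtain ⟨a, b, ha, hb, H⟩ := grid_two (32 ^ j) (by positivity) x
  refine ⟨a, b, ha, hb, ?_⟩
  push_cast at H
  rw [← sub_le_iff_le_add']
  refine (norm_sub_norm_le _ _).trans ?_
  rw [dBlock_eq, dBlock_eq, ← Finset.sum_sub_distrib]
  have hz : ∀ v ∉ modeS N j, blkChi P j v = 0 := by
    intro v hv
    rw [mem_modeS, not_le] at hv
    exact blkChi_supp P j v hv
  rw [← Finset.sum_subset (Finset.subset_univ (modeS N j)) (fun v _ hv => by rw [hz v hv]; simp)]
  refine (norm_sum_le _ _).trans ?_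
  rw [Finset.mul_sum]
  refine Finset.sum_le_sum (fun v hv => ?_)
  rw [← sub_mul, ← mul_sub, norm_mul, norm_mul, norm_mul, Complex.norm_real, Real.norm_of_nonneg (blkChi_mem P j v).1]
  refine mul_le_mul_of_nonneg_right ?_ (norm_nonneg _)
  have h1 := H (latRep2 N v)
  have h2 := mode_abs j v hv
  have h3 := blkChi_mem P j v
  have e : (32:ℝ) ^ j = 2 ^ j * 16 ^ j := by rw [← mul_pow]; norm_num
  have h4 : Real.pi * (|((latRep2 N v).1 : ℝ)| + |((latRep2 N v).2 : ℝ)|) / 32 ^ j ≤ 16 / 16 ^ j := by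
    unfold latRep2
    dsimp only
    rw [e, div_le_div_iff₀ (by positivity) (by positivity)]
    have : Real.pi * (|(latRep N v.1 : ℝ)| + |(latRep N v.2 : ℝ)|) ≤ 4 * (4 * 2 ^ j) := by
      have := Real.pi_le_four
      gcongr
    have h16 : (0:ℝ) < 16 ^ j := by positivity
    nlinarith
  have hn : ‖(1/4 : ℂ)‖ = 1 / 4 := by norm_num
  rw [hn]
  set D := ‖eW (latRep2 N v) x - eW (latRep2 N v) ((a:ℝ) / (32:ℝ) ^ j, (b:ℝ) / (32:ℝ) ^ j)‖
  have hD : 0 ≤ D := norm_nonneg _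
  calc 1 / 4 * blkChi P j v * D ≤ 1 / 4 * 1 * (16 / 16 ^ j) := by
        have := h1.trans h4
        gcongr
        exact h3.2
    _ = 4 / 16 ^ j := by ring

lemma single_le_double (F : ℕ → ℕ → ℝ) (hF : ∀ a b, 0 ≤ F a b) {L a b : ℕ} (ha : a < L) (hb : b < L) :
    F a b ≤ ∑ a ∈ Finset.range L, ∑ b ∈ Finset.range L, F a b := by
  refine le_trans ?_ (Finset.single_le_sum (f := fun a => ∑ b ∈ Finset.range L, F a b)
    (fun a _ => Finset.sum_nonneg (fun b _ => hF a b)) (Finset.mem_range.2 ha))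
  exact Finset.single_le_sum (f := fun b => F a b) (fun b _ => hF a b) (Finset.mem_range.2 hb)

lemma sup_pow_bound (P : LPpartition) (j n : ℕ) (hn : 1 ≤ n) (Q : ℝ) (hQ1 : 1 ≤ Q) (hQ : ∑ w, ew N w ^ (2:ℝ) ≤ Q) (f : Lat N → ℂ) :
    (⨆ x : ℝ × ℝ, ‖dBlock N P ((j:ℤ) - 1) f x‖) ^ (2 * n) ≤ 2 ^ (2 * n) * ((∑ a ∈ Finset.range (2 * 32 ^ j), ∑ b ∈ Finset.range (2 * 32 ^ j),
      ‖dBlock N P ((j:ℤ) - 1) f ((a:ℝ) / (32:ℝ) ^ j, (b:ℝ) / (32:ℝ) ^ j)‖ ^ (2 * n)) +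
      (36 * Q) ^ (2 * n) * ∑ v ∈ modeS N j, ‖dFT N f (latRep2 N v)‖ ^ (2 * n)) := by
  set B := 2 ^ (2 * n) * ((∑ a ∈ Finset.range (2 * 32 ^ j), ∑ b ∈ Finset.range (2 * 32 ^ j),
      ‖dBlock N P ((j:ℤ) - 1) f ((a:ℝ) / (32:ℝ) ^ j, (b:ℝ) / (32:ℝ) ^ j)‖ ^ (2 * n)) +
      (36 * Q) ^ (2 * n) * ∑ v ∈ modeS N j, ‖dFT N f (latRep2 N v)‖ ^ (2 * n)) with hB
  have hB0 : 0 ≤ B := by positivity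
  have hn0 : 2 * n ≠ 0 := by omega
  have key : ∀ x, ‖dBlock N P ((j:ℤ) - 1) f x‖ ^ (2 * n) ≤ B := by
    intro x
    obtain ⟨a, b, ha, hb, H⟩ := dBlock_grid P j f x
    have hcard := modeS_card Q hQ j
    set s := ∑ v ∈ modeS N j, ‖dFT N f (latRep2 N v)‖ with hs
    have hs0 : 0 ≤ s := Finset.sum_nonneg (fun v _ => norm_nonneg _)
    have h1 : s ^ (2 * n) ≤ (9 * Q * 16 ^ j) ^ (2 * n) * ∑ v ∈ modeS N j, ‖dFT N f (latRep2 N v)‖ ^ (2 * n) := by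
      set M := ∑ v ∈ modeS N j, ‖dFT N f (latRep2 N v)‖ ^ (2 * n) with hM
      have hM0 : 0 ≤ M := by positivity
      have hle : ∀ v ∈ modeS N j, ‖dFT N f (latRep2 N v)‖ ≤ M ^ (((2 * n : ℕ) : ℝ)⁻¹) := by
        intro v hv
        rw [Real.le_rpow_inv_iff_of_pos (norm_nonneg _) hM0 (by positivity), Real.rpow_natCast]
        exact Finset.single_le_sum (f := fun v => ‖dFT N f (latRep2 N v)‖ ^ (2 * n)) (fun v _ => by positivity) hv
      have h2 : s ≤ (9 * Q * 16 ^ j) * M ^ (((2 * n : ℕ) : ℝ)⁻¹) := by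
        refine (Finset.sum_le_card_nsmul _ _ _ hle).trans ?_
        rw [nsmul_eq_mul]
        have := Real.rpow_nonneg hM0 (((2 * n : ℕ) : ℝ)⁻¹)
        gcongr
      calc s ^ (2 * n) ≤ ((9 * Q * 16 ^ j) * M ^ (((2 * n : ℕ) : ℝ)⁻¹)) ^ (2 * n) := by gcongr
        _ = _ := by rw [mul_pow, Real.rpow_inv_natCast_pow hM0 hn0]
    set d := ‖dBlock N P ((j:ℤ) - 1) f ((a:ℝ) / (32:ℝ) ^ j, (b:ℝ) / (32:ℝ) ^ j)‖ with hd
    have hd0 : 0 ≤ d := norm_nonneg _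
    have h3 : d ^ (2 * n) ≤ ∑ a ∈ Finset.range (2 * 32 ^ j), ∑ b ∈ Finset.range (2 * 32 ^ j),
      ‖dBlock N P ((j:ℤ) - 1) f ((a:ℝ) / (32:ℝ) ^ j, (b:ℝ) / (32:ℝ) ^ j)‖ ^ (2 * n) := by
      exact single_le_double (fun a b : ℕ => ‖dBlock N P ((j:ℤ) - 1) f ((a:ℝ) / (32:ℝ) ^ j, (b:ℝ) / (32:ℝ) ^ j)‖ ^ (2 * n))
        (fun a b => pow_nonneg (norm_nonneg _) _) ha hb
    have h4 : (4 / 16 ^ j * s) ^ (2 * n) ≤ (36 * Q) ^ (2 * n) * ∑ v ∈ modeS N j, ‖dFT N f (latRep2 N v)‖ ^ (2 * n) := by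
      rw [mul_pow]
      calc _ ≤ (4 / 16 ^ j) ^ (2 * n) * ((9 * Q * 16 ^ j) ^ (2 * n) * ∑ v ∈ modeS N j, ‖dFT N f (latRep2 N v)‖ ^ (2 * n)) := by gcongr
        _ = (4 / 16 ^ j * (9 * Q * 16 ^ j)) ^ (2 * n) * ∑ v ∈ modeS N j, ‖dFT N f (latRep2 N v)‖ ^ (2 * n) := by rw [mul_pow _ (9 * Q * 16 ^ j)]; ring
        _ = _ := by congr 2; field_simp; norm_num
    calc ‖dBlock N P ((j:ℤ) - 1) f x‖ ^ (2 * n) ≤ (d + 4 / 16 ^ j * s) ^ (2 * n) := by gcongr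
      _ ≤ 2 ^ (2 * n - 1) * (d ^ (2 * n) + (4 / 16 ^ j * s) ^ (2 * n)) := add_pow_le hd0 (by positivity) _
      _ ≤ 2 ^ (2 * n) * (d ^ (2 * n) + (4 / 16 ^ j * s) ^ (2 * n)) := by
          gcongr
          · norm_num
          · omega
      _ ≤ B := by
          rw [hB]
          refine mul_le_mul_of_nonneg_left (add_le_add h3 h4) (by positivity)
  have h5 : (⨆ x : ℝ × ℝ, ‖dBlock N P ((j:ℤ) - 1) f x‖) ≤ B ^ (((2 * n : ℕ) : ℝ)⁻¹) := by
    apply ciSup_le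
    intro x
    rw [Real.le_rpow_inv_iff_of_pos (norm_nonneg _) hB0 (by positivity), Real.rpow_natCast]
    exact key x
  have h6 : 0 ≤ (⨆ x : ℝ × ℝ, ‖dBlock N P ((j:ℤ) - 1) f x‖) := Real.iSup_nonneg (fun x => norm_nonneg _)
  calc _ ≤ (B ^ (((2 * n : ℕ) : ℝ)⁻¹)) ^ (2 * n) := by gcongr
    _ = B := Real.rpow_inv_natCast_pow hB0 hn0

end Blocks

/-! ### Part H3: conclusion -/

section Final

lemma block_moment (𝔎 : KacProfile) (P : LPpartition) (A δ : ℝ) (hδ : 0 < δ) (n : ℕ) (hn : 1 ≤ n) :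
    ∃ K C : ℝ, ∃ N₀ : ℕ, 0 < K ∧ 1 ≤ C ∧ ∀ (N : ℕ) [NeZero N], N₀ ≤ N →
    ∀ c : ℝ, 0 < c → (∑ z, kGamma 𝔎 N c (gam N) z) = 1 → ∀ j : ℕ,
      gibbsE N (kGamma 𝔎 N c (gam N)) (betaCrit 𝔎 N c A) 0
        (fun σ => (⨆ x : ℝ × ℝ, ‖dBlock N P ((j:ℤ) - 1) (fun z => ((fluct N (kGamma 𝔎 N c (gam N)) (gam N) σ z : ℝ) : ℂ)) x‖) ^ (2 * n)) ≤
      K * 1024 ^ j * (C * (3 * 4 ^ j) ^ δ) ^ n := by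
  obtain ⟨C0, N₀, hC0, hmom⟩ := moment_main 𝔎 A n
  obtain ⟨C, hC, hcut⟩ := ew_sum_cut δ hδ
  obtain ⟨Q, hQ, hew⟩ := ew_sum 2 (by norm_num)
  refine ⟨2 ^ (2 * n) * (C0 * (4 + (36 * Q) ^ (2 * n) * (9 * Q))), C, N₀, by positivity, hC, ?_⟩
  intro N _ hN c hc hsum j
  have hm := hmom N hN c hc hsum
  set k := kGamma 𝔎 N c (gam N) with hk
  set β := betaCrit 𝔎 N c A with hβ
  set V : ℝ := C * (3 * 4 ^ j) ^ δ with hV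
  have h4 : (1:ℝ) ≤ 4 ^ j := one_le_pow₀ (by norm_num)
  have hV1 : 1 ≤ V := by
    have : (1:ℝ) ≤ (3 * 4 ^ j) ^ δ := Real.one_le_rpow (by linarith) hδ.le
    rw [hV]; nlinarith
  have hVn : (1:ℝ) ≤ V ^ n := one_le_pow₀ hV1
  -- point evaluations
  have hpt : ∀ x : ℝ × ℝ, gibbsE N k β 0 (fun σ => ‖dBlock N P ((j:ℤ) - 1) (fun z => ((fluct N k (gam N) σ z : ℝ) : ℂ)) x‖ ^ (2 * n)) ≤
      C0 * V ^ n := by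
    intro x
    simp only [dBlock_eq]
    refine hm _ V (by linarith) ?_
    calc _ ≤ ∑ w, (if nsq N w ≤ 2 * (4:ℝ) ^ j then ew N w else 0) := by
          refine Finset.sum_le_sum (fun w _ => ?_)
          have hmem := blkChi_mem P j w
          have e : ‖(1/4 : ℂ) * (blkChi P j w : ℂ) * eW (latRep2 N w) x‖ = 1 / 4 * blkChi P j w := by
            rw [norm_mul, norm_mul, eW_norm, Complex.norm_real, Real.norm_of_nonneg hmem.1]
            norm_num
          rw [e]
          split_ifs with h
          · have : (1 / 4 * blkChi P j w) ^ 2 ≤ 1 := by nlinarith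
            nlinarith [ew_pos w]
          · rw [blkChi_supp P j w (not_le.1 h)]; simp
      _ ≤ C * (1 + 2 * (4:ℝ) ^ j) ^ δ := hcut N _ (by positivity)
      _ ≤ V := by
          rw [hV]
          gcongr
          linarith
  -- single modes
  have hmode : ∀ v : Lat N, gibbsE N k β 0 (fun σ => ‖dFT N (fun z => ((fluct N k (gam N) σ z : ℝ) : ℂ)) (latRep2 N v)‖ ^ (2 * n)) ≤ C0 := by
    intro v
    have h := hm (fun w => if w = v then 1 else 0) 1 one_pos (by
      have : ∀ w, ‖(if w = v then (1:ℂ) else 0)‖ ^ 2 * ew N w = if w = v then ew N w else 0 := by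
        intro w; split_ifs <;> simp
      simp only [this, Finset.sum_ite_eq', Finset.mem_univ, if_true]
      exact ew_le_one v)
    simpa using h
  refine (gibbsE_mono k β 0 (fun σ => sup_pow_bound P j n hn Q hQ (hew N) _)).trans ?_
  rw [gibbsE_mul, gibbsE_add, gibbsE_mul, gibbsE_sum]
  simp only [gibbsE_sum]
  have hs1 : ∑ a ∈ Finset.range (2 * 32 ^ j), ∑ b ∈ Finset.range (2 * 32 ^ j),
      gibbsE N k β 0 (fun σ => ‖dBlock N P ((j:ℤ) - 1) (fun z => ((fluct N k (gam N) σ z : ℝ) : ℂ)) ((a:ℝ) / (32:ℝ) ^ j, (b:ℝ) / (32:ℝ) ^ j)‖ ^ (2 * n)) ≤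
      4 * 1024 ^ j * (C0 * V ^ n) := by
    refine (Finset.sum_le_sum (fun a _ => Finset.sum_le_sum (fun b _ => hpt _))).trans (le_of_eq ?_)
    simp only [Finset.sum_const, Finset.card_range, nsmul_eq_mul]
    push_cast
    have e1024 : (1024:ℝ) ^ j = 32 ^ j * 32 ^ j := by rw [← mul_pow]; norm_num
    rw [e1024]
    ring
  have hs2 : ∑ v ∈ modeS N j, gibbsE N k β 0 (fun σ => ‖dFT N (fun z => ((fluct N k (gam N) σ z : ℝ) : ℂ)) (latRep2 N v)‖ ^ (2 * n)) ≤
      9 * Q * 1024 ^ j * (C0 * V ^ n) := by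
    refine (Finset.sum_le_sum (fun v _ => hmode v)).trans ?_
    rw [Finset.sum_const, nsmul_eq_mul]
    have h1 := modeS_card Q (hew N) j
    have h2 : (16:ℝ) ^ j ≤ 1024 ^ j := by gcongr; norm_num
    have h3 : C0 ≤ C0 * V ^ n := by nlinarith
    calc _ ≤ (9 * Q * 16 ^ j) * C0 := by gcongr
      _ ≤ _ := by gcongr
  calc _ ≤ 2 ^ (2 * n) * (4 * 1024 ^ j * (C0 * V ^ n) + (36 * Q) ^ (2 * n) * (9 * Q * 1024 ^ j * (C0 * V ^ n))) := by
        refine mul_le_mul_of_nonneg_left (add_le_add hs1 (mul_le_mul_of_nonneg_left hs2 (by positivity))) (by positivity)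
    _ = _ := by ring

lemma weight_bound (ν C : ℝ) (n j : ℕ) (hC : 0 ≤ C) (hνn : 11 ≤ ν * n) :
    ((2:ℝ) ^ (-ν * ((j:ℝ) - 1))) ^ (2 * n) * (1024 ^ j * (C * (3 * 4 ^ j) ^ (ν / 2)) ^ n) ≤
      (2:ℝ) ^ (2 * ν * n) * (C * 3 ^ (ν / 2)) ^ n * (1 / 2) ^ j := by
  have e1 : ((2:ℝ) ^ (-ν * ((j:ℝ) - 1))) ^ (2 * n) = (2:ℝ) ^ (-ν * ((j:ℝ) - 1) * (2 * n)) := by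
    rw [← Real.rpow_natCast, ← Real.rpow_mul (by norm_num)]; push_cast; rfl
  have e2 : (1024:ℝ) ^ j = (2:ℝ) ^ (10 * (j:ℝ)) := by
    rw [Real.rpow_mul (by norm_num), Real.rpow_natCast]; norm_num
  have e3 : (((4:ℝ) ^ j) ^ (ν / 2)) ^ n = (2:ℝ) ^ (ν * j * n) := by
    have : (4:ℝ) ^ j = (2:ℝ) ^ (2 * (j:ℝ)) := by
      rw [Real.rpow_mul (by norm_num), Real.rpow_natCast]; norm_num
    rw [this, ← Real.rpow_mul (by norm_num), ← Real.rpow_natCast, ← Real.rpow_mul (by norm_num)]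
    congr 1; ring
  have e4 : ((1:ℝ) / 2) ^ j = (2:ℝ) ^ (-(j:ℝ)) := by
    rw [Real.rpow_neg (by norm_num), Real.rpow_natCast, one_div, inv_pow]
  rw [Real.mul_rpow (by norm_num) (by positivity), ← mul_assoc C, mul_pow (C * 3 ^ (ν / 2)), e1, e2, e3, e4]
  have key : (2:ℝ) ^ (-ν * ((j:ℝ) - 1) * (2 * n)) * 2 ^ (10 * (j:ℝ)) * 2 ^ (ν * j * n) ≤ 2 ^ (2 * ν * n) * 2 ^ (-(j:ℝ)) := by
    rw [← Real.rpow_add (by norm_num), ← Real.rpow_add (by norm_num), ← Real.rpow_add (by norm_num)]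
    apply Real.rpow_le_rpow_of_exponent_le (by norm_num)
    have : (0:ℝ) ≤ j := Nat.cast_nonneg j
    nlinarith
  have hc : 0 ≤ (C * (3:ℝ) ^ (ν / 2)) ^ n := by positivity
  calc _ = (C * (3:ℝ) ^ (ν / 2)) ^ n * ((2:ℝ) ^ (-ν * ((j:ℝ) - 1) * (2 * n)) * 2 ^ (10 * (j:ℝ)) * 2 ^ (ν * j * n)) := by ring
    _ ≤ (C * (3:ℝ) ^ (ν / 2)) ^ n * (2 ^ (2 * ν * n) * 2 ^ (-(j:ℝ))) := mul_le_mul_of_nonneg_left key hc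
    _ = _ := by ring

lemma holder_pow {N : ℕ} [NeZero N] (P : LPpartition) (ν : ℝ) (n : ℕ) (hn : 1 ≤ n) (q : ℝ) (hq : 0 < q) (hqn : q ≤ 2 * n) (f : Lat N → ℂ) :
    (holderNeg N P ν f) ^ q ≤ 1 + ∑ j ∈ Finset.range (2 * N + 3), ((2:ℝ) ^ (-ν * ((j:ℝ) - 1))) ^ (2 * n) *
      (⨆ x : ℝ × ℝ, ‖dBlock N P ((j:ℤ) - 1) f x‖) ^ (2 * n) := by
  set B := ∑ j ∈ Finset.range (2 * N + 3), ((2:ℝ) ^ (-ν * ((j:ℝ) - 1))) ^ (2 * n) *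
      (⨆ x : ℝ × ℝ, ‖dBlock N P ((j:ℤ) - 1) f x‖) ^ (2 * n) with hB
  have hs : ∀ j : ℕ, 0 ≤ ⨆ x : ℝ × ℝ, ‖dBlock N P ((j:ℤ) - 1) f x‖ := fun j => Real.iSup_nonneg (fun x => norm_nonneg _)
  have hterm : ∀ j : ℕ, 0 ≤ ((2:ℝ) ^ (-ν * ((j:ℝ) - 1))) ^ (2 * n) * (⨆ x : ℝ × ℝ, ‖dBlock N P ((j:ℤ) - 1) f x‖) ^ (2 * n) :=
    fun j => mul_nonneg (by positivity) (pow_nonneg (hs j) _)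
  have hB0 : 0 ≤ B := Finset.sum_nonneg (fun j _ => hterm j)
  have hn0 : 2 * n ≠ 0 := by omega
  have h0 : 0 ≤ holderNeg N P ν f := Real.iSup_nonneg (fun j => mul_nonneg (by positivity) (hs j))
  have h1 : holderNeg N P ν f ≤ B ^ (((2 * n : ℕ) : ℝ)⁻¹) := by
    unfold holderNeg
    apply ciSup_le
    intro j
    rw [Real.le_rpow_inv_iff_of_pos (mul_nonneg (by positivity) (hs j)) hB0 (by positivity), Real.rpow_natCast, mul_pow]
    by_cases hj : j < 2 * N + 3
    · exact Finset.single_le_sum (f := fun j : ℕ => ((2:ℝ) ^ (-ν * ((j:ℝ) - 1))) ^ (2 * n) *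
        (⨆ x : ℝ × ℝ, ‖dBlock N P ((j:ℤ) - 1) f x‖) ^ (2 * n)) (fun j _ => hterm j) (Finset.mem_range.2 hj)
    · have hz : ∀ x, ‖dBlock N P ((j:ℤ) - 1) f x‖ = 0 := by
        intro x
        rw [dBlock_eq, norm_eq_zero]
        refine Finset.sum_eq_zero (fun v _ => ?_)
        rw [blkChi_large P j v (by omega)]; simp
      simp only [hz, ciSup_const]
      rw [zero_pow hn0, mul_zero]
      exact hB0
  have h2 : holderNeg N P ν f ^ (2 * n) ≤ B := by
    calc _ ≤ (B ^ (((2 * n : ℕ) : ℝ)⁻¹)) ^ (2 * n) := by gcongr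
      _ = B := Real.rpow_inv_natCast_pow hB0 hn0
  rcases le_total (holderNeg N P ν f) 1 with h | h
  · have := Real.rpow_le_one h0 h hq.le
    linarith
  · have h3 := Real.rpow_le_rpow_of_exponent_le h hqn
    have h4 : holderNeg N P ν f ^ (2 * (n:ℝ)) = holderNeg N P ν f ^ (2 * n) := by
      rw [← Real.rpow_natCast]; push_cast; rfl
    rw [h4] at h3
    linarith

theorem final_bound (𝔎 : KacProfile) (P : LPpartition) (A ν q : ℝ) (hν : 0 < ν) (hq : 0 < q) :
    ∃ C : ℝ, ∃ N₀ : ℕ, ∀ (N : ℕ) [NeZero N], N₀ ≤ N →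
    ∀ c : ℝ, 0 < c → (∑ z, kGamma 𝔎 N c (gam N) z) = 1 →
      gibbsE N (kGamma 𝔎 N c (gam N)) (betaCrit 𝔎 N c A) 0
        (fun σ => (holderNeg N P ν (fun z => ((fluct N (kGamma 𝔎 N c (gam N)) (gam N) σ z : ℝ) : ℂ))) ^ q) ≤ C := by
  obtain ⟨n, hn⟩ := exists_nat_ge (max (11 / ν) (max q 1))
  have hn1 : 11 / ν ≤ n := (le_max_left _ _).trans hn
  have hn2 : q ≤ n := ((le_max_left _ _).trans (le_max_right _ _)).trans hn
  have hn3 : (1:ℝ) ≤ n := ((le_max_right _ _).trans (le_max_right _ _)).trans hn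
  have hn3' : 1 ≤ n := by exact_mod_cast hn3
  rw [div_le_iff₀ hν, mul_comm] at hn1
  obtain ⟨K, C, N₀, hK, hC, H⟩ := block_moment 𝔎 P A (ν / 2) (by positivity) n hn3'
  refine ⟨1 + K * ((2:ℝ) ^ (2 * ν * n) * (C * 3 ^ (ν / 2)) ^ n) * 2, N₀, ?_⟩
  intro N _ hN c hc hsum
  refine (gibbsE_mono _ _ 0 (fun σ => holder_pow P ν n hn3' q hq (by linarith) _)).trans ?_
  rw [gibbsE_add, gibbsE_const, gibbsE_sum]
  simp only [gibbsE_mul]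
  refine add_le_add le_rfl ?_
  calc _ ≤ ∑ j ∈ Finset.range (2 * N + 3), K * ((2:ℝ) ^ (2 * ν * n) * (C * 3 ^ (ν / 2)) ^ n) * (1 / 2) ^ j := by
        refine Finset.sum_le_sum (fun j _ => ?_)
        refine (mul_le_mul_of_nonneg_left (H N hN c hc hsum j) (by positivity)).trans ?_
        have := mul_le_mul_of_nonneg_left (weight_bound ν C n j (by linarith) hn1) hK.le
        calc _ = _ := by ring
          _ ≤ _ := this
          _ = _ := by ring
    _ ≤ _ := by
        rw [← Finset.mul_sum]
        refine mul_le_mul_of_nonneg_left ?_ (by positivity)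
        exact sum_geometric_two_le _

end Final

open scoped NNReal

/-- tightness of the fluctuation field in `C^{-ν}`: uniform bound on all moments
of the `C^{-ν}` norm of `Ex X_γ` under the Gibbs measure at `b = 0`,
`β = 1 + γ²(𝔠_γ + A)`, along `γ = N^{-1/2} → 0`. -/
theorem statement0 (𝔎 : KacProfile) (P : LPpartition) (A : ℝ)
    (ν q : ℝ) (hν : 0 < ν) (hq : 0 < q) :
    ∃ C : ℝ, ∃ N₀ : ℕ, ∀ (N : ℕ) [NeZero N], N₀ ≤ N → ∀ c : ℝ, 0 < c →
      (∑ z : Lat N, kGamma 𝔎 N c (gam N) z) = 1 →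
      gibbsE N (kGamma 𝔎 N c (gam N)) (betaCrit 𝔎 N c A) 0
        (fun σ => (holderNeg N P ν (fun z =>
            ((fluct N (kGamma 𝔎 N c (gam N)) (gam N) σ z : ℝ) : ℂ))) ^ q) ≤ C := by
  exact final_bound 𝔎 P A ν q hν hq

end IsingKac
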